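/- Let d ≥ 2 be an integer and let T be a positive integer with the diagonal moment property for degree d. Let s ≥ 2T+1 be an integer, let a₁,…,a_s be non-zero integers, let b be an integer, and let h be an integer polynomial of degree d. Then the equation a₁h(x₁)+⋯+a_sh(x_s) = b is density regular over the primes if and only if b = a₁+⋯+a_s = 0. -/

import Mathlib

open Finset Filter

/-- `T` has the diagonal moment property for degree `d`. -/
def DiagonalMomentProperty (d T : ℕ) : Prop :=
  ∀ g : Polynomial ℤ, g.natDegree = d → ∀ ε : ℝ, 0 < ε →
    ∃ C : ℝ, 0 < C ∧ ∀ X : ℕ, 1 ≤ X →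
      (((Fintype.piFinset fun _ : Fin (2 * T) => Finset.Icc 1 X).filter
          (fun x => (∑ i : Fin T, g.eval (x ⟨i.1, by have := i.isLt; omega⟩ : ℤ))
                  = ∑ i : Fin T, g.eval (x ⟨T + i.1, by have := i.isLt; omega⟩ : ℤ))).card : ℝ)
        ≤ C * (X : ℝ) ^ ((2 * T : ℝ) - (d : ℝ) + ε)

/-- The equation `a₁h(x₁)+⋯+a_sh(x_s) = b` is density regular over the primes: it has a
solution with the `x_i` not all equal in every set of primes of positive relative
upper density. -/
def DensityRegularPrimes (s : ℕ) (a : Fin s → ℤ) (b : ℤ) (h : Polynomial ℤ) : Prop :=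
  ∀ A : Set ℕ, (∀ n ∈ A, n.Prime) →
    0 < Filter.limsup (fun N : ℕ =>
        (Nat.card (A ∩ Set.Icc 1 N : Set ℕ) : ℝ) /
          (Nat.card {p : ℕ | p.Prime ∧ p ≤ N} : ℝ)) Filter.atTop →
    ∃ x : Fin s → ℕ, (∀ i, x i ∈ A) ∧ (∃ i j, x i ≠ x j) ∧
      ∑ i, a i * h.eval (x i : ℤ) = b


section Body

open Polynomial


/-- `ee x = exp(2πix)` -/
noncomputable def ee (x : ℝ) : ℂ := Complex.exp (2 * Real.pi * Complex.I * x)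

lemma ee_add (x y : ℝ) : ee (x + y) = ee x * ee y := by
  unfold ee; rw [← Complex.exp_add]; push_cast; ring_nf

lemma ee_zero : ee 0 = 1 := by simp [ee]

lemma ee_int (n : ℤ) : ee n = 1 := by
  unfold ee
  rw [Complex.exp_eq_one_iff]
  exact ⟨n, by push_cast; ring⟩

lemma ee_nat (n : ℕ) : ee n = 1 := by exact_mod_cast ee_int n

lemma ee_norm (x : ℝ) : ‖ee x‖ = 1 := by
  unfold ee
  have : (2 * Real.pi * Complex.I * x : ℂ) = ((2 * Real.pi * x : ℝ) : ℂ) * Complex.I := by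
    push_cast; ring
  rw [this, Complex.norm_exp_ofReal_mul_I]

lemma ee_ne_zero (x : ℝ) : ee x ≠ 0 := by
  intro h; have := ee_norm x; rw [h] at this; simp at this

lemma ee_neg (x : ℝ) : ee (-x) = (starRingEnd ℂ) (ee x) := by
  unfold ee
  rw [← Complex.exp_conj]
  have : (starRingEnd ℂ) 2 = 2 := map_ofNat _ 2
  simp [this]

lemma ee_sub (x y : ℝ) : ee (x - y) = ee x * (starRingEnd ℂ) (ee y) := by
  rw [sub_eq_add_neg, ee_add, ee_neg]

lemma ee_add_int (x : ℝ) (n : ℤ) : ee (x + n) = ee x := by rw [ee_add, ee_int, mul_one]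

lemma ee_nat_mul (n : ℕ) (x : ℝ) : ee (n * x) = ee x ^ n := by
  unfold ee; rw [← Complex.exp_nat_mul]; push_cast; ring_nf

lemma ee_eq_of_sub_int (x y : ℝ) (n : ℤ) (h : x - y = n) : ee x = ee y := by
  have : x = y + n := by linarith
  rw [this, ee_add_int]

/-- distance to nearest integer -/
noncomputable def nn (x : ℝ) : ℝ := |x - round x|

lemma nn_nonneg (x : ℝ) : 0 ≤ nn x := abs_nonneg _
lemma nn_le (x : ℝ) (n : ℤ) : nn x ≤ |x - n| := round_le x n
lemma nn_le_abs (x : ℝ) : nn x ≤ |x| := by simpa using nn_le x 0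
lemma nn_le_half (x : ℝ) : nn x ≤ 1 / 2 := abs_sub_round x

lemma nn_add_int (x : ℝ) (n : ℤ) : nn (x + n) = nn x := by
  unfold nn; rw [round_add_intCast]; push_cast; ring_nf

lemma nn_add (x y : ℝ) : nn (x + y) ≤ nn x + nn y := by
  refine (nn_le (x+y) (round x + round y)).trans ?_
  unfold nn; push_cast
  have : x + y - (round x + round y) = (x - round x) + (y - round y) := by ring
  rw [this]; exact abs_add_le _ _

lemma nn_neg (x : ℝ) : nn (-x) = nn x := by
  apply le_antisymm
  · refine (nn_le (-x) (-round x)).trans ?_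
    unfold nn; push_cast; rw [← abs_neg]; ring_nf; rfl
  · have := nn_le x (-round (-x))
    refine this.trans ?_
    unfold nn; push_cast; rw [← abs_neg]; ring_nf; rfl

lemma nn_sub (x y : ℝ) : nn (x - y) ≤ nn x + nn y := by
  rw [sub_eq_add_neg]; exact (nn_add _ _).trans (by rw [nn_neg])

lemma nn_nat_mul (n : ℕ) (x : ℝ) : nn (n * x) ≤ n * nn x := by
  refine (nn_le _ (n * round x)).trans ?_
  unfold nn; push_cast
  rw [← mul_sub, abs_mul, Nat.abs_cast]

lemma nn_int_mul (n : ℤ) (x : ℝ) : nn (n * x) ≤ |(n:ℝ)| * nn x := by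
  refine (nn_le _ (n * round x)).trans ?_
  unfold nn; push_cast
  rw [← mul_sub, abs_mul]

/-- `|e(x)-1| = 2|sin πx|` -/
lemma ee_sub_one_norm (x : ℝ) : ‖ee x - 1‖ = 2 * |Real.sin (Real.pi * x)| := by
  unfold ee
  have : (2 * Real.pi * Complex.I * x : ℂ) = Complex.I * ((2 * Real.pi * x : ℝ) : ℂ) := by
    push_cast; ring
  rw [this, Complex.norm_exp_I_mul_ofReal_sub_one, Real.norm_eq_abs, abs_mul, abs_two]
  congr 3; ring

lemma ee_sub_one_le (x : ℝ) : ‖ee x - 1‖ ≤ 2 * Real.pi * |x| := by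
  rw [ee_sub_one_norm]
  have := Real.abs_sin_le_abs (x := Real.pi * x)
  rw [abs_mul, abs_of_pos Real.pi_pos] at this
  linarith

lemma ee_sub_ee_le (x y : ℝ) : ‖ee x - ee y‖ ≤ 2 * Real.pi * |x - y| := by
  have : ee x - ee y = ee y * (ee (x - y) - 1) := by
    rw [mul_sub, ← ee_add]; ring_nf
  rw [this, norm_mul, ee_norm, one_mul]; exact ee_sub_one_le _

lemma ee_nn (x : ℝ) : ee x = ee (x - round x) := by
  apply ee_eq_of_sub_int _ _ (round x); ring

lemma ee_sub_one_le_nn (x : ℝ) : ‖ee x - 1‖ ≤ 2 * Real.pi * nn x := by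
  rw [ee_nn]; exact ee_sub_one_le _

lemma ee_sub_one_ge (x : ℝ) : 4 * nn x ≤ ‖ee x - 1‖ := by
  rw [ee_nn, ee_sub_one_norm]
  set y := x - round x with hy
  have hy2 : |y| ≤ 1/2 := abs_sub_round x
  have h1 : 2 / Real.pi * |Real.pi * y| ≤ |Real.sin (Real.pi * y)| := by
    apply Real.mul_abs_le_abs_sin
    rw [abs_mul, abs_of_pos Real.pi_pos]
    nlinarith [Real.pi_pos]
  rw [abs_mul, abs_of_pos Real.pi_pos] at h1
  have : 2 / Real.pi * (Real.pi * |y|) = 2 * |y| := by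
    field_simp
  have h3 : nn x = |y| := rfl
  rw [h3]; linarith

/-- geometric sum -/
lemma geom_ee (θ c : ℝ) (N : ℕ) : ‖∑ n ∈ range N, ee (θ * n + c)‖ * (2 * nn θ) ≤ 1 := by
  have h1 : (∑ n ∈ range N, ee (θ * n + c)) * (ee θ - 1) = ee c * (ee (N * θ) - 1) := by
    have : ∀ n ∈ range N, ee (θ * n + c) = ee c * (ee θ)^n := by
      intro n _
      rw [← ee_nat_mul, ← ee_add]; ring_nf
    rw [sum_congr rfl this, ← mul_sum, mul_assoc, geom_sum_mul, ee_nat_mul]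
  have h2 : ‖∑ n ∈ range N, ee (θ * n + c)‖ * ‖ee θ - 1‖ ≤ 2 := by
    rw [← norm_mul, h1, norm_mul, ee_norm, one_mul]
    refine (norm_sub_le _ _).trans ?_
    rw [ee_norm]; norm_num
  have h3 := ee_sub_one_ge θ
  have := mul_le_mul_of_nonneg_left h3 (norm_nonneg (∑ n ∈ range N, ee (θ * n + c)))
  linarith

/-- Abel summation bound with monotone weights -/
lemma abel_mono (N : ℕ) (u : ℕ → ℝ) (hu : ∀ n, 0 ≤ u n) (hm : Monotone u) (z : ℕ → ℂ) (B : ℝ)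
    (hB : ∀ k ≤ N, ‖∑ n ∈ range k, z n‖ ≤ B) :
    ‖∑ n ∈ range N, (u n : ℂ) * z n‖ ≤ 2 * u N * B := by
  have hB0 : 0 ≤ B := (norm_nonneg _).trans (hB 0 (Nat.zero_le _))
  have key : ∀ k ≤ N, ∑ n ∈ range k, (u n : ℂ) * z n
      = (u k : ℂ) * ∑ n ∈ range k, z n - ∑ i ∈ range k, ((u (i+1) : ℂ) - u i) * ∑ n ∈ range (i+1), z n := by
    intro k hk
    induction k with
    | zero => simp
    | succ k ih =>
      rw [sum_range_succ, ih (by omega), sum_range_succ (fun i => ((u (i+1) : ℂ) - u i) * ∑ n ∈ range (i+1), z n),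
        sum_range_succ z]
      ring
  rw [key N le_rfl]
  refine (norm_sub_le _ _).trans ?_
  have h1 : ‖(u N : ℂ) * ∑ n ∈ range N, z n‖ ≤ u N * B := by
    rw [norm_mul, Complex.norm_real, Real.norm_of_nonneg (hu N)]
    exact mul_le_mul_of_nonneg_left (hB N le_rfl) (hu N)
  have h2 : ‖∑ i ∈ range N, ((u (i+1) : ℂ) - u i) * ∑ n ∈ range (i+1), z n‖ ≤ (u N - u 0) * B := by
    refine (norm_sum_le _ _).trans ?_
    rw [← sum_range_sub, sum_mul]
    apply sum_le_sum
    intro i hi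
    rw [norm_mul, ← Complex.ofReal_sub, Complex.norm_real, Real.norm_of_nonneg (sub_nonneg.2 (hm (Nat.le_succ i)))]
    exact mul_le_mul_of_nonneg_left (hB _ (by simp at hi; omega)) (sub_nonneg.2 (hm (Nat.le_succ i)))
  nlinarith [mul_nonneg (hu 0) hB0]

/-- average over a period -/
noncomputable def avg (L : ℕ) (f : ℕ → ℂ) : ℂ := (∑ n ∈ range L, f n) / L

lemma sum_period_mul {f : ℕ → ℂ} {L : ℕ} (hf : Function.Periodic f L) (m : ℕ) :
    ∑ n ∈ range (L * m), f n = m * ∑ n ∈ range L, f n := by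
  induction m with
  | zero => simp
  | succ m ih =>
    rw [Nat.mul_succ, sum_range_add, ih]
    have : ∀ n ∈ range L, f (L * m + n) = f n := by
      intro n _
      have := hf.nat_mul m n
      simpa [add_comm, mul_comm] using this
    rw [sum_congr rfl this]; push_cast; ring

lemma avg_mul_period {f : ℕ → ℂ} {L : ℕ} (hf : Function.Periodic f L) {m : ℕ} (hm : 0 < m) :
    avg (L * m) f = avg L f := by
  unfold avg
  rw [sum_period_mul hf]
  have : (m : ℂ) ≠ 0 := by exact_mod_cast hm.ne'
  push_cast
  rw [mul_comm (L:ℂ), mul_div_mul_left _ _ this]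

lemma avg_of_dvd {f : ℕ → ℂ} {L L' : ℕ} (hf : Function.Periodic f L) (h : L ∣ L') (h0 : 0 < L') :
    avg L' f = avg L f := by
  obtain ⟨m, rfl⟩ := h
  exact avg_mul_period hf (Nat.pos_of_mul_pos_left h0)

lemma sum_period_shift {f : ℕ → ℂ} {L : ℕ} (hf : Function.Periodic f L) (t : ℕ) :
    ∑ n ∈ range L, f (n + t) = ∑ n ∈ range L, f n := by
  induction t with
  | zero => simp
  | succ t ih =>
    rw [← ih]
    have h1 := sum_range_succ (fun n => f (n + t)) L
    have h2 := sum_range_succ' (fun n => f (n + t)) L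
    have h3 : f (L + t) = f (0 + t) := by
      have := hf t; rw [zero_add, add_comm L t]; exact this
    rw [h1, h3] at h2
    have h4 := add_right_cancel h2
    rw [h4]
    apply sum_congr rfl; intro n _; congr 1; ring

lemma avg_shift {f : ℕ → ℂ} {L : ℕ} (hf : Function.Periodic f L) (t : ℕ) :
    avg L (fun n => f (n + t)) = avg L f := by
  unfold avg; rw [sum_period_shift hf]

lemma avg_coprime {f g : ℕ → ℂ} {A B : ℕ} (hf : Function.Periodic f A) (hg : Function.Periodic g B)
    (hA : 0 < A) (hB : 0 < B)
    (h : Nat.Coprime A B) : avg (A * B) (fun n => f n * g n) = avg A f * avg B g := by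
  unfold avg
  have : ∑ n ∈ range (A * B), f n * g n = (∑ n ∈ range A, f n) * ∑ n ∈ range B, g n := by
    rw [sum_mul_sum, ← sum_product']
    refine sum_bij (fun n _ => (n % A, n % B)) ?_ ?_ ?_ ?_
    · intro n hn
      simp [Nat.mod_lt _ hA, Nat.mod_lt _ hB]
    · intro n hn m hm hnm
      simp only [Prod.mk.injEq] at hnm
      have h1 : n ≡ m [MOD A * B] := (Nat.modEq_and_modEq_iff_modEq_mul h).1 ⟨hnm.1, hnm.2⟩
      simp only [mem_range] at hn hm
      exact Nat.ModEq.eq_of_lt_of_lt h1 hn hm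
    · rintro ⟨u, v⟩ huv
      simp only [mem_product, mem_range] at huv
      refine ⟨Nat.chineseRemainder h u v, ?_, ?_⟩
      · exact mem_range.2 (Nat.chineseRemainder_lt_mul h u v hA.ne' hB.ne')
      · have := (Nat.chineseRemainder h u v).2
        ext
        · simpa [Nat.ModEq, Nat.mod_eq_of_lt huv.1] using this.1
        · simpa [Nat.ModEq, Nat.mod_eq_of_lt huv.2] using this.2
    · intro n _
      simp only
      rw [hf.map_mod_nat, hg.map_mod_nat]
  rw [this]; push_cast
  rw [mul_div_mul_comm]

lemma avg_norm_le {f : ℕ → ℂ} {L : ℕ} {B : ℝ} (hB0 : 0 ≤ B) (hB : ∀ n, ‖f n‖ ≤ B) : ‖avg L f‖ ≤ B := by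
  unfold avg
  rcases Nat.eq_zero_or_pos L with rfl | hL
  · simpa using hB0
  rw [norm_div, Complex.norm_natCast, div_le_iff₀ (by exact_mod_cast hL)]
  refine (norm_sum_le _ _).trans ?_
  refine (sum_le_sum (fun n _ => hB n)).trans ?_
  simp [mul_comm]

/-- partial sums of a periodic function minus its mean -/
lemma periodic_partial {f : ℕ → ℂ} {L : ℕ} (hL : 0 < L) (hf : Function.Periodic f L) {B : ℝ}
    (hB : ∀ n, ‖f n‖ ≤ B) (k : ℕ) : ‖∑ n ∈ range k, (f n - avg L f)‖ ≤ 2 * L * B := by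
  have hB0 : 0 ≤ B := (norm_nonneg _).trans (hB 0)
  have ha := avg_norm_le (L := L) hB0 hB
  have hp : Function.Periodic (fun n => f n - avg L f) L := fun n => by simp [hf n]
  have h0 : ∑ n ∈ range L, (f n - avg L f) = 0 := by
    rw [sum_sub_distrib]; unfold avg
    have : (L : ℂ) ≠ 0 := by exact_mod_cast hL.ne'
    simp; field_simp; simp
  conv_lhs => rw [← Nat.div_add_mod k L]
  rw [sum_range_add, sum_period_mul hp, h0, mul_zero, zero_add]
  refine (norm_sum_le _ _).trans ?_
  have : ∀ n ∈ range (k % L), ‖f (L * (k / L) + n) - avg L f‖ ≤ 2 * B := by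
    intro n _
    exact (norm_sub_le _ _).trans (by linarith [hB (L * (k / L) + n)])
  refine (sum_le_sum this).trans ?_
  simp only [sum_const, card_range, nsmul_eq_mul]
  have h3 : ((k % L : ℕ) : ℝ) ≤ L := by exact_mod_cast (Nat.mod_lt _ hL).le
  nlinarith

lemma abel_general (N : ℕ) (u : ℕ → ℂ) (z : ℕ → ℂ) (B U D : ℝ) (hB : ∀ k, ‖∑ n ∈ range k, z n‖ ≤ B)
    (hU : ‖u N‖ ≤ U) (hD : ∀ n < N, ‖u (n+1) - u n‖ ≤ D) :
    ‖∑ n ∈ range N, u n * z n‖ ≤ B * (U + N * D) := by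
  have hB0 : 0 ≤ B := (norm_nonneg _).trans (hB 0)
  have key : ∀ k ≤ N, ∑ n ∈ range k, u n * z n
      = u k * ∑ n ∈ range k, z n - ∑ i ∈ range k, (u (i+1) - u i) * ∑ n ∈ range (i+1), z n := by
    intro k hk
    induction k with
    | zero => simp
    | succ k ih =>
      rw [sum_range_succ, ih (by omega), sum_range_succ (fun i => (u (i+1) - u i) * ∑ n ∈ range (i+1), z n),
        sum_range_succ z]
      ring
  rw [key N le_rfl]
  refine (norm_sub_le _ _).trans ?_
  have h1 : ‖u N * ∑ n ∈ range N, z n‖ ≤ U * B := by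
    rw [norm_mul]
    exact mul_le_mul hU (hB N) (norm_nonneg _) ((norm_nonneg _).trans hU)
  have h2 : ‖∑ i ∈ range N, (u (i+1) - u i) * ∑ n ∈ range (i+1), z n‖ ≤ N * (D * B) := by
    refine (norm_sum_le _ _).trans ?_
    refine (sum_le_sum (g := fun _ => D * B) ?_).trans (by simp)
    intro i hi
    rw [norm_mul]
    have := hD i (mem_range.1 hi)
    exact mul_le_mul this (hB _) (norm_nonneg _) ((norm_nonneg _).trans this)
  nlinarith

/-- sum of a slowly varying function against a periodic one -/
lemma periodic_abel {f : ℕ → ℂ} {L : ℕ} (hL : 0 < L) (hf : Function.Periodic f L) {B : ℝ}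
    (hB : ∀ n, ‖f n‖ ≤ B) (N : ℕ) (u : ℕ → ℂ) (U D : ℝ)
    (hU : ‖u N‖ ≤ U) (hD : ∀ n < N, ‖u (n+1) - u n‖ ≤ D) :
    ‖∑ n ∈ range N, u n * f n - avg L f * ∑ n ∈ range N, u n‖ ≤ 2 * L * B * (U + N * D) := by
  have := abel_general N u (fun n => f n - avg L f) (2 * L * B) U D (periodic_partial hL hf hB) hU hD
  convert this using 2
  rw [mul_sum, ← sum_sub_distrib]
  apply sum_congr rfl; intro n _; ring


/-- recurrence lemma -/
lemma recur_lemma (ρ ε θ : ℝ) (hρ : 0 < ρ) (hρ1 : ρ ≤ 1) (hε0 : 0 ≤ ε) (hε : ε ≤ ρ / 64) (N : ℕ)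
    (hN : 12 / ρ ^ 2 ≤ N) (H : Finset ℕ) (hH : H ⊆ range N) (hcard : ρ * N ≤ #H)
    (hh : ∀ h ∈ H, nn (θ * h) ≤ ε) :
    ∃ q : ℕ, 1 ≤ q ∧ (q : ℝ) ≤ 3 / ρ ∧ nn (q * θ) ≤ 12 * ε / (ρ ^ 2 * N) := by
  have hNpos : (0:ℝ) < N := lt_of_lt_of_le (by positivity) hN
  have hN' : 12 ≤ ρ ^ 2 * N := by rw [div_le_iff₀ (by positivity)] at hN; linarith
  -- differences
  have hdiff : ∀ h ∈ H, ∀ h' ∈ H, h' ≤ h → nn (θ * ((h - h' : ℕ) : ℝ)) ≤ 2 * ε := by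
    intro h h1 h' h2 hle
    rw [Nat.cast_sub hle, mul_sub]
    exact (nn_sub _ _).trans (by linarith [hh h h1, hh h' h2])
  -- step a
  obtain ⟨q, hq1, hq2, hq3⟩ : ∃ q : ℕ, 1 ≤ q ∧ (q : ℝ) ≤ 3 / ρ ∧ nn (q * θ) ≤ 2 * ε := by
    set g := ⌈2 / ρ⌉₊ with hg
    have hg1 : 2 / ρ ≤ g := Nat.le_ceil _
    have hg2 : (g : ℝ) < 2 / ρ + 1 := Nat.ceil_lt_add_one (by positivity)
    have hg3 : (g : ℝ) ≤ 3 / ρ := by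
      have : 1 ≤ 1 / ρ := by rw [le_div_iff₀ hρ]; linarith
      have e : 3 / ρ = 2 / ρ + 1 / ρ := by ring
      linarith
    have hg0 : 0 < g := by
      have : (0:ℝ) < g := lt_of_lt_of_le (by positivity) hg1
      exact_mod_cast this
    have hgr : (0:ℝ) < g := by exact_mod_cast hg0
    have hlt : #(range (N / g + 1)) < #H := by
      rw [card_range]
      have h1 : ((N / g : ℕ) : ℝ) ≤ N / g := Nat.cast_div_le
      have h2 : (N : ℝ) / g ≤ ρ * N / 2 := by
        rw [div_le_iff₀ hgr]
        have : 2 ≤ ρ * g := by rw [div_le_iff₀ hρ] at hg1; linarith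
        nlinarith
      have h3 : 12 ≤ ρ * N := by nlinarith [mul_pos hρ hNpos]
      have : ((N / g + 1 : ℕ) : ℝ) < #H := by push_cast; linarith
      exact_mod_cast this
    obtain ⟨x, hx, y, hy, hxy, hf⟩ := exists_ne_map_eq_of_card_lt_of_maps_to hlt
      (f := fun h => h / g) (by
        intro h hhH
        have := mem_range.1 (hH hhH)
        exact mem_coe.2 <| mem_range.2 <| Nat.lt_succ_of_le (Nat.div_le_div_right this.le))
    wlog hlt2 : y < x generalizing x y
    · exact this y hy x hx hxy.symm hf.symm (by omega)
    refine ⟨x - y, by omega, ?_, ?_⟩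
    · have h1 : x - y ≤ g := by
        have e1 := Nat.div_add_mod x g
        have e2 := Nat.div_add_mod y g
        have e3 := Nat.mod_lt x hg0
        rw [hf] at e1
        omega
      exact le_trans (by exact_mod_cast h1) hg3
    · have := hdiff x hx y hy hlt2.le
      rwa [mul_comm] at this
  -- step b
  set τ := (q : ℝ) * θ - round ((q : ℝ) * θ) with hτ
  have hτn : nn (q * θ) = |τ| := rfl
  refine ⟨q, hq1, hq2, ?_⟩
  rw [hτn] at hq3 ⊢
  rcases eq_or_lt_of_le (abs_nonneg τ) with h0 | hτ0
  · rw [← h0]; positivity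
  set t := |τ| with ht
  have hqr : (1:ℝ) ≤ q := by exact_mod_cast hq1
  set ℓ := ⌊1 / (2 * t)⌋₊ with hℓ
  have hbig : 1 ≤ 1 / (2 * t) := by
    rw [le_div_iff₀ (by positivity)]; linarith
  have hℓ1 : (ℓ : ℝ) ≤ 1 / (2 * t) := Nat.floor_le (by positivity)
  have hℓ2 : 1 / (4 * t) ≤ ℓ := by
    have h1 := Nat.lt_floor_add_one (1 / (2 * t))
    have h2 : (1:ℝ) ≤ ℓ := by
      have : 1 ≤ ℓ := Nat.le_floor (by simpa using hbig)
      exact_mod_cast this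
    have e : 1 / (4 * t) = (1 / (2 * t)) / 2 := by field_simp; ring
    rw [e]; linarith
  have hℓr : (0:ℝ) < ℓ := lt_of_lt_of_le (by positivity) hℓ2
  have hℓ0 : 0 < ℓ := by exact_mod_cast hℓr
  set F := ⌊2 * ε / t⌋₊ with hF
  have hcount : #H ≤ (F + 1) * (q * (N / (q * ℓ) + 1)) := by
    have h1 := Finset.card_le_mul_card_image (f := fun h : ℕ => (h % q, h / (q * ℓ))) H (F + 1) ?_
    · refine h1.trans (Nat.mul_le_mul_left _ ?_)
      have : H.image (fun h : ℕ => (h % q, h / (q * ℓ))) ⊆ range q ×ˢ range (N / (q * ℓ) + 1) := by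
        intro x hx
        obtain ⟨h, hhH, rfl⟩ := mem_image.1 hx
        have := mem_range.1 (hH hhH)
        simp only [mem_product, mem_range]
        exact ⟨Nat.mod_lt _ hq1, Nat.lt_succ_of_le (Nat.div_le_div_right this.le)⟩
      simpa using card_le_card this
    · intro a ha
      set S := H.filter (fun h => (h % q, h / (q * ℓ)) = a) with hS
      rcases S.eq_empty_or_nonempty with he | hne
      · rw [he]; simp
      set m := S.min' hne with hm
      have hmS : m ∈ S := S.min'_mem hne
      have hmH := (mem_filter.1 hmS)
      have : ∀ h ∈ S, ∃ k, h = m + q * k ∧ k ≤ F := by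
        intro h hhS
        have hhH := mem_filter.1 hhS
        have hle : m ≤ h := S.min'_le h hhS
        have e := hhH.2.trans hmH.2.symm
        simp only [Prod.mk.injEq] at e
        obtain ⟨k, hk⟩ := (Nat.modEq_iff_dvd' hle).1 e.1.symm
        refine ⟨k, by omega, ?_⟩
        have hkl : k < ℓ := by
          have e1 := Nat.div_add_mod h (q * ℓ)
          have e2 := Nat.div_add_mod m (q * ℓ)
          have e3 := Nat.mod_lt h (show 0 < q * ℓ by positivity)
          rw [e.2] at e1
          have : q * k < q * ℓ := by omega
          exact Nat.lt_of_mul_lt_mul_left this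
        have h2 := hdiff h hhH.1 m hmH.1 hle
        rw [hk] at h2
        have h3 : nn (θ * ((q * k : ℕ) : ℝ)) = nn (τ * k) := by
          have : θ * ((q * k : ℕ) : ℝ) = τ * k + ((round ((q:ℝ) * θ) * k : ℤ) : ℝ) := by
            rw [hτ]; push_cast; ring
          rw [this, nn_add_int]
        rw [h3] at h2
        have hkr : (k : ℝ) ≤ ℓ := by exact_mod_cast hkl.le
        have hkt : t * k ≤ 1 / 2 := by
          have : t * k ≤ t * (1 / (2 * t)) := mul_le_mul_of_nonneg_left (hkr.trans hℓ1) hτ0.le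
          have e : t * (1 / (2 * t)) = 1 / 2 := by field_simp
          linarith
        have h4 : t * k ≤ 2 * ε := by
          refine le_trans ?_ h2
          have e5 : |τ * k| = t * k := by rw [abs_mul, Nat.abs_cast]
          rw [← e5] at hkt ⊢
          unfold nn
          by_cases hr : round (τ * k) = 0
          · rw [hr]; simp
          · have h6 : (1:ℝ) ≤ |((round (τ * k) : ℤ) : ℝ)| := by
              rw [← Int.cast_abs]; exact_mod_cast Int.one_le_abs hr
            have h7 := abs_sub_abs_le_abs_sub ((round (τ * k) : ℤ) : ℝ) (τ * k)
            rw [abs_sub_comm] at h7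
            linarith
        apply Nat.le_floor
        rw [le_div_iff₀ hτ0]; linarith
      have hsub : S ⊆ (range (F + 1)).image (fun k => m + q * k) := by
        intro h hhS
        obtain ⟨k, hk, hk2⟩ := this h hhS
        exact mem_image.2 ⟨k, mem_range.2 (by omega), hk.symm⟩
      calc #S ≤ _ := card_le_card hsub
        _ ≤ _ := card_image_le
        _ = F + 1 := card_range _
  have hcr : (#H : ℝ) ≤ (2 * ε / t + 1) * (N * (4 * t) + q) := by
    have h1 : (#H : ℝ) ≤ ((F : ℝ) + 1) * (q * (((N / (q * ℓ) : ℕ) : ℝ) + 1)) := by exact_mod_cast hcount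
    have h2 : (F : ℝ) ≤ 2 * ε / t := Nat.floor_le (by positivity)
    have h3 : ((N / (q * ℓ) : ℕ) : ℝ) ≤ N / (q * ℓ) := by
      have := @Nat.cast_div_le ℝ _ _ _ N (q * ℓ)
      push_cast at this; exact this
    have h4 : (q:ℝ) * (((N / (q * ℓ) : ℕ) : ℝ) + 1) ≤ N * (4 * t) + q := by
      have h5 : (q:ℝ) * (N / (q * ℓ)) = N / ℓ := by field_simp
      have h6 : (N:ℝ) / ℓ ≤ N * (4 * t) := by
        rw [div_le_iff₀ hℓr]
        have : 1 ≤ 4 * t * ℓ := by rw [div_le_iff₀ (by positivity)] at hℓ2; linarith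
        nlinarith
      nlinarith
    refine h1.trans ?_
    apply mul_le_mul (by linarith) h4 (by positivity) (by positivity)
  have e1 : (2 * ε / t + 1) * (N * (4 * t) + q) = 8 * ε * N + 4 * t * N + 2 * ε * q / t + q := by
    field_simp; ring
  rw [e1] at hcr
  have hqρ : q * ρ ≤ 3 := by rw [le_div_iff₀ hρ] at hq2; exact hq2
  have h1 : (q:ℝ) ≤ ρ * N / 4 := by
    have : q * ρ ≤ (ρ * N / 4) * ρ := by nlinarith
    exact le_of_mul_le_mul_right this hρ
  have h2 : ρ * N / 2 ≤ 2 * ε * q / t := by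
    have a1 : ε * N ≤ ρ / 64 * N := mul_le_mul_of_nonneg_right hε hNpos.le
    have a2 : t * N ≤ 2 * ε * N := mul_le_mul_of_nonneg_right hq3 hNpos.le
    linarith
  rw [le_div_iff₀ hτ0] at h2
  rw [le_div_iff₀ (by positivity)]
  have h3 : ρ * (ρ * N / 2 * t) ≤ ρ * (2 * ε * q) := mul_le_mul_of_nonneg_left h2 hρ.le
  have h4 : ε * (q * ρ) ≤ ε * 3 := mul_le_mul_of_nonneg_left hqρ hε0
  nlinarith

lemma vdc_ineq (z : ℕ → ℂ) (N : ℕ) :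
    ‖∑ n ∈ range N, z n‖ ^ 2 ≤ 2 * ∑ h ∈ range N, ‖∑ n ∈ range (N - h), z (n + h) * (starRingEnd ℂ) (z n)‖ := by
  have h1 : ∀ k, ‖∑ n ∈ range k, z n‖ ^ 2 ≤
      2 * (∑ m ∈ range k, z m * (starRingEnd ℂ) (∑ n ∈ range (m + 1), z n)).re := by
    intro k
    induction k with
    | zero => simp
    | succ k ih =>
      rw [sum_range_succ (fun m => z m * (starRingEnd ℂ) (∑ n ∈ range (m + 1), z n)),
        sum_range_succ z]
      set T := ∑ n ∈ range k, z n
      rw [Complex.add_re]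
      rw [← Complex.normSq_eq_norm_sq] at ih ⊢
      rw [Complex.normSq_add]
      simp only [map_add, Complex.add_re, Complex.mul_re, Complex.conj_re, Complex.conj_im, mul_add, Complex.normSq_apply] at ih ⊢
      nlinarith [mul_self_nonneg (z k).re, mul_self_nonneg (z k).im]
  refine (h1 N).trans ?_
  have h2 := Finset.sum_range_diag_flip N (fun h n => z (n + h) * (starRingEnd ℂ) (z n))
  have h3 : ∀ m ∈ range N, z m * (starRingEnd ℂ) (∑ n ∈ range (m + 1), z n) =
      ∑ k ∈ range (m + 1), z (m - k + k) * (starRingEnd ℂ) (z (m - k)) := by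
    intro m _
    rw [map_sum, mul_sum, ← sum_range_reflect]
    apply sum_congr rfl
    intro k hk
    have := mem_range.1 hk
    rw [show m - k + k = m by omega, show m + 1 - 1 - k = m - k by omega]
  rw [sum_congr rfl h3, h2]
  apply mul_le_mul_of_nonneg_left _ (by norm_num)
  refine (Complex.re_le_norm _).trans (norm_sum_le _ _)

open Polynomial in
lemma diff_poly (φ : ℝ[X]) (d : ℕ) (hφ : φ.natDegree ≤ d + 1) (h : ℝ) :
    (φ.comp (X + C h) - φ).natDegree ≤ d ∧ (φ.comp (X + C h) - φ).coeff d = (d + 1) * h * φ.coeff (d + 1) := by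
  have e : ∀ n, (φ.comp (X + C h)).coeff n = ∑ i ∈ range (d + 2), φ.coeff i * (h ^ (i - n) * (i.choose n)) := by
    intro n
    rw [comp, eval₂_eq_sum_range' C (n := d + 2) (by omega)]
    simp only [finsetSum_coeff, coeff_C_mul, coeff_X_add_C_pow]
  have hz : ∀ i, d + 1 < i → φ.coeff i = 0 := fun i hi => coeff_eq_zero_of_natDegree_lt (by omega)
  constructor
  · rw [natDegree_le_iff_coeff_eq_zero]
    intro n hn
    rw [coeff_sub, e]
    rcases Nat.lt_or_ge (d + 1) n with h1 | h1
    · rw [hz n h1, sub_zero]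
      apply sum_eq_zero
      intro i hi
      rw [Nat.choose_eq_zero_of_lt (by simp at hi; omega)]; simp
    · have : n = d + 1 := by omega
      subst this
      rw [sum_range_succ, sum_eq_zero]
      · simp
      · intro i hi
        rw [Nat.choose_eq_zero_of_lt (by simpa using hi)]; simp
  · rw [coeff_sub, e, sum_range_succ, sum_range_succ, sum_eq_zero]
    · simp; ring
    · intro i hi
      rw [Nat.choose_eq_zero_of_lt (by simpa using hi)]; simp

/-- polynomially bounded functions on `[1,∞)` -/
def PB (f : ℝ → ℝ) : Prop := ∃ C : ℕ, ∀ r : ℝ, 1 ≤ r → 0 ≤ f r ∧ f r ≤ C * r ^ C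

lemma PB.const {c : ℝ} (hc : 0 ≤ c) : PB (fun _ => c) := by
  refine ⟨⌈c⌉₊, fun r hr => ⟨hc, ?_⟩⟩
  have h1 := Nat.le_ceil c
  have h2 : (1:ℝ) ≤ r ^ ⌈c⌉₊ := one_le_pow₀ hr
  nlinarith [(Nat.cast_nonneg ⌈c⌉₊ : (0:ℝ) ≤ _)]

lemma PB.id : PB (fun r => r) := ⟨1, fun r hr => ⟨by linarith, by simp⟩⟩

lemma PB.add {f g : ℝ → ℝ} (hf : PB f) (hg : PB g) : PB (fun r => f r + g r) := by
  obtain ⟨C, hC⟩ := hf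
  obtain ⟨D, hD⟩ := hg
  refine ⟨C + D, fun r hr => ⟨add_nonneg (hC r hr).1 (hD r hr).1, ?_⟩⟩
  have h1 : r ^ C ≤ r ^ (C + D) := pow_le_pow_right₀ hr (by omega)
  have h2 : r ^ D ≤ r ^ (C + D) := pow_le_pow_right₀ hr (by omega)
  have h3 := (hC r hr).2
  have h4 := (hD r hr).2
  have h5 := mul_le_mul_of_nonneg_left h1 (Nat.cast_nonneg C : (0:ℝ) ≤ _)
  have h6 := mul_le_mul_of_nonneg_left h2 (Nat.cast_nonneg D : (0:ℝ) ≤ _)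
  push_cast; linarith

lemma PB.mul {f g : ℝ → ℝ} (hf : PB f) (hg : PB g) : PB (fun r => f r * g r) := by
  obtain ⟨C, hC⟩ := hf
  obtain ⟨D, hD⟩ := hg
  refine ⟨C * D + C + D, fun r hr => ⟨mul_nonneg (hC r hr).1 (hD r hr).1, ?_⟩⟩
  have h1 : r ^ C * r ^ D ≤ r ^ (C * D + C + D) := by
    rw [← pow_add]; exact pow_le_pow_right₀ hr (by omega)
  have h3 := mul_le_mul (hC r hr).2 (hD r hr).2 (hD r hr).1 ((hC r hr).1.trans (hC r hr).2)
  refine h3.trans ?_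
  have h4 : (C:ℝ) * r ^ C * (D * r ^ D) = (C * D : ℕ) * (r ^ C * r ^ D) := by push_cast; ring
  rw [h4]
  apply mul_le_mul _ h1 (by positivity) (by positivity)
  exact_mod_cast (by omega : C * D ≤ C * D + C + D)

lemma PB.pow {f : ℝ → ℝ} (hf : PB f) (n : ℕ) : PB (fun r => f r ^ n) := by
  induction n with
  | zero => simpa using PB.const (c := 1) (by norm_num)
  | succ n ih => simpa only [pow_succ] using ih.mul hf

lemma PB.mono {f g : ℝ → ℝ} (hf : PB f) (hg : ∀ r, 1 ≤ r → 0 ≤ g r ∧ g r ≤ f r) : PB g := by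
  obtain ⟨C, hC⟩ := hf
  exact ⟨C, fun r hr => ⟨(hg r hr).1, (hg r hr).2.trans (hC r hr).2⟩⟩

open Polynomial in
/-- Weyl's inequality, inverse form -/
theorem weyl (d : ℕ) : ∃ B : ℝ → ℝ, PB B ∧ (∀ r, 1 ≤ r → 1 ≤ B r) ∧ ∀ N : ℕ, 1 ≤ N → ∀ r : ℝ, 1 ≤ r → ∀ φ : ℝ[X],
    φ.natDegree ≤ d + 1 → (N : ℝ) ≤ r * ‖∑ n ∈ range N, ee (φ.eval (n : ℝ))‖ →
    ∃ q : ℕ, 1 ≤ q ∧ (q : ℝ) ≤ B r ∧ nn (q * φ.coeff (d + 1)) * N ^ (d + 1) ≤ B r := by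
  induction d with
  | zero =>
    refine ⟨fun r => r, PB.id, fun r hr => hr, ?_⟩
    intro N hN r hr φ hφ hS
    refine ⟨1, le_rfl, by simpa using hr, ?_⟩
    have h1 : ∀ n ∈ range N, ee (φ.eval (n : ℝ)) = ee (φ.coeff 1 * n + φ.coeff 0) := by
      intro n _
      congr 1
      conv_lhs => rw [eq_X_add_C_of_natDegree_le_one hφ]
      simp
    rw [sum_congr rfl h1] at hS
    have h2 := geom_ee (φ.coeff 1) (φ.coeff 0) N
    have hn := nn_nonneg (φ.coeff 1)
    simp only [Nat.cast_one, one_mul, zero_add, pow_one]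
    have h3 := mul_le_mul_of_nonneg_right hS hn
    have h4 : r * ‖∑ n ∈ range N, ee (φ.coeff 1 * n + φ.coeff 0)‖ * nn (φ.coeff 1) ≤ r * (1/2) := by
      rw [mul_assoc]; apply mul_le_mul_of_nonneg_left _ (by linarith); linarith
    linarith
  | succ d ih =>
    obtain ⟨B, hB, hB1, ih⟩ := ih
    set E : ℝ → ℝ := fun r => B (4 * r ^ 2) with hE
    have hEPB : PB E := by
      obtain ⟨C, hC⟩ := hB
      refine PB.mono (f := fun r => C * (4 * r ^ 2) ^ C)
        ((PB.const (Nat.cast_nonneg C)).mul (((PB.const (by norm_num)).mul (PB.id.pow 2)).pow C)) ?_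
      intro r hr
      have : 1 ≤ 4 * r ^ 2 := by nlinarith
      exact hC _ this
    have hE1 : ∀ r, 1 ≤ r → 1 ≤ E r := fun r hr => hB1 _ (by nlinarith)
    set Z : ℝ → ℝ := fun r => 64 * 8 * r ^ 2 * E r ^ 2 * (4 * r ^ 2) ^ (d + 1) + 12 * 64 * r ^ 4 * E r ^ 2 + 16 * r ^ 2 with hZ
    have hZPB : PB Z := by
      have c1 : PB (fun _ => (64 * 8 : ℝ)) := PB.const (by norm_num)
      have c2 : PB (fun _ => (12 * 64 : ℝ)) := PB.const (by norm_num)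
      have c3 : PB (fun _ => (16 : ℝ)) := PB.const (by norm_num)
      have c4 : PB (fun _ => (4 : ℝ)) := PB.const (by norm_num)
      exact ((((c1.mul (PB.id.pow 2)).mul (hEPB.pow 2)).mul ((c4.mul (PB.id.pow 2)).pow (d+1))).add
        ((c2.mul (PB.id.pow 4)).mul (hEPB.pow 2))).add (c3.mul (PB.id.pow 2))
    set q1 : ℝ → ℝ := fun r => 24 * r ^ 2 * E r ^ 2 * (d + 2) with hq1
    have hq1PB : PB q1 := by
      have c1 : PB (fun _ => (24 : ℝ)) := PB.const (by norm_num)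
      have c2 : PB (fun _ => ((d:ℝ) + 2)) := PB.const (by positivity)
      exact ((c1.mul (PB.id.pow 2)).mul (hEPB.pow 2)).mul c2
    set q2 : ℝ → ℝ := fun r => 12 * 64 * r ^ 4 * E r ^ 3 * (4 * r ^ 2) ^ (d + 1) with hq2
    have hq2PB : PB q2 := by
      have c1 : PB (fun _ => (12 * 64 : ℝ)) := PB.const (by norm_num)
      have c4 : PB (fun _ => (4 : ℝ)) := PB.const (by norm_num)
      exact ((c1.mul (PB.id.pow 4)).mul (hEPB.pow 3)).mul ((c4.mul (PB.id.pow 2)).pow (d+1))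
    refine ⟨fun r => 1 + Z r ^ (d + 2) + q1 r + q2 r,
      (((PB.const (by norm_num)).add (hZPB.pow _)).add hq1PB).add hq2PB, ?_, ?_⟩
    · intro r hr
      have e1 := hE1 r hr
      simp only [hZ, hq1, hq2]
      have : 0 ≤ (64 * 8 * r ^ 2 * E r ^ 2 * (4 * r ^ 2) ^ (d + 1) + 12 * 64 * r ^ 4 * E r ^ 2 + 16 * r ^ 2) ^ (d + 2) := by positivity
      have : 0 ≤ 24 * r ^ 2 * E r ^ 2 * ((d:ℝ) + 2) := by positivity
      have : 0 ≤ 12 * 64 * r ^ 4 * E r ^ 3 * (4 * r ^ 2) ^ (d + 1) := by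
        have : 0 ≤ E r := by linarith
        positivity
      linarith
    intro N hN r hr φ hφ hS
    have hNr : (1:ℝ) ≤ N := by exact_mod_cast hN
    have e1 := hE1 r hr
    have hE0 : 0 < E r := by linarith
    have hr0 : 0 < r := by linarith
    have hZ0 : 0 ≤ Z r := by simp only [hZ]; positivity
    have hq10 : 0 ≤ q1 r := by simp only [hq1]; positivity
    have hq20 : 0 ≤ q2 r := by simp only [hq2]; positivity
    have hZp : 0 ≤ Z r ^ (d + 2) := by positivity
    rcases lt_or_ge (N : ℝ) (Z r) with hlt | hge
    · refine ⟨1, le_rfl, by push_cast; linarith, ?_⟩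
      have h1 : (N:ℝ) ^ (d + 2) ≤ Z r ^ (d + 2) := pow_le_pow_left₀ (by linarith) hlt.le _
      have h2 := nn_le_half (((1:ℕ):ℝ) * φ.coeff (d + 1 + 1))
      have h3 := nn_nonneg (((1:ℕ):ℝ) * φ.coeff (d + 1 + 1))
      have h4 : nn (((1:ℕ):ℝ) * φ.coeff (d + 1 + 1)) * (N:ℝ) ^ (d + 2) ≤ 1 * Z r ^ (d + 2) :=
        mul_le_mul (h2.trans (by norm_num)) h1 (by positivity) (by norm_num)
      show _ * (N:ℝ) ^ (d + 2) ≤ _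
      linarith
    -- main case
    set α := φ.coeff (d + 1 + 1) with hα
    set z : ℕ → ℂ := fun n => ee (φ.eval (n:ℝ)) with hz
    set S : ℕ → ℂ := fun h => ∑ n ∈ range (N - h), z (n + h) * (starRingEnd ℂ) (z n) with hSdef
    have hvdc := vdc_ineq z N
    have hSle : ∀ h, ‖S h‖ ≤ ((N - h : ℕ) : ℝ) := by
      intro h
      refine (norm_sum_le _ _).trans ?_
      refine (sum_le_sum (g := fun _ => (1:ℝ)) ?_).trans (by simp)
      intro n _
      simp [hz, ee_norm]
    have hSleN : ∀ h, ‖S h‖ ≤ N := fun h => (hSle h).trans (by exact_mod_cast Nat.sub_le _ _)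
    set H := (range N).filter (fun h => 1 ≤ h ∧ (N:ℝ) ≤ (4 * r ^ 2) * ‖S h‖) with hH
    have hHcard : (N:ℝ) ≤ 8 * r ^ 2 * #H := by
      have h1 : ∑ h ∈ range N, ‖S h‖ ≤ ∑ h ∈ range N, ((if h ∈ H then (N:ℝ) else 0) + (if h = 0 then (N:ℝ) else 0) + N / (4 * r ^ 2)) := by
        apply sum_le_sum
        intro h hh
        have p1 : 0 ≤ (N:ℝ) / (4 * r ^ 2) := by positivity
        have p2 := hSleN h
        by_cases c1 : h ∈ H
        · rw [if_pos c1]; split_ifs <;> linarith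
        · rw [if_neg c1]
          by_cases c2 : h = 0
          · rw [if_pos c2]; linarith
          · rw [if_neg c2]
            have : ¬ ((N:ℝ) ≤ (4 * r ^ 2) * ‖S h‖) := by
              intro hc; exact c1 (mem_filter.2 ⟨hh, by omega, hc⟩)
            push Not at this
            have : ‖S h‖ ≤ N / (4 * r ^ 2) := by
              rw [le_div_iff₀ (by positivity)]; linarith
            linarith
      rw [sum_add_distrib, sum_add_distrib, sum_ite_mem, inter_eq_right.2 (filter_subset _ _), sum_ite_eq' (range N) 0,
        if_pos (mem_range.2 (by omega))] at h1
      simp only [sum_const, card_range, nsmul_eq_mul] at h1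
      have h2 : (N:ℝ)^2 ≤ r ^ 2 * ‖∑ n ∈ range N, z n‖ ^ 2 := by
        rw [← mul_pow]; exact pow_le_pow_left₀ (by linarith) hS 2
      have h3 : (N:ℝ)^2 ≤ r ^ 2 * (2 * (#H * N + N + N * (N / (4 * r ^ 2)))) := by
        refine h2.trans (mul_le_mul_of_nonneg_left (hvdc.trans ?_) (by positivity))
        linarith
      have h4 : r ^ 2 * (2 * (#H * N + N + N * (N / (4 * r ^ 2)))) = N * (2 * r ^ 2 * #H + 2 * r ^ 2 + N / 2) := by
        field_simp; ring
      rw [h4, pow_two] at h3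
      have h5 := le_of_mul_le_mul_left h3 (by linarith)
      have h6 : 16 * r ^ 2 ≤ N := by
        refine le_trans ?_ hge
        simp only [hZ]
        have : 0 ≤ 64 * 8 * r ^ 2 * E r ^ 2 * (4 * r ^ 2) ^ (d + 1) + 12 * 64 * r ^ 4 * E r ^ 2 := by positivity
        linarith
      nlinarith
    -- apply IH
    have hIH : ∀ h ∈ H, ∃ q : ℕ, 1 ≤ q ∧ (q : ℝ) ≤ E r ∧
        nn (((q * (d + 2) : ℕ) * α) * h) ≤ E r * (4 * r ^ 2) ^ (d + 1) / N ^ (d + 1) := by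
      intro h hh
      obtain ⟨hh1, hh2, hh3⟩ := mem_filter.1 hh
      have hlt := mem_range.1 hh1
      obtain ⟨hd1, hd2⟩ := diff_poly φ (d + 1) hφ (h:ℝ)
      have hNh : (N:ℝ) ≤ 4 * r ^ 2 * ((N - h : ℕ) : ℝ) :=
        hh3.trans (mul_le_mul_of_nonneg_left (hSle h) (by positivity))
      obtain ⟨q, k1, k2, k3⟩ := ih (N - h) (by omega) (4 * r ^ 2) (by nlinarith) _ hd1 (by
        refine le_trans ?_ (hh3.trans (le_of_eq ?_))
        · exact_mod_cast Nat.sub_le _ _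
        · congr 2
          apply sum_congr rfl
          intro n _
          simp only [hz]
          rw [← ee_sub]; simp [eval_comp])
      refine ⟨q, k1, k2, ?_⟩
      rw [hd2] at k3
      have e2 : (q:ℝ) * ((((d + 1 : ℕ) : ℝ) + 1) * h * φ.coeff (d + 1 + 1)) = ((q * (d + 2) : ℕ) * α) * h := by
        push_cast; ring
      rw [e2] at k3
      rw [le_div_iff₀ (by positivity)]
      have h5 : (N:ℝ) ^ (d + 1) ≤ (4 * r ^ 2) ^ (d + 1) * ((N - h : ℕ) : ℝ) ^ (d + 1) := by
        rw [← mul_pow]; exact pow_le_pow_left₀ (by linarith) hNh _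
      have h6 := mul_le_mul_of_nonneg_left h5 (nn_nonneg (((q * (d + 2) : ℕ) * α) * h))
      have h7 := mul_le_mul_of_nonneg_right k3 (show 0 ≤ (4 * r ^ 2) ^ (d + 1) by positivity)
      have h8 : B (4 * r ^ 2) = E r := rfl
      rw [h8] at h7
      linarith
    choose! Q hQ1 hQ2 hQ3 using hIH
    -- pigeonhole
    have hHne : 0 < #H := by
      by_contra hc
      have : #H = 0 := by omega
      rw [this] at hHcard; simp at hHcard; linarith
    obtain ⟨q0, hq0mem, hq0⟩ : ∃ q0 ∈ Icc 1 ⌊E r⌋₊, (#H : ℝ) / E r ≤ #(H.filter (fun h => Q h = q0)) := by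
      by_contra hcon
      push Not at hcon
      have h1 : #H = ∑ q ∈ Icc 1 ⌊E r⌋₊, #(H.filter (fun h => Q h = q)) :=
        card_eq_sum_card_fiberwise (fun h hh => by
          simp only [coe_Icc, Set.mem_Icc]
          exact ⟨hQ1 h hh, Nat.le_floor (hQ2 h hh)⟩)
      have hne : (Icc 1 ⌊E r⌋₊).Nonempty := ⟨1, by simp; exact e1⟩
      have h2 : (#H : ℝ) < ∑ q ∈ Icc 1 ⌊E r⌋₊, (#H : ℝ) / E r := by
        have h1' : (#H : ℝ) = ∑ q ∈ Icc 1 ⌊E r⌋₊, (#(H.filter (fun h => Q h = q)) : ℝ) := by exact_mod_cast h1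
        refine lt_of_eq_of_lt h1' (sum_lt_sum_of_nonempty hne hcon)
      rw [sum_const, Nat.card_Icc, nsmul_eq_mul] at h2
      have h3 : ((⌊E r⌋₊ + 1 - 1 : ℕ) : ℝ) ≤ E r := by
        rw [Nat.add_sub_cancel]; exact Nat.floor_le hE0.le
      have h4 : ((⌊E r⌋₊ + 1 - 1 : ℕ) : ℝ) * ((#H : ℝ) / E r) ≤ E r * ((#H : ℝ) / E r) :=
        mul_le_mul_of_nonneg_right h3 (by positivity)
      have h5 : E r * ((#H : ℝ) / E r) = #H := by field_simp
      linarith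
    set ρ := 1 / (8 * r ^ 2 * E r) with hρ
    have hρ0 : 0 < ρ := by positivity
    set ε := E r * (4 * r ^ 2) ^ (d + 1) / N ^ (d + 1) with hε
    have hρinv : ρ * (8 * r ^ 2 * E r) = 1 := by rw [hρ]; field_simp
    obtain ⟨q, hqa, hqb, hqc⟩ := recur_lemma ρ ε ((q0 * (d + 2) : ℕ) * α) hρ0 (by
        rw [hρ, div_le_one (by positivity)]; nlinarith [mul_le_mul (show (1:ℝ) ≤ r ^ 2 by nlinarith) e1 (by norm_num) (by positivity)])
      (by positivity) (by
        rw [hε, div_le_iff₀ (by positivity)]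
        have h1 : (N:ℝ) ≤ N ^ (d + 1) := le_self_pow₀ hNr (by omega)
        have h2 : 64 * 8 * r ^ 2 * E r ^ 2 * (4 * r ^ 2) ^ (d + 1) ≤ N := by
          refine le_trans ?_ hge
          simp only [hZ]
          have : 0 ≤ 12 * 64 * r ^ 4 * E r ^ 2 + 16 * r ^ 2 := by positivity
          linarith
        have h3 := mul_le_mul_of_nonneg_left (h2.trans h1) (show 0 ≤ ρ / 64 by positivity)
        refine le_trans (le_of_eq ?_) h3
        have : ρ / 64 * (64 * 8 * r ^ 2 * E r ^ 2 * (4 * r ^ 2) ^ (d + 1)) =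
          (ρ * (8 * r ^ 2 * E r)) * (E r * (4 * r ^ 2) ^ (d + 1)) := by ring
        rw [this, hρinv, one_mul])
      N (by
        refine le_trans ?_ hge
        have : 12 / ρ ^ 2 = 12 * 64 * r ^ 4 * E r ^ 2 := by rw [hρ]; field_simp; ring
        rw [this]; simp only [hZ]
        have : 0 ≤ 64 * 8 * r ^ 2 * E r ^ 2 * (4 * r ^ 2) ^ (d + 1) + 16 * r ^ 2 := by positivity
        linarith)
      (H.filter (fun h => Q h = q0)) ((filter_subset _ _).trans (filter_subset _ _)) (by
        refine le_trans ?_ hq0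
        rw [le_div_iff₀ hE0]
        have := mul_le_mul_of_nonneg_left hHcard hρ0.le
        have e2 : ρ * (8 * r ^ 2 * #H) * E r = #H := by
          have : ρ * (8 * r ^ 2 * #H) * E r = (ρ * (8 * r ^ 2 * E r)) * #H := by ring
          rw [this, hρinv, one_mul]
        have := mul_le_mul_of_nonneg_right this hE0.le
        linarith)
      (by
        intro h hh
        obtain ⟨hh1, hh2⟩ := mem_filter.1 hh
        have := hQ3 h hh1
        rw [hh2] at this; exact this)
    obtain ⟨hm1, hm2⟩ := mem_Icc.1 hq0mem
    have hq0E : (q0:ℝ) ≤ E r := (Nat.cast_le.2 hm2).trans (Nat.floor_le hE0.le)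
    refine ⟨q * (q0 * (d + 2)), by
      have : 0 < q * (q0 * (d + 2)) := by positivity
      omega, ?_, ?_⟩
    · have : ((q * (q0 * (d + 2)) : ℕ) : ℝ) ≤ q1 r := by
        push_cast
        have h1 : (q:ℝ) * (q0 * (d + 2)) ≤ (3 / ρ) * (E r * (d + 2)) := by
          apply mul_le_mul hqb _ (by positivity) (by positivity)
          exact mul_le_mul_of_nonneg_right hq0E (by positivity)
        refine h1.trans (le_of_eq ?_)
        simp only [hq1, hρ]; field_simp; ring
      linarith
    · have e3 : ((q * (q0 * (d + 2)) : ℕ) : ℝ) * α = q * ((q0 * (d + 2) : ℕ) * α) := by push_cast; ring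
      rw [e3]
      have : nn (q * ((q0 * (d + 2) : ℕ) * α)) * (N:ℝ) ^ (d + 1 + 1) ≤ q2 r := by
        refine (mul_le_mul_of_nonneg_right hqc (by positivity)).trans (le_of_eq ?_)
        simp only [hq2, hρ, hε]; field_simp; ring
      linarith


section Mordell
variable {p : ℕ} [Fact p.Prime]

/-- Newton: equal power sums give a permutation -/
lemma newton_perm (e : ℕ) (he : e < p) (x y : Fin e → ZMod p)
    (hxy : ∀ i, 1 ≤ i → i ≤ e → ∑ j, x j ^ i = ∑ j, y j ^ i) :
    ∃ σ : Fin e → Fin e, x = y ∘ σ := by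
  have key : ∀ k, k ≤ e → MvPolynomial.aeval x (MvPolynomial.esymm (Fin e) (ZMod p) k)
      = MvPolynomial.aeval y (MvPolynomial.esymm (Fin e) (ZMod p) k) := by
    intro k
    induction k using Nat.strong_induction_on with
    | _ k ih =>
      intro hk
      rcases Nat.eq_zero_or_pos k with rfl | hk0
      · simp
      have hx := congrArg (MvPolynomial.aeval x) (MvPolynomial.mul_esymm_eq_sum (Fin e) (ZMod p) k)
      have hy := congrArg (MvPolynomial.aeval y) (MvPolynomial.mul_esymm_eq_sum (Fin e) (ZMod p) k)
      have hrhs : MvPolynomial.aeval x ((-1) ^ (k + 1) *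
          ∑ a ∈ antidiagonal k with a.1 < k, (-1) ^ a.1 * MvPolynomial.esymm (Fin e) (ZMod p) a.1 * MvPolynomial.psum (Fin e) (ZMod p) a.2)
        = MvPolynomial.aeval y ((-1) ^ (k + 1) *
          ∑ a ∈ antidiagonal k with a.1 < k, (-1) ^ a.1 * MvPolynomial.esymm (Fin e) (ZMod p) a.1 * MvPolynomial.psum (Fin e) (ZMod p) a.2) := by
        simp only [map_mul, map_sum, map_pow, map_neg, map_one]
        congr 1
        apply sum_congr rfl
        intro a ha
        simp only [mem_filter, Finset.HasAntidiagonal.mem_antidiagonal] at ha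
        rw [ih a.1 ha.2 (by omega)]
        congr 1
        simp only [MvPolynomial.psum, map_sum, map_pow, MvPolynomial.aeval_X]
        exact hxy a.2 (by omega) (by omega)
      rw [hrhs, ← hy] at hx
      simp only [map_mul, map_natCast] at hx
      have hk1 : (k : ZMod p) ≠ 0 := by
        intro h0
        rw [ZMod.natCast_eq_zero_iff] at h0
        have := Nat.le_of_dvd hk0 h0
        omega
      exact mul_left_cancel₀ hk1 hx
  have hprod : (∏ j, (Polynomial.X - Polynomial.C (x j))) = ∏ j, (Polynomial.X - Polynomial.C (y j)) := by
    have h1 : ∀ z : Fin e → ZMod p, (∏ j, (Polynomial.X - Polynomial.C (z j)))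
        = ∑ i ∈ range (e + 1), (-1) ^ i * (Polynomial.C (MvPolynomial.aeval z (MvPolynomial.esymm (Fin e) (ZMod p) i)) * Polynomial.X ^ (e - i)) := by
      intro z
      have := Multiset.prod_X_sub_X_eq_sum_esymm (Multiset.map z (univ : Finset (Fin e)).val)
      simp only [Multiset.map_map, Multiset.card_map] at this
      have hc : Multiset.card (univ : Finset (Fin e)).val = e := by simp
      rw [hc] at this
      have e1 : (∏ j, (Polynomial.X - Polynomial.C (z j))) = (Multiset.map ((fun t => Polynomial.X - Polynomial.C t) ∘ z) (univ : Finset (Fin e)).val).prod := rfl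
      rw [e1, this]
      apply sum_congr rfl
      intro i _
      rw [MvPolynomial.aeval_esymm_eq_multiset_esymm]
    rw [h1, h1]
    apply sum_congr rfl
    intro i hi
    rw [key i (by simp at hi; omega)]
  have hroots : Multiset.map x (univ : Finset (Fin e)).val = Multiset.map y (univ : Finset (Fin e)).val := by
    have := congrArg Polynomial.roots hprod
    have h2 : ∀ z : Fin e → ZMod p, (∏ j, (Polynomial.X - Polynomial.C (z j))).roots = Multiset.map z (univ : Finset (Fin e)).val := by
      intro z
      have e1 : (∏ j, (Polynomial.X - Polynomial.C (z j))) = (Multiset.map (fun t => Polynomial.X - Polynomial.C t) (Multiset.map z (univ : Finset (Fin e)).val)).prod := by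
        rw [Multiset.map_map]; rfl
      rw [e1, Polynomial.roots_multiset_prod_X_sub_C]
    rwa [h2, h2] at this
  have hj : ∀ j, ∃ i, x j = y i := by
    intro j
    have h1 : x j ∈ Multiset.map x (univ : Finset (Fin e)).val := Multiset.mem_map_of_mem _ (mem_univ j)
    rw [hroots, Multiset.mem_map] at h1
    obtain ⟨i, _, hi⟩ := h1
    exact ⟨i, hi.symm⟩
  choose σ hσ using hj
  exact ⟨σ, funext hσ⟩

lemma addchar_sum {A ι : Type*} [AddCommMonoid A] (ψ : AddChar A ℂ) (t : Finset ι) (f : ι → A) :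
    ψ (∑ i ∈ t, f i) = ∏ i ∈ t, ψ (f i) := by
  classical
  induction t using Finset.induction_on with
  | empty => simp
  | insert a t ha ih => rw [sum_insert ha, prod_insert ha, AddChar.map_add_eq_mul, ih]

noncomputable def msum (p : ℕ) [Fact p.Prime] (e : ℕ) (c : Fin e → ZMod p) : ℂ :=
  ∑ x : ZMod p, ZMod.stdAddChar (∑ i : Fin e, c i * x ^ (i.1 + 1))

lemma stdchar_norm (x : ZMod p) : ‖ZMod.stdAddChar x‖ = 1 := by
  have := AddChar.norm_apply (ZMod.stdAddChar (N := p)) x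
  exact this

lemma char_sum_vec (e : ℕ) (v : Fin e → ZMod p) :
    ∑ c : Fin e → ZMod p, ZMod.stdAddChar (∑ i, c i * v i) = if v = 0 then (p : ℂ) ^ e else 0 := by
  have h1 : ∀ c : Fin e → ZMod p, ZMod.stdAddChar (∑ i, c i * v i) = ∏ i, ZMod.stdAddChar (c i * v i) := by
    intro c
    exact addchar_sum _ _ _
  simp_rw [h1]
  have h2 := Finset.prod_univ_sum (fun _ : Fin e => (univ : Finset (ZMod p))) (fun i (c : ZMod p) => ZMod.stdAddChar (c * v i))
  rw [Fintype.piFinset_univ] at h2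
  rw [← h2]
  have h3 : ∀ i, ∑ c : ZMod p, ZMod.stdAddChar (c * v i) = if v i = 0 then (p : ℂ) else 0 := by
    intro i
    rw [AddChar.sum_mulShift _ (ZMod.isPrimitive_stdAddChar p)]
    simp
  simp_rw [h3]
  by_cases hv : v = 0
  · simp [hv]
  · rw [if_neg hv]
    obtain ⟨i, hi⟩ := Function.ne_iff.1 hv
    exact prod_eq_zero (mem_univ i) (if_neg hi)

lemma moment_id (e : ℕ) : ∑ c : Fin e → ZMod p, ((‖msum p e c‖ ^ (2 * e) : ℝ) : ℂ)
    = ∑ x : Fin e → ZMod p, ∑ y : Fin e → ZMod p,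
      (if (fun i : Fin e => (∑ j, x j ^ (i.1+1)) - ∑ j, y j ^ (i.1+1)) = 0 then (p:ℂ)^e else 0) := by
  have h1 : ∀ c : Fin e → ZMod p, ((‖msum p e c‖ ^ (2 * e) : ℝ) : ℂ)
     = ∑ x : Fin e → ZMod p, ∑ y : Fin e → ZMod p,
       ZMod.stdAddChar (∑ i, c i * ((∑ j, x j ^ (i.1+1)) - ∑ j, y j ^ (i.1+1))) := by
    intro c
    have h2 : ((‖msum p e c‖ ^ (2 * e) : ℝ) : ℂ) = (msum p e c) ^ e * ((starRingEnd ℂ) (msum p e c)) ^ e := by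
      rw [← mul_pow, Complex.mul_conj, Complex.normSq_eq_norm_sq, pow_mul]
      push_cast
      rfl
    have hpow : ∀ f : ZMod p → ℂ, (∑ x, f x) ^ e = ∑ x : Fin e → ZMod p, ∏ j, f (x j) := by
      intro f
      have := Finset.prod_univ_sum (fun _ : Fin e => (univ : Finset (ZMod p))) (fun _ c => f c)
      rw [Fintype.piFinset_univ] at this
      rw [← this]
      simp
    rw [h2]
    unfold msum
    rw [map_sum, hpow, hpow, sum_mul_sum]
    apply sum_congr rfl
    intro x _
    apply sum_congr rfl
    intro y _
    rw [← map_prod (starRingEnd ℂ), ← addchar_sum, ← addchar_sum, ← AddChar.map_neg_eq_conj, ← AddChar.map_add_eq_mul]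
    congr 1
    rw [sum_comm, sum_comm (s := univ) (t := univ) (f := fun x1 i => c i * y x1 ^ (i.1 + 1)), ← sub_eq_add_neg, ← sum_sub_distrib]
    apply sum_congr rfl
    intro i _
    rw [← mul_sum, ← mul_sum, mul_sub]
  simp_rw [h1]
  rw [sum_comm]
  apply sum_congr rfl
  intro x _
  rw [sum_comm]
  apply sum_congr rfl
  intro y _
  exact char_sum_vec e _

lemma moment_le (e : ℕ) (he : e < p) : ∑ c : Fin e → ZMod p, ‖msum p e c‖ ^ (2 * e) ≤ (e:ℝ) ^ e * (p:ℝ) ^ (2 * e) := by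
  have h := moment_id (p := p) e
  have h2 : ∑ c : Fin e → ZMod p, ‖msum p e c‖ ^ (2 * e) = ∑ x : Fin e → ZMod p, ∑ y : Fin e → ZMod p,
      (if (fun i : Fin e => (∑ j, x j ^ (i.1+1)) - ∑ j, y j ^ (i.1+1)) = 0 then (p:ℝ)^e else 0) := by
    have : ((∑ c : Fin e → ZMod p, ‖msum p e c‖ ^ (2 * e) : ℝ) : ℂ) = ((∑ x : Fin e → ZMod p, ∑ y : Fin e → ZMod p,
      (if (fun i : Fin e => (∑ j, x j ^ (i.1+1)) - ∑ j, y j ^ (i.1+1)) = 0 then (p:ℝ)^e else 0) : ℝ) : ℂ) := by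
      push_cast
      push_cast at h
      rw [h]
      apply sum_congr rfl; intro x _; apply sum_congr rfl; intro y _
      split_ifs <;> simp
    exact_mod_cast this
  rw [h2, sum_comm]
  have h3 : ∀ y : Fin e → ZMod p, ∑ x : Fin e → ZMod p,
      (if (fun i : Fin e => (∑ j, x j ^ (i.1+1)) - ∑ j, y j ^ (i.1+1)) = 0 then (p:ℝ)^e else 0) ≤ (e:ℝ)^e * (p:ℝ)^e := by
    intro y
    rw [← sum_filter, sum_const, nsmul_eq_mul]
    gcongr
    have hsub : (univ.filter (fun x : Fin e → ZMod p => (fun i : Fin e => (∑ j, x j ^ (i.1+1)) - ∑ j, y j ^ (i.1+1)) = 0))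
        ⊆ (univ : Finset (Fin e → Fin e)).image (fun σ => y ∘ σ) := by
      intro x hx
      rw [mem_filter] at hx
      obtain ⟨σ, hσ⟩ := newton_perm e he x y (by
        intro i hi1 hi2
        have := congrFun hx.2 ⟨i - 1, by omega⟩
        simp only [Pi.zero_apply, sub_eq_zero] at this
        have hi : i - 1 + 1 = i := by omega
        rwa [hi] at this)
      rw [mem_image]
      exact ⟨σ, mem_univ _, hσ.symm⟩
    have := (card_le_card hsub).trans card_image_le
    have hc : (univ : Finset (Fin e → Fin e)).card = e ^ e := by simp
    rw [hc] at this
    exact_mod_cast this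
  refine (sum_le_sum (fun y _ => h3 y)).trans ?_
  rw [sum_const, nsmul_eq_mul]
  have : (univ : Finset (Fin e → ZMod p)).card = p ^ e := by simp [ZMod.card]
  rw [this]
  apply le_of_eq
  push_cast
  ring

end Mordell


section Mordell
variable {p : ℕ} [Fact p.Prime]

noncomputable def psumF (p : ℕ) [Fact p.Prime] (f : (ZMod p)[X]) : ℂ := ∑ x : ZMod p, ZMod.stdAddChar (f.eval x)

lemma psumF_norm (e : ℕ) (f : (ZMod p)[X]) (hf : f.natDegree ≤ e) :
    ‖psumF p f‖ = ‖msum p e (fun i => f.coeff (i.1 + 1))‖ := by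
  have : psumF p f = ZMod.stdAddChar (f.coeff 0) * msum p e (fun i => f.coeff (i.1 + 1)) := by
    unfold psumF msum
    rw [mul_sum]
    apply sum_congr rfl
    intro x _
    rw [← AddChar.map_add_eq_mul]
    congr 1
    rw [eval_eq_sum_range' (n := e + 1) (by omega), sum_range_succ']
    rw [add_comm, Finset.sum_range]
    simp
  rw [this, norm_mul, stdchar_norm, one_mul]

lemma psumF_affine (f : (ZMod p)[X]) (u v : ZMod p) (hu : u ≠ 0) :
    psumF p ((taylor v f).comp (C u * X)) = psumF p f := by
  unfold psumF
  refine Fintype.sum_bijective (fun x => u * x + v) ?_ _ _ ?_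
  · constructor
    · intro x y hxy
      simpa [hu] using hxy
    · intro y
      refine ⟨u⁻¹ * (y - v), ?_⟩
      field_simp
      ring
  · intro x
    rw [eval_comp, taylor_eval]
    simp

lemma affine_coeff_top (f : (ZMod p)[X]) (e : ℕ) (he : f.natDegree = e) (u v : ZMod p) :
    ((taylor v f).comp (C u * X)).coeff e = f.coeff e * u ^ e := by
  rw [comp_C_mul_X_coeff, taylor_coeff]
  congr 1
  have h1 : (hasseDeriv e f).natDegree ≤ 0 := by
    refine (natDegree_hasseDeriv_le f e).trans (by omega)
  rw [eq_C_of_natDegree_le_zero h1]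
  simp [hasseDeriv_coeff]

lemma affine_coeff_sub (f : (ZMod p)[X]) (e : ℕ) (he : f.natDegree = e + 1) (u v : ZMod p) :
    ((taylor v f).comp (C u * X)).coeff e = (f.coeff e + (e + 1) * f.coeff (e + 1) * v) * u ^ e := by
  rw [comp_C_mul_X_coeff, taylor_coeff]
  congr 1
  have h1 : (hasseDeriv e f).natDegree ≤ 1 := by
    refine (natDegree_hasseDeriv_le f e).trans (by omega)
  rw [eq_X_add_C_of_natDegree_le_one h1]
  simp [hasseDeriv_coeff, add_comm 1 e]
  ring

lemma mordell (f : (ZMod p)[X]) (e : ℕ) (he2 : 1 ≤ e) (hep : e + 1 < p) (he : f.natDegree = e + 1) :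
    ‖psumF p f‖ ^ (2 * (e + 1)) * (p * (p - 1) : ℝ) ≤ (e + 1 : ℝ) ^ (e + 2) * (p : ℝ) ^ (2 * (e + 1)) := by
  classical
  set S : Finset (ZMod p × ZMod p) := (univ.erase 0) ×ˢ univ with hS
  set V : ZMod p × ZMod p → (Fin (e + 1) → ZMod p) := fun uv i => ((taylor uv.2 f).comp (C uv.1 * X)).coeff (i.1 + 1) with hV
  have hnat : ∀ uv : ZMod p × ZMod p, ((taylor uv.2 f).comp (C uv.1 * X)).natDegree ≤ e + 1 := by
    intro uv
    refine natDegree_comp_le.trans ?_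
    rw [natDegree_taylor, he]
    have : (C uv.1 * X).natDegree ≤ 1 := (natDegree_C_mul_le _ _).trans natDegree_X_le
    nlinarith
  have hlead : f.coeff (e + 1) ≠ 0 := by
    rw [← he]
    have : f ≠ 0 := by rintro rfl; simp at he
    exact leadingCoeff_ne_zero.2 this
  have hcard : (S.card : ℝ) = p * (p - 1) := by
    rw [hS, card_product, card_erase_of_mem (mem_univ _)]
    have := (Fact.out : p.Prime).two_le
    simp only [card_univ, ZMod.card]
    push_cast [Nat.cast_sub (show 1 ≤ p by omega)]
    ring
  have h1 : ∑ uv ∈ S, ‖msum p (e+1) (V uv)‖ ^ (2 * (e + 1)) = ‖psumF p f‖ ^ (2 * (e + 1)) * (p * (p - 1) : ℝ) := by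
    rw [← hcard, mul_comm _ (S.card : ℝ), ← nsmul_eq_mul, ← sum_const]
    apply sum_congr rfl
    intro uv huv
    rw [hS, mem_product, mem_erase] at huv
    rw [← psumF_affine f uv.1 uv.2 huv.1.1, psumF_norm (e + 1) _ (hnat uv)]
  have hfib : ∀ c : Fin (e + 1) → ZMod p, (S.filter (fun uv => V uv = c)).card ≤ e + 1 := by
    intro c
    have hinj : Set.InjOn Prod.fst (S.filter (fun uv => V uv = c) : Set (ZMod p × ZMod p)) := by
      rintro ⟨u, v⟩ h1 ⟨u', v'⟩ h2 huu
      simp only [coe_filter, Set.mem_ofPred_eq] at h1 h2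
      simp only at huu
      subst huu
      have hu : u ≠ 0 := by
        have := h1.1
        rw [hS, mem_product, mem_erase] at this
        exact this.1.1
      have h3 := congrFun (h1.2.trans h2.2.symm) ⟨e - 1, by omega⟩
      simp only [hV] at h3
      rw [show e - 1 + 1 = e by omega, affine_coeff_sub f e he, affine_coeff_sub f e he] at h3
      have h4 := mul_right_cancel₀ (pow_ne_zero e hu) h3
      have h5 : ((e : ZMod p) + 1) * f.coeff (e + 1) ≠ 0 := by
        apply mul_ne_zero _ hlead
        intro h0
        have h0' : ((e + 1 : ℕ) : ZMod p) = 0 := by push_cast; exact h0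
        rw [ZMod.natCast_eq_zero_iff] at h0'
        have := Nat.le_of_dvd (by omega) h0'
        omega
      have h6 := mul_left_cancel₀ h5 (add_left_cancel h4)
      rw [h6]
    rw [← card_image_of_injOn hinj]
    have hsub : (S.filter (fun uv => V uv = c)).image Prod.fst ⊆ (nthRoots (e + 1) (c ⟨e, by omega⟩ / f.coeff (e + 1))).toFinset := by
      intro u hu
      rw [mem_image] at hu
      obtain ⟨⟨u', v⟩, h, rfl⟩ := hu
      rw [mem_filter] at h
      rw [Multiset.mem_toFinset, mem_nthRoots (by omega)]
      rw [← h.2]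
      simp only [hV]
      rw [affine_coeff_top f (e + 1) he]
      field_simp
    exact (card_le_card hsub).trans ((Multiset.toFinset_card_le _).trans (card_nthRoots _ _))
  have h2 : ∑ uv ∈ S, ‖msum p (e+1) (V uv)‖ ^ (2 * (e + 1)) ≤ (e + 1 : ℝ) * ∑ c : Fin (e+1) → ZMod p, ‖msum p (e+1) c‖ ^ (2 * (e+1)) := by
    rw [← sum_fiberwise S V, mul_sum]
    apply sum_le_sum
    intro c _
    have : ∑ uv ∈ S with V uv = c, ‖msum p (e+1) (V uv)‖ ^ (2 * (e + 1)) = ∑ uv ∈ S with V uv = c, ‖msum p (e+1) c‖ ^ (2 * (e + 1)) := by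
      apply sum_congr rfl
      intro uv h
      rw [(mem_filter.1 h).2]
    rw [this, sum_const, nsmul_eq_mul]
    gcongr
    exact_mod_cast hfib c
  rw [← h1]
  refine h2.trans ?_
  have := moment_le (p := p) (e + 1) hep
  calc _ ≤ (e + 1 : ℝ) * (((e + 1 : ℕ) : ℝ) ^ (e + 1) * (p:ℝ) ^ (2 * (e + 1))) := by gcongr
    _ = _ := by push_cast; ring

/-- normalized Mordell bound -/
lemma mordell_norm (d : ℕ) (hd : 1 ≤ d) (hp : d < p) (t : ℝ) (ht : 0 < t) (htp : t ^ d = p) (f : (ZMod p)[X])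
    (h1 : 1 ≤ f.natDegree) (h2 : f.natDegree ≤ d) : ‖psumF p f‖ / p ≤ 2 * (d:ℝ) ^ (d + 1) / t := by
  have hp2 := (Fact.out : p.Prime).two_le
  have hp0 : (0:ℝ) < p := by positivity
  have hd1 : (1:ℝ) ≤ d := by exact_mod_cast hd
  have ht1 : 1 ≤ t := by
    by_contra hlt
    push Not at hlt
    have := pow_le_one₀ ht.le hlt.le (n := d)
    rw [htp] at this
    have : (2:ℝ) ≤ p := by exact_mod_cast hp2
    linarith
  obtain ⟨e, he⟩ : ∃ e, f.natDegree = e + 1 := ⟨f.natDegree - 1, by omega⟩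
  rcases Nat.eq_zero_or_pos e with rfl | he0
  · have : psumF p f = 0 := by
      have hf := eq_X_add_C_of_natDegree_le_one (p := f) (by omega)
      have hl : f.coeff 1 ≠ 0 := by
        have : f ≠ 0 := by rintro rfl; simp at he
        have h3 := leadingCoeff_ne_zero.2 this
        rwa [leadingCoeff, he] at h3
      unfold psumF
      rw [hf]
      simp only [eval_add, eval_mul, eval_C, eval_X, AddChar.map_add_eq_mul]
      rw [← sum_mul]
      have := AddChar.sum_mulShift (f.coeff 1) (ZMod.isPrimitive_stdAddChar p)
      rw [if_neg hl] at this
      simp_rw [mul_comm (f.coeff 1)]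
      rw [this]
      simp
    rw [this]; simp; positivity
  · have hm := mordell f e he0 (by omega) he
    have hpow : (‖psumF p f‖ / p) ^ (2 * (e + 1)) ≤ (2 * (d:ℝ) ^ (d + 1) / t) ^ (2 * (e + 1)) := by
      have hA : (‖psumF p f‖ / p) ^ (2 * (e + 1)) * (p * (p - 1)) ≤ (e + 1 : ℝ) ^ (e + 2) := by
        rw [div_pow, div_mul_eq_mul_div, div_le_iff₀ (by positivity)]
        exact hm
      have hpp : (p:ℝ)^2 / 2 ≤ p * (p - 1) := by
        have : (2:ℝ) ≤ p := by exact_mod_cast hp2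
        nlinarith
      have hed : (e + 1 : ℝ) ≤ d := by have : e + 1 ≤ d := by omega
                                       exact_mod_cast this
      have hB : (e + 1 : ℝ) ^ (e + 2) ≤ (d:ℝ) ^ (d + 1) := by
        calc (e + 1 : ℝ) ^ (e + 2) ≤ (d:ℝ) ^ (e + 2) := by gcongr
          _ ≤ _ := pow_le_pow_right₀ hd1 (by omega)
      set y := (‖psumF p f‖ / p) ^ (2 * (e + 1)) with hy
      have hy0 : 0 ≤ y := by positivity
      have hC : y * (p:ℝ)^2 ≤ 2 * (d:ℝ) ^ (d+1) := by nlinarith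
      have hD : t ^ (2 * (e + 1)) ≤ (p:ℝ)^2 := by
        rw [← htp, ← pow_mul]
        exact pow_le_pow_right₀ ht1 (by omega)
      rw [div_pow, le_div_iff₀ (by positivity)]
      calc y * t ^ (2 * (e+1)) ≤ y * (p:ℝ)^2 := by gcongr
        _ ≤ 2 * (d:ℝ) ^ (d+1) := hC
        _ ≤ _ := le_self_pow₀ (by nlinarith [one_le_pow₀ hd1 (n := d+1)]) (by omega)
    exact le_of_pow_le_pow_left₀ (by omega) (by positivity) hpow

end Mordell


section Hua

lemma ee_eq_one {x : ℝ} (h : ee x = 1) : ∃ n : ℤ, x = n := by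
  have := ee_sub_one_ge x
  rw [h] at this
  simp at this
  have h2 : nn x = 0 := le_antisymm (by linarith) (nn_nonneg x)
  refine ⟨round x, ?_⟩
  unfold nn at h2
  have := abs_eq_zero.1 h2
  linarith

lemma ee_div_eq_one {a : ℤ} {q : ℕ} (hq : 0 < q) (h : ee ((a:ℝ) / q) = 1) : (q:ℤ) ∣ a := by
  obtain ⟨n, hn⟩ := ee_eq_one h
  have hq' : (q:ℝ) ≠ 0 := by positivity
  rw [div_eq_iff hq'] at hn
  refine ⟨n, ?_⟩
  have : (a:ℝ) = ((n * q : ℤ) : ℝ) := by push_cast; exact hn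
  rw [mul_comm]
  exact_mod_cast this

lemma ee_div_congr {a b : ℤ} {q : ℕ} (hq : 0 < q) (h : (q:ℤ) ∣ a - b) : ee ((a:ℝ) / q) = ee ((b:ℝ) / q) := by
  obtain ⟨n, hn⟩ := h
  have hq' : (q:ℝ) ≠ 0 := by positivity
  apply ee_eq_of_sub_int _ _ n
  rw [← sub_div, div_eq_iff hq']
  have : ((a - b : ℤ) : ℝ) = ((q * n : ℤ) : ℝ) := by rw [hn]
  push_cast at this
  rw [this]; ring

lemma poly_periodic (g : ℤ[X]) {q : ℕ} (hq : 0 < q) :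
    Function.Periodic (fun n : ℕ => ee (((g.eval (n:ℤ) : ℤ) : ℝ) / q)) q := by
  intro n
  apply ee_div_congr hq
  have := sub_dvd_eval_sub ((n + q : ℕ) : ℤ) (n : ℤ) g
  simpa using this

lemma class_avg {F : ℕ → ℂ} {p L n0 : ℕ} (hp : 0 < p) (hn0 : n0 < p) :
    avg (p * L) (fun n => if n % p = n0 then F n else 0) = avg L (fun y => F (n0 + p * y)) / p := by
  unfold avg
  have : ∑ n ∈ range (p * L), (if n % p = n0 then F n else 0) = ∑ y ∈ range L, F (n0 + p * y) := by
    rw [← sum_filter]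
    refine sum_nbij' (fun n => n / p) (fun y => n0 + p * y) ?_ ?_ ?_ ?_ ?_
    · intro n hn
      simp only [mem_filter, mem_range] at hn ⊢
      exact Nat.div_lt_of_lt_mul hn.1
    · intro y hy
      simp only [mem_filter, mem_range] at hy ⊢
      constructor
      · have : p * (y + 1) ≤ p * L := Nat.mul_le_mul_left _ hy
        rw [mul_add, mul_one] at this
        omega
      · rw [Nat.add_mul_mod_self_left, Nat.mod_eq_of_lt hn0]
    · intro n hn
      simp only [mem_filter, mem_range] at hn
      rw [← hn.2]
      exact Nat.mod_add_div n p
    · intro y _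
      show (n0 + p * y) / p = y
      rw [Nat.add_mul_div_left _ _ hp, Nat.div_eq_of_lt hn0, zero_add]
    · intro n hn
      simp only [mem_filter, mem_range] at hn
      rw [← hn.2, Nat.mod_add_div n p]
  rw [this]
  push_cast
  rw [div_div, mul_comm]

lemma sum_class {F : ℕ → ℂ} {p L : ℕ} (hp : 0 < p) :
    avg L F = ∑ n0 ∈ range p, avg L (fun n => if n % p = n0 then F n else 0) := by
  unfold avg
  rw [← sum_div, sum_comm]
  congr 1
  apply sum_congr rfl
  intro n _
  rw [sum_ite_eq, if_pos (mem_range.2 (Nat.mod_lt _ hp))]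

lemma class_vanish {p : ℕ} (hp : p.Prime) (k : ℕ) (hk : 2 ≤ k) (g : ℤ[X]) (n0 : ℕ) (h : ¬ (p:ℤ) ∣ g.derivative.eval (n0:ℤ)) :
    avg (p ^ k) (fun n => if n % p = n0 then ee (((g.eval (n:ℤ) : ℤ) : ℝ) / (p^k : ℕ)) else 0) = 0 := by
  set f : ℕ → ℂ := fun n => if n % p = n0 then ee (((g.eval (n:ℤ) : ℤ) : ℝ) / (p^k : ℕ)) else 0 with hf
  have hpk : 0 < p ^ k := pow_pos hp.pos _
  have hper : Function.Periodic f (p ^ k) := by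
    intro n
    have h1 := poly_periodic g hpk n
    simp only [hf]
    simp only at h1
    rw [h1]
    have h2 : (n + p ^ k) % p = n % p := by
      obtain ⟨m, rfl⟩ : ∃ m, k = m + 1 := ⟨k - 1, by omega⟩
      rw [pow_succ, Nat.add_mul_mod_self_right]
    rw [h2]
  have hsh := avg_shift hper (p ^ (k - 1))
  have h2 : ∀ n, f (n + p ^ (k - 1)) = ee (((g.derivative.eval (n0:ℤ) : ℤ) : ℝ) / p) * f n := by
    intro n
    simp only [hf]
    have h2 : (n + p ^ (k - 1)) % p = n % p := by
      obtain ⟨m, rfl⟩ : ∃ m, k = m + 2 := ⟨k - 2, by omega⟩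
      rw [show m + 2 - 1 = m + 1 by omega, pow_succ, Nat.add_mul_mod_self_right]
    rw [h2]
    split_ifs with hn
    · rw [← ee_add]
      have e1 : ((g.derivative.eval (n0:ℤ) : ℤ) : ℝ) / p + ((g.eval (n:ℤ) : ℤ) : ℝ) / (p^k : ℕ) =
         ((g.eval (n:ℤ) + g.derivative.eval (n0:ℤ) * p ^ (k - 1) : ℤ) : ℝ) / (p^k : ℕ) := by
        have : (p:ℝ) ^ k = p ^ (k-1) * p := by rw [← pow_succ]; congr 1; omega
        have hp0 : (p:ℝ) ≠ 0 := by exact_mod_cast hp.ne_zero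
        push_cast
        rw [this]
        field_simp
        ring
      rw [e1]
      apply ee_div_congr hpk
      obtain ⟨c, hc⟩ := g.binomExpansion (n:ℤ) ((p:ℤ)^(k-1))
      have h3 : (p:ℤ) ∣ g.derivative.eval (n:ℤ) - g.derivative.eval (n0:ℤ) := by
        refine dvd_trans ?_ (sub_dvd_eval_sub (n:ℤ) n0 g.derivative)
        rw [← hn]
        rw [Int.natCast_mod]
        exact Int.dvd_self_sub_emod
      obtain ⟨m, hm⟩ := h3
      push_cast
      rw [hc]
      have e2 : (p:ℤ)^k = p^(k-1) * p := by rw [← pow_succ]; congr 1; omega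
      have e3 : ((p:ℤ)^(k-1))^2 = p^k * p^(k-2) := by rw [← pow_mul, ← pow_add]; congr 1; omega
      refine ⟨m + c * p^(k-2), ?_⟩
      have : g.derivative.eval (n:ℤ) = g.derivative.eval (n0:ℤ) + p * m := by linarith
      rw [this]
      calc _ = (p:ℤ) * m * p^(k-1) + c * (p^(k-1))^2 := by ring
        _ = _ := by rw [e3, e2]; ring
    · simp
  have h3 : avg (p^k) f = ee (((g.derivative.eval (n0:ℤ) : ℤ) : ℝ) / p) * avg (p^k) f := by
    conv_lhs => rw [← hsh]
    unfold avg
    rw [← mul_div_assoc, mul_sum]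
    congr 1
    exact sum_congr rfl (fun n _ => h2 n)
  by_contra hne
  have h4 : ee (((g.derivative.eval (n0:ℤ) : ℤ) : ℝ) / p) = 1 := by
    have : (1 - ee (((g.derivative.eval (n0:ℤ) : ℤ) : ℝ) / p)) * avg (p^k) f = 0 := by linear_combination h3
    rcases mul_eq_zero.1 this with h | h
    · exact (sub_eq_zero.1 h).symm
    · exact absurd h hne
  exact h (ee_div_eq_one hp.pos h4)

/-- rescaling: g(n0+pX)-g(n0)=p^σ g2 -/
lemma rescale {p : ℕ} (hp : p.Prime) (d : ℕ) (g : ℤ[X]) (hg : g.natDegree ≤ d) (hc : ∃ i, 1 ≤ i ∧ ¬ (p:ℤ) ∣ g.coeff i) (n0 : ℕ) :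
    ∃ σ : ℕ, 1 ≤ σ ∧ σ ≤ d ∧ ∃ g2 : ℤ[X], g2.natDegree ≤ d ∧ (∃ i, 1 ≤ i ∧ ¬ (p:ℤ) ∣ g2.coeff i) ∧
      ∀ y : ℤ, g.eval ((n0:ℤ) + p * y) = g.eval (n0:ℤ) + p ^ σ * g2.eval y := by
  have : Fact p.Prime := ⟨hp⟩
  set g3 : ℤ[X] := (taylor (n0:ℤ) g - C (g.eval (n0:ℤ))).comp (C (p:ℤ) * X) with hg3
  have hcoef : ∀ i, 1 ≤ i → g3.coeff i = (taylor (n0:ℤ) g).coeff i * p ^ i := by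
    intro i hi
    rw [hg3, comp_C_mul_X_coeff, coeff_sub, coeff_C, if_neg (by omega), sub_zero]
  have hcoef0 : g3.coeff 0 = 0 := by
    rw [hg3, comp_C_mul_X_coeff, coeff_sub, coeff_C, if_pos rfl, taylor_coeff_zero]; simp
  have hdeg3 : g3.natDegree ≤ d := by
    rw [natDegree_le_iff_coeff_eq_zero]
    intro i hi
    rw [hcoef i (by omega), coeff_eq_zero_of_natDegree_lt (by rw [natDegree_taylor]; omega), zero_mul]
  have htay : ∃ i, 1 ≤ i ∧ ¬ (p:ℤ) ∣ (taylor (n0:ℤ) g).coeff i := by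
    by_contra hcon
    push Not at hcon
    obtain ⟨i, hi1, hi2⟩ := hc
    set gb := g.map (Int.castRingHom (ZMod p)) with hgb
    have h1 : (taylor (n0:ZMod p) gb).natDegree ≤ 0 := by
      rw [natDegree_le_iff_coeff_eq_zero]
      intro j hj
      have h2 : (taylor (n0:ZMod p) gb) = (taylor (n0:ℤ) g).map (Int.castRingHom (ZMod p)) := by
        simp [taylor_apply, hgb, Polynomial.map_comp]
      rw [h2, coeff_map]
      simp only [eq_intCast]
      exact (ZMod.intCast_zmod_eq_zero_iff_dvd _ _).2 (hcon j hj)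
    rw [natDegree_taylor] at h1
    have h3 : gb.coeff i = 0 := coeff_eq_zero_of_natDegree_lt (by omega)
    rw [hgb, coeff_map] at h3
    simp only [eq_intCast] at h3
    exact hi2 ((ZMod.intCast_zmod_eq_zero_iff_dvd _ _).1 h3)
  obtain ⟨i0, hi1, hi2⟩ := htay
  have hi0d : i0 ≤ d := by
    by_contra h
    apply hi2
    rw [coeff_eq_zero_of_natDegree_lt (by rw [natDegree_taylor]; omega)]
    exact dvd_zero _
  have hbound : ∀ σ, (∀ i, (p:ℤ) ^ σ ∣ g3.coeff i) → σ ≤ d := by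
    intro σ hσ
    by_contra hcon
    have h1 := hσ i0
    rw [hcoef i0 hi1, mul_comm] at h1
    apply hi2
    have h2 : (p:ℤ)^(i0 + 1) ∣ (p:ℤ)^i0 * (taylor (n0:ℤ) g).coeff i0 := (pow_dvd_pow _ (by omega)).trans h1
    rw [pow_succ] at h2
    exact Int.dvd_of_mul_dvd_mul_left (by exact_mod_cast pow_ne_zero _ hp.ne_zero) h2
  classical
  set σ := Nat.findGreatest (fun σ => ∀ i, (p:ℤ) ^ σ ∣ g3.coeff i) d with hσ
  have hP1 : ∀ i, (p:ℤ) ^ 1 ∣ g3.coeff i := by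
    intro i
    rcases Nat.eq_zero_or_pos i with rfl | hi
    · rw [hcoef0]; exact dvd_zero _
    · rw [hcoef i hi]
      exact Dvd.dvd.mul_left (pow_dvd_pow _ hi) _
  have hσP : ∀ i, (p:ℤ) ^ σ ∣ g3.coeff i := Nat.findGreatest_spec (P := fun σ => ∀ i, (p:ℤ) ^ σ ∣ g3.coeff i) (hbound 1 hP1) hP1
  have hσ1 : 1 ≤ σ := Nat.le_findGreatest (hbound 1 hP1) hP1
  have hp0 : (p:ℤ)^σ ≠ 0 := by exact_mod_cast pow_ne_zero _ hp.ne_zero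
  obtain ⟨g2, hg2⟩ := (C_dvd_iff_dvd_coeff _ _).2 hσP
  have hcoef2 : ∀ i, g3.coeff i = p^σ * g2.coeff i := by
    intro i; rw [hg2, coeff_C_mul]
  refine ⟨σ, hσ1, hbound σ hσP, g2, ?_, ?_, ?_⟩
  · rw [natDegree_le_iff_coeff_eq_zero]
    intro i hi
    have := hcoef2 i
    rw [coeff_eq_zero_of_natDegree_lt (by omega)] at this
    rcases mul_eq_zero.1 this.symm with h | h
    · exact absurd h hp0
    · exact h
  · by_contra hcon
    push Not at hcon
    have h1 : ∀ i, (p:ℤ)^(σ+1) ∣ g3.coeff i := by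
      intro i
      rcases Nat.eq_zero_or_pos i with rfl | hi
      · rw [hcoef0]; exact dvd_zero _
      · rw [hcoef2, pow_succ]
        exact mul_dvd_mul_left _ (hcon i hi)
    have := Nat.le_findGreatest (P := fun σ => ∀ i, (p:ℤ) ^ σ ∣ g3.coeff i) (hbound _ h1) h1
    omega
  · intro y
    have h1 : g3.eval y = p^σ * g2.eval y := by rw [hg2, eval_mul, eval_C]
    rw [← h1, hg3, eval_comp, eval_sub, taylor_eval]
    simp [add_comm]

lemma avg_prime_eq {p : ℕ} [Fact p.Prime] (g : ℤ[X]) :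
    avg p (fun n => ee (((g.eval (n:ℤ) : ℤ) : ℝ) / p)) = psumF p (g.map (Int.castRingHom (ZMod p))) / p := by
  unfold avg psumF
  congr 1
  refine sum_bij (fun n _ => (n : ZMod p)) (fun _ _ => mem_univ _) ?_ ?_ ?_
  · intro a ha b hb hab
    rw [mem_range] at ha hb
    rw [ZMod.natCast_eq_natCast_iff'] at hab
    rwa [Nat.mod_eq_of_lt ha, Nat.mod_eq_of_lt hb] at hab
  · intro b _
    exact ⟨b.val, mem_range.2 (ZMod.val_lt b), by simp⟩
  · intro n _
    have h1 : (g.map (Int.castRingHom (ZMod p))).eval (n : ZMod p) = ((g.eval (n:ℤ) : ℤ) : ZMod p) := by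
      have := eval_map_apply (f := Int.castRingHom (ZMod p)) (p := g) (n:ℤ)
      simpa using this
    rw [h1, ZMod.stdAddChar_coe]
    unfold ee
    congr 1
    push_cast
    ring

theorem hua (d : ℕ) (hd : 1 ≤ d) {p : ℕ} (hp : p.Prime) (hpd : d < p) (t : ℝ) (ht : 0 < t) (htp : t ^ d = p) (k : ℕ) (hk : 1 ≤ k) :
    ∀ g : ℤ[X], g.natDegree ≤ d → (∃ i, 1 ≤ i ∧ ¬ (p:ℤ) ∣ g.coeff i) →
     (∀ n0 < p, ‖avg (p ^ k) (fun n => if n % p = n0 then ee (((g.eval (n:ℤ) : ℤ) : ℝ) / (p^k : ℕ)) else 0)‖ ≤ (2 * (d:ℝ)^(d+1)) ^ (k-1) / t ^ k)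
     ∧ ‖avg (p ^ k) (fun n => ee (((g.eval (n:ℤ) : ℤ) : ℝ) / (p^k : ℕ)))‖ ≤ (2 * (d:ℝ)^(d+1)) ^ k / t ^ k := by
  have : Fact p.Prime := ⟨hp⟩
  have hd1 : (1:ℝ) ≤ d := by exact_mod_cast hd
  set C0 : ℝ := 2 * (d:ℝ)^(d+1) with hC0
  have hC1 : (d:ℝ) ≤ C0 := by
    have : (d:ℝ) ≤ (d:ℝ)^(d+1) := le_self_pow₀ hd1 (by omega)
    rw [hC0]; linarith
  have hp2 : (2:ℝ) ≤ p := by exact_mod_cast hp.two_le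
  have ht1 : 1 ≤ t := by
    by_contra hlt
    push Not at hlt
    have := pow_le_one₀ ht.le hlt.le (n := d)
    rw [htp] at this
    linarith
  induction k using Nat.strong_induction_on with
  | _ k ih =>
  intro g hg hc
  have hclass : ∀ n0 < p, (k = 1 ∨ (p:ℤ) ∣ g.derivative.eval (n0:ℤ)) → ‖avg (p ^ k) (fun n => if n % p = n0 then ee (((g.eval (n:ℤ) : ℤ) : ℝ) / (p^k : ℕ)) else 0)‖ ≤ C0 ^ (k-1) / t ^ k := by
    intro n0 hn0 hor
    have e1 : p ^ k = p * p ^ (k-1) := by rw [← pow_succ']; congr 1; omega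
    have e2 := class_avg (F := fun n => ee (((g.eval (n:ℤ) : ℤ) : ℝ) / (p^k : ℕ))) (p := p) (L := p^(k-1)) hp.pos hn0
    rw [← e1] at e2
    rw [e2, norm_div, Complex.norm_natCast]
    have htriv : ‖avg (p^(k-1)) (fun y => ee (((g.eval ((n0 + p * y : ℕ):ℤ) : ℤ) : ℝ) / (p^k : ℕ)))‖ ≤ 1 :=
      avg_norm_le zero_le_one (fun n => (ee_norm _).le)
    have hcase1 : k ≤ d → ‖avg (p^(k-1)) (fun y => ee (((g.eval ((n0 + p * y : ℕ):ℤ) : ℤ) : ℝ) / (p^k : ℕ)))‖ / p ≤ C0 ^ (k-1) / t ^ k := by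
      intro hkd
      calc _ ≤ 1 / (p:ℝ) := by gcongr
        _ = 1 / t ^ d := by rw [htp]
        _ ≤ 1 / t ^ k := by
          apply one_div_le_one_div_of_le (by positivity)
          exact pow_le_pow_right₀ ht1 hkd
        _ ≤ _ := by
          gcongr
          exact one_le_pow₀ (hd1.trans hC1)
    rcases Nat.lt_or_ge d k with hlt | hge
    swap
    · exact hcase1 hge
    obtain ⟨σ, hσ1, hσd, g2, hg2, hc2, hev⟩ := rescale hp d g hg hc n0
    have e3 : avg (p^(k-1)) (fun y => ee (((g.eval ((n0 + p * y : ℕ):ℤ) : ℤ) : ℝ) / (p^k : ℕ)))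
       = ee (((g.eval (n0:ℤ) : ℤ) : ℝ) / (p^k:ℕ)) * avg (p^(k-σ)) (fun y => ee (((g2.eval (y:ℤ) : ℤ) : ℝ) / (p^(k-σ) : ℕ))) := by
      have hper := poly_periodic g2 (q := p^(k-σ)) (pow_pos hp.pos _)
      rw [← avg_of_dvd hper (L' := p^(k-1)) (pow_dvd_pow _ (by omega)) (pow_pos hp.pos _)]
      unfold avg
      rw [← mul_div_assoc, mul_sum]
      congr 1
      apply sum_congr rfl
      intro y _
      rw [← ee_add]
      have := hev y
      have e4 : (g.eval ((n0 + p * y : ℕ):ℤ) : ℤ) = g.eval (n0:ℤ) + p ^ σ * g2.eval (y:ℤ) := by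
        rw [← this]; push_cast; rfl
      simp only [e4]
      congr 1
      have e5 : (p:ℝ)^k = p^σ * p^(k-σ) := by rw [← pow_add]; congr 1; omega
      have hp0 : (p:ℝ) ≠ 0 := by positivity
      push_cast
      rw [e5]
      field_simp
    rw [e3, norm_mul, ee_norm, one_mul]
    have h3 := (ih (k-σ) (by omega) (by omega) g2 hg2 hc2).2
    calc _ ≤ (C0 ^ (k-σ) / t^(k-σ)) / p := by gcongr
      _ = C0 ^ (k-σ) / (t^(k-σ) * t ^ d) := by rw [htp, div_div]
      _ ≤ C0 ^ (k-1) / t ^ k := by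
        have : t ^ k ≤ t^(k-σ) * t^d := by
          rw [← pow_add]
          exact pow_le_pow_right₀ ht1 (by omega)
        have h5 : C0 ^ (k-σ) ≤ C0^(k-1) := pow_le_pow_right₀ (hd1.trans hC1) (by omega)
        gcongr
  have hclass2 : ∀ n0 < p, ‖avg (p ^ k) (fun n => if n % p = n0 then ee (((g.eval (n:ℤ) : ℤ) : ℝ) / (p^k : ℕ)) else 0)‖ ≤ C0 ^ (k-1) / t ^ k := by
    intro n0 hn0
    by_cases hor : k = 1 ∨ (p:ℤ) ∣ g.derivative.eval (n0:ℤ)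
    · exact hclass n0 hn0 hor
    · push Not at hor
      rw [class_vanish hp k (by omega) g n0 hor.2]
      rw [norm_zero]
      have : 0 ≤ C0 := by linarith
      positivity
  refine ⟨hclass2, ?_⟩
  obtain ⟨i0, hi1, hi2⟩ := hc
  have hi0d : i0 ≤ d := by
    by_contra h
    apply hi2
    rw [coeff_eq_zero_of_natDegree_lt (by omega)]
    exact dvd_zero _
  rcases Nat.lt_or_ge 1 k with hk2 | hk1
  swap
  · have hk' : k = 1 := by omega
    subst hk'
    simp only [pow_one]
    rw [avg_prime_eq, norm_div, Complex.norm_natCast]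
    apply mordell_norm d hd hpd t ht htp
    · by_contra hcon
      push Not at hcon
      have h3 : (g.map (Int.castRingHom (ZMod p))).coeff i0 = 0 := coeff_eq_zero_of_natDegree_lt (lt_of_lt_of_le hcon hi1)
      rw [coeff_map] at h3
      simp only [eq_intCast] at h3
      exact hi2 ((ZMod.intCast_zmod_eq_zero_iff_dvd _ _).1 h3)
    · exact natDegree_map_le.trans hg
  · rw [sum_class hp.pos]
    set gb := (g.derivative).map (Int.castRingHom (ZMod p)) with hgb
    have hgb0 : gb ≠ 0 := by
      intro h0
      have h1 : gb.coeff (i0 - 1) = 0 := by rw [h0]; simp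
      rw [hgb, coeff_map, coeff_derivative] at h1
      simp only [eq_intCast] at h1
      have h2 := (ZMod.intCast_zmod_eq_zero_iff_dvd _ _).1 h1
      rw [show i0 - 1 + 1 = i0 by omega] at h2
      rcases (Nat.prime_iff_prime_int.1 hp).dvd_or_dvd h2 with h | h
      · exact hi2 h
      · have h4 : (p:ℤ) ∣ (i0 : ℤ) := by
          have : ((i0 - 1 : ℕ) : ℤ) + 1 = i0 := by omega
          rwa [this] at h
        have := Nat.le_of_dvd (by omega) (Int.natCast_dvd_natCast.1 h4)
        omega
    set bad := (range p).filter (fun n0 : ℕ => (p:ℤ) ∣ g.derivative.eval (n0:ℤ)) with hbad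
    have hbadcard : bad.card ≤ d := by
      have h1 : (bad.image (fun n : ℕ => (n : ZMod p))) ⊆ gb.roots.toFinset := by
        intro x hx
        rw [mem_image] at hx
        obtain ⟨n, hn, rfl⟩ := hx
        rw [Multiset.mem_toFinset, mem_roots hgb0, IsRoot]
        have h1 : gb.eval (n : ZMod p) = ((g.derivative.eval (n:ℤ) : ℤ) : ZMod p) := by
          have := eval_map_apply (f := Int.castRingHom (ZMod p)) (p := g.derivative) (n:ℤ)
          rw [hgb]; simp
        rw [h1]
        exact (ZMod.intCast_zmod_eq_zero_iff_dvd _ _).2 (mem_filter.1 hn).2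
      have h2 : (bad.image (fun n : ℕ => (n : ZMod p))).card = bad.card := by
        apply card_image_of_injOn
        intro a ha b hb hab
        simp only [hbad, coe_filter, mem_range, Set.mem_ofPred_eq] at ha hb
        simp only at hab
        rw [ZMod.natCast_eq_natCast_iff'] at hab
        rwa [Nat.mod_eq_of_lt ha.1, Nat.mod_eq_of_lt hb.1] at hab
      rw [← h2]
      refine (card_le_card h1).trans ((Multiset.toFinset_card_le _).trans ((card_roots' _).trans ?_))
      exact natDegree_map_le.trans ((natDegree_derivative_le _).trans (by omega))
    have h5 : ∑ n0 ∈ range p, avg (p ^ k) (fun n => if n % p = n0 then ee (((g.eval (n:ℤ) : ℤ) : ℝ) / (p^k : ℕ)) else 0)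
       = ∑ n0 ∈ bad, avg (p ^ k) (fun n => if n % p = n0 then ee (((g.eval (n:ℤ) : ℤ) : ℝ) / (p^k : ℕ)) else 0) := by
      symm
      apply sum_subset (filter_subset _ _)
      intro n0 hn0 hnb
      apply class_vanish hp k (by omega)
      intro hdv
      exact hnb (mem_filter.2 ⟨hn0, hdv⟩)
    rw [h5]
    refine (norm_sum_le _ _).trans ?_
    refine (sum_le_sum (fun n0 hn0 => hclass2 n0 (mem_range.1 (mem_filter.1 hn0).1))).trans ?_
    rw [sum_const, nsmul_eq_mul]
    have hC00 : 0 ≤ C0 := by linarith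
    calc (bad.card : ℝ) * (C0 ^ (k-1) / t^k) ≤ C0 * (C0 ^ (k-1) / t^k) := by
          gcongr
          exact le_trans (by exact_mod_cast hbadcard) hC1
      _ = C0 ^ k / t ^ k := by
        rw [← mul_div_assoc, ← pow_succ']
        congr 2; omega

end Hua


section Local

/-- the local sieve function -/
noncomputable def xi (p x : ℕ) : ℝ := if p ∣ x then (p:ℝ) - 1 else -1

lemma xi_abs {p : ℕ} (hp : p.Prime) (x : ℕ) : |xi p x| ≤ (p:ℝ) - 1 := by
  have : (2:ℝ) ≤ p := by exact_mod_cast hp.two_le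
  unfold xi
  split_ifs
  · rw [abs_of_nonneg (by linarith)]
  · rw [abs_neg, abs_one]; linarith

lemma xi_periodic (p W b : ℕ) {L : ℕ} (h : p ∣ L) : Function.Periodic (fun n => xi p (W * n + b)) L := by
  intro n
  simp only [xi]
  have : p ∣ W * (n + L) + b ↔ p ∣ W * n + b := by
    rw [show W * (n + L) + b = (W * n + b) + W * L by ring]
    exact Nat.dvd_add_left (Dvd.dvd.mul_left h W)
  simp only [this]

lemma exists_class {p W : ℕ} (hp : p.Prime) (hW : ¬ p ∣ W) (b : ℕ) : ∃ n0 < p, ∀ n, p ∣ W * n + b ↔ n % p = n0 := by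
  have : Fact p.Prime := ⟨hp⟩
  have hW0 : (W : ZMod p) ≠ 0 := by rwa [Ne, ZMod.natCast_eq_zero_iff]
  refine ⟨(-(b : ZMod p) / W).val, ZMod.val_lt _, fun n => ?_⟩
  rw [← ZMod.natCast_eq_zero_iff]
  push_cast
  constructor
  · intro h
    have : (n : ZMod p) = -(b : ZMod p) / W := by
      rw [eq_div_iff hW0]
      linear_combination h
    rw [← this, ZMod.val_natCast]
  · intro h
    have : (n : ZMod p) = -(b : ZMod p) / W := by
      have h2 : ((n % p : ℕ) : ZMod p) = n := ZMod.natCast_mod n p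
      rw [← h2, h, ZMod.natCast_zmod_val]
    rw [this]
    field_simp
    ring

lemma xi_pow {p W b n0 : ℕ} (h : ∀ n, p ∣ W * n + b ↔ n % p = n0) (i n : ℕ) :
    ((xi p (W * n + b) : ℝ) : ℂ) ^ i = (-1) ^ i + (((p:ℂ) - 1) ^ i - (-1)^i) * (if n % p = n0 then 1 else 0) := by
  unfold xi
  simp only [h n]
  split_ifs <;> simp

lemma avg_add (L : ℕ) (f g : ℕ → ℂ) : avg L (fun n => f n + g n) = avg L f + avg L g := by
  unfold avg; rw [sum_add_distrib, add_div]

lemma avg_smul (L : ℕ) (c : ℂ) (f : ℕ → ℂ) : avg L (fun n => c * f n) = c * avg L f := by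
  unfold avg; rw [← mul_sum, mul_div_assoc]

lemma avg_const (L : ℕ) (hL : 0 < L) (c : ℂ) : avg L (fun _ => c) = c := by
  unfold avg; 
  have : (L:ℂ) ≠ 0 := by exact_mod_cast hL.ne'
  simp; field_simp

lemma avg_class (p L n0 : ℕ) (hL : 0 < L) (hn0 : n0 < p) : avg (p * L) (fun n => if n % p = n0 then (1:ℂ) else 0) = 1 / p := by
  rw [class_avg (F := fun _ => 1) (by omega) hn0, avg_const L hL]

lemma avg_congr {L : ℕ} {f g : ℕ → ℂ} (h : ∀ n, f n = g n) : avg L f = avg L g := by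
  unfold avg; simp [h]

/-- the local average -/
noncomputable def locavg (P : ℤ[X]) (W b p i k : ℕ) (α : ℤ) : ℂ :=
  avg (p ^ (k + 1)) (fun n => ((xi p (W * n + b) : ℝ) : ℂ) ^ i * ee (((α * P.eval (n:ℤ) : ℤ) : ℝ) / (p ^ k : ℕ)))

lemma locavg_k0 (P : ℤ[X]) (W b p i : ℕ) (α : ℤ) :
    locavg P W b p i 0 α = avg p (fun n => ((xi p (W * n + b) : ℝ) : ℂ) ^ i) := by
  unfold locavg
  rw [zero_add, pow_one]
  apply avg_congr
  intro n
  rw [pow_zero, Nat.cast_one, div_one, ee_int, mul_one]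

lemma locavg_00 (P : ℤ[X]) (W b p : ℕ) (hp : 0 < p) (α : ℤ) : locavg P W b p 0 0 α = 1 := by
  rw [locavg_k0]
  simp only [pow_zero]
  exact avg_const p hp 1

lemma avg_xi_pow {p W : ℕ} (hp : p.Prime) (hW : ¬ p ∣ W) (b i : ℕ) :
   avg p (fun n => ((xi p (W * n + b) : ℝ) : ℂ) ^ i) = (-1) ^ i + (((p:ℂ) - 1) ^ i - (-1)^i) / p := by
  obtain ⟨n0, hn0, h⟩ := exists_class hp hW b
  rw [avg_congr (xi_pow h i), avg_add, avg_const p hp.pos, avg_smul]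
  have := avg_class p 1 n0 one_pos hn0
  rw [mul_one] at this
  rw [this]
  ring

lemma locavg_10 (P : ℤ[X]) {p W : ℕ} (hp : p.Prime) (hW : ¬ p ∣ W) (b : ℕ) (α : ℤ) : locavg P W b p 1 0 α = 0 := by
  rw [locavg_k0, avg_xi_pow hp hW]
  have : (p:ℂ) ≠ 0 := by exact_mod_cast hp.ne_zero
  field_simp
  ring

lemma locavg_20 (P : ℤ[X]) {p W : ℕ} (hp : p.Prime) (hW : ¬ p ∣ W) (b : ℕ) (α : ℤ) : locavg P W b p 2 0 α = (p:ℂ) - 1 := by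
  rw [locavg_k0, avg_xi_pow hp hW]
  have : (p:ℂ) ≠ 0 := by exact_mod_cast hp.ne_zero
  field_simp
  ring

lemma locavg_W (P : ℤ[X]) {p W : ℕ} (hp : p.Prime) (b k : ℕ) (hk : 1 ≤ k) (α : ℤ) (hα : ¬ (p:ℤ) ∣ α)
    (h1 : ¬ (p:ℤ) ∣ P.coeff 1) (h2 : ∀ i, 2 ≤ i → (p:ℤ) ∣ P.coeff i) : locavg P W b p 0 k α = 0 := by
  unfold locavg
  simp only [pow_zero, one_mul]
  set g : ℤ[X] := C α * P with hg
  have hev : ∀ n : ℕ, α * P.eval (n:ℤ) = g.eval (n:ℤ) := by intro n; rw [hg]; simp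
  simp only [hev]
  have hpk : 0 < p ^ k := pow_pos hp.pos k
  have hper := poly_periodic g hpk
  rw [avg_of_dvd hper (pow_dvd_pow _ (by omega)) (pow_pos hp.pos _)]
  have hsh := avg_shift hper (p ^ (k-1))
  have hder : ∀ n : ℤ, (p:ℤ) ∣ g.derivative.eval n - α * P.coeff 1 := by
    intro n
    rw [hg, derivative_C_mul, eval_mul, eval_C, ← mul_sub]
    apply Dvd.dvd.mul_left
    rw [eval_eq_sum_range, sum_range_succ']
    simp only [coeff_derivative, pow_zero, mul_one, zero_add, Nat.cast_zero]
    rw [add_sub_cancel_right]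
    apply dvd_sum
    intro i _
    apply Dvd.dvd.mul_right
    apply Dvd.dvd.mul_right
    exact h2 _ (by omega)
  have h3 : ∀ n : ℕ, ee (((g.eval ((n + p^(k-1) : ℕ) : ℤ) : ℤ) : ℝ) / (p^k:ℕ)) = ee (((α * P.coeff 1 : ℤ) : ℝ) / p) * ee (((g.eval (n:ℤ) : ℤ) : ℝ) / (p^k:ℕ)) := by
    intro n
    rw [← ee_add]
    have e2 : (p:ℤ)^k = p^(k-1) * p := by rw [← pow_succ]; congr 1; omega
    have e1 : ((α * P.coeff 1 : ℤ) : ℝ) / p + ((g.eval (n:ℤ) : ℤ) : ℝ) / (p^k : ℕ) =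
         ((g.eval (n:ℤ) + α * P.coeff 1 * p ^ (k - 1) : ℤ) : ℝ) / (p^k : ℕ) := by
      have : (p:ℝ) ^ k = p ^ (k-1) * p := by rw [← pow_succ]; congr 1; omega
      have hp0 : (p:ℝ) ≠ 0 := by exact_mod_cast hp.ne_zero
      push_cast
      rw [this]
      field_simp
      ring
    rw [e1]
    apply ee_div_congr hpk
    -- the difference
    push_cast
    rcases Nat.lt_or_ge 1 k with hk2 | hk1
    · obtain ⟨c, hc⟩ := g.binomExpansion (n:ℤ) ((p:ℤ)^(k-1))
      rw [hc]
      obtain ⟨m, hm⟩ := hder n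
      have e3 : ((p:ℤ)^(k-1))^2 = p^k * p^(k-2) := by rw [← pow_mul, ← pow_add]; congr 1; omega
      refine ⟨m + c * p^(k-2), ?_⟩
      have : g.derivative.eval (n:ℤ) = α * P.coeff 1 + p * m := by linarith
      rw [this]
      calc _ = (p:ℤ) * m * p^(k-1) + c * (p^(k-1))^2 := by ring
        _ = _ := by rw [e3, e2]; ring
    · have hk' : k = 1 := by omega
      subst hk'
      simp only [Nat.sub_self, pow_zero, pow_one, mul_one]
      rw [hg]
      simp only [eval_mul, eval_C]
      rw [show α * P.eval ((n:ℤ) + 1) - (α * P.eval (n:ℤ) + α * P.coeff 1) = α * (P.eval ((n:ℤ) + 1) - P.eval (n:ℤ) - P.coeff 1) by ring]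
      apply Dvd.dvd.mul_left
      rw [eval_eq_sum_range, eval_eq_sum_range, ← sum_sub_distrib]
      rcases Nat.lt_or_ge P.natDegree 1 with h0 | h0
      · exact absurd (by rw [coeff_eq_zero_of_natDegree_lt h0]; exact dvd_zero _) h1
      obtain ⟨m, hm⟩ : ∃ m, P.natDegree + 1 = m + 2 := ⟨P.natDegree - 1, by omega⟩
      rw [hm, sum_range_succ', sum_range_succ']
      have : (∑ k ∈ range m, (P.coeff (k + 1 + 1) * ((n:ℤ) + 1) ^ (k + 1 + 1) - P.coeff (k + 1 + 1) * (n:ℤ) ^ (k + 1 + 1)) +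
          (P.coeff (0 + 1) * ((n:ℤ) + 1) ^ (0 + 1) - P.coeff (0 + 1) * (n:ℤ) ^ (0 + 1)) +
          (P.coeff 0 * ((n:ℤ) + 1) ^ 0 - P.coeff 0 * (n:ℤ) ^ 0) - P.coeff 1)
          = ∑ k ∈ range m, (P.coeff (k + 1 + 1) * ((n:ℤ) + 1) ^ (k + 1 + 1) - P.coeff (k + 1 + 1) * (n:ℤ) ^ (k + 1 + 1)) := by
        rw [zero_add]; ring
      rw [this]
      apply dvd_sum
      intro i _
      rw [← mul_sub]
      apply Dvd.dvd.mul_right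
      exact h2 _ (by omega)
  set f : ℕ → ℂ := fun n => ee (((g.eval (n : ℤ) : ℤ) : ℝ) / (p^k:ℕ)) with hf
  have h4 : avg (p^k) f = ee (((α * P.coeff 1 : ℤ) : ℝ) / p) * avg (p^k) f := by
    conv_lhs => rw [← hsh]
    rw [← avg_smul]
    exact avg_congr h3
  by_contra hne
  have h5 : ee (((α * P.coeff 1 : ℤ) : ℝ) / p) = 1 := by
    have : (1 - ee (((α * P.coeff 1 : ℤ) : ℝ) / p)) * avg (p^k) f = 0 := by linear_combination h4
    rcases mul_eq_zero.1 this with h | h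
    · exact (sub_eq_zero.1 h).symm
    · exact absurd h hne
  have h6 := ee_div_eq_one hp.pos h5
  rcases (Nat.prime_iff_prime_int.1 hp).dvd_or_dvd h6 with h | h
  · exact hα h
  · exact h1 h

lemma locavg_le (d : ℕ) (hd : 1 ≤ d) (P : ℤ[X]) (hP : P.natDegree = d) {p W : ℕ} (hp : p.Prime) (hpd : d < p) (hW : ¬ p ∣ W) (b k : ℕ) (hk : 1 ≤ k) (α : ℤ) (hα : ¬ (p:ℤ) ∣ α)
    (h1 : ¬ (p:ℤ) ∣ P.coeff d) (t : ℝ) (ht : 0 < t) (htp : t ^ d = p) (i : ℕ) :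
    ‖locavg P W b p i k α‖ ≤ 3 * ((p:ℝ) - 1)^i * (2 * (d:ℝ)^(d+1) / t) ^ k := by
  unfold locavg
  set g : ℤ[X] := C α * P with hg
  have hev : ∀ n : ℕ, α * P.eval (n:ℤ) = g.eval (n:ℤ) := by intro n; rw [hg]; simp
  simp only [hev]
  have hgd : g.natDegree ≤ d := by rw [hg]; exact (natDegree_C_mul_le _ _).trans hP.le
  obtain ⟨n0, hn0, h⟩ := exists_class hp hW b
  have hp1 : 0 < p ^ k := pow_pos hp.pos k
  obtain ⟨H1, H2⟩ := hua d hd hp hpd t ht htp k hk g hgd ⟨d, hd, by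
    rw [hg, coeff_C_mul]
    intro hdv
    rcases (Nat.prime_iff_prime_int.1 hp).dvd_or_dvd hdv with h | h
    · exact hα h
    · exact h1 h⟩
  have H1 := H1 n0 hn0
  have hper := poly_periodic g hp1
  set E : ℕ → ℂ := fun n => ee (((g.eval (n:ℤ) : ℤ) : ℝ) / (p^k:ℕ)) with hE
  set F : ℕ → ℂ := fun n => if n % p = n0 then E n else 0 with hF
  have hperF : Function.Periodic F (p^k) := by
    intro n
    simp only [hF]
    have h2 : (n + p ^ k) % p = n % p := by
      obtain ⟨m, rfl⟩ : ∃ m, k = m + 1 := ⟨k - 1, by omega⟩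
      rw [pow_succ, Nat.add_mul_mod_self_right]
    rw [h2, hper n]
  have e1 : ∀ n, ((xi p (W * n + b) : ℝ) : ℂ) ^ i * ee (((g.eval (n:ℤ) : ℤ) : ℝ) / (p^k:ℕ)) = (-1)^i * E n + (((p:ℂ) - 1) ^ i - (-1)^i) * F n := by
    intro n
    rw [xi_pow h]
    simp only [hF, hE]
    split_ifs <;> ring
  rw [avg_congr e1, avg_add, avg_smul, avg_smul, avg_of_dvd hper (pow_dvd_pow _ (by omega)) (pow_pos hp.pos _),
     avg_of_dvd hperF (pow_dvd_pow _ (by omega)) (pow_pos hp.pos _)]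
  have hp2 : (2:ℝ) ≤ p := by exact_mod_cast hp.two_le
  set C0 : ℝ := 2 * (d:ℝ)^(d+1) with hC0
  have hC1 : 1 ≤ C0 := by
    have : (1:ℝ) ≤ (d:ℝ)^(d+1) := one_le_pow₀ (by exact_mod_cast hd)
    rw [hC0]; linarith
  have H1' : ‖avg (p^k) F‖ ≤ (C0 / t)^k := by
    refine H1.trans ?_
    rw [div_pow]
    gcongr
    omega
  have H2' : ‖avg (p^k) E‖ ≤ (C0 / t)^k := by rw [div_pow]; exact H2
  have hq1 : (1:ℝ) ≤ ((p:ℝ) - 1)^i := one_le_pow₀ (by linarith)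
  have hn1 : ‖((p:ℂ) - 1) ^ i - (-1)^i‖ ≤ 2 * ((p:ℝ)-1)^i := by
    have hn2 : ‖((p:ℂ) - 1) ^ i‖ = ((p:ℝ) - 1)^i := by
      rw [norm_pow]
      congr 1
      have : (p:ℂ) - 1 = ((p - 1 : ℝ) : ℂ) := by push_cast; rfl
      rw [this, Complex.norm_real, Real.norm_of_nonneg (by linarith)]
    refine (norm_sub_le _ _).trans ?_
    rw [hn2, norm_pow, norm_neg, norm_one, one_pow]
    linarith
  have hpos : 0 ≤ (C0/t)^k := by positivity
  calc _ ≤ ‖(-1:ℂ)^i * avg (p^k) E‖ + ‖(((p:ℂ) - 1) ^ i - (-1)^i) * avg (p^k) F‖ := norm_add_le _ _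
    _ ≤ 1 * (C0/t)^k + (2 * ((p:ℝ)-1)^i) * (C0/t)^k := by
      rw [norm_mul, norm_mul, norm_pow, norm_neg, norm_one, one_pow]
      gcongr
    _ ≤ _ := by nlinarith

/-- products over pairwise coprime periods -/
lemma avg_prod (S : Finset ℕ) (A : ℕ → ℕ) (hA : ∀ p ∈ S, 0 < A p) (hco : ∀ p ∈ S, ∀ p' ∈ S, p ≠ p' → Nat.Coprime (A p) (A p'))
    (f : ℕ → ℕ → ℂ) (hf : ∀ p ∈ S, Function.Periodic (f p) (A p)) :
    avg (∏ p ∈ S, A p) (fun n => ∏ p ∈ S, f p n) = ∏ p ∈ S, avg (A p) (f p) := by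
  classical
  induction S using Finset.induction_on with
  | empty => simp [avg]
  | insert a S ha ih =>
    have ih' := ih (fun p hp => hA p (mem_insert_of_mem hp)) (fun p hp p' hp' => hco p (mem_insert_of_mem hp) p' (mem_insert_of_mem hp')) (fun p hp => hf p (mem_insert_of_mem hp))
    rw [prod_insert ha, prod_insert ha, ← ih']
    simp only [prod_insert ha]
    apply avg_coprime (hf a (mem_insert_self _ _))
    · intro n
      apply prod_congr rfl
      intro p hp
      have h1 := hf p (mem_insert_of_mem hp)
      obtain ⟨m, hm⟩ := dvd_prod_of_mem A hp
      rw [hm, mul_comm]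
      exact h1.nat_mul m n
    · exact hA a (mem_insert_self _ _)
    · exact prod_pos (fun p hp => hA p (mem_insert_of_mem hp))
    · apply Nat.Coprime.prod_right
      intro p hp
      exact hco a (mem_insert_self _ _) p (mem_insert_of_mem hp) (by rintro rfl; exact ha hp)

/-- partial fractions -/
lemma ee_partial (q : ℕ) (hq : 0 < q) : ∀ a : ℤ, IsCoprime a (q:ℤ) → ∃ α : ℕ → ℤ, (∀ p ∈ q.primeFactors, ¬ (p:ℤ) ∣ α p) ∧
    ∀ x : ℤ, ee (((a * x : ℤ) : ℝ) / q) = ∏ p ∈ q.primeFactors, ee (((α p * x : ℤ) : ℝ) / (p ^ q.factorization p : ℕ)) := by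
  induction q using Nat.recOnPosPrimePosCoprime with
  | zero => omega
  | one =>
    intro a _
    refine ⟨fun _ => 0, by simp, fun x => ?_⟩
    simp only [Nat.cast_one, div_one, Nat.primeFactors_one, prod_empty]
    exact ee_int _
  | prime_pow p n hp hn =>
    intro a ha
    refine ⟨fun _ => a, ?_, fun x => ?_⟩
    · intro p' hp'
      rw [Nat.primeFactors_prime_pow (by omega) hp, mem_singleton] at hp'
      subst hp'
      intro hdv
      have h1 : (p':ℤ) ∣ ((p'^n : ℕ) : ℤ) := by push_cast; exact dvd_pow_self _ (by omega)
      have := ha.isUnit_of_dvd' hdv h1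
      exact (Nat.prime_iff_prime_int.1 hp).not_isUnit this
    · rw [Nat.primeFactors_prime_pow (by omega) hp, prod_singleton, hp.factorization_pow]
      simp
  | coprime A B hA hB hco ihA ihB =>
    intro a ha
    obtain ⟨u, v, huv⟩ := Nat.isCoprime_iff_coprime.2 hco
    -- u*A + v*B = 1
    push_cast at ha
    have hcA : IsCoprime (a * v) (A:ℤ) := by
      apply IsCoprime.mul_left (ha.of_mul_right_left)
      exact ⟨B, u, by linarith⟩
    have hcB : IsCoprime (a * u) (B:ℤ) := by
      apply IsCoprime.mul_left (ha.of_mul_right_right)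
      exact ⟨A, v, by linarith⟩
    obtain ⟨α, hα1, hα2⟩ := ihA (by omega) _ hcA
    obtain ⟨β, hβ1, hβ2⟩ := ihB (by omega) _ hcB
    have hdis : Disjoint A.primeFactors B.primeFactors := hco.disjoint_primeFactors
    refine ⟨fun p => if p ∈ A.primeFactors then α p else β p, ?_, fun x => ?_⟩
    · intro p hp
      rw [hco.primeFactors_mul, mem_union] at hp
      simp only
      split_ifs with h
      · exact hα1 p h
      · exact hβ1 p (by tauto)
    · rw [hco.primeFactors_mul, prod_union hdis]
      have e1 : ∏ p ∈ A.primeFactors, ee ((((if p ∈ A.primeFactors then α p else β p) * x : ℤ) : ℝ) / (p ^ (A*B).factorization p : ℕ))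
         = ∏ p ∈ A.primeFactors, ee (((α p * x : ℤ) : ℝ) / (p ^ A.factorization p : ℕ)) := by
        apply prod_congr rfl
        intro p hp
        rw [if_pos hp, Nat.factorization_eq_of_coprime_left hco (Nat.mem_primeFactors_iff_mem_primeFactorsList.1 hp)]
      have e2 : ∏ p ∈ B.primeFactors, ee ((((if p ∈ A.primeFactors then α p else β p) * x : ℤ) : ℝ) / (p ^ (A*B).factorization p : ℕ))
         = ∏ p ∈ B.primeFactors, ee (((β p * x : ℤ) : ℝ) / (p ^ B.factorization p : ℕ)) := by
        apply prod_congr rfl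
        intro p hp
        rw [if_neg (fun h => (disjoint_left.1 hdis h hp)), Nat.factorization_eq_of_coprime_right hco (Nat.mem_primeFactors_iff_mem_primeFactorsList.1 hp)]
      rw [e1, e2, ← hα2, ← hβ2, ← ee_add]
      congr 1
      have hA0 : (A:ℝ) ≠ 0 := by positivity
      have hB0 : (B:ℝ) ≠ 0 := by positivity
      have : (u:ℝ) * A + v * B = 1 := by exact_mod_cast huv
      push_cast
      field_simp
      linear_combination (-(a:ℝ) * x) * this

end Local


section Sieve

noncomputable def cc (j x : ℕ) : ℝ := ∏ p ∈ j.primeFactors, xi p x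

def Js (R W : ℕ) : Finset ℕ := (Icc 1 R).filter (fun j => Squarefree j ∧ Nat.Coprime j W)

noncomputable def VV (R W : ℕ) : ℝ := ∑ j ∈ Js R W, 1 / (j.totient : ℝ)

noncomputable def lam (R W x : ℕ) : ℝ := ∑ j ∈ Js R W, (ArithmeticFunction.moebius j : ℝ) / j.totient * cc j x

noncomputable def mjk (P : ℤ[X]) (W b q : ℕ) (a : ℤ) (j k : ℕ) : ℂ :=
  avg (q * j * k) (fun n => (cc j (W * n + b) : ℂ) * (cc k (W * n + b) : ℂ) * ee (((a * P.eval (n:ℤ) : ℤ) : ℝ) / q))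

noncomputable def cqa (P : ℤ[X]) (R W b q : ℕ) (a : ℤ) : ℂ :=
  (1 / (VV R W : ℂ)) * ∑ j ∈ Js R W, ∑ k ∈ Js R W,
    (((ArithmeticFunction.moebius j : ℝ) / j.totient * ((ArithmeticFunction.moebius k : ℝ) / k.totient) : ℝ) : ℂ) * mjk P W b q a j k

lemma mem_Js {R W j : ℕ} : j ∈ Js R W ↔ (1 ≤ j ∧ j ≤ R) ∧ Squarefree j ∧ Nat.Coprime j W := by
  unfold Js; rw [mem_filter, mem_Icc]

lemma phi_sqf {j : ℕ} (hj : Squarefree j) : (j.totient : ℝ) = ∏ p ∈ j.primeFactors, ((p:ℝ) - 1) := by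
  rw [Nat.totient_eq_div_primeFactors_mul, Nat.prod_primeFactors_of_squarefree hj, Nat.div_self (Nat.pos_of_ne_zero hj.ne_zero), one_mul]
  push_cast
  apply prod_congr rfl
  intro p hp
  rw [Nat.cast_sub (Nat.prime_of_mem_primeFactors hp).one_le]; simp

lemma cc_periodic (j W b : ℕ) {L : ℕ} (h : j ∣ L) : Function.Periodic (fun n => (cc j (W * n + b) : ℂ)) L := by
  intro n
  simp only [cc]
  congr 1
  apply prod_congr rfl
  intro p hp
  exact xi_periodic p W b ((Nat.dvd_of_mem_primeFactors hp).trans h) n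

lemma cc_abs {j : ℕ} (hj : Squarefree j) (x : ℕ) : |cc j x| ≤ j.totient := by
  rw [phi_sqf hj, cc, abs_prod]
  apply Finset.prod_le_prod
  · intro p _; positivity
  · intro p hp
    exact xi_abs (Nat.prime_of_mem_primeFactors hp) x

def ipow (j k p : ℕ) : ℕ := (if p ∈ j.primeFactors then 1 else 0) + (if p ∈ k.primeFactors then 1 else 0)

lemma mjk_periodic (P : ℤ[X]) (W b q : ℕ) (hq : 0 < q) (a : ℤ) (j k : ℕ) :
   Function.Periodic (fun n => (cc j (W * n + b) : ℂ) * (cc k (W * n + b) : ℂ) * ee (((a * P.eval (n:ℤ) : ℤ) : ℝ) / q)) (q * j * k) := by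
  intro n
  have h1 := cc_periodic j W b (L := q*j*k) ⟨q * k, by ring⟩ n
  have h2 := cc_periodic k W b (L := q*j*k) ⟨q * j, by ring⟩ n
  simp only at h1 h2 ⊢
  rw [h1, h2]
  congr 1
  apply ee_div_congr hq
  rw [← mul_sub]
  apply Dvd.dvd.mul_left
  refine dvd_trans ?_ (sub_dvd_eval_sub _ _ _)
  exact ⟨j * k, by push_cast; ring⟩

lemma mjk_eq (P : ℤ[X]) (W b q : ℕ) (hq : 0 < q) (a : ℤ) {j k : ℕ} (hj : 0 < j) (hk : 0 < k) (α : ℕ → ℤ)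
    (hα : ∀ x : ℤ, ee (((a * x : ℤ) : ℝ) / q) = ∏ p ∈ q.primeFactors, ee (((α p * x : ℤ) : ℝ) / (p ^ q.factorization p : ℕ))) :
    mjk P W b q a j k = ∏ p ∈ (q * j * k).primeFactors, locavg P W b p (ipow j k p) (q.factorization p) (α p) := by
  set S := (q * j * k).primeFactors with hS
  have hL : q * j * k ≠ 0 := by positivity
  have hpS : ∀ p ∈ S, p.Prime := fun p hp => Nat.prime_of_mem_primeFactors hp
  have hsub : ∀ m, m ∣ q * j * k → m.primeFactors ⊆ S := fun m hm => Nat.primeFactors_mono hm hL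
  have hfac : ∀ n, (cc j (W * n + b) : ℂ) * (cc k (W * n + b) : ℂ) * ee (((a * P.eval (n:ℤ) : ℤ) : ℝ) / q)
     = ∏ p ∈ S, (((xi p (W * n + b) : ℝ) : ℂ) ^ (ipow j k p) * ee (((α p * P.eval (n:ℤ) : ℤ) : ℝ) / (p ^ q.factorization p : ℕ))) := by
    intro n
    rw [hα, prod_mul_distrib]
    congr 1
    · simp only [ipow, pow_add, prod_mul_distrib]
      have : ∀ m, m ∣ q * j * k → (cc m (W * n + b) : ℂ) = ∏ p ∈ S, ((xi p (W * n + b) : ℝ) : ℂ) ^ (if p ∈ m.primeFactors then 1 else 0) := by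
        intro m hm
        rw [cc, Complex.ofReal_prod, ← prod_subset (hsub m hm)]
        · apply prod_congr rfl
          intro p hp
          rw [if_pos hp, pow_one]
        · intro p _ hp
          rw [if_neg hp, pow_zero]
      rw [this j ⟨q * k, by ring⟩, this k ⟨q * j, by ring⟩]
    · apply prod_subset (hsub q ⟨j * k, by ring⟩)
      intro p hp hpq
      have h0 : q.factorization p = 0 := by
        rw [← Finsupp.notMem_support_iff, Nat.support_factorization]; exact hpq
      rw [h0, pow_zero, Nat.cast_one, div_one, ee_int]
  have hper := mjk_periodic P W b q hq a j k
  unfold mjk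
  set f : ℕ → ℂ := (fun n => (cc j (W * n + b) : ℂ) * (cc k (W * n + b) : ℂ) * ee (((a * P.eval (n:ℤ) : ℤ) : ℝ) / q)) with hf
  set F : ℕ → ℕ → ℂ := fun p n => (((xi p (W * n + b) : ℝ) : ℂ) ^ (ipow j k p) * ee (((α p * P.eval (n:ℤ) : ℤ) : ℝ) / (p ^ q.factorization p : ℕ))) with hF
  have hFper : ∀ p ∈ S, Function.Periodic (F p) (p ^ (q.factorization p + 1)) := by
    intro p hp n
    have hp' := hpS p hp
    have h1 := xi_periodic p W b (L := p ^ (q.factorization p + 1)) (dvd_pow_self _ (by omega)) n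
    simp only at h1
    simp only [hF]
    rw [h1]
    congr 1
    apply ee_div_congr (pow_pos hp'.pos _)
    rw [← mul_sub]
    apply Dvd.dvd.mul_left
    refine dvd_trans ?_ (sub_dvd_eval_sub _ _ _)
    exact ⟨p, by push_cast; ring⟩
  have h1 := avg_prod S (fun p => p ^ (q.factorization p + 1)) (fun p hp => pow_pos (hpS p hp).pos _)
    (fun p hp p' hp' hne => Nat.Coprime.pow _ _ ((Nat.coprime_primes (hpS p hp) (hpS p' hp')).2 hne)) F hFper
  have h2 : ∏ p ∈ S, locavg P W b p (ipow j k p) (q.factorization p) (α p) = ∏ p ∈ S, avg (p ^ (q.factorization p + 1)) (F p) := rfl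
  rw [h2, ← h1]
  set L2 := ∏ p ∈ S, p ^ (q.factorization p + 1) with hL2
  have hL2pos : 0 < L2 := prod_pos (fun p hp => pow_pos (hpS p hp).pos _)
  have hper2 : Function.Periodic f L2 := by
    intro n
    have : ∀ n, f n = ∏ p ∈ S, F p n := hfac
    rw [this, this]
    apply prod_congr rfl
    intro p hp
    obtain ⟨m, hm⟩ := dvd_prod_of_mem (fun p => p ^ (q.factorization p + 1)) hp
    rw [hL2, hm, mul_comm]
    exact (hFper p hp).nat_mul m n
  rw [← avg_of_dvd hper (L' := q * j * k * L2) ⟨L2, rfl⟩ (by positivity), avg_of_dvd hper2 ⟨q * j * k, by ring⟩ (by positivity)]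
  exact avg_congr hfac

structure Hyp (d : ℕ) (P : ℤ[X]) (W w : ℕ) : Prop where
  hd : 2 ≤ d
  hW : 0 < W
  deg : P.natDegree = d
  nonneg : ∀ i, 0 ≤ P.coeff i
  c0 : P.coeff 0 = 0
  h1 : ∀ p : ℕ, p.Prime → p ∣ W → ¬ (p:ℤ) ∣ P.coeff 1 ∧ ∀ i, 2 ≤ i → (p:ℤ) ∣ P.coeff i
  h2 : ∀ p : ℕ, p.Prime → ¬ p ∣ W → w < p ∧ ¬ (p:ℤ) ∣ P.coeff d
  hdw : d ≤ w
  hw : ∀ p : ℕ, w < p → 24 * (d:ℝ)^(d+1) * (p:ℝ) ^ ((8:ℝ) / (8 * d + 1)) ≤ (p:ℝ) ^ ((1:ℝ) / d)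

noncomputable def wt (A : Finset ℕ) : ℝ := ∏ p ∈ A, 1 / ((p:ℝ) - 1)

def j2 (q j : ℕ) : ℕ := ∏ p ∈ j.primeFactors \ q.primeFactors, p

lemma j2_pf (q j : ℕ) : (j2 q j).primeFactors = j.primeFactors \ q.primeFactors :=
  Nat.primeFactors_prod (fun _ hp => Nat.prime_of_mem_primeFactors (Finset.mem_sdiff.1 hp).1)

lemma j2_dvd (q j : ℕ) : j2 q j ∣ j := by
  refine dvd_trans ?_ (Nat.prod_primeFactors_dvd j)
  exact prod_dvd_prod_of_subset _ _ _ sdiff_subset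

lemma j2_mem {R W q j : ℕ} (hj : j ∈ Js R W) : j2 q j ∈ Js R W := by
  rw [mem_Js] at hj ⊢
  have hpos : 0 < j := by omega
  refine ⟨⟨Nat.pos_of_dvd_of_pos (j2_dvd q j) hpos, (Nat.le_of_dvd hpos (j2_dvd q j)).trans hj.1.2⟩,
    hj.2.1.squarefree_of_dvd (j2_dvd q j), hj.2.2.coprime_dvd_left (j2_dvd q j)⟩

lemma j2_fiber (R W q y : ℕ) : ((Js R W).filter (fun j => j2 q j = y)).card ≤ 2 ^ q.primeFactors.card := by
  rw [← card_powerset]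
  apply card_le_card_of_injOn (fun j => j.primeFactors ∩ q.primeFactors)
  · intro j _
    simp
  · intro j hj k hk h
    simp only [coe_filter, Set.mem_ofPred_eq, mem_Js] at hj hk
    simp only at h
    have h1 : j.primeFactors = k.primeFactors := by
      rw [← sdiff_union_inter j.primeFactors q.primeFactors, ← sdiff_union_inter k.primeFactors q.primeFactors, h,
        ← j2_pf, ← j2_pf, hj.2, hk.2]
    rw [← Nat.prod_primeFactors_of_squarefree hj.1.2.1, ← Nat.prod_primeFactors_of_squarefree hk.1.2.1, h1]

lemma VV_eq (R W : ℕ) : VV R W = ∑ j ∈ Js R W, wt j.primeFactors := by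
  unfold VV wt
  apply sum_congr rfl
  intro j hj
  rw [phi_sqf (mem_Js.1 hj).2.1]
  simp

lemma wt_nonneg {A : Finset ℕ} (hA : ∀ p ∈ A, p.Prime) : 0 ≤ wt A := by
  apply prod_nonneg
  intro p hp
  have : (1:ℝ) ≤ p := by exact_mod_cast (hA p hp).one_le
  apply div_nonneg zero_le_one; linarith

lemma sum_agree (R W q : ℕ) : ∑ j ∈ Js R W, ∑ k ∈ Js R W, (if j2 q j = j2 q k then wt (j2 q j).primeFactors else 0)
    ≤ 4 ^ q.primeFactors.card * VV R W := by
  have h1 : ∀ j ∈ Js R W, ∑ k ∈ Js R W, (if j2 q j = j2 q k then wt (j2 q j).primeFactors else 0) ≤ 2 ^ q.primeFactors.card * wt (j2 q j).primeFactors := by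
    intro j _
    rw [← sum_filter, sum_const, nsmul_eq_mul]
    apply mul_le_mul_of_nonneg_right _ (wt_nonneg (fun p hp => Nat.prime_of_mem_primeFactors hp))
    have := j2_fiber R W q (j2 q j)
    simp only [eq_comm (a := j2 q j)]
    exact_mod_cast this
  refine (sum_le_sum h1).trans ?_
  rw [← mul_sum, ← sum_fiberwise_of_maps_to (fun j hj => j2_mem (q := q) hj)]
  have h2 : ∀ y ∈ Js R W, ∑ j ∈ Js R W with j2 q j = y, wt (j2 q j).primeFactors ≤ 2 ^ q.primeFactors.card * wt y.primeFactors := by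
    intro y _
    have : ∑ j ∈ Js R W with j2 q j = y, wt (j2 q j).primeFactors = ∑ j ∈ Js R W with j2 q j = y, wt y.primeFactors := by
      apply sum_congr rfl
      intro j hj
      rw [(mem_filter.1 hj).2]
    rw [this, sum_const, nsmul_eq_mul]
    apply mul_le_mul_of_nonneg_right _ (wt_nonneg (fun p hp => Nat.prime_of_mem_primeFactors hp))
    exact_mod_cast j2_fiber R W q y
  have h3 := sum_le_sum h2
  rw [← mul_sum, ← VV_eq] at h3
  calc _ ≤ (2:ℝ) ^ q.primeFactors.card * (2 ^ q.primeFactors.card * VV R W) := by gcongr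
    _ = _ := by rw [← mul_assoc, ← mul_pow]; norm_num

lemma Js_one {R W : ℕ} (hR : 1 ≤ R) : 1 ∈ Js R W := by rw [mem_Js]; simp [hR]

lemma VV_ge_one {R W : ℕ} (hR : 1 ≤ R) : 1 ≤ VV R W := by
  unfold VV
  have := single_le_sum (f := fun j : ℕ => 1 / (j.totient : ℝ)) (fun j _ => by positivity) (Js_one (W := W) hR)
  simpa using this

lemma VV_le (R W : ℕ) : VV R W ≤ R := by
  unfold VV
  calc _ ≤ ∑ j ∈ Js R W, (1:ℝ) := by
        apply sum_le_sum
        intro j hj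
        have : 0 < j.totient := Nat.totient_pos.2 (by have := (mem_Js.1 hj).1.1; omega)
        rw [div_le_one (by exact_mod_cast this)]
        exact_mod_cast this
    _ ≤ R := by
      rw [sum_const, nsmul_eq_mul, mul_one]
      have := card_filter_le (Icc 1 R) (fun j => Squarefree j ∧ Nat.Coprime j W)
      rw [Nat.card_Icc] at this
      unfold Js
      exact_mod_cast this.trans (by omega)

lemma phi_ratio {q j k : ℕ} (hq : 0 < q) (hj : Squarefree j) (hk : Squarefree k) :
   (j.totient : ℝ) * k.totient = ∏ p ∈ (q * j * k).primeFactors, ((p:ℝ) - 1) ^ (ipow j k p) := by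
  have hL : q * j * k ≠ 0 := mul_ne_zero (mul_ne_zero hq.ne' hj.ne_zero) hk.ne_zero
  have : ∀ m, Squarefree m → m ∣ q * j * k → (m.totient : ℝ) = ∏ p ∈ (q * j * k).primeFactors, ((p:ℝ) - 1) ^ (if p ∈ m.primeFactors then 1 else 0) := by
    intro m hm hdv
    rw [phi_sqf hm, ← prod_subset (Nat.primeFactors_mono hdv hL)]
    · apply prod_congr rfl
      intro p hp
      rw [if_pos hp, pow_one]
    · intro p _ hp
      rw [if_neg hp, pow_zero]
  simp only [ipow, pow_add, prod_mul_distrib]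
  rw [← this j hj ⟨q * k, by ring⟩, ← this k hk ⟨q * j, by ring⟩]

/-- normalised bound -/
lemma mjk_bound {d : ℕ} {P : ℤ[X]} {W w : ℕ} (H : Hyp d P W w) {R : ℕ} (b q : ℕ) (hq : 0 < q) (hqW : Nat.Coprime q W) (a : ℤ) (ha : IsCoprime a (q:ℤ))
    {j k : ℕ} (hj : j ∈ Js R W) (hk : k ∈ Js R W) :
    ‖mjk P W b q a j k‖ ≤ (j.totient : ℝ) * k.totient * ((∏ p ∈ q.primeFactors, 3 * (2 * (d:ℝ)^(d+1) / (p:ℝ)^((1:ℝ)/d)) ^ (q.factorization p))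
       * (if j2 q j = j2 q k then wt (j2 q j).primeFactors else 0)) := by
  obtain ⟨α, hα1, hα2⟩ := ee_partial q hq a ha
  rw [mem_Js] at hj hk
  rw [mjk_eq P W b q hq a (by omega) (by omega) α hα2, norm_prod, phi_ratio hq hj.2.1 hk.2.1]
  set S := (q * j * k).primeFactors with hS
  have hL : q * j * k ≠ 0 := mul_ne_zero (mul_ne_zero hq.ne' hj.2.1.ne_zero) hk.2.1.ne_zero
  have hpS : ∀ p ∈ S, p.Prime := fun p hp => Nat.prime_of_mem_primeFactors hp
  have hSW : ∀ p ∈ S, ¬ p ∣ W := by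
    intro p hp hpW
    have hco : Nat.Coprime (q * j * k) W := Nat.Coprime.mul_left (Nat.Coprime.mul_left hqW hj.2.2) hk.2.2
    have := Nat.dvd_gcd (Nat.dvd_of_mem_primeFactors hp) hpW
    rw [hco] at this
    exact (hpS p hp).one_lt.ne' (Nat.dvd_one.1 this)
  have hqS : q.primeFactors ⊆ S := Nat.primeFactors_mono ⟨j * k, by ring⟩ hL
  have hjS : j.primeFactors ⊆ S := Nat.primeFactors_mono ⟨q * k, by ring⟩ hL
  have hkS : k.primeFactors ⊆ S := Nat.primeFactors_mono ⟨q * j, by ring⟩ hL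
  have hSu : ∀ p ∈ S, p ∈ q.primeFactors ∨ p ∈ j.primeFactors ∨ p ∈ k.primeFactors := by
    intro p hp
    rw [hS, Nat.primeFactors_mul (mul_ne_zero hq.ne' hj.2.1.ne_zero) hk.2.1.ne_zero, Nat.primeFactors_mul hq.ne' hj.2.1.ne_zero] at hp
    simp only [mem_union] at hp
    tauto
  have hfac0 : ∀ p, p ∉ q.primeFactors → q.factorization p = 0 := by
    intro p hp
    rw [← Finsupp.notMem_support_iff, Nat.support_factorization]; exact hp
  have hagree : j2 q j = j2 q k ↔ j.primeFactors \ q.primeFactors = k.primeFactors \ q.primeFactors := by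
    constructor
    · intro h; rw [← j2_pf, ← j2_pf, h]
    · intro h; unfold j2; rw [h]
  split_ifs with hag
  · rw [← prod_sdiff hqS, ← prod_sdiff hqS]
    have hsd : S \ q.primeFactors = j.primeFactors \ q.primeFactors := by
      rw [hagree] at hag
      ext p
      constructor
      · intro hp
        rw [Finset.mem_sdiff] at hp
        rcases hSu p hp.1 with h | h | h
        · exact absurd h hp.2
        · exact Finset.mem_sdiff.2 ⟨h, hp.2⟩
        · rw [hag]; exact Finset.mem_sdiff.2 ⟨h, hp.2⟩
      · intro hp
        rw [Finset.mem_sdiff] at hp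
        exact Finset.mem_sdiff.2 ⟨hjS hp.1, hp.2⟩
    rw [hagree] at hag
    have e1 : ∏ p ∈ S \ q.primeFactors, ‖locavg P W b p (ipow j k p) (q.factorization p) (α p)‖ =
       (∏ p ∈ S \ q.primeFactors, ((p:ℝ) - 1) ^ (ipow j k p)) * wt (j2 q j).primeFactors := by
      rw [j2_pf, hsd, wt, ← prod_mul_distrib]
      apply prod_congr rfl
      intro p hp
      have hp' := Finset.mem_sdiff.1 hp
      have hpk : p ∈ k.primeFactors := by rw [hag] at hp; exact (Finset.mem_sdiff.1 hp).1
      have hpp := hpS p (hjS hp'.1)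
      have hi : ipow j k p = 2 := by unfold ipow; rw [if_pos hp'.1, if_pos hpk]
      rw [hi, hfac0 p hp'.2, locavg_20 P hpp (hSW p (hjS hp'.1))]
      have h2 : (2:ℝ) ≤ p := by exact_mod_cast hpp.two_le
      have : (p:ℂ) - 1 = ((p - 1 : ℝ) : ℂ) := by push_cast; rfl
      rw [this, Complex.norm_real, Real.norm_of_nonneg (by linarith)]
      have : (p:ℝ) - 1 ≠ 0 := by linarith
      field_simp
    have e2 : ∏ p ∈ q.primeFactors, ‖locavg P W b p (ipow j k p) (q.factorization p) (α p)‖ ≤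
       (∏ p ∈ q.primeFactors, ((p:ℝ) - 1) ^ (ipow j k p)) * ∏ p ∈ q.primeFactors, 3 * (2 * (d:ℝ)^(d+1) / (p:ℝ)^((1:ℝ)/d)) ^ (q.factorization p) := by
      rw [← prod_mul_distrib]
      apply Finset.prod_le_prod
      · intro p _; positivity
      · intro p hp
        have hpp := hpS p (hqS hp)
        obtain ⟨h3, h4⟩ := H.h2 p hpp (hSW p (hqS hp))
        have hk1 : 1 ≤ q.factorization p := by
          have := (Nat.support_factorization q ▸ hp : p ∈ q.factorization.support)
          rw [Finsupp.mem_support_iff] at this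
          omega
        have hp0 : (0:ℝ) < p := by exact_mod_cast hpp.pos
        have := locavg_le d (by have := H.hd; omega) P H.deg hpp (by have := H.hdw; omega) (hSW p (hqS hp)) b (q.factorization p) hk1 (α p) (hα1 p hp) h4
          ((p:ℝ)^((1:ℝ)/d)) (by positivity) (by
            rw [← Real.rpow_natCast, ← Real.rpow_mul hp0.le, one_div, inv_mul_cancel₀, Real.rpow_one]
            have := H.hd; positivity) (ipow j k p)
        refine this.trans (le_of_eq ?_)
        ring
    rw [e1]
    have hA0 : 0 ≤ (∏ p ∈ S \ q.primeFactors, ((p:ℝ) - 1) ^ (ipow j k p)) * wt (j2 q j).primeFactors := by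
      apply mul_nonneg
      · apply prod_nonneg
        intro p hp
        have h2 : (1:ℝ) ≤ p := by exact_mod_cast (hpS p (Finset.mem_sdiff.1 hp).1).one_le
        exact pow_nonneg (by linarith) _
      · exact wt_nonneg (fun p hp => Nat.prime_of_mem_primeFactors hp)
    refine (mul_le_mul_of_nonneg_left e2 hA0).trans (le_of_eq ?_)
    ring
  · rw [mul_zero, mul_zero]
    apply le_of_eq
    rw [hagree] at hag
    have : ∃ p ∈ S, p ∉ q.primeFactors ∧ ipow j k p = 1 := by
      by_contra hcon
      push Not at hcon
      apply hag
      ext p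
      simp only [Finset.mem_sdiff]
      constructor
      · rintro ⟨h1, h2⟩
        refine ⟨?_, h2⟩
        by_contra h3
        apply hcon p (hjS h1) h2
        unfold ipow; rw [if_pos h1, if_neg h3]
      · rintro ⟨h1, h2⟩
        refine ⟨?_, h2⟩
        by_contra h3
        apply hcon p (hkS h1) h2
        unfold ipow; rw [if_neg h3, if_pos h1]
    obtain ⟨p, hp, hpq, hi⟩ := this
    apply prod_eq_zero hp
    rw [hi, hfac0 p hpq, locavg_10 P (hpS p hp) (hSW p hp), norm_zero]

lemma mjk_zero {d : ℕ} {P : ℤ[X]} {W w : ℕ} (H : Hyp d P W w) {R : ℕ} (b q : ℕ) (hq : 0 < q) (hqW : ¬ Nat.Coprime q W) (a : ℤ) (ha : IsCoprime a (q:ℤ))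
    {j k : ℕ} (hj : j ∈ Js R W) (hk : k ∈ Js R W) : mjk P W b q a j k = 0 := by
  obtain ⟨α, hα1, hα2⟩ := ee_partial q hq a ha
  rw [mem_Js] at hj hk
  rw [mjk_eq P W b q hq a (by omega) (by omega) α hα2]
  obtain ⟨p, hp, hpq, hpW⟩ := Nat.Prime.not_coprime_iff_dvd.1 hqW
  have hL : q * j * k ≠ 0 := mul_ne_zero (mul_ne_zero hq.ne' hj.2.1.ne_zero) hk.2.1.ne_zero
  have hpf : p ∈ q.primeFactors := Nat.mem_primeFactors.2 ⟨hp, hpq, hq.ne'⟩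
  apply prod_eq_zero (Nat.primeFactors_mono ⟨j * k, by ring⟩ hL hpf)
  have hn : ∀ m, Nat.Coprime m W → p ∉ m.primeFactors := by
    intro m hm hpm
    have := Nat.dvd_gcd (Nat.dvd_of_mem_primeFactors hpm) hpW
    rw [hm] at this
    exact hp.one_lt.ne' (Nat.dvd_one.1 this)
  have hi : ipow j k p = 0 := by unfold ipow; rw [if_neg (hn j hj.2.2), if_neg (hn k hk.2.2)]
  rw [hi]
  have hk1 : 1 ≤ q.factorization p := by
    have := (Nat.support_factorization q ▸ hpf : p ∈ q.factorization.support)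
    rw [Finsupp.mem_support_iff] at this
    omega
  exact locavg_W P hp b _ hk1 (α p) (hα1 p hpf) (H.h1 p hp hpW).1 (H.h1 p hp hpW).2

lemma mjk_one (P : ℤ[X]) {R W : ℕ} (b : ℕ) (a : ℤ) {j k : ℕ} (hj : j ∈ Js R W) (hk : k ∈ Js R W) :
    mjk P W b 1 a j k = if j = k then (j.totient : ℂ) else 0 := by
  rw [mem_Js] at hj hk
  rw [mjk_eq P W b 1 one_pos a (by omega) (by omega) (fun _ => 0) (by intro x; simp only [Nat.primeFactors_one, prod_empty, Nat.cast_one, div_one]; exact ee_int _)]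
  have hL : 1 * j * k ≠ 0 := mul_ne_zero (mul_ne_zero one_ne_zero hj.2.1.ne_zero) hk.2.1.ne_zero
  set S := (1 * j * k).primeFactors with hS
  have hjS : j.primeFactors ⊆ S := Nat.primeFactors_mono ⟨1 * k, by ring⟩ hL
  have hkS : k.primeFactors ⊆ S := Nat.primeFactors_mono ⟨1 * j, by ring⟩ hL
  have hpS : ∀ p ∈ S, p.Prime := fun p hp => Nat.prime_of_mem_primeFactors hp
  have hSW : ∀ p ∈ S, ¬ p ∣ W := by
    intro p hp hpW
    have hco : Nat.Coprime (1 * j * k) W := Nat.Coprime.mul_left (Nat.Coprime.mul_left (Nat.coprime_one_left W) hj.2.2) hk.2.2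
    have := Nat.dvd_gcd (Nat.dvd_of_mem_primeFactors hp) hpW
    rw [hco] at this
    exact (hpS p hp).one_lt.ne' (Nat.dvd_one.1 this)
  have hf0 : ∀ p, (1:ℕ).factorization p = 0 := by intro p; simp
  split_ifs with h
  · subst h
    have h1 : S = j.primeFactors := by
      rw [hS, one_mul, Nat.primeFactors_mul hj.2.1.ne_zero hj.2.1.ne_zero, union_self]
    have h2 : (j.totient : ℂ) = ((j.totient : ℝ) : ℂ) := by simp
    rw [h2, phi_sqf hj.2.1, Complex.ofReal_prod, ← h1]
    apply prod_congr rfl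
    intro p hp
    have hi : ipow j j p = 2 := by unfold ipow; rw [h1] at hp; rw [if_pos hp]
    rw [hi, hf0, locavg_20 P (hpS p hp) (hSW p hp)]
    push_cast; rfl
  · have : ∃ p ∈ S, ipow j k p = 1 := by
      by_contra hcon
      push Not at hcon
      apply h
      have h1 : j.primeFactors = k.primeFactors := by
        ext p
        constructor
        · intro h1
          by_contra h3
          apply hcon p (hjS h1)
          unfold ipow; rw [if_pos h1, if_neg h3]
        · intro h1
          by_contra h3
          apply hcon p (hkS h1)
          unfold ipow; rw [if_neg h3, if_pos h1]
      rw [← Nat.prod_primeFactors_of_squarefree hj.2.1, ← Nat.prod_primeFactors_of_squarefree hk.2.1, h1]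
    obtain ⟨p, hp, hi⟩ := this
    apply prod_eq_zero hp
    rw [hi, hf0, locavg_10 P (hpS p hp) (hSW p hp)]

lemma cqa_zero {d : ℕ} {P : ℤ[X]} {W w : ℕ} (H : Hyp d P W w) {R : ℕ} (b q : ℕ) (hq : 0 < q) (hqW : ¬ Nat.Coprime q W) (a : ℤ) (ha : IsCoprime a (q:ℤ)) :
    cqa P R W b q a = 0 := by
  unfold cqa
  rw [sum_eq_zero, mul_zero]
  intro j hj
  apply sum_eq_zero
  intro k hk
  rw [mjk_zero H b q hq hqW a ha hj hk, mul_zero]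

lemma moeb_sq {j : ℕ} (hj : Squarefree j) : (ArithmeticFunction.moebius j : ℝ) * ArithmeticFunction.moebius j = 1 := by
  rcases ArithmeticFunction.moebius_ne_zero_iff_eq_or.1 (ArithmeticFunction.moebius_ne_zero_iff_squarefree.2 hj) with h | h <;> rw [h] <;> norm_num

lemma moeb_abs (j : ℕ) : |(ArithmeticFunction.moebius j : ℝ)| ≤ 1 := by
  have := ArithmeticFunction.abs_moebius_le_one (n := j)
  exact_mod_cast this

lemma cqa_one (P : ℤ[X]) {R W : ℕ} (hR : 1 ≤ R) (b : ℕ) (a : ℤ) : cqa P R W b 1 a = 1 := by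
  unfold cqa
  have : ∑ j ∈ Js R W, ∑ k ∈ Js R W,
    (((ArithmeticFunction.moebius j : ℝ) / j.totient * ((ArithmeticFunction.moebius k : ℝ) / k.totient) : ℝ) : ℂ) * mjk P W b 1 a j k = (VV R W : ℂ) := by
    unfold VV
    rw [Complex.ofReal_sum]
    apply sum_congr rfl
    intro j hj
    rw [sum_eq_single j]
    · rw [mjk_one P b a hj hj, if_pos rfl]
      have hpos : 0 < j.totient := Nat.totient_pos.2 (by have := (mem_Js.1 hj).1.1; omega)
      have h0 : (j.totient : ℝ) ≠ 0 := by positivity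
      have h1 := moeb_sq (mem_Js.1 hj).2.1
      have : ((j.totient : ℂ)) = ((j.totient : ℝ) : ℂ) := by simp
      rw [this, ← Complex.ofReal_mul]
      congr 1
      field_simp
      rw [sq, h1]
    · intro k hk hne
      rw [mjk_one P b a hj hk, if_neg hne.symm, mul_zero]
    · intro h; exact absurd hj h
  rw [this]
  have := VV_ge_one (W := W) hR
  have h0 : (VV R W : ℂ) ≠ 0 := by
    have : VV R W ≠ 0 := by linarith
    exact_mod_cast this
  field_simp

lemma cqa_le {d : ℕ} {P : ℤ[X]} {W w : ℕ} (H : Hyp d P W w) {R : ℕ} (hR : 1 ≤ R) (b q : ℕ) (hq : 0 < q) (a : ℤ) (ha : IsCoprime a (q:ℤ)) :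
    ‖cqa P R W b q a‖ ≤ (q:ℝ) ^ (-((8:ℝ) / (8 * d + 1))) := by
  by_cases hqW : Nat.Coprime q W
  swap
  · rw [cqa_zero H b q hq hqW a ha, norm_zero]; positivity
  have hV := VV_ge_one (W := W) hR
  set B : ℝ := ∏ p ∈ q.primeFactors, 3 * (2 * (d:ℝ)^(d+1) / (p:ℝ)^((1:ℝ)/d)) ^ (q.factorization p) with hB
  have hB0 : 0 ≤ B := prod_nonneg (fun p _ => by positivity)
  have h1 : ‖cqa P R W b q a‖ ≤ B * 4 ^ q.primeFactors.card := by
    unfold cqa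
    rw [norm_mul, norm_div, norm_one, Complex.norm_real, Real.norm_of_nonneg (by linarith), one_div_mul_eq_div, div_le_iff₀ (by linarith)]
    have h2 : ∀ j ∈ Js R W, ∀ k ∈ Js R W, ‖(((ArithmeticFunction.moebius j : ℝ) / j.totient * ((ArithmeticFunction.moebius k : ℝ) / k.totient) : ℝ) : ℂ) * mjk P W b q a j k‖
       ≤ B * (if j2 q j = j2 q k then wt (j2 q j).primeFactors else 0) := by
      intro j hj k hk
      have h3 := mjk_bound H b q hq hqW a ha hj hk
      have hpj : 0 < j.totient := Nat.totient_pos.2 (by have := (mem_Js.1 hj).1.1; omega)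
      have hpk : 0 < k.totient := Nat.totient_pos.2 (by have := (mem_Js.1 hk).1.1; omega)
      have hpj' : (0:ℝ) < j.totient := by exact_mod_cast hpj
      have hpk' : (0:ℝ) < k.totient := by exact_mod_cast hpk
      rw [norm_mul, Complex.norm_real, Real.norm_eq_abs, abs_mul, abs_div, abs_div, abs_of_pos hpj', abs_of_pos hpk']
      calc _ ≤ (1 / (j.totient:ℝ) * (1 / (k.totient : ℝ))) * ‖mjk P W b q a j k‖ := by
            gcongr
            · exact moeb_abs j
            · exact moeb_abs k
        _ ≤ (1 / (j.totient:ℝ) * (1 / (k.totient : ℝ))) * _ := mul_le_mul_of_nonneg_left h3 (by positivity)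
        _ = _ := by rw [← hB]; field_simp
    refine (norm_sum_le _ _).trans ?_
    refine (sum_le_sum (fun j hj => (norm_sum_le _ _).trans (sum_le_sum (h2 j hj)))).trans ?_
    simp_rw [← mul_sum]
    rw [mul_assoc]
    exact mul_le_mul_of_nonneg_left (sum_agree R W q) hB0
  refine h1.trans ?_
  have hqr : (q:ℝ) ^ (-((8:ℝ) / (8 * d + 1))) = ∏ p ∈ q.primeFactors, ((p:ℝ) ^ (-((8:ℝ) / (8 * d + 1)))) ^ (q.factorization p) := by
    conv_lhs => rw [← Nat.prod_factorization_pow_eq_self hq.ne']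
    rw [Finsupp.prod, Nat.support_factorization]
    push_cast
    rw [← Real.finsetProd_rpow _ _ (fun i _ => by positivity)]
    apply prod_congr rfl
    intro p _
    rw [← Real.rpow_natCast, ← Real.rpow_natCast, ← Real.rpow_mul (by positivity), ← Real.rpow_mul (by positivity), mul_comm]
  rw [hqr, hB, ← prod_const, ← prod_mul_distrib]
  apply Finset.prod_le_prod
  · intro p _; positivity
  · intro p hp
    have hpp := Nat.prime_of_mem_primeFactors hp
    have hpW : ¬ p ∣ W := by
      intro hpW
      have := Nat.dvd_gcd (Nat.dvd_of_mem_primeFactors hp) hpW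
      rw [hqW] at this
      exact hpp.one_lt.ne' (Nat.dvd_one.1 this)
    have hw := H.hw p (H.h2 p hpp hpW).1
    have hk1 : 1 ≤ q.factorization p := by
      have := (Nat.support_factorization q ▸ hp : p ∈ q.factorization.support)
      rw [Finsupp.mem_support_iff] at this
      omega
    have hp0 : (0:ℝ) < p := by exact_mod_cast hpp.pos
    set e := q.factorization p with he
    have h12 : (3:ℝ) * 4 ≤ 12 ^ e := by
      calc (3:ℝ) * 4 = 12 ^ 1 := by norm_num
        _ ≤ _ := pow_le_pow_right₀ (by norm_num) hk1
    set X : ℝ := 2 * (d:ℝ)^(d+1) / (p:ℝ)^((1:ℝ)/d) with hX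
    have hX0 : 0 ≤ X := by positivity
    calc 3 * X ^ e * 4 = 3 * 4 * X^e := by ring
      _ ≤ 12 ^ e * X ^ e := by gcongr
      _ = (12 * X) ^ e := by rw [mul_pow]
      _ ≤ _ := by
        gcongr
        rw [Real.rpow_neg hp0.le, hX, ← one_div, le_div_iff₀ (by positivity), mul_div_assoc', div_mul_eq_mul_div, div_le_one (by positivity)]
        linarith

end Sieve


noncomputable def pv (P : ℤ[X]) (n : ℕ) : ℝ := ((P.eval (n:ℤ) : ℤ) : ℝ)
noncomputable def dl (P : ℤ[X]) (n : ℕ) : ℝ := pv P (n+1) - pv P n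
noncomputable def dP (P : ℤ[X]) : ℤ[X] := taylor 1 P - P

lemma pv_eq (P : ℤ[X]) (n : ℕ) : pv P n = ∑ i ∈ range (P.natDegree + 1), (P.coeff i : ℝ) * (n:ℝ)^i := by
  unfold pv; rw [eval_eq_sum_range]; push_cast; rfl

lemma pv_eq_le (P : ℤ[X]) (n : ℕ) {d : ℕ} (h : P.natDegree ≤ d) : pv P n = ∑ i ∈ range (d + 1), (P.coeff i : ℝ) * (n:ℝ)^i := by
  unfold pv; rw [eval_eq_sum_range' (Nat.lt_succ_of_le h)]; push_cast; rfl

lemma pv_dP (P : ℤ[X]) (n : ℕ) : pv (dP P) n = dl P n := by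
  unfold pv dl dP
  simp only [eval_sub, taylor_eval]
  unfold pv; push_cast; ring_nf

lemma dP_deg (P : ℤ[X]) : (dP P).natDegree ≤ P.natDegree := by
  unfold dP
  refine (natDegree_sub_le _ _).trans ?_
  rw [natDegree_taylor, max_self]

lemma dP_nonneg {P : ℤ[X]} (h : ∀ i, 0 ≤ P.coeff i) : ∀ i, 0 ≤ (dP P).coeff i := by
  intro i
  unfold dP
  rw [coeff_sub, taylor_coeff, sub_nonneg, eval_eq_sum, sum_def]
  have hc : ∀ n, 0 ≤ (hasseDeriv i P).coeff n := fun n => by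
    rw [hasseDeriv_coeff]; exact mul_nonneg (by positivity) (h _)
  by_cases h0 : (hasseDeriv i P).coeff 0 = 0
  · rw [hasseDeriv_coeff] at h0
    simp at h0
    rw [h0]
    exact sum_nonneg (fun n _ => by rw [one_pow, mul_one]; exact hc n)
  · have := single_le_sum (f := fun n => (hasseDeriv i P).coeff n * 1^n) (fun n _ => by rw [one_pow, mul_one]; exact hc n) (mem_support_iff.2 h0)
    refine le_trans ?_ this
    simp [hasseDeriv_coeff]

lemma pv_nonneg {P : ℤ[X]} (h : ∀ i, 0 ≤ P.coeff i) (n : ℕ) : 0 ≤ pv P n := by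
  rw [pv_eq]; exact sum_nonneg (fun i _ => mul_nonneg (by exact_mod_cast h i) (by positivity))

lemma pv_mono {P : ℤ[X]} (h : ∀ i, 0 ≤ P.coeff i) : Monotone (pv P) := by
  intro m n hmn
  rw [pv_eq, pv_eq]
  apply sum_le_sum
  intro i _
  have : (0:ℝ) ≤ P.coeff i := by exact_mod_cast h i
  gcongr

lemma dl_nonneg {P : ℤ[X]} (h : ∀ i, 0 ≤ P.coeff i) (n : ℕ) : 0 ≤ dl P n := by
  rw [← pv_dP]; exact pv_nonneg (dP_nonneg h) n

lemma dl_mono {P : ℤ[X]} (h : ∀ i, 0 ≤ P.coeff i) : Monotone (dl P) := by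
  have := pv_mono (dP_nonneg h)
  intro m n hmn
  rw [← pv_dP, ← pv_dP]; exact this hmn

lemma succ_pow_le (X : ℝ) (i : ℕ) (hX : 1 ≤ X) : X * (X+1)^i ≤ X * X^i + (2^i - 1) * X^i := by
  induction i with
  | zero => simp
  | succ i ih =>
    have h2 : (0:ℝ) ≤ 2^i - 1 := by have : (1:ℝ) ≤ 2^i := one_le_pow₀ (by norm_num); linarith
    have h0 : (0:ℝ) ≤ X^i := by positivity
    calc X * (X+1)^(i+1) = (X * (X+1)^i) * (X+1) := by ring
      _ ≤ (X * X^i + (2^i-1) * X^i) * (X+1) := by gcongr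
      _ = X * X^(i+1) + (2^(i+1)-1) * X^(i+1) - (2^i-1) * (X^i * (X - 1)) := by ring
      _ ≤ _ := by
        have : 0 ≤ (2^i-1) * (X^i * (X - 1)) := mul_nonneg h2 (mul_nonneg h0 (by linarith))
        linarith

lemma dl_le {P : ℤ[X]} (h : ∀ i, 0 ≤ P.coeff i) {d : ℕ} (hd : P.natDegree ≤ d) {X : ℕ} (hX : 1 ≤ X) :
    X * dl P X ≤ 2^d * pv P X := by
  unfold dl
  rw [pv_eq_le P _ hd, pv_eq_le P _ hd, ← sum_sub_distrib, mul_sum, mul_sum]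
  apply sum_le_sum
  intro i hi
  have hc : (0:ℝ) ≤ P.coeff i := by exact_mod_cast h i
  have h1 := succ_pow_le (X:ℝ) i (by exact_mod_cast hX)
  have h2 : (2:ℝ)^i ≤ 2^d := pow_le_pow_right₀ (by norm_num) (by have := mem_range.1 hi; omega)
  have h3 : (0:ℝ) ≤ (X:ℝ)^i := by positivity
  have h4 : X * (((X+1:ℕ):ℝ)^i - (X:ℝ)^i) ≤ 2^d * (X:ℝ)^i := by
    push_cast; nlinarith
  calc _ = (P.coeff i : ℝ) * (X * (((X+1:ℕ):ℝ)^i - (X:ℝ)^i)) := by ring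
    _ ≤ (P.coeff i : ℝ) * (2^d * (X:ℝ)^i) := by gcongr
    _ = _ := by ring

lemma ddl_le {P : ℤ[X]} (h : ∀ i, 0 ≤ P.coeff i) {d : ℕ} (hd : P.natDegree ≤ d) {X : ℕ} (hX : 1 ≤ X) :
    (X:ℝ)^2 * (dl P (X+1) - dl P X) ≤ 4^d * pv P X := by
  have h1 := dl_le (dP_nonneg h) ((dP_deg P).trans hd) hX
  have h2 := dl_le h hd hX
  unfold dl at h1
  rw [pv_dP, pv_dP] at h1
  have h4 : (4:ℝ)^d = 2^d * 2^d := by rw [← mul_pow]; norm_num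
  rw [h4]
  calc _ = (X:ℝ) * (X * (dl P (X+1) - dl P X)) := by ring
    _ ≤ X * (2^d * dl P X) := by gcongr
    _ = 2^d * (X * dl P X) := by ring
    _ ≤ 2^d * (2^d * pv P X) := by gcongr
    _ = _ := by ring

lemma ddl_mono {P : ℤ[X]} (h : ∀ i, 0 ≤ P.coeff i) {n X : ℕ} (hn : n ≤ X) :
    dl P (n+1) - dl P n ≤ dl P (X+1) - dl P X := by
  have := dl_mono (dP_nonneg h) hn
  unfold dl at this
  simpa only [pv_dP] using this

lemma pv_zero {P : ℤ[X]} (h : P.coeff 0 = 0) : pv P 0 = 0 := by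
  unfold pv; simp [← coeff_zero_eq_eval_zero, h]

lemma pv_one {P : ℤ[X]} {d : ℕ} (hd : P.natDegree ≤ d) : pv P 1 = ∑ i ∈ range (d+1), (P.coeff i : ℝ) := by
  rw [pv_eq_le P 1 hd]; simp

lemma pv_le {P : ℤ[X]} (h : ∀ i, 0 ≤ P.coeff i) {d : ℕ} (hd : P.natDegree ≤ d) {X : ℕ} (hX : 1 ≤ X) :
    pv P X ≤ pv P 1 * (X:ℝ)^d := by
  rw [pv_one hd, pv_eq_le P X hd, sum_mul]
  apply sum_le_sum
  intro i hi
  have hc : (0:ℝ) ≤ P.coeff i := by exact_mod_cast h i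
  have : (1:ℝ) ≤ X := by exact_mod_cast hX
  gcongr
  · have := mem_range.1 hi; omega

lemma pv_ge {P : ℤ[X]} (h : ∀ i, 0 ≤ P.coeff i) {d : ℕ} (hd : P.natDegree = d) (hd1 : 1 ≤ d) (X : ℕ) :
    (X:ℝ)^d ≤ pv P X := by
  rw [pv_eq_le P X hd.le]
  have h1 := single_le_sum (f := fun i => (P.coeff i : ℝ) * (X:ℝ)^i) (s := range (d+1)) (fun i _ => mul_nonneg (by exact_mod_cast h i) (by positivity)) (mem_range.2 (Nat.lt_succ_self d))
  refine le_trans ?_ h1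
  have h2 : P.coeff d ≠ 0 := by
    rw [← hd]; intro h0
    have : P = 0 := leadingCoeff_eq_zero.1 h0
    rw [this] at hd; simp at hd; omega
  have h3 : (1:ℝ) ≤ P.coeff d := by have := h d; exact_mod_cast (by omega : 1 ≤ P.coeff d)
  have : (0:ℝ) ≤ (X:ℝ)^d := by positivity
  nlinarith

lemma coeff_le_pv_one {P : ℤ[X]} (h : ∀ i, 0 ≤ P.coeff i) {d : ℕ} (hd : P.natDegree ≤ d) : (P.coeff d : ℝ) ≤ pv P 1 := by
  rw [pv_one hd]
  exact single_le_sum (f := fun i => (P.coeff i : ℝ)) (fun i _ => by exact_mod_cast h i) (mem_range.2 (Nat.lt_succ_self d))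

lemma sum_dl (P : ℤ[X]) (h0 : P.coeff 0 = 0) (X : ℕ) : ∑ n ∈ range X, dl P n = pv P X := by
  unfold dl; rw [sum_range_sub, pv_zero h0, sub_zero]

noncomputable def GG (P : ℤ[X]) (R W b X : ℕ) (θ : ℝ) : ℂ :=
  (1 / (VV R W : ℂ)) * ∑ n ∈ range X, (dl P n : ℂ) * ((lam R W (W * n + b))^2 : ℝ) * ee (θ * pv P n)

noncomputable def DM (M : ℕ) (β : ℝ) : ℂ := ∑ m ∈ range M, ee (β * m)

noncomputable def Sjk (P : ℤ[X]) (W b X : ℕ) (θ : ℝ) (j k : ℕ) : ℂ :=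
  ∑ n ∈ range X, (dl P n : ℂ) * ((cc j (W * n + b) : ℂ) * (cc k (W * n + b) : ℂ) * ee (θ * pv P n))

noncomputable def cjk (j k : ℕ) : ℝ := (ArithmeticFunction.moebius j : ℝ) / j.totient * ((ArithmeticFunction.moebius k : ℝ) / k.totient)

lemma cjk_abs (j k : ℕ) : |cjk j k| ≤ 1 / ((j.totient : ℝ) * k.totient) := by
  unfold cjk
  rw [abs_mul, abs_div, abs_div, Nat.abs_cast, Nat.abs_cast, div_mul_div_comm]
  gcongr
  have h1 := moeb_abs j
  have h2 := moeb_abs k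
  calc _ ≤ (1:ℝ) * 1 := by gcongr
    _ = 1 := one_mul 1

lemma GG_eq (P : ℤ[X]) (R W b X : ℕ) (θ : ℝ) : GG P R W b X θ = (1 / (VV R W : ℂ)) * ∑ j ∈ Js R W, ∑ k ∈ Js R W, (cjk j k : ℂ) * Sjk P W b X θ j k := by
  unfold GG Sjk
  congr 1
  simp_rw [mul_sum]
  rw [show ∑ j ∈ Js R W, ∑ k ∈ Js R W, ∑ n ∈ range X, (cjk j k : ℂ) * ((dl P n : ℂ) * ((cc j (W * n + b) : ℂ) * (cc k (W * n + b) : ℂ) * ee (θ * pv P n)))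
    = ∑ j ∈ Js R W, ∑ n ∈ range X, ∑ k ∈ Js R W, (cjk j k : ℂ) * ((dl P n : ℂ) * ((cc j (W * n + b) : ℂ) * (cc k (W * n + b) : ℂ) * ee (θ * pv P n))) from
      sum_congr rfl (fun j _ => sum_comm), sum_comm]
  apply sum_congr rfl
  intro n _
  unfold lam
  rw [pow_two, sum_mul_sum]
  push_cast
  rw [mul_sum, sum_mul]
  apply sum_congr rfl
  intro j _
  rw [mul_sum, sum_mul]
  apply sum_congr rfl
  intro k _
  unfold cjk
  push_cast
  ring


lemma sum_residues (N L : ℕ) (hL : 0 < L) (f : ℕ → ℂ) :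
    ∑ n ∈ range N, f n = ∑ r ∈ range L, ∑ m ∈ range ((N + L - 1 - r) / L), f (r + L * m) := by
  rw [← sum_fiberwise_of_maps_to (t := range L) (g := fun n => n % L) (fun n _ => mem_range.2 (Nat.mod_lt _ hL))]
  apply sum_congr rfl
  intro r hr
  have hr := mem_range.1 hr
  symm
  refine sum_nbij' (fun m => r + L * m) (fun n => n / L) ?_ ?_ ?_ ?_ ?_
  · intro m hm
    rw [mem_range, Nat.lt_div_iff_mul_lt hL] at hm
    rw [mem_filter, mem_range]
    constructor
    · have : m * L = L * m := mul_comm _ _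
      omega
    · simp [Nat.add_mul_mod_self_left, Nat.mod_eq_of_lt hr]
  · intro n hn
    rw [mem_filter, mem_range] at hn
    rw [mem_range, Nat.lt_div_iff_mul_lt hL]
    have := Nat.div_add_mod n L
    have h2 : n / L * L = L * (n / L) := mul_comm _ _
    omega
  · intro m _
    rw [Nat.add_mul_div_left _ _ hL, Nat.div_eq_of_lt hr, zero_add]
  · intro n hn
    rw [mem_filter] at hn
    have := Nat.div_add_mod n L
    omega
  · intro _ _; rfl

/-- from `nn (q θ)` small to a reduced fraction -/
lemma reduce_frac (θ : ℝ) (q : ℕ) (hq : 1 ≤ q) (B : ℝ) (h : nn (q * θ) ≤ B) :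
    ∃ q' : ℕ, ∃ a : ℤ, 1 ≤ q' ∧ q' ≤ q ∧ IsCoprime a (q':ℤ) ∧ |θ - a / q'| ≤ B := by
  set z := round ((q:ℝ) * θ) with hz
  set x : ℚ := (z : ℚ) / q with hx
  have hq0 : (0:ℝ) < q := by exact_mod_cast hq
  have hxr : (x : ℝ) = (z:ℝ) / q := by rw [hx]; push_cast; rfl
  refine ⟨x.den, x.num, x.den_pos, ?_, ?_, ?_⟩
  · have : (x.den : ℤ) ∣ (q:ℤ) := by
      have := Rat.den_dvd z q
      rw [hx]; exact_mod_cast this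
    exact Nat.le_of_dvd hq (by exact_mod_cast this)
  · have := x.reduced
    exact Int.isCoprime_iff_gcd_eq_one.2 (by simpa [Int.gcd] using this)
  · have h1 : (x.num : ℝ) / x.den = x := by exact_mod_cast x.num_div_den
    rw [h1, hxr]
    unfold nn at h
    have h2 : θ - z / q = (q * θ - z) / q := by field_simp
    rw [h2, abs_div, abs_of_pos hq0]
    refine (div_le_self (abs_nonneg _) (by exact_mod_cast hq)).trans h

lemma weylpoly (P : ℤ[X]) {d : ℕ} (hd : P.natDegree = d) (θ : ℝ) (r L : ℕ) (hL : 0 < L) :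
    ∃ φ : ℝ[X], φ.natDegree ≤ d ∧ φ.coeff d = θ * (P.coeff d * (L:ℝ)^d) ∧ ∀ m : ℕ, φ.eval (m:ℝ) = θ * pv P (r + L * m) := by
  have hlin : (C (L:ℤ) * X + C (r:ℤ)).natDegree = 1 := natDegree_linear (by exact_mod_cast hL.ne')
  refine ⟨C θ * (P.comp (C (L:ℤ) * X + C (r:ℤ))).map (Int.castRingHom ℝ), ?_, ?_, ?_⟩
  · refine (natDegree_C_mul_le _ _).trans ((natDegree_map_le).trans ?_)
    refine natDegree_comp_le.trans ?_
    rw [hlin, hd, mul_one]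
  · rw [coeff_C_mul, coeff_map]
    have : (P.comp (C (L:ℤ) * X + C (r:ℤ))).coeff d = P.coeff d * (L:ℤ)^d := by
      have h1 := coeff_comp_degree_mul_degree (p := P) (q := C (L:ℤ) * X + C (r:ℤ)) (by rw [hlin]; norm_num)
      rw [hlin, hd, mul_one] at h1
      rw [h1]
      rw [leadingCoeff, leadingCoeff, hlin, hd]
      simp
    rw [this]; simp
  · intro m
    rw [eval_mul, eval_C]
    have : ((m:ℕ):ℝ) = (Int.castRingHom ℝ) (m:ℤ) := by simp
    rw [this, eval_map_apply, eval_comp]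
    simp only [eval_add, eval_mul, eval_C, eval_X, pv]
    congr 1
    push_cast
    simp only [eq_intCast]
    congr 2
    ring

theorem minor (d : ℕ) : ∃ A : ℕ, ∀ (P : ℤ[X]) (W w : ℕ), Hyp d P W w → ∀ R Q X b : ℕ, 1 ≤ R → R ≤ Q → 2 ≤ Q → pv P 1 ≤ Q → 1 ≤ X →
    ∀ θ : ℝ, pv P X < Q * ‖GG P R W b X θ‖ →
    ∃ q : ℕ, ∃ a : ℤ, 1 ≤ q ∧ q ≤ Q^A ∧ IsCoprime a (q:ℤ) ∧ |θ - a / q| ≤ (Q:ℝ)^A / X^d := by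
  rcases Nat.lt_or_ge d 2 with hd2 | hd2
  · exact ⟨0, fun P W w H => absurd H.hd (by omega)⟩
  obtain ⟨e, rfl⟩ : ∃ e, d = e + 1 := ⟨d-1, by omega⟩
  set d := e + 1 with hde
  obtain ⟨B, ⟨C, hC⟩, hB1, hB⟩ := weyl e
  refine ⟨C + (d+6)*C + (d+6)*d + 1 + 2 * d, ?_⟩
  intro P W w H R Q X b hR hRQ hQ hP1 hX θ hθ
  have hQr : (2:ℝ) ≤ Q := by exact_mod_cast hQ
  have hXr : (1:ℝ) ≤ X := by exact_mod_cast hX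
  have hM := pv_ge H.nonneg H.deg (by omega) X
  set M := pv P X with hMd
  have hM0 : 0 < M := lt_of_lt_of_le (by positivity) hM
  -- pick j k
  obtain ⟨j, hj, k, hk, hS⟩ : ∃ j ∈ Js R W, ∃ k ∈ Js R W, (j.totient : ℝ) * k.totient * M < Q^3 * ‖Sjk P W b X θ j k‖ := by
    by_contra hcon
    push Not at hcon
    have hbd : ‖GG P R W b X θ‖ ≤ M / Q := by
      rw [GG_eq, norm_mul]
      have hV := VV_ge_one (W := W) hR
      have h1 : ‖(1 / (VV R W : ℂ))‖ ≤ 1 := by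
        rw [norm_div, norm_one, Complex.norm_real, Real.norm_eq_abs, abs_of_nonneg (by linarith)]
        exact (div_le_one (by linarith)).2 hV
      have hcard : ((Js R W).card : ℝ) ≤ Q := by
        have : (Js R W).card ≤ R := by
          unfold Js; refine (card_filter_le _ _).trans ?_; simp
        exact_mod_cast this.trans hRQ
      have h2 : ‖∑ j ∈ Js R W, ∑ k ∈ Js R W, (cjk j k : ℂ) * Sjk P W b X θ j k‖ ≤ ∑ j ∈ Js R W, ∑ k ∈ Js R W, M / Q^3 := by
        refine (norm_sum_le _ _).trans (sum_le_sum (fun j hj => (norm_sum_le _ _).trans (sum_le_sum (fun k hk => ?_))))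
        have := hcon j hj k hk
        rw [norm_mul, Complex.norm_real, Real.norm_eq_abs]
        have hpj : (0:ℝ) < j.totient := by exact_mod_cast Nat.totient_pos.2 (mem_Js.1 hj).1.1
        have hpk : (0:ℝ) < k.totient := by exact_mod_cast Nat.totient_pos.2 (mem_Js.1 hk).1.1
        calc _ ≤ 1 / ((j.totient : ℝ) * k.totient) * ‖Sjk P W b X θ j k‖ := by gcongr; exact cjk_abs j k
          _ ≤ 1 / ((j.totient : ℝ) * k.totient) * ((j.totient : ℝ) * k.totient * M / Q^3) := by
            gcongr
            rw [le_div_iff₀ (by positivity)]; linarith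
          _ = M / Q^3 := by field_simp
      simp only [sum_const, nsmul_eq_mul] at h2
      calc _ ≤ 1 * ((Q:ℝ) * (Q * (M / Q^3))) := by
            gcongr
            refine h2.trans ?_
            gcongr
        _ = M / Q := by field_simp
    have : (Q:ℝ) * ‖GG P R W b X θ‖ ≤ Q * (M / Q) := by gcongr
    rw [mul_div_cancel₀ _ (by positivity)] at this
    linarith
  have hj1 := (mem_Js.1 hj).1
  have hk1 := (mem_Js.1 hk).1
  have hpj : (0:ℝ) < j.totient := by exact_mod_cast Nat.totient_pos.2 hj1.1
  have hpk : (0:ℝ) < k.totient := by exact_mod_cast Nat.totient_pos.2 hk1.1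
  set z : ℕ → ℂ := fun n => ((cc j (W * n + b) : ℂ) * (cc k (W * n + b) : ℂ) * ee (θ * pv P n)) with hz
  -- remove weights
  obtain ⟨N, hN, hNz⟩ : ∃ N ≤ X, (j.totient : ℝ) * k.totient * X < 2^(d+1) * Q^3 * ‖∑ n ∈ range N, z n‖ := by
    by_contra hcon
    push Not at hcon
    have h1 := abel_mono X (dl P) (dl_nonneg H.nonneg) (dl_mono H.nonneg) z ((j.totient : ℝ) * k.totient * X / (2^(d+1) * Q^3))
      (fun N hN => by rw [le_div_iff₀ (by positivity)]; have := hcon N hN; linarith)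
    have h2 := dl_le H.nonneg H.deg.le hX
    have h3 : ‖Sjk P W b X θ j k‖ ≤ (j.totient : ℝ) * k.totient * M / Q^3 := by
      refine h1.trans ?_
      calc _ = (j.totient : ℝ) * k.totient * (X * dl P X) / (2^d * Q^3) := by field_simp; ring
        _ ≤ (j.totient : ℝ) * k.totient * (2^d * M) / (2^d * Q^3) := by gcongr
        _ = _ := by field_simp
    rw [le_div_iff₀ (by positivity)] at h3
    linarith
  set L := j * k with hLd
  have hL : 0 < L := Nat.mul_pos (by omega) (by omega)
  have hLQ : (L:ℝ) ≤ Q^2 := by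
    have : L ≤ Q^2 := by rw [pow_two]; exact Nat.mul_le_mul (by omega) (by omega)
    exact_mod_cast this
  -- pick residue
  set Nr : ℕ → ℕ := fun r => (N + L - 1 - r) / L with hNr
  obtain ⟨r, hr⟩ : ∃ r, (X:ℝ) ≤ 2^(d+1) * Q^5 * ‖∑ m ∈ range (Nr r), ee (θ * pv P (r + L * m))‖ := by
    by_contra hcon
    push Not at hcon
    have h1 : ‖∑ n ∈ range N, z n‖ ≤ ∑ r ∈ range L, (j.totient : ℝ) * k.totient * (X / (2^(d+1) * Q^5)) := by
      rw [sum_residues N L hL]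
      refine (norm_sum_le _ _).trans (sum_le_sum (fun r _ => ?_))
      have : ∀ m ∈ range ((N + L - 1 - r) / L), z (r + L * m) = ((cc j (W * r + b) : ℂ) * (cc k (W * r + b) : ℂ)) * ee (θ * pv P (r + L * m)) := by
        intro m _
        simp only [hz]
        have e1 := (cc_periodic j W b (L := L) ⟨k, rfl⟩).nat_mul m r
        have e2 := (cc_periodic k W b (L := L) ⟨j, by rw [hLd, mul_comm]⟩).nat_mul m r
        simp only [Nat.cast_id] at e1 e2
        rw [mul_comm L m, e1, e2]
      rw [sum_congr rfl this, ← mul_sum, norm_mul, norm_mul, Complex.norm_real, Complex.norm_real, Real.norm_eq_abs, Real.norm_eq_abs]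
      have c1 := cc_abs (mem_Js.1 hj).2.1 (W * r + b)
      have c2 := cc_abs (mem_Js.1 hk).2.1 (W * r + b)
      gcongr
      rw [le_div_iff₀ (by positivity)]
      have := hcon r
      simp only [hNr] at this
      linarith
    rw [sum_const, card_range, nsmul_eq_mul] at h1
    have h2 : 2^(d+1) * Q^3 * ‖∑ n ∈ range N, z n‖ ≤ 2^(d+1) * Q^3 * ((Q:ℝ)^2 * ((j.totient : ℝ) * k.totient * (X / (2^(d+1) * Q^5)))) := by
      gcongr
      refine h1.trans (by gcongr)
    have h3 : 2^(d+1) * (Q:ℝ)^3 * ((Q:ℝ)^2 * ((j.totient : ℝ) * k.totient * (X / (2^(d+1) * Q^5)))) = (j.totient : ℝ) * k.totient * X := by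
      field_simp
    linarith
  set r0 : ℝ := 2^(d+1) * Q^5 with hr0
  have hr01 : 1 ≤ r0 := by
    have : (1:ℝ) ≤ 2^(d+1) := one_le_pow₀ (by norm_num)
    have : (1:ℝ) ≤ Q^5 := one_le_pow₀ (by linarith)
    nlinarith
  have hr0Q : r0 ≤ Q^(d+6) := by
    rw [hr0, show d + 6 = (d+1) + 5 by ring, pow_add (Q:ℝ)]
    gcongr
  obtain ⟨φ, hφd, hφc, hφe⟩ := weylpoly P H.deg θ r L hL
  have hNrX : Nr r ≤ X := by
    simp only [hNr]
    have h1 : (N + L - 1 - r) / L < N + 1 := by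
      apply Nat.div_lt_of_lt_mul
      nlinarith [Nat.sub_le (N + L - 1) r, Nat.sub_le (N+L) 1, Nat.mul_le_mul_left N hL, (by omega : N + L - 1 - r < N + L)]
    omega
  have hnorm : ‖∑ m ∈ range (Nr r), ee (θ * pv P (r + L * m))‖ ≤ Nr r := by
    refine (norm_sum_le _ _).trans ?_
    simp [ee_norm]
  have hXN : (X:ℝ) ≤ r0 * Nr r := hr.trans (by gcongr)
  have hN1 : 1 ≤ Nr r := by
    by_contra h0
    have : Nr r = 0 := by omega
    rw [this] at hXN; simp at hXN; linarith
  have hw := hB (Nr r) hN1 r0 hr01 φ hφd (by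
    simp_rw [hφe]
    refine le_trans ?_ hr
    exact_mod_cast hNrX)
  obtain ⟨q, hq1, hqB, hqn⟩ := hw
  obtain ⟨c, hc⟩ : ∃ c : ℕ, P.coeff d = c := Int.eq_ofNat_of_zero_le (H.nonneg d)
  have hc0 : 1 ≤ c := by
    rcases Nat.eq_zero_or_pos c with h | h
    · exfalso
      have h1 : P.leadingCoeff = 0 := by rw [leadingCoeff, H.deg, hc, h]; rfl
      have h2 := H.deg
      rw [leadingCoeff_eq_zero.1 h1] at h2; simp at h2
    · exact h
  have hcQ : (c:ℝ) ≤ Q := by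
    have := coeff_le_pv_one H.nonneg H.deg.le
    rw [hc] at this
    refine le_trans ?_ hP1
    exact_mod_cast this
  have hBr : B r0 ≤ (Q:ℝ)^(C + (d+6)*C) := by
    refine (hC r0 hr01).2.trans ?_
    rw [pow_add, pow_mul]
    have h1 : (C:ℝ) ≤ (Q:ℝ)^C := by
      have : C ≤ Q^C := (Nat.lt_pow_self (by omega)).le
      exact_mod_cast this
    gcongr
  have hBr1 := hB1 r0 hr01
  have hQ1 : (1:ℝ) ≤ Q := by linarith
  obtain ⟨q', a, h1, h2, h3, h4⟩ := reduce_frac θ (q * (c * L^d)) (Nat.mul_pos hq1 (Nat.mul_pos hc0 (pow_pos hL d))) (B r0 * r0^d / X^d) (by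
    have e1 : ((q * (c * L^d) : ℕ) : ℝ) * θ = q * φ.coeff d := by
      rw [hφc, hc]; push_cast; ring
    rw [e1, le_div_iff₀ (by positivity)]
    calc _ ≤ nn (q * φ.coeff d) * (r0 * Nr r)^d := by
          have := nn_nonneg (q * φ.coeff d)
          gcongr
      _ = nn (q * φ.coeff d) * Nr r ^ d * r0^d := by ring
      _ ≤ _ := by gcongr)
  refine ⟨q', a, h1, ?_, h3, h4.trans ?_⟩
  · refine h2.trans ?_
    have : ((q * (c * L^d) : ℕ) : ℝ) ≤ (Q:ℝ)^(C + (d+6)*C + (d+6)*d + 1 + 2 * d) := by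
      push_cast
      calc (q:ℝ) * (c * L^d) ≤ (Q:ℝ)^(C + (d+6)*C) * (Q * ((Q:ℝ)^2)^d) := by gcongr; exact hqB.trans hBr
        _ = (Q:ℝ)^(C + (d+6)*C + 1 + 2 * d) := by rw [← pow_mul]; ring
        _ ≤ _ := pow_le_pow_right₀ hQ1 (by omega)
    exact_mod_cast this
  · gcongr
    calc B r0 * r0^d ≤ (Q:ℝ)^(C + (d+6)*C) * ((Q:ℝ)^(d+6))^d := by gcongr
      _ = (Q:ℝ)^(C + (d+6)*C + (d+6)*d) := by rw [← pow_mul]; ring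
      _ ≤ _ := pow_le_pow_right₀ hQ1 (by omega)

lemma Sjk_major {d : ℕ} {P : ℤ[X]} {W w : ℕ} (H : Hyp d P W w) {A Q X b : ℕ} (hQ : 1 ≤ Q) (hP1 : pv P 1 ≤ Q) (hX : 1 ≤ X)
    {q : ℕ} (hq : 1 ≤ q) (a : ℤ) (β : ℝ) (hβ : |β| ≤ (Q:ℝ)^A / X^d) {j k : ℕ} (hj : Squarefree j) (hk : Squarefree k) :
    ‖Sjk P W b X (a / q + β) j k - mjk P W b q a j k * ∑ n ∈ range X, (dl P n : ℂ) * ee (β * pv P n)‖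
      ≤ (q * j * k : ℕ) * ((j.totient : ℝ) * k.totient) * (20 * 4^d * Q^(A+1)) * pv P X / X := by
  have hXr : (1:ℝ) ≤ X := by exact_mod_cast hX
  have hQr : (1:ℝ) ≤ Q := by exact_mod_cast hQ
  set M := pv P X with hMd
  have hM0 : 0 ≤ M := pv_nonneg H.nonneg X
  have hj0 := hj.ne_zero
  have hk0 := hk.ne_zero
  have hβM : |β| * M ≤ Q^(A+1) := by
    have h1 := pv_le H.nonneg H.deg.le hX
    calc |β| * M ≤ (Q:ℝ)^A / X^d * (Q * X^d) := by
          gcongr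
          exact h1.trans (by gcongr)
      _ = Q^(A+1) := by field_simp; ring
  have hdlX := dl_le H.nonneg H.deg.le hX
  have hdX0 := dl_nonneg H.nonneg X
  have hdl' : dl P X ≤ 2^d * M / X := by rw [le_div_iff₀ (by linarith)]; linarith
  have hddl := ddl_le H.nonneg H.deg.le hX
  have hddl' : dl P (X+1) - dl P X ≤ 4^d * M / X^2 := by rw [le_div_iff₀ (by positivity)]; linarith
  have h4 : (4:ℝ)^d = 2^d * 2^d := by rw [← mul_pow]; norm_num
  have h2d : (1:ℝ) ≤ 2^d := one_le_pow₀ (by norm_num)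
  have hpi := Real.pi_lt_four
  have hpi0 := Real.pi_pos
  have hQA : (1:ℝ) ≤ Q^(A+1) := one_le_pow₀ hQr
  have key := periodic_abel (L := q * j * k) (by positivity) (mjk_periodic P W b q (by omega) a j k) (B := (j.totient : ℝ) * k.totient)
    (fun n => by
      rw [norm_mul, norm_mul, ee_norm, mul_one, Complex.norm_real, Complex.norm_real]
      exact mul_le_mul (cc_abs hj _) (cc_abs hk _) (norm_nonneg _) (by positivity)) X
    (fun n => (dl P n : ℂ) * ee (β * pv P n)) (2^d * M / X) (9 * 4^d * Q^(A+1) * M / X^2)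
    (by rw [norm_mul, ee_norm, mul_one, Complex.norm_real, Real.norm_eq_abs, abs_of_nonneg hdX0]; exact hdl')
    (by
      intro n hn
      have e1 : (dl P (n+1) : ℂ) * ee (β * pv P (n+1)) - (dl P n : ℂ) * ee (β * pv P n)
        = ((dl P (n+1) - dl P n : ℝ) : ℂ) * ee (β * pv P (n+1)) + (dl P n : ℂ) * (ee (β * pv P (n+1)) - ee (β * pv P n)) := by
        push_cast; ring
      rw [e1]
      have hn0 := dl_nonneg H.nonneg n
      have hnX : dl P n ≤ 2^d * M / X := (dl_mono H.nonneg hn.le).trans hdl'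
      have hd0 : 0 ≤ dl P (n+1) - dl P n := sub_nonneg.2 (dl_mono H.nonneg (Nat.le_succ n))
      refine (norm_add_le _ _).trans ?_
      rw [norm_mul, norm_mul, ee_norm, mul_one, Complex.norm_real, Complex.norm_real, Real.norm_eq_abs, Real.norm_eq_abs, abs_of_nonneg hd0, abs_of_nonneg hn0]
      have h5 : ‖ee (β * pv P (n+1)) - ee (β * pv P n)‖ ≤ 8 * (|β| * dl P n) := by
        refine (ee_sub_ee_le _ _).trans ?_
        rw [← mul_sub, abs_mul, show |pv P (n+1) - pv P n| = dl P n from abs_of_nonneg hn0]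
        have : 0 ≤ |β| * dl P n := by positivity
        nlinarith
      have h6 : dl P (n+1) - dl P n ≤ 4^d * M / X^2 := (ddl_mono H.nonneg hn.le).trans hddl'
      calc _ ≤ 4^d * M / X^2 + 2^d * M / X * (8 * (|β| * (2^d * M / X))) := by
            gcongr
            exact h5.trans (by gcongr)
        _ = 4^d * M / X^2 * (1 + 8 * (|β| * M)) := by rw [h4]; field_simp
        _ ≤ 4^d * M / X^2 * (9 * Q^(A+1)) := by gcongr; linarith
        _ = _ := by ring)
  have hL : ∑ n ∈ range X, (dl P n : ℂ) * ee (β * pv P n) * ((cc j (W * n + b) : ℂ) * (cc k (W * n + b) : ℂ) * ee (((a * P.eval (n:ℤ) : ℤ) : ℝ) / q))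
      = Sjk P W b X (a / q + β) j k := by
    unfold Sjk
    apply sum_congr rfl
    intro n _
    have : ((a:ℝ) / q + β) * pv P n = β * pv P n + ((a * P.eval (n:ℤ) : ℤ) : ℝ) / q := by
      unfold pv; push_cast; ring
    rw [this, ee_add]; ring
  rw [hL] at key
  refine key.trans ?_
  have : (X:ℝ) ≠ 0 := by positivity
  have h2M : (2:ℝ)^d * M ≤ 4^d * Q^(A+1) * M := by
    have h8 : (2:ℝ)^d ≤ 4^d := pow_le_pow_left₀ (by norm_num) (by norm_num) d
    have : (2:ℝ)^d * 1 ≤ 4^d * Q^(A+1) := by gcongr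
    gcongr
    linarith
  calc _ = 2 * ((q * j * k : ℕ) : ℝ) * ((j.totient : ℝ) * k.totient) * (2^d * M + 9 * 4^d * Q^(A+1) * M) / X := by
        field_simp
    _ ≤ 2 * ((q * j * k : ℕ) : ℝ) * ((j.totient : ℝ) * k.totient) * (4^d * Q^(A+1) * M + 9 * 4^d * Q^(A+1) * M) / X := by gcongr
    _ = _ := by ring

noncomputable def pn (P : ℤ[X]) (n : ℕ) : ℕ := (P.eval (n:ℤ)).toNat

lemma pn_cast {P : ℤ[X]} (h : ∀ i, 0 ≤ P.coeff i) (n : ℕ) : (pn P n : ℝ) = pv P n := by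
  have h1 : (0:ℤ) ≤ P.eval (n:ℤ) := by
    have := pv_nonneg h n; unfold pv at this; exact_mod_cast this
  unfold pn pv
  have := Int.toNat_of_nonneg h1
  exact_mod_cast congrArg (Int.cast : ℤ → ℝ) this

lemma pn_mono {P : ℤ[X]} (h : ∀ i, 0 ≤ P.coeff i) : Monotone (pn P) := by
  intro m n hmn
  have := pv_mono h hmn
  rw [← pn_cast h, ← pn_cast h] at this
  exact_mod_cast this

lemma block_cmp {P : ℤ[X]} (h : ∀ i, 0 ≤ P.coeff i) (h0 : P.coeff 0 = 0) (β : ℝ) (X : ℕ) :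
    ‖∑ n ∈ range X, (dl P n : ℂ) * ee (β * pv P n) - DM (pn P X) β‖ ≤ ∑ n ∈ range X, dl P n * (8 * |β| * dl P n) := by
  induction X with
  | zero =>
    have : pn P 0 = 0 := by have := pn_cast h 0; rw [pv_zero h0] at this; exact_mod_cast this
    simp [this, DM]
  | succ X ih =>
    rw [sum_range_succ, sum_range_succ]
    obtain ⟨e, he⟩ := Nat.exists_eq_add_of_le (pn_mono h (Nat.le_succ X))
    have hdl : dl P X = e := by
      unfold dl; rw [← pn_cast h, ← pn_cast h, he]; push_cast; ring
    have hDM : DM (pn P (X+1)) β = DM (pn P X) β + ∑ i ∈ range e, ee (β * ((pn P X + i : ℕ):ℝ)) := by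
      unfold DM; rw [← Nat.succ_eq_add_one, he, sum_range_add]
    rw [hDM]
    have e1 : (dl P X : ℂ) * ee (β * pv P X) - ∑ i ∈ range e, ee (β * ((pn P X + i : ℕ):ℝ)) = ∑ i ∈ range e, (ee (β * pv P X) - ee (β * ((pn P X + i : ℕ):ℝ))) := by
      rw [sum_sub_distrib, sum_const, card_range, hdl, nsmul_eq_mul]; push_cast; rfl
    have e2 : ‖∑ i ∈ range e, (ee (β * pv P X) - ee (β * ((pn P X + i : ℕ):ℝ)))‖ ≤ dl P X * (8 * |β| * dl P X) := by
      refine (norm_sum_le _ _).trans ?_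
      have : ∀ i ∈ range e, ‖ee (β * pv P X) - ee (β * ((pn P X + i : ℕ):ℝ))‖ ≤ 8 * |β| * dl P X := by
        intro i hi
        refine (ee_sub_ee_le _ _).trans ?_
        rw [← mul_sub, abs_mul]
        push_cast
        rw [pn_cast h, sub_add_cancel_left, abs_neg, Nat.abs_cast]
        have hi : (i:ℝ) ≤ dl P X := by rw [hdl]; exact_mod_cast (mem_range.1 hi).le
        have hpi := Real.pi_lt_four
        have hpi0 := Real.pi_pos
        calc 2 * Real.pi * (|β| * i) ≤ 2 * 4 * (|β| * dl P X) := by gcongr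
          _ = _ := by ring
      refine (sum_le_sum this).trans ?_
      rw [sum_const, card_range, nsmul_eq_mul, hdl]
    calc _ = ‖(∑ n ∈ range X, (dl P n : ℂ) * ee (β * pv P n) - DM (pn P X) β) + ((dl P X : ℂ) * ee (β * pv P X) - ∑ i ∈ range e, ee (β * ((pn P X + i : ℕ):ℝ)))‖ := by
          congr 1; ring
      _ ≤ _ := by
        refine (norm_add_le _ _).trans (add_le_add ih ?_)
        rw [e1]; exact e2

theorem major (d A : ℕ) : ∃ K : ℕ, ∀ (P : ℤ[X]) (W w : ℕ), Hyp d P W w → ∀ R Q X b : ℕ, 1 ≤ R → R ≤ Q → 2 ≤ Q → pv P 1 ≤ Q → Q^K ≤ X →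
    ∀ (q : ℕ) (a : ℤ) (β : ℝ), 1 ≤ q → q ≤ Q^A → IsCoprime a (q:ℤ) → |β| ≤ (Q:ℝ)^A / X^d →
    ‖GG P R W b X (a / q + β) - cqa P R W b q a * DM (pn P X) β‖ * Q ≤ pv P X := by
  refine ⟨2*A+2*d+13, ?_⟩
  intro P W w H R Q X b hR hRQ hQ hP1 hXQ q a β hq hqA hcop hβ
  have hQr : (2:ℝ) ≤ Q := by exact_mod_cast hQ
  have hX : 1 ≤ X := le_trans (Nat.one_le_pow _ _ (by omega)) hXQ
  have hXr : (1:ℝ) ≤ X := by exact_mod_cast hX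
  set M := pv P X with hMd
  have hM0 : 0 ≤ M := pv_nonneg H.nonneg X
  set SB : ℂ := ∑ n ∈ range X, (dl P n : ℂ) * ee (β * pv P n) with hSB
  set E : ℝ := 20 * 4^d * Q^(A+1) * M / X with hE
  have hE0 : 0 ≤ E := by positivity
  have hcard : ((Js R W).card : ℝ) ≤ Q := by
    have : (Js R W).card ≤ R := by
      unfold Js; refine (card_filter_le _ _).trans ?_; simp
    exact_mod_cast this.trans hRQ
  have hV := VV_ge_one (W := W) hR
  have hV1 : ‖(1 / (VV R W : ℂ))‖ ≤ 1 := by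
    rw [norm_div, norm_one, Complex.norm_real, Real.norm_eq_abs, abs_of_nonneg (by linarith)]
    exact (div_le_one (by linarith)).2 hV
  have h1 : ‖GG P R W b X (a / q + β) - cqa P R W b q a * SB‖ ≤ Q * (Q * (Q^(A+2) * E)) := by
    have e1 : GG P R W b X (a / q + β) - cqa P R W b q a * SB = (1 / (VV R W : ℂ)) * ∑ j ∈ Js R W, ∑ k ∈ Js R W,
       (cjk j k : ℂ) * (Sjk P W b X (a/q+β) j k - mjk P W b q a j k * SB) := by
      rw [GG_eq]; unfold cqa
      rw [mul_assoc, ← mul_sub, sum_mul, ← sum_sub_distrib]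
      congr 1
      apply sum_congr rfl; intro j _
      rw [sum_mul, ← sum_sub_distrib]
      apply sum_congr rfl; intro k _
      unfold cjk; ring
    rw [e1, norm_mul]
    have h2 : ‖∑ j ∈ Js R W, ∑ k ∈ Js R W, (cjk j k : ℂ) * (Sjk P W b X (a/q+β) j k - mjk P W b q a j k * SB)‖ ≤ ∑ j ∈ Js R W, ∑ k ∈ Js R W, (Q^(A+2) * E) := by
      refine (norm_sum_le _ _).trans (sum_le_sum (fun j hj => (norm_sum_le _ _).trans (sum_le_sum (fun k hk => ?_))))
      rw [norm_mul, Complex.norm_real, Real.norm_eq_abs]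
      have hj' := mem_Js.1 hj
      have hk' := mem_Js.1 hk
      have hpj : (0:ℝ) < j.totient := by exact_mod_cast Nat.totient_pos.2 hj'.1.1
      have hpk : (0:ℝ) < k.totient := by exact_mod_cast Nat.totient_pos.2 hk'.1.1
      have hs := Sjk_major H (b := b) (by omega) hP1 hX hq a β hβ hj'.2.1 hk'.2.1
      have hqjk : ((q * j * k : ℕ) : ℝ) ≤ Q^(A+2) := by
        have : q * j * k ≤ Q^A * Q * Q := Nat.mul_le_mul (Nat.mul_le_mul hqA (by omega)) (by omega)
        have e : Q^(A+2) = Q^A * Q * Q := by ring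
        exact_mod_cast this.trans e.ge
      calc _ ≤ 1 / ((j.totient : ℝ) * k.totient) * ((q * j * k : ℕ) * ((j.totient : ℝ) * k.totient) * (20 * 4^d * Q^(A+1)) * pv P X / X) := by
            gcongr; exact cjk_abs j k
        _ = (q * j * k : ℕ) * E := by rw [hE, hMd]; field_simp
        _ ≤ _ := by gcongr
    simp only [sum_const, nsmul_eq_mul] at h2
    calc _ ≤ 1 * ((Q:ℝ) * (Q * (Q^(A+2) * E))) := by
          gcongr
          refine h2.trans ?_
          gcongr
      _ = _ := one_mul _
  have h2 : ‖SB - DM (pn P X) β‖ ≤ E := by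
    refine (block_cmp H.nonneg H.c0 β X).trans ?_
    have hdlX := dl_le H.nonneg H.deg.le hX
    have hdl' : dl P X ≤ 2^d * M / X := by rw [le_div_iff₀ (by linarith)]; linarith
    have hβM : |β| * M ≤ Q^(A+1) := by
      have h1 := pv_le H.nonneg H.deg.le hX
      calc |β| * M ≤ (Q:ℝ)^A / X^d * (Q * X^d) := by
            gcongr
            exact h1.trans (by gcongr)
        _ = Q^(A+1) := by field_simp; ring
    calc _ ≤ ∑ n ∈ range X, dl P n * (8 * |β| * (2^d * M / X)) := by
          apply sum_le_sum; intro n hn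
          have := (dl_mono H.nonneg (mem_range.1 hn).le).trans hdl'
          have := dl_nonneg H.nonneg n
          gcongr
      _ = M * (8 * |β| * (2^d * M / X)) := by rw [← sum_mul, sum_dl P H.c0]
      _ = 8 * 2^d * (|β| * M) * M / X := by ring
      _ ≤ 20 * 4^d * Q^(A+1) * M / X := by
        have : (2:ℝ)^d ≤ 4^d := pow_le_pow_left₀ (by norm_num) (by norm_num) d
        gcongr; norm_num
  have hc1 : ‖cqa P R W b q a‖ ≤ 1 := by
    refine (cqa_le H hR b q (by omega) a hcop).trans ?_
    apply Real.rpow_le_one_of_one_le_of_nonpos (by exact_mod_cast hq)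
    have : (0:ℝ) ≤ 8 / (8 * (d:ℝ) + 1) := by positivity
    linarith
  have h3 : ‖GG P R W b X (a / q + β) - cqa P R W b q a * DM (pn P X) β‖ ≤ 2 * Q^(A+4) * E := by
    have : GG P R W b X (a / q + β) - cqa P R W b q a * DM (pn P X) β = (GG P R W b X (a / q + β) - cqa P R W b q a * SB) + cqa P R W b q a * (SB - DM (pn P X) β) := by ring
    rw [this]
    refine (norm_add_le _ _).trans ?_
    rw [norm_mul]
    have h5 : (1:ℝ) ≤ Q^(A+4) := one_le_pow₀ (by linarith)
    calc _ ≤ (Q:ℝ) * (Q * (Q^(A+2) * E)) + 1 * E := by gcongr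
      _ = Q^(A+4) * E + 1 * E := by ring
      _ ≤ Q^(A+4) * E + Q^(A+4) * E := by gcongr
      _ = _ := by ring
  have h40 : (40:ℝ) * 4^d ≤ Q^(6 + 2*d) := by
    have : (40:ℝ) ≤ Q^6 := by
      calc (40:ℝ) ≤ 2^6 := by norm_num
        _ ≤ Q^6 := by gcongr
    rw [pow_add, pow_mul]
    gcongr
    nlinarith
  calc _ ≤ 2 * Q^(A+4) * E * Q := by gcongr
    _ = (40 * 4^d) * Q^(2*A+6) * M / X := by rw [hE]; ring
    _ ≤ Q^(6+2*d) * Q^(2*A+6) * M / X := by gcongr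
    _ ≤ M := by
      rw [div_le_iff₀ (by linarith), mul_comm]
      gcongr
      rw [← pow_add]
      have : (Q:ℝ)^(2*A+2*d+13) ≤ X := by exact_mod_cast hXQ
      exact (pow_le_pow_right₀ (by linarith) (by omega)).trans this


lemma DM_norm_le (M : ℕ) (β : ℝ) : ‖DM M β‖ ≤ M := by
  unfold DM; refine (norm_sum_le _ _).trans ?_; simp [ee_norm]

lemma DM_nn (M : ℕ) (β : ℝ) : ‖DM M β‖ * (2 * nn β) ≤ 1 := by
  have := geom_ee β 0 M
  simpa [DM] using this

lemma DM_sub_int (M : ℕ) (θ : ℝ) (a : ℤ) : DM M (θ - a) = DM M θ := by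
  unfold DM
  apply sum_congr rfl
  intro m _
  exact ee_eq_of_sub_int _ _ (-(a * m)) (by push_cast; ring)

theorem kernel (d : ℕ) (hd2 : 2 ≤ d) : ∃ K : ℕ, 1 ≤ K ∧ ∀ (P : ℤ[X]) (W w : ℕ), Hyp d P W w → ∀ R Q X b : ℕ, 1 ≤ R → R ≤ Q → 2 ≤ Q → pv P 1 ≤ Q → Q^K ≤ X →
    (‖GG P R W b X 0‖ ≤ 2 * pv P X) ∧
    (∀ θ : ℝ, ‖GG P R W b X θ - DM (pn P X) θ‖ ≤ ((w:ℝ) ^ (-((8:ℝ) / (8 * d + 1))) + 2 / Q) * pv P X) ∧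
    (∀ θ : ℝ, ‖GG P R W b X θ‖ ≤ pv P X / Q ∨ ∃ (q : ℕ) (a : ℤ), 1 ≤ q ∧ IsCoprime a (q:ℤ) ∧
      ‖GG P R W b X θ‖ ≤ (q:ℝ) ^ (-((8:ℝ) / (8 * d + 1))) * ‖DM (pn P X) (θ - a / q)‖ + pv P X / Q) := by
  obtain ⟨A0, hA⟩ := minor d
  set A := A0 + 1 with hA1
  obtain ⟨K, hK⟩ := major d A
  refine ⟨K + 1, by omega, ?_⟩
  intro P W w H R Q X b hR hRQ hQ hP1 hX'
  have hX : Q^K ≤ X := le_trans (Nat.pow_le_pow_right (by omega) (by omega)) hX'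
  have hQr : (2:ℝ) ≤ Q := by exact_mod_cast hQ
  have hX1 : 1 ≤ X := le_trans (Nat.one_le_pow _ _ (by omega)) hX
  have hXr : (1:ℝ) ≤ X := by exact_mod_cast hX1
  have hmaj := hK P W w H R Q X b hR hRQ hQ hP1 hX
  set M := pv P X with hMd
  have hMX : (X:ℝ)^d ≤ M := pv_ge H.nonneg H.deg (by omega) X
  have hX0 : (0:ℝ) < (X:ℝ)^d := by positivity
  have hM0 : 0 < M := by linarith
  have hMn : (pn P X : ℝ) = M := pn_cast H.nonneg X
  have hmaj' : ∀ (θ : ℝ) (q : ℕ) (a : ℤ), 1 ≤ q → q ≤ Q^A → IsCoprime a (q:ℤ) → |θ - a / q| ≤ (Q:ℝ)^A / X^d →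
      ‖GG P R W b X θ - cqa P R W b q a * DM (pn P X) (θ - a / q)‖ ≤ M / Q := by
    intro θ q a h1 h2 h3 h4
    have := hmaj q a (θ - a / q) h1 h2 h3 h4
    rw [add_sub_cancel] at this
    rwa [le_div_iff₀ (by linarith)]
  have hAX : (Q:ℝ)^A0 / X^d ≤ (Q:ℝ)^A / X^d := by
    gcongr
    · linarith
    · omega
  have hone : ∀ (θ : ℝ) (a : ℤ), |θ - a| ≤ (Q:ℝ)^A / X^d → ‖GG P R W b X θ - DM (pn P X) θ‖ ≤ M / Q := by
    intro θ a h
    have := hmaj' θ 1 a le_rfl (Nat.one_le_pow _ _ (by omega)) (by simpa using isCoprime_one_right) (by simpa using h)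
    rw [cqa_one P hR, one_mul] at this
    simpa [DM_sub_int] using this
  have hmin : ∀ θ, M / Q < ‖GG P R W b X θ‖ → ∃ q : ℕ, ∃ a : ℤ, 1 ≤ q ∧ q ≤ Q^A ∧ IsCoprime a (q:ℤ) ∧ |θ - a / q| ≤ (Q:ℝ)^A / X^d := by
    intro θ hθ
    rw [div_lt_iff₀ (by linarith), mul_comm] at hθ
    obtain ⟨q, a, h1, h2, h3, h4⟩ := hA P W w H R Q X b hR hRQ hQ hP1 hX1 θ hθ
    exact ⟨q, a, h1, h2.trans (Nat.pow_le_pow_right (by omega) (by omega)), h3, h4.trans hAX⟩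
  have hwn : (0:ℝ) ≤ (w:ℝ) ^ (-((8:ℝ) / (8 * d + 1))) := by positivity
  refine ⟨?_, ?_, ?_⟩
  · have h1 := hone 0 0 (by simp; positivity)
    have h2 : M / Q ≤ M := div_le_self hM0.le (by linarith)
    have h3 := DM_norm_le (pn P X) 0
    rw [hMn] at h3
    calc _ = ‖(GG P R W b X 0 - DM (pn P X) 0) + DM (pn P X) 0‖ := by congr 1; ring
      _ ≤ _ := norm_add_le _ _
      _ ≤ _ := by linarith
  · intro θ
    have e1 : ((w:ℝ) ^ (-((8:ℝ) / (8 * d + 1))) + 2 / Q) * M = (w:ℝ) ^ (-((8:ℝ) / (8 * d + 1))) * M + 2 * (M / Q) := by ring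
    have hMQ : 0 < M / Q := by positivity
    have hwM : 0 ≤ (w:ℝ) ^ (-((8:ℝ) / (8 * d + 1))) * M := by positivity
    rw [e1]
    by_cases hD : M / Q < ‖DM (pn P X) θ‖
    · have h1 := DM_nn (pn P X) θ
      have h2 : nn θ ≤ (Q:ℝ)^A / X^d := by
        have h0 := nn_nonneg θ
        have h3 : M / Q * (2 * nn θ) ≤ 1 := le_trans (by gcongr) h1
        have h4 : M * nn θ ≤ Q := by
          rw [div_mul_eq_mul_div, div_le_one (by linarith)] at h3
          nlinarith
        rw [le_div_iff₀ hX0]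
        have h5 : (Q:ℝ)^1 ≤ Q^A := pow_le_pow_right₀ (by linarith) (by omega)
        nlinarith
      have := hone θ (round θ) h2
      linarith
    · push Not at hD
      by_cases hG : M / Q < ‖GG P R W b X θ‖
      · obtain ⟨q, a, h1, h2, h3, h4⟩ := hmin θ hG
        by_cases hq1 : q = 1
        · subst hq1
          have := hone θ a (by simpa using h4)
          linarith
        · have h5 := hmaj' θ q a h1 h2 h3 h4
          have h6 : ‖cqa P R W b q a‖ ≤ (w:ℝ) ^ (-((8:ℝ) / (8 * d + 1))) := by
            by_cases hqW : Nat.Coprime q W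
            · refine (cqa_le H hR b q (by omega) a h3).trans ?_
              have hqw : w ≤ q := by
                obtain ⟨p, hp, hpq⟩ := Nat.exists_prime_and_dvd hq1
                have h7 := (H.h2 p hp (fun hpW => by
                  have := Nat.dvd_gcd hpq hpW
                  rw [hqW] at this
                  exact hp.one_lt.ne' (Nat.dvd_one.1 this))).1
                exact h7.le.trans (Nat.le_of_dvd (by omega) hpq)
              have hw0 : (0:ℝ) < w := by have := H.hdw; exact_mod_cast (by omega : 0 < w)
              apply Real.rpow_le_rpow_of_nonpos hw0 (by exact_mod_cast hqw)
              have : (0:ℝ) ≤ 8 / (8 * (d:ℝ) + 1) := by positivity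
              linarith
            · rw [cqa_zero H b q (by omega) hqW a h3, norm_zero]; exact hwn
          have h7 := DM_norm_le (pn P X) (θ - a / q)
          rw [hMn] at h7
          have h8 : ‖cqa P R W b q a * DM (pn P X) (θ - a / q)‖ ≤ (w:ℝ) ^ (-((8:ℝ) / (8 * d + 1))) * M := by
            rw [norm_mul]; gcongr
          calc _ = ‖(GG P R W b X θ - cqa P R W b q a * DM (pn P X) (θ - a / q)) + cqa P R W b q a * DM (pn P X) (θ - a / q) - DM (pn P X) θ‖ := by congr 1; ring
            _ ≤ ‖(GG P R W b X θ - cqa P R W b q a * DM (pn P X) (θ - a / q)) + cqa P R W b q a * DM (pn P X) (θ - a / q)‖ + ‖DM (pn P X) θ‖ := norm_sub_le _ _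
            _ ≤ (‖(GG P R W b X θ - cqa P R W b q a * DM (pn P X) (θ - a / q))‖ + ‖cqa P R W b q a * DM (pn P X) (θ - a / q)‖) + ‖DM (pn P X) θ‖ := by gcongr; exact norm_add_le _ _
            _ ≤ _ := by linarith
      · push Not at hG
        refine (norm_sub_le _ _).trans ?_
        linarith
  · intro θ
    by_cases hG : M / Q < ‖GG P R W b X θ‖
    · right
      obtain ⟨q, a, h1, h2, h3, h4⟩ := hmin θ hG
      refine ⟨q, a, h1, h3, ?_⟩
      have h5 := hmaj' θ q a h1 h2 h3 h4
      have h6 := cqa_le H hR b q (by omega) a h3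
      calc _ = ‖(GG P R W b X θ - cqa P R W b q a * DM (pn P X) (θ - a / q)) + cqa P R W b q a * DM (pn P X) (θ - a / q)‖ := by congr 1; ring
        _ ≤ _ := norm_add_le _ _
        _ ≤ M / Q + (q:ℝ) ^ (-((8:ℝ) / (8 * d + 1))) * ‖DM (pn P X) (θ - a / q)‖ := by
          rw [norm_mul]; gcongr
        _ = _ := by ring
    · left; push Not at hG; exact hG


def dq (Q : ℕ) (l : ℤ) : ℕ := ((Icc 1 Q).filter (fun q : ℕ => (q:ℤ) ∣ l)).card

lemma dq_pow (Q B : ℕ) (l : ℤ) : dq Q l ^ B ≤ ∑ n ∈ (Icc 1 (Q^B)).filter (fun n : ℕ => (n:ℤ) ∣ l), n.divisors.card ^ B := by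
  unfold dq
  set D := (Icc 1 Q).filter (fun q : ℕ => (q:ℤ) ∣ l) with hD
  have h1 : D.card ^ B = (Fintype.piFinset (fun _ : Fin B => D)).card := by simp [Fintype.card_piFinset]
  rw [h1, card_eq_sum_card_fiberwise (f := fun t : Fin B → ℕ => Finset.univ.lcm t) (t := (Icc 1 (Q^B)).filter (fun n : ℕ => (n:ℤ) ∣ l))]
  · apply sum_le_sum
    intro n hn
    have hn' := mem_filter.1 hn
    have h2 : n.divisors.card ^ B = (Fintype.piFinset (fun _ : Fin B => n.divisors)).card := by simp [Fintype.card_piFinset]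
    rw [h2]
    apply card_le_card
    intro t ht
    rw [mem_filter] at ht
    rw [Fintype.mem_piFinset]
    intro i
    rw [Nat.mem_divisors]
    refine ⟨?_, by have := (mem_Icc.1 hn'.1).1; omega⟩
    rw [← ht.2]; exact dvd_lcm (mem_univ i)
  · intro t ht
    have ht' : ∀ i, t i ∈ D := by simpa [Fintype.mem_piFinset] using ht
    have hpos : ∀ i, 1 ≤ t i ∧ t i ≤ Q := fun i => mem_Icc.1 (mem_filter.1 (ht' i)).1
    have hd : univ.lcm t ∣ ∏ i, t i := Finset.lcm_dvd (fun i _ => dvd_prod_of_mem t (mem_univ i))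
    have hp : 0 < ∏ i, t i := prod_pos (fun i _ => (hpos i).1)
    simp only [coe_filter, mem_Icc, Set.mem_ofPred_eq]
    refine ⟨⟨Nat.pos_of_dvd_of_pos hd hp, ?_⟩, ?_⟩
    · refine (Nat.le_of_dvd hp hd).trans ?_
      calc ∏ i, t i ≤ ∏ i : Fin B, Q := Finset.prod_le_prod' (fun i _ => (hpos i).2)
        _ = Q^B := by simp
    · rw [Int.natCast_dvd]
      apply Finset.lcm_dvd
      intro i _
      exact Int.natCast_dvd.1 (mem_filter.1 (ht' i)).2

lemma count_mult (M m n : ℕ) (hn : 1 ≤ n) (hm : m < M) :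
    (((range M).filter (fun m' => m' ≠ m ∧ (n:ℤ) ∣ (m:ℤ) - m')).card : ℝ) ≤ 2 * M / n := by
  have hc : ((Ioc 0 M).filter (fun k => n ∣ k)).card = M / n := Nat.Ioc_filter_dvd_card_eq_div M n
  have h1 : (range M).filter (fun m' => m' ≠ m ∧ (n:ℤ) ∣ (m:ℤ) - m') ⊆
     (range M).filter (fun m' => m' < m ∧ n ∣ m - m') ∪ (range M).filter (fun m' => m < m' ∧ n ∣ m' - m) := by
    intro x hx
    simp only [mem_union, mem_filter, mem_range] at hx ⊢
    rcases lt_or_gt_of_ne hx.2.1 with h | h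
    · left; refine ⟨hx.1, h, ?_⟩
      have := hx.2.2
      rw [← Nat.cast_sub h.le] at this; exact_mod_cast this
    · right; refine ⟨hx.1, h, ?_⟩
      have := (dvd_neg.2 hx.2.2)
      rw [neg_sub, ← Nat.cast_sub h.le] at this; exact_mod_cast this
  have h2 : ((range M).filter (fun m' => m' < m ∧ n ∣ m - m')).card ≤ M / n := by
    rw [← hc]
    apply card_le_card_of_injOn (fun m' => m - m')
    · intro x hx
      simp only [coe_filter, mem_range, Set.mem_ofPred_eq, mem_Ioc] at hx ⊢
      exact ⟨by omega, hx.2.2⟩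
    · intro x hx y hy hxy
      simp only [coe_filter, mem_range, Set.mem_ofPred_eq] at hx hy hxy
      omega
  have h3 : ((range M).filter (fun m' => m < m' ∧ n ∣ m' - m)).card ≤ M / n := by
    rw [← hc]
    apply card_le_card_of_injOn (fun m' => m' - m)
    · intro x hx
      simp only [coe_filter, mem_range, Set.mem_ofPred_eq, mem_Ioc] at hx ⊢
      exact ⟨by omega, hx.2.2⟩
    · intro x hx y hy hxy
      simp only [coe_filter, mem_range, Set.mem_ofPred_eq] at hx hy hxy
      omega
  have h4 := (card_le_card h1).trans (card_union_le _ _)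
  have h5 : ((M / n : ℕ) : ℝ) ≤ (M:ℝ) / n := Nat.cast_div_le
  calc _ ≤ ((M/n + M/n : ℕ) : ℝ) := Nat.cast_le.2 (h4.trans (add_le_add h2 h3))
    _ = 2 * ((M / n : ℕ) : ℝ) := by push_cast; ring
    _ ≤ 2 * ((M:ℝ) / n) := by gcongr
    _ = _ := by ring

lemma tau_mul (a b : ℕ) : (a * b).divisors.card ≤ a.divisors.card * b.divisors.card := by
  classical
  rw [Nat.divisors_mul]; exact card_mul_le

lemma tau_sum (N B : ℕ) : ∑ n ∈ Icc 1 N, (n.divisors.card : ℝ)^B / n ≤ (∑ n ∈ Icc 1 N, 1 / (n:ℝ)) ^ (2^B) := by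
  induction B with
  | zero => simp
  | succ B ih =>
    have h1 : ∑ n ∈ Icc 1 N, (n.divisors.card : ℝ)^(B+1) / n ≤ (∑ n ∈ Icc 1 N, (n.divisors.card : ℝ)^B / n) ^ 2 := by
      rw [pow_two, sum_mul_sum, ← sum_product']
      have : ∀ n ∈ Icc 1 N, (n.divisors.card : ℝ)^(B+1) / n = ∑ x ∈ n.divisorsAntidiagonal, (n.divisors.card : ℝ)^B / n := by
        intro n _
        rw [sum_const, nsmul_eq_mul, ← Nat.map_div_right_divisors, card_map]; ring
      rw [sum_congr rfl this, sum_sigma']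
      refine le_trans (b := ∑ x ∈ (Icc 1 N).sigma (fun n => n.divisorsAntidiagonal), ((x.2.1.divisors.card : ℝ)^B / x.2.1 * ((x.2.2.divisors.card : ℝ)^B / x.2.2))) ?_ ?_
      · apply sum_le_sum
        rintro ⟨n, a, b⟩ hx
        simp only [mem_sigma, Nat.mem_divisorsAntidiagonal] at hx ⊢
        rw [div_mul_div_comm, ← mul_pow]
        have := tau_mul a b
        rw [← hx.2.1]
        push_cast
        gcongr
        exact_mod_cast this
      · rw [← sum_image (g := fun x : (_ : ℕ) × ℕ × ℕ => x.2) (f := fun x : ℕ × ℕ => (x.1.divisors.card : ℝ)^B / x.1 * ((x.2.divisors.card : ℝ)^B / x.2))]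
        · apply sum_le_sum_of_subset_of_nonneg
          · intro x hx
            rw [mem_image] at hx
            obtain ⟨⟨n, a, b⟩, hy, rfl⟩ := hx
            simp only [mem_sigma, Nat.mem_divisorsAntidiagonal, mem_Icc, mem_product] at hy ⊢
            obtain ⟨⟨h1, h2⟩, rfl, h3⟩ := hy
            have ha : 0 < a := Nat.pos_of_ne_zero (fun h => by simp [h] at h3)
            have hb : 0 < b := Nat.pos_of_ne_zero (fun h => by simp [h] at h3)
            refine ⟨⟨ha, by nlinarith⟩, ⟨hb, by nlinarith⟩⟩
          · intros; positivity
        · rintro ⟨n, a, b⟩ h1 ⟨n', a', b'⟩ h2 h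
          simp only [coe_sigma, Set.mem_sigma_iff, mem_coe, Nat.mem_divisorsAntidiagonal] at h1 h2 h
          obtain ⟨rfl, rfl⟩ := Prod.mk.inj h
          have : n = n' := h1.2.1.symm.trans h2.2.1
          subst this; rfl
    refine h1.trans ?_
    rw [pow_succ 2 B, pow_mul]
    exact pow_le_pow_left₀ (by positivity) ih 2

lemma log_pow_le (B k : ℕ) (hB : 1 ≤ B) : ∃ C : ℝ, 0 < C ∧ ∀ y : ℝ, 1 ≤ y → (1 + B * Real.log y)^k ≤ C * y := by
  refine ⟨(B:ℝ)^k * k.factorial * Real.exp 1, by positivity, ?_⟩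
  intro y hy
  have hl := Real.log_nonneg hy
  have hB' : (1:ℝ) ≤ B := by exact_mod_cast hB
  have h1 : (1 + Real.log y)^k / k.factorial ≤ Real.exp (1 + Real.log y) := Real.pow_div_factorial_le_exp _ (by linarith) k
  rw [div_le_iff₀ (by positivity), Real.exp_add, Real.exp_log (by linarith)] at h1
  calc (1 + B * Real.log y)^k ≤ (B * (1 + Real.log y))^k := by
        gcongr; nlinarith
    _ = B^k * (1 + Real.log y)^k := by rw [mul_pow]
    _ ≤ B^k * (Real.exp 1 * y * k.factorial) := by gcongr
    _ = _ := by ring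

theorem dq_moment (B : ℕ) (hB : 1 ≤ B) : ∃ C : ℝ, 0 < C ∧ ∀ Q M m : ℕ, 1 ≤ Q → m < M →
    ∑ m' ∈ (range M).filter (fun m' => m' ≠ m), (dq Q ((m:ℤ) - m') : ℝ)^B ≤ C * Q * M := by
  obtain ⟨C, hC0, hC⟩ := log_pow_le B (2^B) hB
  refine ⟨2 * C, by positivity, ?_⟩
  intro Q M m hQ hm
  have h1 : ∀ m' ∈ (range M).filter (fun m' => m' ≠ m), (dq Q ((m:ℤ) - m') : ℝ)^B ≤ ∑ n ∈ Icc 1 (Q^B), (if (n:ℤ) ∣ (m:ℤ) - m' then (n.divisors.card : ℝ)^B else 0) := by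
    intro m' _
    rw [← sum_filter]
    have := dq_pow Q B ((m:ℤ) - m')
    exact_mod_cast this
  refine (sum_le_sum h1).trans ?_
  rw [sum_comm]
  have h2 : ∀ n ∈ Icc 1 (Q^B), ∑ m' ∈ (range M).filter (fun m' => m' ≠ m), (if (n:ℤ) ∣ (m:ℤ) - m' then (n.divisors.card : ℝ)^B else 0) ≤ 2 * M * ((n.divisors.card : ℝ)^B / n) := by
    intro n hn
    rw [← sum_filter, filter_filter, sum_const, nsmul_eq_mul]
    have := count_mult M m n (mem_Icc.1 hn).1 hm
    calc _ ≤ 2 * (M:ℝ) / n * (n.divisors.card : ℝ)^B := by gcongr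
      _ = _ := by ring
  refine (sum_le_sum h2).trans ?_
  rw [← mul_sum]
  have h3 := tau_sum (Q^B) B
  have h4 : ∑ n ∈ Icc 1 (Q^B), 1 / (n:ℝ) ≤ 1 + B * Real.log Q := by
    have := harmonic_le_one_add_log (Q^B)
    rw [harmonic_eq_sum_Icc] at this
    push_cast at this
    rw [Real.log_pow] at this
    simpa [one_div] using this
  have h5 : (∑ n ∈ Icc 1 (Q^B), 1 / (n:ℝ))^(2^B) ≤ C * Q := (pow_le_pow_left₀ (by positivity) h4 _).trans (hC Q (by exact_mod_cast hQ))
  calc _ ≤ 2 * (M:ℝ) * (C * Q) := by gcongr; exact h3.trans h5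
    _ = _ := by ring


lemma DM_add (M N : ℕ) (β : ℝ) : DM (N + M) β = DM N β + ee (β * N) * DM M β := by
  unfold DM
  rw [sum_range_add, mul_sum]
  congr 1
  apply sum_congr rfl; intro m _
  rw [← ee_add]; congr 1; push_cast; ring

lemma DM_sq (M : ℕ) (β : ℝ) : M * ‖DM M β‖^2 ≤ 4 * ∑ N ∈ range (M+1), ‖DM N β‖^2 := by
  have h1 : ∀ N ∈ range (M+1), ‖DM M β‖^2 ≤ 2 * ‖DM N β‖^2 + 2 * ‖DM (M - N) β‖^2 := by
    intro N hN
    have hN := mem_range.1 hN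
    have h2 : DM M β = DM N β + ee (β * N) * DM (M - N) β := by
      rw [← DM_add]; congr 1; omega
    have h3 : ‖DM M β‖ ≤ ‖DM N β‖ + ‖DM (M-N) β‖ := by
      rw [h2]; refine (norm_add_le _ _).trans ?_
      rw [norm_mul, ee_norm, one_mul]
    have := norm_nonneg (DM M β)
    nlinarith [sq_nonneg (‖DM N β‖ - ‖DM (M-N) β‖), norm_nonneg (DM N β), norm_nonneg (DM (M-N) β)]
  have h2 := sum_le_sum h1
  rw [sum_const, card_range, nsmul_eq_mul, sum_add_distrib, ← mul_sum, ← mul_sum] at h2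
  have h3 : ∑ N ∈ range (M+1), ‖DM (M - N) β‖^2 = ∑ N ∈ range (M+1), ‖DM N β‖^2 := by
    rw [← sum_range_reflect (fun N => ‖DM N β‖^2)]
    apply sum_congr rfl; intro N _; congr 3
  rw [h3] at h2
  push_cast at h2
  nlinarith [sq_nonneg ‖DM M β‖]

lemma ee_conj (x : ℝ) : (starRingEnd ℂ) (ee x) = ee (-x) := by
  unfold ee
  rw [← Complex.exp_conj]
  congr 1
  simp [Complex.conj_ofReal]
  left; exact Complex.conj_ofNat 2

lemma norm_sq_sum {ι : Type*} (S : Finset ι) (t : ι → ℝ) :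
    ((‖∑ r ∈ S, ee (t r)‖^2 : ℝ) : ℂ) = ∑ r ∈ S, ∑ r' ∈ S, ee (t r - t r') := by
  rw [Complex.ofReal_pow, ← Complex.mul_conj', map_sum, sum_mul_sum]
  apply sum_congr rfl; intro r _; apply sum_congr rfl; intro r' _
  rw [ee_conj, ← ee_add]; rfl

noncomputable def Sh (p : ℕ) (S : Finset ℕ) (l : ℤ) : ℂ := ∑ r ∈ S, ee (l * ((r:ℝ) / p))

lemma Sh_le (p : ℕ) (S : Finset ℕ) (l : ℤ) : ‖Sh p S l‖ ≤ S.card := by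
  unfold Sh; refine (norm_sum_le _ _).trans ?_; simp [ee_norm]

lemma orth (q : ℕ) (hq : 0 < q) (l : ℤ) : ∑ a ∈ range q, ee (l * ((a:ℝ) / q)) = if (q:ℤ) ∣ l then (q:ℂ) else 0 := by
  have hq' : (q:ℝ) ≠ 0 := by positivity
  have h1 : ∀ a ∈ range q, ee (l * ((a:ℝ) / q)) = ee ((l:ℝ) / q) ^ a := by
    intro a _; rw [← ee_nat_mul]; congr 1; ring
  rw [sum_congr rfl h1]
  split_ifs with h
  · obtain ⟨k, rfl⟩ := h
    have : ee (((q * k : ℤ) : ℝ) / q) = 1 := by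
      rw [← ee_int k]; congr 1; push_cast; field_simp
    rw [this]; simp
  · have hne : ee ((l:ℝ) / q) ≠ 1 := fun h' => h (ee_div_eq_one hq h')
    rw [geom_sum_eq hne, ← ee_nat_mul]
    have : ee ((q:ℝ) * ((l:ℝ) / q)) = 1 := by
      rw [← ee_int l]; congr 1; field_simp
    simp [this]

lemma qsum (p q N : ℕ) (hq : 0 < q) (S : Finset ℕ) :
    ∑ a ∈ range q, ∑ r ∈ S, ∑ r' ∈ S, ‖DM N (((r:ℝ) - r') / p - (a:ℝ) / q)‖^2
     = q * ∑ m ∈ range N, ∑ m' ∈ range N, if (q:ℤ) ∣ (m:ℤ) - m' then ‖Sh p S ((m:ℤ) - m')‖^2 else 0 := by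
  have key : ((∑ a ∈ range q, ∑ r ∈ S, ∑ r' ∈ S, ‖DM N (((r:ℝ) - r') / p - (a:ℝ) / q)‖^2 : ℝ) : ℂ)
     = ((q * ∑ m ∈ range N, ∑ m' ∈ range N, if (q:ℤ) ∣ (m:ℤ) - m' then ‖Sh p S ((m:ℤ) - m')‖^2 else 0 : ℝ) : ℂ) := by
    have h1 : ∀ a ∈ range q, ((∑ r ∈ S, ∑ r' ∈ S, ‖DM N (((r:ℝ) - r') / p - (a:ℝ) / q)‖^2 : ℝ) : ℂ)
       = ∑ m ∈ range N, ∑ m' ∈ range N, ee ((((m':ℤ) - (m:ℤ) : ℤ) : ℝ) * ((a:ℝ) / q)) * ((‖Sh p S ((m:ℤ) - m')‖^2 : ℝ) : ℂ) := by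
      intro a _
      have h2 : ∀ r ∈ S, ∀ r' ∈ S, ((‖DM N (((r:ℝ) - r') / p - (a:ℝ) / q)‖^2 : ℝ) : ℂ) =
          ∑ m ∈ range N, ∑ m' ∈ range N, ee ((((m':ℤ) - (m:ℤ) : ℤ) : ℝ) * ((a:ℝ) / q)) * ee ((((m:ℤ) - (m':ℤ) : ℤ) : ℝ) * ((r:ℝ) / p) - (((m:ℤ) - (m':ℤ) : ℤ) : ℝ) * ((r':ℝ) / p)) := by
        intro r _ r' _
        unfold DM
        rw [norm_sq_sum]
        apply sum_congr rfl; intro m _; apply sum_congr rfl; intro m' _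
        rw [← ee_add]; congr 1; push_cast; ring
      rw [Complex.ofReal_sum]
      simp_rw [Complex.ofReal_sum]
      rw [sum_congr rfl (fun r hr => sum_congr rfl (h2 r hr))]
      have h3 : ∀ m m' : ℕ, ((‖Sh p S ((m:ℤ) - m')‖^2 : ℝ) : ℂ) = ∑ r ∈ S, ∑ r' ∈ S, ee ((((m:ℤ) - (m':ℤ) : ℤ) : ℝ) * ((r:ℝ) / p) - (((m:ℤ) - (m':ℤ) : ℤ) : ℝ) * ((r':ℝ) / p)) := by
        intro m m'
        unfold Sh
        rw [norm_sq_sum]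
      simp_rw [h3, mul_sum]
      rw [sum_congr rfl (fun r _ => sum_comm), sum_comm]
      apply sum_congr rfl; intro m _
      rw [sum_congr rfl (fun r _ => sum_comm), sum_comm]
    rw [Complex.ofReal_sum, sum_congr rfl h1, sum_comm]
    push_cast
    rw [mul_sum]
    apply sum_congr rfl; intro m _
    rw [sum_comm, mul_sum]
    apply sum_congr rfl; intro m' _
    rw [← sum_mul]
    have := orth q hq ((m':ℤ) - m)
    push_cast at this
    rw [this]
    have e : ((q:ℤ) ∣ (m':ℤ) - m) ↔ ((q:ℤ) ∣ (m:ℤ) - m') := by rw [← dvd_neg, neg_sub]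
    by_cases h : (q:ℤ) ∣ (m:ℤ) - m'
    · rw [if_pos h, if_pos (e.2 h)]; push_cast; rfl
    · rw [if_neg h, if_neg (fun h' => h (e.1 h'))]; simp
  exact_mod_cast key

lemma parseval_S (p M m : ℕ) (hp : 0 < p) (hM : M ≤ p) (S : Finset ℕ) (hS : S ⊆ range p) :
    ∑ m' ∈ range M, ‖Sh p S ((m:ℤ) - m')‖^2 ≤ p * S.card := by
  have h1 : ∑ m' ∈ range M, ‖Sh p S ((m:ℤ) - m')‖^2 ≤ ∑ m' ∈ range p, ‖Sh p S ((m:ℤ) - m')‖^2 :=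
    sum_le_sum_of_subset_of_nonneg (range_mono hM) (fun _ _ _ => by positivity)
  refine h1.trans (le_of_eq ?_)
  have key : ((∑ m' ∈ range p, ‖Sh p S ((m:ℤ) - m')‖^2 : ℝ) : ℂ) = ((p * S.card : ℝ) : ℂ) := by
    have h2 : ∀ m' ∈ range p, ((‖Sh p S ((m:ℤ) - m')‖^2 : ℝ) : ℂ) = ∑ r ∈ S, ∑ r' ∈ S, ee ((m:ℝ) * (((r:ℝ) - r') / p)) * ee ((((r':ℤ) - r : ℤ) : ℝ) * ((m':ℝ) / p)) := by
      intro m' _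
      unfold Sh
      rw [norm_sq_sum]
      apply sum_congr rfl; intro r _; apply sum_congr rfl; intro r' _
      rw [← ee_add]; congr 1; push_cast; ring
    rw [Complex.ofReal_sum, sum_congr rfl h2, sum_comm]
    rw [sum_congr rfl (fun r _ => sum_comm)]
    simp_rw [← mul_sum, orth p hp]
    have h3 : ∀ r ∈ S, ∑ r' ∈ S, ee ((m:ℝ) * (((r:ℝ) - r') / p)) * (if (p:ℤ) ∣ (r':ℤ) - r then (p:ℂ) else 0) = p := by
      intro r hr
      rw [sum_eq_single r]
      · simp [ee_zero]
      · intro r' hr' hne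
        rw [if_neg, mul_zero]
        intro hdvd
        have a1 := mem_range.1 (hS hr)
        have a2 := mem_range.1 (hS hr')
        have := Int.emod_emod_of_dvd
        have h4 : (r':ℤ) - r = 0 := Int.eq_zero_of_abs_lt_dvd hdvd (by rw [abs_lt]; omega)
        omega
      · intro h; exact absurd hr h
    rw [sum_congr rfl h3]; simp [mul_comm]
  exact_mod_cast key

lemma dq_split (B : ℕ) (n : ℕ) (Λ : ℝ) (hΛ : 0 < Λ) : (n:ℝ) ≤ Λ + n^(B+1) / Λ^B := by
  by_cases h : (n:ℝ) ≤ Λ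
  · have : (0:ℝ) ≤ n^(B+1) / Λ^B := by positivity
    linarith
  · push Not at h
    have : (n:ℝ) ≤ n^(B+1) / Λ^B := by
      rw [le_div_iff₀ (by positivity), pow_succ, mul_comm]
      gcongr
    linarith

theorem pair_sum (B : ℕ) : ∃ C : ℝ, 0 < C ∧ ∀ (Q p M : ℕ) (S : Finset ℕ) (Λ : ℝ), 1 ≤ Q → 1 ≤ M → M ≤ p → S ⊆ range p → 0 < Λ →
    ∑ q ∈ Icc 1 Q, ∑ a ∈ range q, (1 / (q:ℝ)) * ∑ r ∈ S, ∑ r' ∈ S, ‖DM M (((r:ℝ) - r') / p - (a:ℝ) / q)‖^2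
      ≤ 8 * M * (Q * S.card^2 + Λ * (p * S.card) + C * Q * M / Λ^B * S.card^2) := by
  obtain ⟨C, hC0, hC⟩ := dq_moment (B+1) (by omega)
  refine ⟨C, hC0, ?_⟩
  intro Q p M S Λ hQ hM hMp hS hΛ
  have hMr : (1:ℝ) ≤ M := by exact_mod_cast hM
  -- per m
  have hm : ∀ m ∈ range M, ∑ m' ∈ range M, (dq Q ((m:ℤ) - m') : ℝ) * ‖Sh p S ((m:ℤ) - m')‖^2 ≤ Q * S.card^2 + Λ * (p * S.card) + C * Q * M / Λ^B * S.card^2 := by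
    intro m hm
    have hm' := mem_range.1 hm
    rw [← sum_filter_add_sum_filter_not (range M) (fun m' => m' ≠ m)]
    have h1 : ∑ m' ∈ (range M).filter (fun m' => ¬ m' ≠ m), (dq Q ((m:ℤ) - m') : ℝ) * ‖Sh p S ((m:ℤ) - m')‖^2 ≤ Q * S.card^2 := by
      have : (range M).filter (fun m' => ¬ m' ≠ m) = {m} := by
        ext x; simp only [mem_filter, mem_range, mem_singleton, not_not]; constructor
        · exact fun h => h.2
        · rintro rfl; exact ⟨hm', rfl⟩
      rw [this, sum_singleton]
      have h2 : dq Q ((m:ℤ) - m) ≤ Q := by unfold dq; refine (card_filter_le _ _).trans ?_; simp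
      have := Sh_le p S ((m:ℤ) - m)
      gcongr
    have h2 : ∑ m' ∈ (range M).filter (fun m' => m' ≠ m), (dq Q ((m:ℤ) - m') : ℝ) * ‖Sh p S ((m:ℤ) - m')‖^2 ≤
       Λ * ∑ m' ∈ range M, ‖Sh p S ((m:ℤ) - m')‖^2 + S.card^2 / Λ^B * ∑ m' ∈ (range M).filter (fun m' => m' ≠ m), (dq Q ((m:ℤ) - m') : ℝ)^(B+1) := by
      have h3 : ∑ m' ∈ (range M).filter (fun m' => m' ≠ m), ‖Sh p S ((m:ℤ) - m')‖^2 ≤ ∑ m' ∈ range M, ‖Sh p S ((m:ℤ) - m')‖^2 :=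
        sum_le_sum_of_subset_of_nonneg (filter_subset _ _) (fun _ _ _ => by positivity)
      calc _ ≤ ∑ m' ∈ (range M).filter (fun m' => m' ≠ m), (Λ * ‖Sh p S ((m:ℤ) - m')‖^2 + S.card^2 / Λ^B * (dq Q ((m:ℤ) - m') : ℝ)^(B+1)) := by
            apply sum_le_sum; intro m' _
            have h4 := dq_split B (dq Q ((m:ℤ) - m')) Λ hΛ
            have h5 := Sh_le p S ((m:ℤ) - m')
            calc _ ≤ (Λ + (dq Q ((m:ℤ) - m') : ℝ)^(B+1) / Λ^B) * ‖Sh p S ((m:ℤ) - m')‖^2 := by gcongr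
              _ = Λ * ‖Sh p S ((m:ℤ) - m')‖^2 + (dq Q ((m:ℤ) - m') : ℝ)^(B+1) / Λ^B * ‖Sh p S ((m:ℤ) - m')‖^2 := by ring
              _ ≤ Λ * ‖Sh p S ((m:ℤ) - m')‖^2 + (dq Q ((m:ℤ) - m') : ℝ)^(B+1) / Λ^B * (S.card:ℝ)^2 := by gcongr
              _ = _ := by ring
        _ = Λ * ∑ m' ∈ (range M).filter (fun m' => m' ≠ m), ‖Sh p S ((m:ℤ) - m')‖^2 + S.card^2 / Λ^B * ∑ m' ∈ (range M).filter (fun m' => m' ≠ m), (dq Q ((m:ℤ) - m') : ℝ)^(B+1) := by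
            rw [sum_add_distrib, ← mul_sum, ← mul_sum]
        _ ≤ _ := by gcongr
    have h3 := parseval_S p M m (by omega) hMp S hS
    have h4 := hC Q M m hQ hm'
    calc _ ≤ (Λ * (p * S.card) + S.card^2 / Λ^B * (C * Q * M)) + Q * S.card^2 := by
          refine add_le_add (h2.trans ?_) h1
          gcongr
      _ = _ := by ring
  set E := (Q:ℝ) * S.card^2 + Λ * (p * S.card) + C * Q * M / Λ^B * S.card^2 with hE
  -- per q, N
  have hq : ∀ q ∈ Icc 1 Q, (M:ℝ) * ∑ a ∈ range q, (1 / (q:ℝ)) * ∑ r ∈ S, ∑ r' ∈ S, ‖DM M (((r:ℝ) - r') / p - (a:ℝ) / q)‖^2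
      ≤ 4 * (M+1) * ∑ m ∈ range M, ∑ m' ∈ range M, if (q:ℤ) ∣ (m:ℤ) - m' then ‖Sh p S ((m:ℤ) - m')‖^2 else 0 := by
    intro q hq
    have hq1 := (mem_Icc.1 hq).1
    have hq0 : (0:ℝ) < q := by exact_mod_cast hq1
    rw [← mul_sum]
    have h1 : (M:ℝ) * ∑ a ∈ range q, ∑ r ∈ S, ∑ r' ∈ S, ‖DM M (((r:ℝ) - r') / p - (a:ℝ) / q)‖^2
       ≤ 4 * ∑ N ∈ range (M+1), ∑ a ∈ range q, ∑ r ∈ S, ∑ r' ∈ S, ‖DM N (((r:ℝ) - r') / p - (a:ℝ) / q)‖^2 := by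
      conv_rhs => rw [sum_comm, mul_sum]
      rw [mul_sum]
      apply sum_le_sum; intro a _
      conv_rhs => rw [sum_comm, mul_sum]
      rw [mul_sum]
      apply sum_le_sum; intro r _
      conv_rhs => rw [sum_comm, mul_sum]
      rw [mul_sum]
      apply sum_le_sum; intro r' _
      exact DM_sq _ _
    have h2 : ∀ N ∈ range (M+1), ∑ a ∈ range q, ∑ r ∈ S, ∑ r' ∈ S, ‖DM N (((r:ℝ) - r') / p - (a:ℝ) / q)‖^2
       ≤ q * ∑ m ∈ range M, ∑ m' ∈ range M, if (q:ℤ) ∣ (m:ℤ) - m' then ‖Sh p S ((m:ℤ) - m')‖^2 else 0 := by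
      intro N hN
      have hN' : N ≤ M := by have := mem_range.1 hN; omega
      rw [qsum p q N hq1 S]
      gcongr
      refine (sum_le_sum (fun m _ => sum_le_sum_of_subset_of_nonneg (range_mono hN') ?_)).trans (sum_le_sum_of_subset_of_nonneg (range_mono hN') ?_)
      · intros; positivity
      · intros; positivity
    have h3 := sum_le_sum h2
    rw [sum_const, card_range, nsmul_eq_mul] at h3
    push_cast at h3
    set T1 := ∑ a ∈ range q, ∑ r ∈ S, ∑ r' ∈ S, ‖DM M (((r:ℝ) - r') / p - (a:ℝ) / q)‖^2
    set T2 := ∑ m ∈ range M, ∑ m' ∈ range M, if (q:ℤ) ∣ (m:ℤ) - m' then ‖Sh p S ((m:ℤ) - m')‖^2 else 0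
    have h4 : (M:ℝ) * T1 ≤ 4 * ((M+1) * (q * T2)) := h1.trans (by gcongr)
    rw [show (M:ℝ) * (1 / q * T1) = (M * T1) / q by ring, div_le_iff₀ hq0]
    linarith
  have hsum := sum_le_sum hq
  rw [← mul_sum, ← mul_sum, sum_comm] at hsum
  have h5 : ∑ m ∈ range M, ∑ q ∈ Icc 1 Q, (∑ m' ∈ range M, if (q:ℤ) ∣ (m:ℤ) - m' then ‖Sh p S ((m:ℤ) - m')‖^2 else 0) ≤ M * E := by
    have h6 : ∀ m ∈ range M, ∑ q ∈ Icc 1 Q, (∑ m' ∈ range M, if (q:ℤ) ∣ (m:ℤ) - m' then ‖Sh p S ((m:ℤ) - m')‖^2 else 0) ≤ E := by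
      intro m hm0
      refine le_trans (le_of_eq ?_) (hm m hm0)
      rw [sum_comm]
      apply sum_congr rfl; intro m' _
      rw [← sum_filter, sum_const, nsmul_eq_mul]; rfl
    refine (sum_le_sum h6).trans ?_
    rw [sum_const, card_range, nsmul_eq_mul]
  have hE0 : 0 ≤ E := by positivity
  set T0 := ∑ q ∈ Icc 1 Q, ∑ a ∈ range q, (1 / (q:ℝ)) * ∑ r ∈ S, ∑ r' ∈ S, ‖DM M (((r:ℝ) - r') / p - (a:ℝ) / q)‖^2
  have h7 : (M:ℝ) * T0 ≤ 4 * (M+1) * (M * E) := hsum.trans (by gcongr)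
  have h8 : (M:ℝ) * T0 ≤ M * (8 * M * E) := by
    refine h7.trans ?_
    nlinarith [mul_nonneg (by linarith : (0:ℝ) ≤ M) hE0]
  exact le_of_mul_le_mul_left h8 (by linarith)


lemma exists_phase (z : ℂ) : ∃ c : ℂ, ‖c‖ ≤ 1 ∧ c * z = (‖z‖ : ℂ) := by
  by_cases h : z = 0
  · exact ⟨0, by simp, by simp [h]⟩
  · refine ⟨(starRingEnd ℂ) z / ‖z‖, ?_, ?_⟩
    · rw [norm_div, RCLike.norm_conj]; simp [h]
    · have : (‖z‖ : ℂ) ≠ 0 := by simpa using h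
      rw [div_mul_eq_mul_div, Complex.conj_mul', div_eq_iff this]; ring

/-- duality (Cauchy-Schwarz) -/
lemma dual (N : ℕ) (f u : ℕ → ℝ) (hf : ∀ n, 0 ≤ f n) (hfu : ∀ n < N, f n ≤ u n) (v : ℕ → ℝ) (S : Finset ℕ) (t : ℕ → ℝ) :
    (∑ r ∈ S, ‖∑ n ∈ range N, (f n : ℂ) * ee (t r * v n)‖)^2 ≤
      (∑ n ∈ range N, u n) * ∑ r ∈ S, ∑ r' ∈ S, ‖∑ n ∈ range N, (u n : ℂ) * ee ((t r - t r') * v n)‖ := by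
  choose c hc1 hc2 using fun r : ℕ => exists_phase (∑ n ∈ range N, (f n : ℂ) * ee (t r * v n))
  set A : ℕ → ℂ := fun n => ∑ r ∈ S, c r * ee (t r * v n) with hA
  have h1 : ((∑ r ∈ S, ‖∑ n ∈ range N, (f n : ℂ) * ee (t r * v n)‖ : ℝ) : ℂ) = ∑ n ∈ range N, (f n : ℂ) * A n := by
    rw [Complex.ofReal_sum, sum_congr rfl (fun r _ => (hc2 r).symm)]
    simp_rw [hA, mul_sum]
    rw [sum_comm]
    apply sum_congr rfl; intro n _; apply sum_congr rfl; intro r _; ring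
  have h2 : ∑ r ∈ S, ‖∑ n ∈ range N, (f n : ℂ) * ee (t r * v n)‖ ≤ ∑ n ∈ range N, f n * ‖A n‖ := by
    have h0 : 0 ≤ ∑ r ∈ S, ‖∑ n ∈ range N, (f n : ℂ) * ee (t r * v n)‖ := sum_nonneg (fun _ _ => norm_nonneg _)
    calc _ = ‖((∑ r ∈ S, ‖∑ n ∈ range N, (f n : ℂ) * ee (t r * v n)‖ : ℝ) : ℂ)‖ := by
          rw [Complex.norm_real, Real.norm_of_nonneg h0]
      _ = ‖∑ n ∈ range N, (f n : ℂ) * A n‖ := by rw [h1]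
      _ ≤ ∑ n ∈ range N, ‖(f n : ℂ) * A n‖ := norm_sum_le _ _
      _ = _ := by
          apply sum_congr rfl; intro n _
          rw [norm_mul, Complex.norm_real, Real.norm_of_nonneg (hf n)]
  have h3 : (∑ n ∈ range N, f n * ‖A n‖)^2 ≤ (∑ n ∈ range N, u n) * ∑ n ∈ range N, u n * ‖A n‖^2 := by
    have hcs := sum_sq_le_sum_mul_sum_of_sq_le_mul (range N) (r := fun n => f n * ‖A n‖) (f := f) (g := fun n => f n * ‖A n‖^2)
      (fun n _ => hf n) (fun n _ => mul_nonneg (hf n) (by positivity)) (fun n _ => le_of_eq (by ring))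
    refine hcs.trans (mul_le_mul ?_ ?_ ?_ ?_)
    · exact sum_le_sum (fun n hn => hfu n (mem_range.1 hn))
    · exact sum_le_sum (fun n hn => mul_le_mul_of_nonneg_right (hfu n (mem_range.1 hn)) (by positivity))
    · exact sum_nonneg (fun n _ => mul_nonneg (hf n) (by positivity))
    · exact sum_nonneg (fun n hn => (hf n).trans (hfu n (mem_range.1 hn)))
  have hu0 : 0 ≤ ∑ n ∈ range N, u n := sum_nonneg (fun n hn => (hf n).trans (hfu n (mem_range.1 hn)))
  have h4 : ∑ n ∈ range N, u n * ‖A n‖^2 ≤ ∑ r ∈ S, ∑ r' ∈ S, ‖∑ n ∈ range N, (u n : ℂ) * ee ((t r - t r') * v n)‖ := by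
    have h5 : ((∑ n ∈ range N, u n * ‖A n‖^2 : ℝ) : ℂ) = ∑ r ∈ S, ∑ r' ∈ S, (c r * (starRingEnd ℂ) (c r')) * ∑ n ∈ range N, (u n : ℂ) * ee ((t r - t r') * v n) := by
      have h6 : ∀ n, ((‖A n‖^2 : ℝ) : ℂ) = ∑ r ∈ S, ∑ r' ∈ S, (c r * (starRingEnd ℂ) (c r')) * ee ((t r - t r') * v n) := by
        intro n
        rw [Complex.ofReal_pow, ← Complex.mul_conj', hA, map_sum, sum_mul_sum]
        apply sum_congr rfl; intro r _; apply sum_congr rfl; intro r' _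
        rw [map_mul, ee_conj, show (t r - t r') * v n = t r * v n + -(t r' * v n) by ring, ee_add]; ring
      rw [Complex.ofReal_sum]
      simp_rw [Complex.ofReal_mul, h6, mul_sum]
      rw [sum_comm]
      apply sum_congr rfl; intro r _
      rw [sum_comm]
      apply sum_congr rfl; intro r' _
      apply sum_congr rfl; intro n _; ring
    have h0 : 0 ≤ ∑ n ∈ range N, u n * ‖A n‖^2 := sum_nonneg (fun n hn => mul_nonneg ((hf n).trans (hfu n (mem_range.1 hn))) (by positivity))
    calc _ = ‖((∑ n ∈ range N, u n * ‖A n‖^2 : ℝ) : ℂ)‖ := by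
          rw [Complex.norm_real, Real.norm_of_nonneg h0]
      _ ≤ _ := by
        rw [h5]
        refine (norm_sum_le _ _).trans (sum_le_sum fun r _ => (norm_sum_le _ _).trans (sum_le_sum fun r' _ => ?_))
        rw [norm_mul, norm_mul, RCLike.norm_conj]
        have := mul_le_one₀ (hc1 r) (norm_nonneg _) (hc1 r')
        exact mul_le_of_le_one_left (norm_nonneg _) this
  calc _ ≤ (∑ n ∈ range N, f n * ‖A n‖)^2 := by
        gcongr
    _ ≤ _ := h3.trans (by gcongr)

set_option maxHeartbeats 1000000 in
/-- level set bound, abstract form; `y = 8/δ^2` -/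
theorem level_abs (d T : ℕ) (hd : 2 ≤ d) (hT : d ≤ T) (C1 : ℝ) (hC1 : 1 ≤ C1) : ∃ C : ℝ, 1 ≤ C ∧
    ∀ (M p : ℕ) (Q y : ℝ) (G : ℝ → ℂ) (S : Finset ℕ), 1 ≤ M → M ≤ p → (p:ℝ) ≤ C1 * M → 8 ≤ y → y ≤ Q → y^(T+d+4) ≤ M → S ⊆ range p →
      (∀ θ : ℝ, ‖G θ‖ ≤ M / Q ∨ ∃ (q : ℕ) (a : ℤ), 1 ≤ q ∧ ‖G θ‖ ≤ (q:ℝ) ^ (-((8:ℝ) / (8 * d + 1))) * ‖DM M (θ - a / q)‖ + M / Q) →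
      8 / y * M * S.card^2 ≤ 2 * ∑ r ∈ S, ∑ r' ∈ S, ‖G ((r:ℝ) / p - r' / p)‖ →
      (S.card : ℝ) ≤ C * y ^ ((T:ℝ) + 1/4) := by
  set B := 8 * (T + d + 2) with hB
  obtain ⟨C2, hC20, hC2⟩ := pair_sum B
  set L := 1 + 32 * C2 with hL
  refine ⟨16 * L * C1, by nlinarith, ?_⟩
  intro M p Q y G S hM hMp hpM hy hyQ hyM hS hG hsum
  have hM0 : (0:ℝ) < M := by exact_mod_cast hM
  have hQ0 : 0 < Q := by linarith
  have hy0 : 0 < y := by linarith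
  set κ : ℝ := (8:ℝ) / (8 * d + 1) with hκ
  have hdr : (2:ℝ) ≤ d := by exact_mod_cast hd
  have hTr : (d:ℝ) ≤ T := by exact_mod_cast hT
  have hκ0 : 0 < κ := by positivity
  set γ : ℝ := T + 1/8 with hγ
  have hγκ : 1 ≤ κ * γ := by
    rw [hκ, hγ, div_mul_eq_mul_div, le_div_iff₀ (by positivity)]; linarith
  set Q' : ℕ := ⌊y^(d+1)⌋₊ with hQ'
  have hQ'1 : 1 ≤ Q' := by
    rw [hQ']; apply Nat.le_floor; rw [Nat.cast_one]; exact one_le_pow₀ (by linarith)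
  have hQ'le : (Q':ℝ) ≤ y^(d+1) := Nat.floor_le (by positivity)
  set E : ℕ → ℕ → ℝ := fun r r' => ∑ q ∈ Icc 1 Q', ∑ a ∈ range q, (1 / (q:ℝ)) * ‖DM M (((r:ℝ) - r') / p - (a:ℝ) / q)‖^2 with hE
  have hE0 : ∀ r r', 0 ≤ E r r' := fun r r' => sum_nonneg fun q _ => sum_nonneg fun a _ => by positivity
  -- pairwise
  have hpair : ∀ r r' : ℕ, ‖G ((r:ℝ) / p - r' / p)‖ ≤ 2 / y * M + M * (2 / y) * y ^ γ * (E r r' / M^2) := by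
    intro r r'
    by_cases hb : ‖G ((r:ℝ) / p - r' / p)‖ ≤ 2 / y * M
    · have : 0 ≤ M * (2 / y) * y ^ γ * (E r r' / M^2) := by have := hE0 r r'; positivity
      linarith
    · push Not at hb
      have hMQ : M / Q ≤ 1 / y * M := by
        rw [div_le_iff₀ hQ0]
        calc (M:ℝ) = 1 / y * M * y := by field_simp
          _ ≤ _ := by gcongr
      rcases hG ((r:ℝ) / p - r' / p) with h | ⟨q, a, hq, h⟩
      · exfalso
        have : 1 / y * M ≤ 2 / y * M := by gcongr; norm_num
        linarith
      have hq1 : (1:ℝ) ≤ q := by exact_mod_cast hq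
      have hq0 : (0:ℝ) < q := by linarith
      set a' : ℕ := (a % q).toNat with ha'
      have ha'0 : (0:ℤ) ≤ a % q := Int.emod_nonneg _ (by omega)
      have ha'q : a' < q := by
        have := Int.emod_lt_of_pos a (show (0:ℤ) < q by omega); omega
      have hDM : DM M ((r:ℝ) / p - r' / p - a / q) = DM M (((r:ℝ) - r') / p - (a':ℝ) / q) := by
        rw [← DM_sub_int M (((r:ℝ) - r') / p - (a':ℝ) / q) (a / q)]
        congr 1
        have h2 : (a:ℝ) = a' + q * ((a / (q:ℤ) : ℤ) : ℝ) := by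
          have h3 : (a' : ℤ) = a % q := Int.toNat_of_nonneg ha'0
          have h4 : a = a' + q * (a / (q:ℤ)) := by rw [h3]; exact (Int.emod_add_mul_ediv a q).symm
          exact_mod_cast h4
        rw [h2]; field_simp; ring
      rw [hDM] at h
      set D := ‖DM M (((r:ℝ) - r') / p - (a':ℝ) / q)‖ / M with hD
      have hD' : ‖DM M (((r:ℝ) - r') / p - (a':ℝ) / q)‖ = D * M := by rw [hD]; field_simp
      have hD0 : 0 ≤ D := by positivity
      have hD1 : D ≤ 1 := by rw [hD, div_le_one hM0]; exact DM_norm_le _ _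
      rw [hD'] at h
      set g := ‖G ((r:ℝ) / p - r' / p)‖ / M with hg
      have hg' : ‖G ((r:ℝ) / p - r' / p)‖ = g * M := by rw [hg]; field_simp
      rw [hg'] at h hb ⊢
      have hgb : 2 / y < g := lt_of_mul_lt_mul_right hb hM0.le
      have hg1 : g ≤ (q:ℝ)^(-κ) * D + 1 / y := by
        have : g * M ≤ ((q:ℝ)^(-κ) * D + 1 / y) * M := by linarith
        exact le_of_mul_le_mul_right this hM0
      set z := (q:ℝ)^(-κ) * D with hz
      have hy2 : 2 / y = 1 / y + 1 / y := by ring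
      have hz1 : 1 / y ≤ z := by linarith
      have hgz : g ≤ 2 * z := by linarith
      have hz0 : 0 ≤ z := by positivity
      -- q bounded
      have hqle : (q:ℝ) ≤ y^(d+1) := by
        have h1 : 1 / y ≤ (q:ℝ)^(-κ) := hz1.trans (mul_le_of_le_one_right (by positivity) hD1)
        rw [Real.rpow_neg hq0.le, ← one_div] at h1
        have h2 : (q:ℝ)^κ ≤ y := by
          rwa [one_div_le_one_div hy0 (by positivity)] at h1
        have h3 : (q:ℝ) = ((q:ℝ)^κ) ^ (1/κ) := by
          rw [← Real.rpow_mul hq0.le, mul_one_div_cancel hκ0.ne', Real.rpow_one]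
        rw [h3]
        calc _ ≤ y ^ (1/κ) := by gcongr
          _ ≤ y ^ ((d+1 : ℕ):ℝ) := by
            apply Real.rpow_le_rpow_of_exponent_le (by linarith)
            rw [hκ, one_div_div, div_le_iff₀ (by norm_num)]; push_cast; linarith
          _ = _ := Real.rpow_natCast _ _
      have hqQ : q ∈ Icc 1 Q' := mem_Icc.2 ⟨hq, Nat.le_floor hqle⟩
      -- E lower bound
      have hEl : (1 / (q:ℝ)) * (D * M)^2 ≤ E r r' := by
        rw [← hD']
        have h1 := single_le_sum (f := fun a : ℕ => (1 / (q:ℝ)) * ‖DM M (((r:ℝ) - r') / p - (a:ℝ) / q)‖^2) (fun a _ => by positivity) (mem_range.2 ha'q)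
        have h2 := single_le_sum (f := fun q : ℕ => ∑ a ∈ range q, (1 / (q:ℝ)) * ‖DM M (((r:ℝ) - r') / p - (a:ℝ) / q)‖^2) (fun q _ => sum_nonneg fun a _ => by positivity) hqQ
        exact h1.trans h2
      -- z ≤ (1/y) * y^γ * (1/q) D^2
      have hzz : z ≤ 1 / y * y ^ γ * ((1 / (q:ℝ)) * D^2) := by
        have h1 : (y * z) ^ (1:ℝ) ≤ (y * z) ^ γ := by
          apply Real.rpow_le_rpow_of_exponent_le
          · rw [div_le_iff₀ hy0] at hz1; linarith
          · rw [hγ]; linarith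
        rw [Real.rpow_one, Real.mul_rpow hy0.le hz0] at h1
        have h2 : z ^ γ ≤ (1 / (q:ℝ)) * D^2 := by
          rw [hz, Real.mul_rpow (by positivity) hD0, ← Real.rpow_mul hq0.le]
          have h3 : (q:ℝ) ^ (-κ * γ) ≤ 1 / q := by
            rw [one_div, ← Real.rpow_neg_one]
            apply Real.rpow_le_rpow_of_exponent_le hq1; linarith
          have h4 : D ^ γ ≤ D ^ 2 := by
            rw [← Real.rpow_natCast]
            apply Real.rpow_le_rpow_of_exponent_ge' hD0 hD1 (by norm_num)
            rw [hγ]; push_cast; linarith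
          gcongr
        calc z = 1 / y * (y * z) := by field_simp
          _ ≤ 1 / y * (y ^ γ * ((1 / (q:ℝ)) * D^2)) := mul_le_mul_of_nonneg_left (h1.trans (by gcongr)) (by positivity)
          _ = _ := by ring
      have : (1 / (q:ℝ)) * D^2 ≤ E r r' / M^2 := by
        rw [le_div_iff₀ (by positivity)]; linarith
      have h9 : z ≤ 1 / y * y ^ γ * (E r r' / M^2) := hzz.trans (by gcongr)
      have h10 : g * M ≤ 2 * (1 / y * y ^ γ * (E r r' / M^2)) * M := by gcongr; linarith
      have h11 : 0 ≤ 2 / y * M := by positivity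
      calc g * M ≤ 2 * (1 / y * y ^ γ * (E r r' / M^2)) * M := h10
        _ = M * (2 / y) * y ^ γ * (E r r' / M^2) := by ring
        _ ≤ _ := by linarith
  set Rr : ℝ := (S.card : ℝ) with hRr
  have hR0 : 0 ≤ Rr := by positivity
  have h1 : ∑ r ∈ S, ∑ r' ∈ S, ‖G ((r:ℝ) / p - r' / p)‖ ≤ 2 / y * M * Rr^2 + M * (2 / y) * y ^ γ / M^2 * ∑ r ∈ S, ∑ r' ∈ S, E r r' := by
    refine (sum_le_sum fun r _ => sum_le_sum fun r' _ => hpair r r').trans (le_of_eq ?_)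
    simp_rw [sum_add_distrib, sum_const, nsmul_eq_mul, mul_sum]
    rw [← hRr]
    congr 1
    · ring
    · apply sum_congr rfl; intro r _; apply sum_congr rfl; intro r' _; ring
  set Λ := L * y ^ ((1:ℝ)/8) with hΛ
  have hL1 : 1 ≤ L := by linarith
  have hΛ0 : 0 < Λ := by positivity
  have h2 : ∑ r ∈ S, ∑ r' ∈ S, E r r' ≤ 8 * M * (Q' * Rr^2 + Λ * (p * Rr) + C2 * Q' * M / Λ^B * Rr^2) := by
    refine le_trans (le_of_eq ?_) (hC2 Q' p M S Λ hQ'1 hM hMp hS hΛ0)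
    simp_rw [hE, mul_sum]
    rw [sum_congr rfl (fun r _ => sum_comm), sum_comm]
    apply sum_congr rfl; intro q _
    rw [sum_congr rfl (fun r _ => sum_comm), sum_comm]
  set SE := ∑ r ∈ S, ∑ r' ∈ S, E r r' with hSE
  -- combine: R^2 ≤ y^γ SE / M^2
  have h3 : Rr^2 ≤ y ^ γ * (SE / M^2) := by
    have h4 : 8 / y * M * Rr^2 ≤ 2 * (2 / y * M * Rr^2 + M * (2 / y) * y ^ γ / M^2 * SE) := hsum.trans (by gcongr)
    have h5 : (4 / y * M) * Rr^2 ≤ (4 / y * M) * (y ^ γ * (SE / M^2)) := by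
      have e1 : 2 * (2 / y * M * Rr^2 + M * (2 / y) * y ^ γ / M^2 * SE) = (4 / y * M) * Rr^2 + (4 / y * M) * (y ^ γ * (SE / M^2)) := by ring
      have e2 : 8 / y * M * Rr^2 = (4 / y * M) * Rr^2 + (4 / y * M) * Rr^2 := by ring
      linarith
    exact le_of_mul_le_mul_left h5 (by positivity)
  have h4 : SE / M^2 ≤ 8 * (Q' / M * Rr^2 + Λ * C1 * Rr + C2 * Q' / Λ^B * Rr^2) := by
    rw [div_le_iff₀ (by positivity)]
    refine h2.trans ?_
    have : Λ * (p * Rr) ≤ Λ * (C1 * M * Rr) := by gcongr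
    calc 8 * M * (Q' * Rr^2 + Λ * (p * Rr) + C2 * Q' * M / Λ^B * Rr^2) ≤ 8 * M * (Q' * Rr^2 + Λ * (C1 * M * Rr) + C2 * Q' * M / Λ^B * Rr^2) := by gcongr
      _ = _ := by field_simp
  have hyγ : y ^ γ ≤ y ^ (T+1) := by
    rw [← Real.rpow_natCast]; apply Real.rpow_le_rpow_of_exponent_le (by linarith); rw [hγ]; push_cast; linarith
  have h5 : y ^ γ * (8 * (Q' / M)) ≤ 1/4 := by
    have : (Q':ℝ) / M ≤ y^(d+1) / y^(T+d+4) := by gcongr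
    have e : y ^ (T+1) * (8 * (y^(d+1) / y^(T+d+4))) = 8 / y^2 := by
      rw [show y^(T + d + 4) = y^(T+1) * y^(d+1) * y^2 by ring]; field_simp
    calc _ ≤ y ^ (T+1) * (8 * (y^(d+1) / y^(T+d+4))) := by gcongr
      _ = 8 / y^2 := e
      _ ≤ _ := by rw [div_le_div_iff₀ (by positivity) (by norm_num)]; nlinarith
  have hΛB : 32 * C2 * y^(T+d+2) ≤ Λ^B := by
    rw [hΛ, mul_pow]
    have e1 : (y ^ ((1:ℝ)/8))^B = y^(T+d+2) := by
      rw [← Real.rpow_natCast, ← Real.rpow_mul hy0.le, ← Real.rpow_natCast]; congr 1; rw [hB]; push_cast; ring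
    have e2 : 32 * C2 ≤ L^B := by
      calc 32 * C2 ≤ L := by linarith
        _ = L^1 := (pow_one L).symm
        _ ≤ L^B := pow_le_pow_right₀ hL1 (by omega)
    rw [e1]; gcongr
  have h6 : y ^ γ * (8 * (C2 * Q' / Λ^B)) ≤ 1/4 := by
    have e : 8 * (C2 * Q' / Λ^B) ≤ 8 * (C2 * y^(d+1) / (32 * C2 * y^(T+d+2))) := by gcongr
    have e2 : y ^ (T+1) * (8 * (C2 * y^(d+1) / (32 * C2 * y^(T+d+2)))) = 1/4 := by
      rw [show y^(T + d + 2) = y^(T+1) * y^(d+1) by ring]; field_simp; norm_num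
    calc _ ≤ y ^ (T+1) * (8 * (C2 * y^(d+1) / (32 * C2 * y^(T+d+2)))) := by gcongr
      _ ≤ _ := e2.le
  have h7 : y ^ γ * y ^ ((1:ℝ)/8) = y ^ ((T:ℝ) + 1/4) := by
    rw [← Real.rpow_add hy0]; congr 1; rw [hγ]; ring
  have h8 : Rr^2 ≤ 1/4 * Rr^2 + 8 * L * C1 * y ^ ((T:ℝ) + 1/4) * Rr + 1/4 * Rr^2 := by
    calc Rr^2 ≤ y ^ γ * (8 * (Q' / M * Rr^2 + Λ * C1 * Rr + C2 * Q' / Λ^B * Rr^2)) := h3.trans (by gcongr)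
      _ = y ^ γ * (8 * (Q' / M)) * Rr^2 + 8 * L * C1 * (y ^ γ * y ^ ((1:ℝ)/8)) * Rr + y ^ γ * (8 * (C2 * Q' / Λ^B)) * Rr^2 := by rw [hΛ]; ring
      _ ≤ _ := by rw [h7]; gcongr
  by_contra hcon
  push Not at hcon
  have hpos : 0 < y ^ ((T:ℝ) + 1/4) := by positivity
  have hRpos : 0 < Rr := lt_of_le_of_lt (by positivity) hcon
  nlinarith


lemma dyadic (p T : ℕ) (v : ℕ → ℝ) (hv : ∀ r, 0 ≤ v r) (C δ1 ε : ℝ) (hC : 0 ≤ C) (hδ1 : 0 < δ1) (hδε : δ1 ≤ ε) (hε1 : ε ≤ 1)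
    (hlev : ∀ δ, δ1 ≤ δ → δ ≤ 1 → (((range p).filter (fun r => δ ≤ v r)).card : ℝ) ≤ C * δ ^ (-(2 * (T:ℝ) + 1/2))) :
    ∑ r ∈ (range p).filter (fun r => v r < ε), v r ^ (2*T+1) ≤
      2 ^ (2*T+3) * C * ε ^ ((1:ℝ)/2) + ∑ r ∈ (range p).filter (fun r => v r < 2 * δ1), v r ^ (2*T+1) := by
  have hε0 : 0 < ε := by linarith
  set ρ : ℝ := (1/2 : ℝ) ^ ((1:ℝ)/2) with hρ
  have hρ0 : 0 < ρ := by positivity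
  have hρ1 : ρ ≤ 3/4 := by
    rw [hρ, ← Real.sqrt_eq_rpow]
    apply Real.sqrt_le_iff.2; norm_num
  have key : ∀ J : ℕ, δ1 ≤ ε * (1/2)^J → ∑ r ∈ (range p).filter (fun r => v r < ε), v r ^ (2*T+1) ≤
      2 ^ (2*T+1) * C * ε ^ ((1:ℝ)/2) * ∑ j ∈ range J, ρ^j + ∑ r ∈ (range p).filter (fun r => v r < ε * (1/2)^J), v r ^ (2*T+1) := by
    intro J
    induction J with
    | zero => intro _; simp
    | succ J ih =>
      intro hJ
      have hle : ε * (1/2)^(J+1) ≤ ε * (1/2)^J := by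
        rw [pow_succ]; nlinarith [show 0 < ε * (1/2:ℝ)^J by positivity]
      refine (ih (hJ.trans hle)).trans ?_
      rw [sum_range_succ, mul_add, add_assoc]
      gcongr
      rw [← sum_filter_add_sum_filter_not _ (fun r => ε * (1/2)^(J+1) ≤ v r)]
      have e2 : ((range p).filter (fun r => v r < ε * (1/2)^J)).filter (fun r => ¬ ε * (1/2)^(J+1) ≤ v r) = (range p).filter (fun r => v r < ε * (1/2)^(J+1)) := by
        ext r; simp only [mem_filter, not_le]; constructor
        · rintro ⟨⟨a, _⟩, b⟩; exact ⟨a, b⟩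
        · rintro ⟨a, b⟩; exact ⟨⟨a, lt_of_lt_of_le b hle⟩, b⟩
      rw [e2]
      gcongr
      set δ := ε * (1/2:ℝ)^(J+1) with hδ
      have hδ0 : 0 < δ := by positivity
      have hδ1' : δ ≤ 1 := by
        have : (1/2:ℝ)^(J+1) ≤ 1 := pow_le_one₀ (by norm_num) (by norm_num)
        calc δ ≤ 1 * 1 := mul_le_mul hε1 this (by positivity) (by norm_num)
          _ = 1 := by norm_num
      have e3 : ε * (1/2:ℝ)^J = 2 * δ := by rw [hδ, pow_succ]; ring
      have e4 : ∑ r ∈ ((range p).filter (fun r => v r < ε * (1/2)^J)).filter (fun r => δ ≤ v r), v r ^ (2*T+1) ≤ (C * δ ^ (-(2 * (T:ℝ) + 1/2))) * (2*δ)^(2*T+1) := by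
        calc _ ≤ ∑ r ∈ ((range p).filter (fun r => v r < ε * (1/2)^J)).filter (fun r => δ ≤ v r), (2*δ) ^ (2*T+1) := by
              apply sum_le_sum; intro r hr
              rw [mem_filter, mem_filter, e3] at hr
              have := hv r
              gcongr
              exact hr.1.2.le
          _ ≤ ∑ r ∈ (range p).filter (fun r => δ ≤ v r), (2*δ) ^ (2*T+1) := by
              apply sum_le_sum_of_subset_of_nonneg
              · intro r hr; rw [mem_filter, mem_filter] at hr; rw [mem_filter]; exact ⟨hr.1.1, hr.2⟩
              · intros; positivity
          _ ≤ _ := by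
              rw [sum_const, nsmul_eq_mul]
              gcongr
              exact hlev δ hJ hδ1'
      refine e4.trans ?_
      have e5 : δ ^ (-(2 * (T:ℝ) + 1/2)) * δ^(2*T+1) = δ ^ ((1:ℝ)/2) := by
        rw [← Real.rpow_natCast, ← Real.rpow_add hδ0]; congr 1; push_cast; ring
      have e6 : δ ^ ((1:ℝ)/2) ≤ ε ^ ((1:ℝ)/2) * ρ^J := by
        have : δ ≤ ε * (1/2)^J := hle
        calc δ ^ ((1:ℝ)/2) ≤ (ε * (1/2)^J) ^ ((1:ℝ)/2) := by gcongr
          _ = _ := by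
            rw [Real.mul_rpow hε0.le (by positivity), hρ, ← Real.rpow_natCast, ← Real.rpow_natCast, ← Real.rpow_mul (by norm_num), ← Real.rpow_mul (by norm_num), mul_comm (J:ℝ)]
      calc _ = 2^(2*T+1) * C * (δ ^ (-(2 * (T:ℝ) + 1/2)) * δ^(2*T+1)) := by rw [mul_pow]; ring
        _ ≤ 2^(2*T+1) * C * (ε ^ ((1:ℝ)/2) * ρ^J) := by rw [e5]; gcongr
        _ = _ := by ring
  -- choose J
  obtain ⟨n, hn⟩ := exists_pow_lt_of_lt_one (show 0 < δ1 / ε by positivity) (show (1/2:ℝ) < 1 by norm_num)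
  have hex : ∃ n : ℕ, ε * (1/2:ℝ)^n < δ1 := ⟨n, by rw [lt_div_iff₀ hε0] at hn; linarith⟩
  classical
  set N := Nat.find hex with hN
  have hN1 := Nat.find_spec hex
  have hN0 : N ≠ 0 := by
    intro h0
    rw [← hN, h0] at hN1; simp at hN1; linarith
  obtain ⟨J, hJ⟩ := Nat.exists_eq_succ_of_ne_zero hN0
  have hJ1 : δ1 ≤ ε * (1/2)^J := not_lt.1 (Nat.find_min hex (show J < N by omega))
  have hJ2 : ε * (1/2)^J < 2 * δ1 := by
    rw [← hN, hJ, Nat.succ_eq_add_one, pow_succ] at hN1; linarith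
  refine (key J hJ1).trans ?_
  have hg : ∑ j ∈ range J, ρ^j ≤ 4 := by
    have h1 := mul_neg_geom_sum ρ J
    have h2 : 0 ≤ ∑ j ∈ range J, ρ^j := sum_nonneg (fun _ _ => by positivity)
    have h3 : 0 < ρ^J := by positivity
    nlinarith
  apply add_le_add
  · calc _ ≤ 2 ^ (2*T+1) * C * ε ^ ((1:ℝ)/2) * 4 := by gcongr
      _ = _ := by ring
  · apply sum_le_sum_of_subset_of_nonneg
    · intro r hr; rw [mem_filter] at hr ⊢; exact ⟨hr.1, hr.2.trans hJ2⟩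
    · intro r _ _; have := hv r; positivity

/-- even moment via counting -/
lemma moment (p T X : ℕ) (hp : 0 < p) (f : ℕ → ℝ) (v : ℕ → ℕ) (c : ℝ) (hf : ∀ n, 0 ≤ f n) (hfc : ∀ n < X, f n ≤ c) (M : ℕ)
    (hv : ∀ n < X, v n ≤ M) (hMp : T * M < p) :
    ∑ r ∈ range p, ‖∑ n ∈ range X, (f n : ℂ) * ee ((r:ℝ) / p * v n)‖^(2*T) ≤
      p * c^(2*T) * (((Fintype.piFinset fun _ : Fin T => range X) ×ˢ (Fintype.piFinset fun _ : Fin T => range X)).filter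
        (fun x => ∑ i, v (x.1 i) = ∑ i, v (x.2 i))).card := by
  set Ω := Fintype.piFinset fun _ : Fin T => range X with hΩ
  have h1 : ∀ θ : ℝ, (∑ n ∈ range X, (f n : ℂ) * ee (θ * v n))^T = ∑ x ∈ Ω, ((∏ i, f (x i) : ℝ) : ℂ) * ee (θ * ((∑ i, v (x i) : ℕ) : ℝ)) := by
    intro θ
    have := Finset.prod_univ_sum (fun _ : Fin T => range X) (fun _ n => (f n : ℂ) * ee (θ * v n))
    rw [prod_const, card_univ, Fintype.card_fin] at this
    rw [this]
    apply sum_congr rfl; intro x _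
    rw [Finset.prod_mul_distrib, Complex.ofReal_prod]
    congr 1
    have h2 : ∀ s : Finset (Fin T), ∏ i ∈ s, ee (θ * v (x i)) = ee (θ * ((∑ i ∈ s, v (x i) : ℕ) : ℝ)) := by
      intro s
      induction s using Finset.induction_on with
      | empty => simp [ee_zero]
      | insert a s ha ih => rw [prod_insert ha, sum_insert ha, ih, ← ee_add]; congr 1; push_cast; ring
    exact h2 univ
  have h2 : ∀ r : ℕ, ((‖∑ n ∈ range X, (f n : ℂ) * ee ((r:ℝ) / p * v n)‖^(2*T) : ℝ) : ℂ) =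
      ∑ x ∈ Ω, ∑ y ∈ Ω, ((∏ i, f (x i) : ℝ) : ℂ) * ((∏ i, f (y i) : ℝ) : ℂ) * ee ((((∑ i, v (x i) : ℕ) - (∑ i, v (y i) : ℕ) : ℤ) : ℝ) * ((r:ℝ) / p)) := by
    intro r
    rw [mul_comm 2 T, pow_mul, ← norm_pow, h1, Complex.ofReal_pow, ← Complex.mul_conj', map_sum, sum_mul_sum]
    apply sum_congr rfl; intro x _; apply sum_congr rfl; intro y _
    rw [map_mul, ee_conj, Complex.conj_ofReal]
    rw [show (((((∑ i, v (x i) : ℕ) : ℤ) - ((∑ i, v (y i) : ℕ) : ℤ) : ℤ) : ℝ) * ((r:ℝ) / p)) = (r:ℝ) / p * ((∑ i, v (x i) : ℕ) : ℝ) + -((r:ℝ) / p * ((∑ i, v (y i) : ℕ) : ℝ)) by push_cast; ring, ee_add]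
    ring
  have h3 : ∑ r ∈ range p, ‖∑ n ∈ range X, (f n : ℂ) * ee ((r:ℝ) / p * v n)‖^(2*T) =
      ∑ x ∈ Ω, ∑ y ∈ Ω, (∏ i, f (x i)) * (∏ i, f (y i)) * (if ∑ i, v (x i) = ∑ i, v (y i) then (p:ℝ) else 0) := by
    have : ((∑ r ∈ range p, ‖∑ n ∈ range X, (f n : ℂ) * ee ((r:ℝ) / p * v n)‖^(2*T) : ℝ) : ℂ) =
      ((∑ x ∈ Ω, ∑ y ∈ Ω, (∏ i, f (x i)) * (∏ i, f (y i)) * (if ∑ i, v (x i) = ∑ i, v (y i) then (p:ℝ) else 0) : ℝ) : ℂ) := by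
      rw [Complex.ofReal_sum, sum_congr rfl (fun r _ => h2 r), sum_comm, Complex.ofReal_sum]
      apply sum_congr rfl; intro x hx
      rw [sum_comm, Complex.ofReal_sum]
      apply sum_congr rfl; intro y hy
      rw [← mul_sum, orth p hp]
      have hb : ∀ x ∈ Ω, ∑ i, v (x i) ≤ T * M := by
        intro x hx
        rw [hΩ, Fintype.mem_piFinset] at hx
        calc _ ≤ ∑ i : Fin T, M := sum_le_sum (fun i _ => hv _ (mem_range.1 (hx i)))
          _ = _ := by simp
      have hbx := hb x hx
      have hby := hb y hy
      have e : ((p:ℤ) ∣ ((∑ i, v (x i) : ℕ) : ℤ) - ((∑ i, v (y i) : ℕ) : ℤ)) ↔ ∑ i, v (x i) = ∑ i, v (y i) := by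
        constructor
        · intro h
          have := Int.eq_zero_of_abs_lt_dvd h (by rw [abs_lt]; omega)
          omega
        · intro h; rw [h]; simp
      by_cases h : ∑ i, v (x i) = ∑ i, v (y i)
      · rw [if_pos h, if_pos (e.2 h)]; push_cast; rfl
      · rw [if_neg h, if_neg (fun h' => h (e.1 h'))]; simp
    exact_mod_cast this
  rw [h3, ← sum_product', card_filter]
  push_cast
  rw [mul_sum]
  apply sum_le_sum
  intro x hx
  rw [mem_product, hΩ, Fintype.mem_piFinset, Fintype.mem_piFinset] at hx
  have hc : ∀ z : Fin T → ℕ, (∀ i, z i ∈ range X) → ∏ i, f (z i) ≤ c^T := by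
    intro z hz
    calc _ ≤ ∏ i : Fin T, c := Finset.prod_le_prod (fun i _ => hf _) (fun i _ => hfc _ (mem_range.1 (hz i)))
      _ = _ := by simp
  have hpos : ∀ z : Fin T → ℕ, 0 ≤ ∏ i, f (z i) := fun z => prod_nonneg (fun i _ => hf _)
  have h7 : (∏ i, f (x.1 i)) * (∏ i, f (x.2 i)) ≤ c^(2*T) := by
    rw [two_mul, pow_add]
    exact mul_le_mul (hc _ hx.1) (hc _ hx.2) (hpos _) ((hpos _).trans (hc _ hx.1))
  split_ifs
  · rw [mul_one, mul_comm]; gcongr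
  · simp

def DMP (d T : ℕ) : Prop :=
  ∀ g : Polynomial ℤ, g.natDegree = d → ∀ ε : ℝ, 0 < ε →
    ∃ C : ℝ, 0 < C ∧ ∀ X : ℕ, 1 ≤ X →
      (((Fintype.piFinset fun _ : Fin (2 * T) => Finset.Icc 1 X).filter
          (fun x => (∑ i : Fin T, g.eval (x ⟨i.1, by have := i.isLt; omega⟩ : ℤ))
                  = ∑ i : Fin T, g.eval (x ⟨T + i.1, by have := i.isLt; omega⟩ : ℤ))).card : ℝ)
        ≤ C * (X : ℝ) ^ ((2 * T : ℝ) - (d : ℝ) + ε)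

lemma count_le (T X : ℕ) (v : ℕ → ℕ) (g : Polynomial ℤ) (hg : ∀ n : ℕ, g.eval ((n + 1 : ℕ) : ℤ) = v n) :
    (((Fintype.piFinset fun _ : Fin T => range X) ×ˢ (Fintype.piFinset fun _ : Fin T => range X)).filter
        (fun x => ∑ i, v (x.1 i) = ∑ i, v (x.2 i))).card ≤
    ((Fintype.piFinset fun _ : Fin (2 * T) => Finset.Icc 1 X).filter
          (fun x => (∑ i : Fin T, g.eval (x ⟨i.1, by have := i.isLt; omega⟩ : ℤ))
                  = ∑ i : Fin T, g.eval (x ⟨T + i.1, by have := i.isLt; omega⟩ : ℤ))).card := by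
  apply card_le_card_of_injOn (fun x (i : Fin (2*T)) => if h : i.1 < T then x.1 ⟨i.1, h⟩ + 1 else x.2 ⟨i.1 - T, by have := i.isLt; omega⟩ + 1)
  · intro x hx
    simp only [coe_filter, mem_product, Fintype.mem_piFinset, mem_range, Set.mem_ofPred_eq] at hx
    simp only [coe_filter, Fintype.mem_piFinset, mem_Icc, Set.mem_ofPred_eq]
    constructor
    · intro i
      split_ifs with h
      · have := hx.1.1 ⟨i.1, h⟩; omega
      · have := hx.1.2 ⟨i.1 - T, by have := i.isLt; omega⟩; omega
    · have e1 : ∀ i : Fin T, i.1 < T := fun i => i.isLt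
      have e2 : ∀ i : Fin T, ¬ (T + i.1 < T) := fun i => by omega
      simp only [e1, e2, dite_true, dite_false, hg, Nat.add_sub_cancel_left]
      exact_mod_cast hx.2
  · intro x hx y hy hxy
    have h1 := fun i => congrFun hxy i
    ext i
    · have := h1 ⟨i.1, by have := i.isLt; omega⟩
      simp only [i.isLt, dite_true] at this
      simpa using this
    · have := h1 ⟨T + i.1, by have := i.isLt; omega⟩
      have e2 : ¬ (T + i.1 < T) := by omega
      simp only [e2, dite_false, Nat.add_sub_cancel_left] at this
      simpa using this

/-- the moment property forces `d ≤ T` -/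
lemma T_ge (d T : ℕ) (hT : 0 < T) (hd : 1 ≤ d) (h : DMP d T) : d ≤ T := by
  by_contra hcon
  push Not at hcon
  obtain ⟨C, hC0, hC⟩ := h (Polynomial.X ^ d) (Polynomial.natDegree_X_pow d) (1/2) (by norm_num)
  have h1 : ∀ X : ℕ, 1 ≤ X → (X:ℝ)^T ≤ C * (X:ℝ) ^ ((T:ℝ) - 1/2) := by
    intro X hX
    have hXr : (1:ℝ) ≤ X := by exact_mod_cast hX
    have h2 : X^T ≤ ((Fintype.piFinset fun _ : Fin (2 * T) => Finset.Icc 1 X).filter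
          (fun x => (∑ i : Fin T, ((Polynomial.X : Polynomial ℤ)^d).eval (x ⟨i.1, by have := i.isLt; omega⟩ : ℤ))
                  = ∑ i : Fin T, ((Polynomial.X : Polynomial ℤ)^d).eval (x ⟨T + i.1, by have := i.isLt; omega⟩ : ℤ))).card := by
      have : (Fintype.piFinset fun _ : Fin T => Finset.Icc 1 X).card = X^T := by
        rw [Fintype.card_piFinset]; simp
      rw [← this]
      apply card_le_card_of_injOn (fun x (i : Fin (2*T)) => x ⟨i.1 % T, Nat.mod_lt _ hT⟩)
      · intro x hx
        simp only [mem_coe, Fintype.mem_piFinset] at hx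
        simp only [coe_filter, Fintype.mem_piFinset, Set.mem_ofPred_eq]
        refine ⟨fun i => hx _, ?_⟩
        apply sum_congr rfl; intro i _
        simp
      · intro x _ y _ hxy
        ext i
        have := congrFun hxy ⟨i.1, by have := i.isLt; omega⟩
        simpa [Nat.mod_eq_of_lt i.isLt] using this
    have h3 := hC X hX
    calc (X:ℝ)^T = ((X^T : ℕ) : ℝ) := by push_cast; rfl
      _ ≤ _ := Nat.cast_le.2 h2
      _ ≤ _ := h3
      _ ≤ _ := by
        gcongr
        have : (T:ℝ) + 1 ≤ d := by exact_mod_cast hcon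
        linarith
  have h2 : ∀ X : ℕ, 1 ≤ X → (X:ℝ) ^ ((1:ℝ)/2) ≤ C := by
    intro X hX
    have hXr : (1:ℝ) ≤ X := by exact_mod_cast hX
    have h3 := h1 X hX
    rw [← Real.rpow_natCast, show (T:ℝ) = 1/2 + ((T:ℝ) - 1/2) by ring, Real.rpow_add (by linarith)] at h3
    have e : (1:ℝ)/2 + ((T:ℝ) - 1/2) - 1/2 = (T:ℝ) - 1/2 := by ring
    rw [e] at h3
    exact le_of_mul_le_mul_right h3 (by positivity)
  obtain ⟨n, hn⟩ := exists_nat_gt (C^2 + 1)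
  have h3 := h2 n (by
    have : (1:ℝ) ≤ n := by nlinarith [sq_nonneg C]
    exact_mod_cast this)
  rw [← Real.sqrt_eq_rpow] at h3
  have := Real.sqrt_le_iff.1 h3
  linarith [this.2]


noncomputable def Rf (A X : ℕ) : ℕ := ⌊(X:ℝ) ^ ((1:ℝ) / A)⌋₊

lemma Rf_pow_le {A : ℕ} (hA : 1 ≤ A) (X : ℕ) : (Rf A X)^A ≤ X := by
  have h1 : ((Rf A X : ℕ) : ℝ) ≤ (X:ℝ) ^ ((1:ℝ) / A) := Nat.floor_le (by positivity)
  have h2 : ((Rf A X : ℕ) : ℝ)^A ≤ ((X:ℝ) ^ ((1:ℝ) / A))^A := by gcongr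
  rw [← Real.rpow_natCast (_ ^ _), ← Real.rpow_mul (by positivity), one_div_mul_cancel (by positivity), Real.rpow_one] at h2
  exact_mod_cast h2

lemma Rf_ge {A : ℕ} (hA : 1 ≤ A) {N X : ℕ} (h : N^A ≤ X) : N ≤ Rf A X := by
  apply Nat.le_floor
  calc (N:ℝ) = ((N:ℝ)^A) ^ ((1:ℝ)/A) := by
        rw [← Real.rpow_natCast, ← Real.rpow_mul (by positivity), mul_one_div_cancel (by positivity), Real.rpow_one]
    _ ≤ _ := by
        have : (N:ℝ)^A ≤ X := by exact_mod_cast h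
        gcongr

lemma Rf_lt (A X : ℕ) : (X:ℝ) ^ ((1:ℝ) / A) < Rf A X + 1 := Nat.lt_floor_add_one _

noncomputable def uu (P : ℤ[X]) (R W b n : ℕ) : ℝ := 1 / VV R W * (dl P n * (lam R W (W * n + b))^2)

noncomputable def Fh (P : ℤ[X]) (X : ℕ) (f : ℕ → ℝ) (θ : ℝ) : ℂ := ∑ n ∈ range X, (f n : ℂ) * ee (θ * pn P n)

lemma GG_uu {P : ℤ[X]} (h : ∀ i, 0 ≤ P.coeff i) (R W b X : ℕ) (θ : ℝ) : GG P R W b X θ = Fh P X (uu P R W b) θ := by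
  unfold GG Fh uu
  rw [mul_sum]
  apply sum_congr rfl; intro n _
  rw [pn_cast h]; push_cast; ring

set_option maxHeartbeats 1000000 in
theorem restriction (d T : ℕ) (hd : 2 ≤ d) (hT : 0 < T) (hm : DMP d T) (C1 : ℝ) (hC1 : 1 ≤ C1) :
    ∃ (A : ℕ) (C : ℝ), 4 ≤ A ∧ 0 < C ∧ ∀ (P : ℤ[X]) (W w : ℕ), Hyp d P W w → ∀ ε : ℝ, 0 < ε → ε ≤ 1 → ∃ X0 : ℕ, ∀ X, X0 ≤ X →
      ∀ (b p : ℕ) (f : ℕ → ℝ), T * pn P X < p → (p:ℝ) ≤ C1 * pn P X → (∀ n, 0 ≤ f n) →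
      (∀ n < X, f n ≤ uu P (Rf A X) W b n) → (∀ n < X, f n ≤ dl P n * Rf A X) →
      (∑ r ∈ (range p).filter (fun r : ℕ => ‖Fh P X f ((r:ℝ) / p)‖ < ε * pn P X), ‖Fh P X f ((r:ℝ) / p)‖^(2*T+1) ≤ C * ε ^ ((1:ℝ)/2) * (pn P X : ℝ)^(2*T+1)) ∧
      ((((range p).filter (fun r : ℕ => ε * pn P X ≤ ‖Fh P X f ((r:ℝ) / p)‖)).card : ℝ) ≤ C * ε ^ (-(2 * (T:ℝ) + 1/2))) ∧
      (∑ n ∈ range X, uu P (Rf A X) W b n ≤ 2 * pn P X) ∧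
      (∀ θ : ℝ, ‖Fh P X (uu P (Rf A X) W b) θ - DM (pn P X) θ‖ ≤ ((w:ℝ) ^ (-((8:ℝ) / (8 * d + 1))) + ε) * pn P X) := by
  have hTd := T_ge d T hT (by omega) hm
  obtain ⟨K0, hK01, hK⟩ := kernel d hd
  obtain ⟨C2, hC2, hlev⟩ := level_abs d T hd hTd C1 hC1
  set K := K0 + T + d + 4 with hKd
  set n1 := 4 * T + 11 with hn1
  set A := n1 * K with hA
  have hA1 : 4 ≤ A := by rw [hA]; nlinarith
  set C3 : ℝ := C2 * 8 ^ ((T:ℝ) + 1/4) with hC3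
  have hC30 : 0 < C3 := by positivity
  refine ⟨A, C3 * 2^(2*T+3) + 1, hA1, by positivity, ?_⟩
  intro P W w H ε hε hε1
  obtain ⟨Cm, hCm0, hCm⟩ := hm (P.comp (X - C 1)) (by rw [natDegree_comp, natDegree_X_sub_C, mul_one, H.deg]) (1 / A) (by positivity)
  set CP : ℝ := C1 * pv P 1 * 2^(2*T*d) * Cm * 2 with hCP
  have hnn := H.nonneg
  have hpv1 : 0 ≤ pv P 1 := pv_nonneg hnn 1
  obtain ⟨N, hN⟩ := exists_nat_ge (2 + 2 / ε + pv P 1 + 2 * CP / ε ^ ((1:ℝ)/2))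
  have hCP0 : 0 ≤ CP := by positivity
  have hN2 : (2:ℝ) ≤ N := by
    have : 0 ≤ 2 / ε + pv P 1 + 2 * CP / ε ^ ((1:ℝ)/2) := by positivity
    linarith
  have hNε : 2 / ε ≤ N := by
    have : 0 ≤ 2 + pv P 1 + 2 * CP / ε ^ ((1:ℝ)/2) := by positivity
    linarith
  have hNP : pv P 1 ≤ N := by
    have : 0 ≤ 2 + 2 / ε + 2 * CP / ε ^ ((1:ℝ)/2) := by positivity
    linarith
  have hNC : 2 * CP / ε ^ ((1:ℝ)/2) ≤ N := by
    have : 0 ≤ 2 + 2 / ε + pv P 1 := by positivity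
    linarith
  refine ⟨N^A, ?_⟩
  intro X hX b p f hTp hpC hf hfu hfR
  set R := Rf A X with hR
  have hNR : N ≤ R := Rf_ge (by omega) hX
  have hNRr : (N:ℝ) ≤ R := by exact_mod_cast hNR
  have hR2 : (2:ℝ) ≤ R := by linarith
  have hR2' : 2 ≤ R := by exact_mod_cast hR2
  have hRA : R^A ≤ X := Rf_pow_le (by omega) X
  set Q := R^n1 with hQ
  have hQK : Q^K ≤ X := by rw [hQ, ← pow_mul]; exact hRA
  have hRQ : R ≤ Q := by rw [hQ]; exact Nat.le_self_pow (by omega) R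
  have hQ1 : 1 ≤ Q := by omega
  have hX1 : 1 ≤ X := le_trans (Nat.one_le_pow _ _ (by omega)) hQK
  have hXr : (1:ℝ) ≤ X := by exact_mod_cast hX1
  have hRQr : (R:ℝ) ≤ Q := by exact_mod_cast hRQ
  have hker := hK P W w H R Q X b (by omega) hRQ (by omega) (by linarith) ((Nat.pow_le_pow_right hQ1 (by omega)).trans hQK)
  obtain ⟨hk1, hk2, hk3⟩ := hker
  set M := pn P X with hM
  have hMv : pv P X = M := (pn_cast hnn X).symm
  rw [hMv] at hk1 hk2 hk3
  have hMX : (X:ℝ)^d ≤ M := by rw [← hMv]; exact pv_ge hnn H.deg (by omega) X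
  have hM1r : (1:ℝ) ≤ M := (one_le_pow₀ hXr).trans hMX
  have hM1 : 1 ≤ M := by exact_mod_cast hM1r
  have hM0 : (0:ℝ) < M := by linarith
  have hMp : M ≤ p := by nlinarith
  have hp0 : 0 < p := by omega
  have huu0 : ∀ n, 0 ≤ uu P R W b n := by
    intro n; unfold uu
    have := VV_ge_one (W := W) (show 1 ≤ R by omega)
    have := dl_nonneg hnn n
    positivity
  -- sum of uu
  have hsu : ∑ n ∈ range X, uu P R W b n ≤ 2 * M := by
    rw [GG_uu hnn] at hk1
    unfold Fh at hk1
    simp only [zero_mul, ee_zero, mul_one] at hk1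
    rw [← Complex.ofReal_sum, Complex.norm_real, Real.norm_of_nonneg (sum_nonneg fun n _ => huu0 n)] at hk1
    exact hk1
  -- level sets
  have hQr : (Q:ℝ) = (R:ℝ)^n1 := by rw [hQ]; push_cast; rfl
  have hlevel : ∀ δ : ℝ, 1 / (2 * (R:ℝ)^(2*T+3)) ≤ δ → δ ≤ 1 →
      (((range p).filter (fun r : ℕ => δ * M ≤ ‖Fh P X f ((r:ℝ) / p)‖)).card : ℝ) ≤ C3 * δ ^ (-(2 * (T:ℝ) + 1/2)) := by
    intro δ hδ hδ1
    have hδ0 : 0 < δ := lt_of_lt_of_le (by positivity) hδ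
    set S := (range p).filter (fun r : ℕ => δ * M ≤ ‖Fh P X f ((r:ℝ) / p)‖) with hS
    set y := 8 / δ^2 with hy
    have hy8 : 8 ≤ y := by rw [hy, le_div_iff₀ (by positivity)]; nlinarith
    have hyQ : y ≤ Q := by
      have h1 : y ≤ 8 / (1 / (2 * (R:ℝ)^(2*T+3)))^2 := by rw [hy]; gcongr
      have h2 : 8 / (1 / (2 * (R:ℝ)^(2*T+3)))^2 = 2^5 * (R:ℝ)^(4*T+6) := by
        have : (R:ℝ)^(4*T+6) = ((R:ℝ)^(2*T+3))^2 := by rw [← pow_mul]; congr 1; ring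
        rw [this]; field_simp; norm_num
      have h3 : (2:ℝ)^5 * (R:ℝ)^(4*T+6) ≤ R^5 * (R:ℝ)^(4*T+6) := by gcongr
      rw [hQr]
      calc y ≤ R^5 * (R:ℝ)^(4*T+6) := by rw [h2] at h1; linarith
        _ = _ := by rw [← pow_add]; congr 1; omega
    have hyM : y^(T+d+4) ≤ M := by
      calc y^(T+d+4) ≤ (Q:ℝ)^(T+d+4) := by gcongr
        _ ≤ (Q:ℝ)^K := pow_le_pow_right₀ (by exact_mod_cast hQ1) (by omega)
        _ ≤ X := by exact_mod_cast hQK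
        _ = (X:ℝ)^1 := (pow_one _).symm
        _ ≤ (X:ℝ)^d := pow_le_pow_right₀ hXr (by omega)
        _ ≤ _ := hMX
    have hd1 := dual X f (uu P R W b) hf hfu (fun n => (pn P n : ℝ)) S (fun r => (r:ℝ) / p)
    have hsum : 8 / y * M * S.card^2 ≤ 2 * ∑ r ∈ S, ∑ r' ∈ S, ‖GG P R W b X ((r:ℝ) / p - r' / p)‖ := by
      have h1 : (S.card : ℝ) * (δ * M) ≤ ∑ r ∈ S, ‖Fh P X f ((r:ℝ) / p)‖ := by
        rw [← nsmul_eq_mul, ← sum_const]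
        apply sum_le_sum; intro r hr; exact (mem_filter.1 hr).2
      have h2 : ((S.card : ℝ) * (δ * M))^2 ≤ (2 * M) * ∑ r ∈ S, ∑ r' ∈ S, ‖GG P R W b X ((r:ℝ) / p - r' / p)‖ := by
        simp_rw [GG_uu hnn]
        calc _ ≤ (∑ r ∈ S, ‖Fh P X f ((r:ℝ) / p)‖)^2 := by gcongr
          _ ≤ _ := hd1
          _ ≤ _ := by
            apply mul_le_mul_of_nonneg_right hsu
            exact sum_nonneg fun _ _ => sum_nonneg fun _ _ => norm_nonneg _
      have h3 : 8 / y = δ^2 := by rw [hy]; field_simp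
      rw [h3]
      have h4 : (M:ℝ) * (δ^2 * M * S.card^2) ≤ M * (2 * ∑ r ∈ S, ∑ r' ∈ S, ‖GG P R W b X ((r:ℝ) / p - r' / p)‖) := by
        calc _ = ((S.card : ℝ) * (δ * M))^2 := by ring
          _ ≤ _ := h2
          _ = _ := by ring
      exact le_of_mul_le_mul_left h4 hM0
    have hres := hlev M p Q y (GG P R W b X) S hM1 hMp hpC hy8 hyQ hyM (filter_subset _ _)
      (fun θ => (hk3 θ).imp id (fun ⟨q, a, h1, _, h3⟩ => ⟨q, a, h1, h3⟩)) hsum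
    refine hres.trans (le_of_eq ?_)
    rw [hy, hC3, Real.div_rpow (by norm_num) (by positivity), ← Real.rpow_natCast, ← Real.rpow_mul hδ0.le, Real.rpow_neg hδ0.le]
    rw [show ((2:ℕ):ℝ) * ((T:ℝ) + 1/4) = 2 * (T:ℝ) + 1/2 by push_cast; ring]
    ring
  have hδ1pos : 0 < 1 / (2 * (R:ℝ)^(2*T+3)) := by positivity
  have hδ1ε : 1 / (2 * (R:ℝ)^(2*T+3)) ≤ ε := by
    have h1 : 2 / ε ≤ R := hNε.trans hNRr
    rw [div_le_iff₀ hε] at h1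
    rw [div_le_iff₀ (by positivity)]
    have : (R:ℝ) ≤ (R:ℝ)^(2*T+3) := le_self_pow₀ (by linarith) (by omega)
    nlinarith
  refine ⟨?_, ?_, hsu, ?_⟩
  · -- restriction
    set v : ℕ → ℝ := fun r => ‖Fh P X f ((r:ℝ) / p)‖ / M with hv
    have hvF : ∀ r : ℕ, ‖Fh P X f ((r:ℝ) / p)‖ = v r * M := by intro r; rw [hv]; field_simp
    have hv0 : ∀ r, 0 ≤ v r := fun r => by rw [hv]; positivity
    have hdy := dyadic p T v hv0 C3 (1 / (2 * (R:ℝ)^(2*T+3))) ε hC30.le hδ1pos hδ1ε hε1 (by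
      intro δ h1 h2
      refine le_trans (le_of_eq ?_) (hlevel δ h1 h2)
      congr 3; ext r
      rw [hvF, mul_le_mul_iff_left₀ hM0])
    -- tail
    have hmo := moment p T X hp0 f (pn P) (2^d * M * R / X) hf (by
      intro n hn
      refine (hfR n hn).trans ?_
      have h1 := dl_mono hnn hn.le
      have h2 := dl_le hnn H.deg.le hX1
      rw [hMv] at h2
      rw [le_div_iff₀ (by linarith)]
      calc dl P n * R * X ≤ dl P X * R * X := by gcongr
        _ = (X * dl P X) * R := by ring
        _ ≤ _ := by gcongr) M (fun n hn => pn_mono hnn hn.le) hTp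
    have hcl := count_le T X (pn P) (P.comp (Polynomial.X - C 1)) (by
      intro n
      rw [eval_comp]
      have h1 : ((pn P n : ℕ) : ℝ) = pv P n := pn_cast hnn n
      unfold pv at h1
      have h2 : ((pn P n : ℕ) : ℤ) = P.eval (n:ℤ) := by exact_mod_cast h1
      rw [h2]; simp)
    have hcnt := (Nat.cast_le (α := ℝ).2 hcl).trans (hCm X hX1)
    have hXA : (X:ℝ) ^ ((2 * T : ℝ) - (d : ℝ) + 1 / A) ≤ (X:ℝ)^(2*T) / (X:ℝ)^d * (2 * R) := by
      rw [Real.rpow_add (by linarith), Real.rpow_sub (by linarith)]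
      have h1 : (X:ℝ) ^ ((1:ℝ) / A) ≤ 2 * R := by have := Rf_lt A X; linarith
      have h2 : (X:ℝ) ^ (2 * (T:ℝ)) = (X:ℝ)^(2*T) := by rw [← Real.rpow_natCast]; push_cast; rfl
      rw [h2, Real.rpow_natCast]
      gcongr
    have hmom : ∑ r ∈ range p, ‖Fh P X f ((r:ℝ) / p)‖^(2*T) ≤ CP * R^(2*T+1) * M^(2*T) := by
      refine hmo.trans ?_
      have h1 : (p:ℝ) ≤ C1 * (pv P 1 * (X:ℝ)^d) := hpC.trans (by
        have := pv_le hnn H.deg.le hX1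
        rw [hMv] at this; gcongr)
      calc _ ≤ (C1 * (pv P 1 * (X:ℝ)^d)) * (2^d * M * R / X)^(2*T) * (Cm * ((X:ℝ)^(2*T) / (X:ℝ)^d * (2 * R))) := by
            exact mul_le_mul (mul_le_mul_of_nonneg_right h1 (by positivity)) (hcnt.trans (mul_le_mul_of_nonneg_left hXA hCm0.le)) (Nat.cast_nonneg _) (by positivity)
        _ = _ := by
            rw [hCP, div_pow, mul_pow, mul_pow, ← pow_mul, show d * (2 * T) = 2 * T * d by ring, pow_succ (R:ℝ) (2*T)]
            field_simp
    have htail : ∑ r ∈ (range p).filter (fun r => v r < 2 * (1 / (2 * (R:ℝ)^(2*T+3)))), v r ^ (2*T+1) ≤ ε ^ ((1:ℝ)/2) := by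
      calc _ ≤ ∑ r ∈ (range p).filter (fun r => v r < 2 * (1 / (2 * (R:ℝ)^(2*T+3)))), (1 / (R:ℝ)^(2*T+3)) * v r ^ (2*T) := by
            apply sum_le_sum; intro r hr
            have h1 := (mem_filter.1 hr).2
            have h2 : v r ≤ 1 / (R:ℝ)^(2*T+3) := by
              refine h1.le.trans (le_of_eq ?_); field_simp
            have := hv0 r
            rw [pow_succ, mul_comm]; gcongr
        _ ≤ ∑ r ∈ range p, (1 / (R:ℝ)^(2*T+3)) * v r ^ (2*T) := by
            apply sum_le_sum_of_subset_of_nonneg (filter_subset _ _)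
            intro r _ _; have := hv0 r; positivity
        _ = (1 / (R:ℝ)^(2*T+3)) * ((∑ r ∈ range p, ‖Fh P X f ((r:ℝ) / p)‖^(2*T)) / M^(2*T)) := by
            rw [← mul_sum, sum_div]; congr 1; apply sum_congr rfl; intro r _; rw [hv, div_pow]
        _ ≤ (1 / (R:ℝ)^(2*T+3)) * ((CP * R^(2*T+1) * M^(2*T)) / M^(2*T)) := by gcongr
        _ = CP / R^2 := by
            rw [show (R:ℝ)^(2*T+3) = R^(2*T+1) * R^2 by rw [← pow_add]]; field_simp
        _ ≤ ε ^ ((1:ℝ)/2) := by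
            have h3 := hNC.trans hNRr
            rw [div_le_iff₀ (by positivity)] at h3 ⊢
            have : (R:ℝ) ≤ R^2 := by nlinarith
            have h4 : 0 < ε ^ ((1:ℝ)/2) := by positivity
            nlinarith
    have hfil : (range p).filter (fun r : ℕ => ‖Fh P X f ((r:ℝ) / p)‖ < ε * M) = (range p).filter (fun r => v r < ε) := by
      apply filter_congr; intro r _; rw [hvF, mul_lt_mul_iff_left₀ hM0]
    rw [hfil]
    calc _ = (∑ r ∈ (range p).filter (fun r => v r < ε), v r^(2*T+1)) * M^(2*T+1) := by
          rw [sum_mul]; apply sum_congr rfl; intro r _; rw [hvF, mul_pow]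
      _ ≤ (2 ^ (2*T+3) * C3 * ε ^ ((1:ℝ)/2) + ε ^ ((1:ℝ)/2)) * M^(2*T+1) := by gcongr; exact hdy.trans (by gcongr)
      _ = _ := by ring
  · refine (hlevel ε hδ1ε hε1).trans ?_
    have h4 : 0 ≤ ε ^ (-(2 * (T:ℝ) + 1/2)) := by positivity
    have h5 : (1:ℝ) ≤ 2^(2*T+3) := one_le_pow₀ (by norm_num)
    apply mul_le_mul_of_nonneg_right _ h4
    nlinarith
  · intro θ
    rw [← GG_uu hnn]
    refine (hk2 θ).trans ?_
    gcongr
    rw [div_le_iff₀ (by linarith)]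
    have h1 : 2 / ε ≤ Q := hNε.trans (hNRr.trans hRQr)
    rw [div_le_iff₀ hε] at h1; linarith


section dense
set_option linter.unusedSectionVars false
variable {K : Type} [Field K] [Fintype K] [DecidableEq K]

/-- number of solutions of `∑ l_i x_i = z`, `x_i ∈ A` -/
def cnt (A : Finset K) : List K → K → ℕ
  | [], z => if z = 0 then 1 else 0
  | a :: l, z => ∑ x ∈ A, cnt A l (z - a * x)

lemma cnt_perm (A : Finset K) {l l' : List K} (h : l.Perm l') : ∀ z, cnt A l z = cnt A l' z := by
  induction h with
  | nil => intro z; rfl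
  | cons a _ ih => intro z; simp only [cnt]; exact sum_congr rfl fun x _ => ih _
  | swap a b l =>
    intro z; simp only [cnt]; rw [sum_comm]
    refine sum_congr rfl fun x _ => sum_congr rfl fun y _ => ?_
    rw [sub_right_comm]
  | trans _ _ ih1 ih2 => intro z; rw [ih1, ih2]

lemma cnt_mono {A B : Finset K} (h : A ⊆ B) : ∀ (l : List K) z, cnt A l z ≤ cnt B l z
  | [], z => le_rfl
  | a :: l, z => by
    simp only [cnt]
    exact (sum_le_sum fun x _ => cnt_mono h l _).trans (sum_le_sum_of_subset h)

lemma cnt_ofFn (A : Finset K) : ∀ (s : ℕ) (a : Fin s → K) (z : K),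
    cnt A (List.ofFn a) z = ∑ x : Fin s → K, if (∀ i, x i ∈ A) ∧ ∑ i, a i * x i = z then 1 else 0 := by
  intro s
  induction s with
  | zero => intro a z; simp [cnt, eq_comm]
  | succ s ih =>
    intro a z
    rw [List.ofFn_succ]; simp only [cnt]
    rw [← (Fin.consEquiv (fun _ : Fin (s+1) => K)).sum_comp, Fintype.sum_prod_type, ← sum_filter_add_sum_filter_not univ (fun x => x ∈ A),
      sum_eq_zero (s := univ.filter (fun x => ¬ x ∈ A)), add_zero, filter_mem_eq_inter, univ_inter]
    · refine sum_congr rfl fun x hx => ?_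
      rw [ih]
      refine sum_congr rfl fun y _ => ?_
      congr 1
      rw [Fin.forall_fin_succ, Fin.sum_univ_succ]
      simp only [Fin.consEquiv_apply, Fin.cons_zero, Fin.cons_succ, eq_iff_iff, hx, true_and]
      rw [eq_sub_iff_add_eq, add_comm]
    · intro x hx
      simp only [mem_filter, mem_univ, true_and] at hx
      refine sum_eq_zero fun y _ => ?_
      rw [if_neg]
      rintro ⟨h, -⟩; exact hx (by simpa using h 0)

open SimpleGraph SimpleGraph.TripartiteFromTriangles in
lemma dense3 (δ : ℝ) (hδ : 0 < δ) : ∃ c : ℝ, 0 < c ∧ ∀ (K : Type) [Field K] [Fintype K] [DecidableEq K] (a b : K) (A : Finset K),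
    a ≠ 0 → b ≠ 0 → a + b ≠ 0 → δ * Fintype.card K ≤ #A →
    c * (Fintype.card K : ℝ)^2 ≤ #((A ×ˢ A ×ˢ A).filter (fun x : K × K × K => a * x.1 + b * x.2.1 = (a + b) * x.2.2)) := by
  refine ⟨triangleRemovalBound (δ / 9), triangleRemovalBound_pos (by positivity), ?_⟩
  intro K _ _ _ a b A ha hb hab hA
  set t : Finset (K × K × K) := (univ ×ˢ A).map ⟨fun x : K × K => (x.1, x.1 + a * x.2, x.1 + (a + b) * x.2), by
    rintro ⟨x, m⟩ ⟨x', m'⟩ h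
    simp only [Prod.mk.injEq] at h
    obtain ⟨h1, h2, h3⟩ := h
    subst h1
    have := mul_left_cancel₀ ha (add_left_cancel h2)
    rw [this]⟩ with ht
  have hmem : ∀ x y z, (x, y, z) ∈ t ↔ ∃ m ∈ A, y = x + a * m ∧ z = x + (a + b) * m := by
    intro x y z
    simp only [ht, Finset.mem_map, mem_product, mem_univ, true_and, Function.Embedding.coeFn_mk, Prod.mk.injEq, Prod.exists]
    constructor
    · rintro ⟨x', m, hm, h⟩; cases h; exact ⟨m, hm, rfl, rfl⟩
    · rintro ⟨m, hm, rfl, rfl⟩; exact ⟨x, m, hm, rfl⟩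
  haveI : ExplicitDisjoint t := by
    constructor
    · intro x y z x' h1 h2
      obtain ⟨m, _, h3, h4⟩ := (hmem _ _ _).1 h1
      obtain ⟨m', _, h5, h6⟩ := (hmem _ _ _).1 h2
      have h7 : b * m = b * m' := by linear_combination h3 - h4 + h6 - h5
      have h8 := mul_left_cancel₀ hb h7
      subst h8; linear_combination h5 - h3
    · intro x y z y' h1 h2
      obtain ⟨m, _, h3, h4⟩ := (hmem _ _ _).1 h1
      obtain ⟨m', _, h5, h6⟩ := (hmem _ _ _).1 h2
      have h7 : (a + b) * m = (a + b) * m' := by linear_combination h6 - h4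
      have h8 := mul_left_cancel₀ hab h7
      subst h8; rw [h3, h5]
    · intro x y z z' h1 h2
      obtain ⟨m, _, h3, h4⟩ := (hmem _ _ _).1 h1
      obtain ⟨m', _, h5, h6⟩ := (hmem _ _ _).1 h2
      have h7 : a * m = a * m' := by linear_combination h5 - h3
      have h8 := mul_left_cancel₀ ha h7
      subst h8; rw [h4, h6]
  have hct : #t = Fintype.card K * #A := by rw [ht, card_map, card_product, card_univ]
  have hfar : (graph t).FarFromTriangleFree (δ / 9) := by
    refine farFromTriangleFree _ ?_
    rw [hct]; push_cast
    have : (0:ℝ) ≤ Fintype.card K := by positivity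
    nlinarith
  have h1 := hfar.le_card_cliqueFinset
  set S := (A ×ˢ A ×ˢ A).filter (fun x : K × K × K => a * x.1 + b * x.2.1 = (a + b) * x.2.2) with hS
  -- map x × S onto cliques
  have h2 : (graph t).cliqueFinset 3 ⊆ ((univ : Finset K) ×ˢ S).image (fun x => toTriangle (x.1, x.1 + a * x.2.1, x.1 + (a + b) * x.2.2.2)) := by
    intro c hc
    rw [mem_cliqueFinset_iff, SimpleGraph.is3Clique_iff] at hc
    obtain ⟨x, y, z, hxy, hxz, hyz, rfl⟩ := hc
    obtain ⟨x, y, z, habc, h1, h2, h3⟩ := graph_triple hxy hxz hyz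
    obtain ⟨z', h4⟩ := Graph.in₀₁_iff.1 h1
    obtain ⟨y', h5⟩ := Graph.in₀₂_iff.1 h2
    obtain ⟨x', h6⟩ := Graph.in₁₂_iff.1 h3
    obtain ⟨m1, hm1, h7, -⟩ := (hmem _ _ _).1 h4
    obtain ⟨m3, hm3, -, h8⟩ := (hmem _ _ _).1 h5
    obtain ⟨m2, hm2, h9, h10⟩ := (hmem _ _ _).1 h6
    rw [mem_image]
    refine ⟨(x, m1, m2, m3), ?_, ?_⟩
    · simp only [mem_product, mem_univ, true_and, hS, mem_filter]
      refine ⟨⟨hm1, hm2, hm3⟩, ?_⟩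
      linear_combination h8 - h10 - h7 + h9
    · simp only [← h7, ← h8]; exact habc
  have h3 := (card_le_card h2).trans card_image_le
  rw [card_product, card_univ] at h3
  have h4 : (#((graph t).cliqueFinset 3) : ℝ) ≤ Fintype.card K * #S := by exact_mod_cast h3
  have hK : (0:ℝ) < Fintype.card K := by exact_mod_cast Fintype.card_pos
  have hb0 : 0 < triangleRemovalBound (δ / 9) := triangleRemovalBound_pos (by positivity)
  simp only [Fintype.card_sum, Nat.cast_add] at h1
  have h5 := h1.trans h4
  have h6 : triangleRemovalBound (δ/9) * (Fintype.card K:ℝ)^2 * Fintype.card K ≤ #S * Fintype.card K := by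
    have : 0 < triangleRemovalBound (δ/9) * (Fintype.card K:ℝ)^3 := by positivity
    nlinarith
  exact le_of_mul_le_mul_right h6 hK

lemma cnt2 (A : Finset K) (a b : K) (l : List K) (z : K) (m : ℕ) (D : Finset K) (hD : D ⊆ A) (hab : a + b ≠ 0)
    (h : ∀ y ∈ D, m ≤ #((A ×ˢ A).filter (fun x : K × K => a * x.1 + b * x.2 = (a + b) * y))) :
    m * cnt D ((a + b) :: l) z ≤ cnt A (a :: b :: l) z := by
  have h1 : cnt A (a :: b :: l) z = ∑ y : K, ∑ x ∈ (A ×ˢ A).filter (fun x : K × K => a * x.1 + b * x.2 = (a + b) * y), cnt A l (z - (a + b) * y) := by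
    simp only [cnt]
    rw [← sum_product (f := fun x : K × K => cnt A l (z - a * x.1 - b * x.2)), 
      ← sum_fiberwise_of_maps_to (t := (univ : Finset K)) (g := fun x : K × K => (a + b)⁻¹ * (a * x.1 + b * x.2)) (fun _ _ => mem_univ _)]
    refine sum_congr rfl fun y _ => ?_
    have : ∀ x : K × K, (a + b)⁻¹ * (a * x.1 + b * x.2) = y ↔ a * x.1 + b * x.2 = (a + b) * y := by
      intro x; rw [inv_mul_eq_iff_eq_mul₀ hab]
    simp only [this]
    refine sum_congr rfl fun x hx => ?_
    rw [mem_filter] at hx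
    congr 1; rw [← hx.2]; ring
  rw [h1]; simp only [cnt]; rw [mul_sum]
  refine (sum_le_sum fun y hy => ?_).trans (sum_le_sum_of_subset (subset_univ D))
  rw [sum_const, smul_eq_mul]
  exact Nat.mul_le_mul (h y hy) (cnt_mono hD l _)

end dense

lemma dense (n : ℕ) : ∀ δ : ℝ, 0 < δ → ∃ c : ℝ, 0 < c ∧ ∀ (K : Type) [Field K] [Fintype K] [DecidableEq K], (2:K) ≠ 0 →
    ∀ (l : List K) (A : Finset K), l.length = n + 3 → (∀ a ∈ l, a ≠ 0) → l.sum = 0 → δ * Fintype.card K ≤ #A →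
      c * (Fintype.card K : ℝ)^(n+2) ≤ cnt A l 0 := by
  induction n with
  | zero =>
    intro δ hδ
    obtain ⟨c, hc, h⟩ := dense3 δ hδ
    refine ⟨c, hc, fun K _ _ _ h2 l A hl h0 hs hA => ?_⟩
    obtain ⟨a, b, e, rfl⟩ := List.length_eq_three.1 hl
    simp only [List.sum_cons, List.sum_nil, add_zero] at hs
    have he : e = -(a + b) := by linear_combination hs
    have ha := h0 a (by simp); have hb := h0 b (by simp); have he0 := h0 e (by simp)
    refine (h K a b A ha hb (by rw [he] at he0; exact neg_ne_zero.1 he0) hA).trans (le_of_eq ?_)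
    norm_cast
    rw [card_filter, sum_product]; simp only [cnt]
    refine sum_congr rfl fun x _ => ?_
    rw [sum_product]
    refine sum_congr rfl fun y _ => sum_congr rfl fun z _ => ?_
    simp only
    congr 1
    rw [he, eq_iff_iff]
    constructor <;> intro h <;> linear_combination -h
  | succ n ih =>
    intro δ hδ
    obtain ⟨c3, hc3, h3⟩ := dense3 (δ/2) (by positivity)
    obtain ⟨c, hc, h⟩ := ih (δ/2) (by positivity)
    refine ⟨c3 / 2 * c, by positivity, fun K _ _ _ h2 l A hl h0 hs hA => ?_⟩
    have hK : (0:ℝ) < Fintype.card K := by exact_mod_cast Fintype.card_pos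
    -- find a permutation
    obtain ⟨a, b, l', hp, hab⟩ : ∃ a b l', l.Perm (a :: b :: l') ∧ a + b ≠ 0 := by
      match l, hl with
      | a :: b :: e :: l', _ =>
        by_cases h1 : a + b = 0
        · by_cases h4 : a + e = 0
          · refine ⟨b, e, a :: l', ?_, ?_⟩
            · exact (List.Perm.swap _ _ _).trans (List.Perm.cons _ (List.Perm.swap _ _ _))
            · intro h5
              have : 2 * a = 0 := by linear_combination h1 + h4 - h5
              exact (mul_ne_zero h2 (h0 a (by simp))) this
          · exact ⟨a, e, b :: l', List.Perm.cons _ (List.Perm.swap _ _ _), h4⟩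
        · exact ⟨a, b, e :: l', List.Perm.refl _, h1⟩
    have hlen : l'.length + 2 = n + 4 := by have := hp.length_eq; simp at this; omega
    have hsum : (a + b) + l'.sum = 0 := by have := hp.sum_eq; rw [hs] at this; simp at this; rw [add_assoc]; exact this.symm
    have hne : ∀ x ∈ a :: b :: l', x ≠ 0 := fun x hx => h0 x (hp.mem_iff.2 hx)
    rw [cnt_perm A hp]
    set f : K → ℕ := fun y => #((A ×ˢ A).filter (fun x : K × K => a * x.1 + b * x.2 = (a + b) * y)) with hf
    set m : ℕ := ⌈c3 / 2 * Fintype.card K⌉₊ with hm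
    set D := A.filter (fun y => m ≤ f y) with hD
    have hDc : δ / 2 * Fintype.card K ≤ #D := by
      by_contra hcon
      push Not at hcon
      set E := A.filter (fun y => ¬ m ≤ f y) with hE
      have h5 : #D + #E = #A := card_filter_add_card_filter_not _
      have h5' : (#D:ℝ) + #E = #A := by exact_mod_cast h5
      have h6 := h3 K a b E (hne a (by simp)) (hne b (by simp)) hab (by linarith)
      have h7 : #((E ×ˢ E ×ˢ E).filter (fun x : K × K × K => a * x.1 + b * x.2.1 = (a + b) * x.2.2)) ≤ ∑ y ∈ E, f y := by
        simp only [hf]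
        rw [← card_sigma]
        apply card_le_card_of_injOn (fun x => (⟨x.2.2, (x.1, x.2.1)⟩ : (_ : K) × (K × K)))
        · rintro ⟨x, y, z⟩ hx
          simp only [coe_filter, mem_product, Set.mem_ofPred_eq] at hx
          simp only [coe_sigma, Set.mem_sigma_iff, mem_coe, mem_filter, mem_product]
          exact ⟨hx.1.2.2, ⟨(mem_filter.1 hx.1.1).1, (mem_filter.1 hx.1.2.1).1⟩, hx.2⟩
        · rintro ⟨x, y, z⟩ _ ⟨x', y', z'⟩ _ h
          simp at h
          obtain ⟨rfl, rfl, rfl⟩ := h; rfl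
      have h8 : (∑ y ∈ E, f y : ℝ) ≤ ∑ y ∈ E, c3 / 2 * Fintype.card K := by
        refine sum_le_sum fun y hy => ?_
        have := (mem_filter.1 hy).2
        rw [hm, Nat.ceil_le] at this
        push Not at this; exact this.le
      rw [sum_const, nsmul_eq_mul] at h8
      have h7' : (#((E ×ˢ E ×ˢ E).filter (fun x : K × K × K => a * x.1 + b * x.2.1 = (a + b) * x.2.2)) : ℝ) ≤ ∑ y ∈ E, (f y:ℝ) := by exact_mod_cast h7
      have h9 : (#E:ℝ) ≤ Fintype.card K := by exact_mod_cast card_le_univ E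
      have h10 : (#E:ℝ) * (c3 / 2 * Fintype.card K) ≤ Fintype.card K * (c3 / 2 * Fintype.card K) := by gcongr
      have : 0 < c3 * (Fintype.card K:ℝ)^2 := by positivity
      nlinarith
    have h11 := cnt2 A a b l' 0 m D (filter_subset _ _) hab (fun y hy => (mem_filter.1 hy).2)
    have h12 := h K h2 ((a + b) :: l') D (by simp; omega) (by
      intro x hx
      rcases List.mem_cons.1 hx with rfl | hx
      · exact hab
      · exact hne x (by simp [hx])) (by simpa using hsum) hDc
    have h13 : c3 / 2 * (Fintype.card K:ℝ) ≤ m := Nat.le_ceil _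
    calc c3 / 2 * c * (Fintype.card K:ℝ)^(n+1+2) = (c3 / 2 * Fintype.card K) * (c * (Fintype.card K:ℝ)^(n+2)) := by ring
      _ ≤ m * cnt D ((a + b) :: l') 0 := mul_le_mul h13 h12 (by positivity) (by positivity)
      _ ≤ _ := by exact_mod_cast h11


section transfer
variable {p : ℕ} [hp : Fact p.Prime]

noncomputable def ps (x : ZMod p) : ℂ := ZMod.stdAddChar x

lemma ps_add (x y : ZMod p) : ps (x + y) = ps x * ps y := AddChar.map_add_eq_mul _ _ _
lemma ps_neg (x : ZMod p) : ps (-x) = (starRingEnd ℂ) (ps x) := AddChar.map_neg_eq_conj _ _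
lemma ps_norm (x : ZMod p) : ‖ps x‖ = 1 := AddChar.norm_apply _ _
lemma ps_zero : ps (0 : ZMod p) = 1 := AddChar.map_zero_eq_one _
lemma ps_sum (b : ZMod p) : ∑ r : ZMod p, ps (r * b) = if b = 0 then (p:ℂ) else 0 := by
  unfold ps
  rw [AddChar.sum_mulShift b (ZMod.isPrimitive_stdAddChar p), ZMod.card]; split_ifs <;> simp
lemma ps_int (j : ℤ) : ps (j : ZMod p) = ee ((j:ℝ) / p) := by
  unfold ps ee
  rw [ZMod.stdAddChar_coe]; congr 1; push_cast; ring
lemma ps_val (x : ZMod p) : ps x = ee ((x.val:ℝ) / p) := by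
  conv_lhs => rw [← ZMod.natCast_zmod_val x]
  have h := ps_int (p := p) (x.val : ℤ)
  simpa only [Int.cast_natCast] using h

noncomputable def ft (F : ZMod p → ℝ) (r : ZMod p) : ℂ := ∑ x, (F x : ℂ) * ps (r * x)

noncomputable def wc {s : ℕ} (F : ZMod p → ℝ) (a : Fin s → ZMod p) : ℝ :=
  ∑ x : Fin s → ZMod p, if ∑ i, a i * x i = 0 then ∏ i, F (x i) else 0

lemma ps_sum_fin {s : ℕ} (f : Fin s → ZMod p) : ps (∑ i, f i) = ∏ i, ps (f i) := by
  induction s with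
  | zero => simp [ps_zero]
  | succ n ih => rw [Fin.sum_univ_succ, Fin.prod_univ_succ, ps_add, ih]

lemma wc_fourier {s : ℕ} (F : ZMod p → ℝ) (a : Fin s → ZMod p) :
    (p:ℂ) * (wc F a : ℂ) = ∑ r : ZMod p, ∏ i, ft F (a i * r) := by
  unfold wc ft
  simp only [prod_univ_sum, Fintype.piFinset_univ]
  rw [sum_comm]; push_cast; rw [mul_sum]
  refine sum_congr rfl fun x _ => ?_
  simp only [prod_mul_distrib]
  rw [← mul_sum]
  have : ∀ r : ZMod p, ∏ i, ps (a i * r * x i) = ps (r * ∑ i, a i * x i) := by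
    intro r; rw [mul_sum, ps_sum_fin]
    refine prod_congr rfl fun i _ => ?_
    congr 1; ring
  simp only [this, ps_sum]
  split_ifs <;> push_cast <;> ring

noncomputable def gam (B : Finset (ZMod p)) (r : ZMod p) : ℝ := ‖∑ b ∈ B, ps (r * b)‖^2 / (#B:ℝ)^2

noncomputable def sm (B : Finset (ZMod p)) (F : ZMod p → ℝ) (x : ZMod p) : ℝ :=
  (∑ b ∈ B, ∑ b' ∈ B, F (x + b - b')) / (#B:ℝ)^2

lemma gam_eq (B : Finset (ZMod p)) (r : ZMod p) :
    ((gam B r : ℝ) : ℂ) = (∑ b ∈ B, ∑ b' ∈ B, ps (r * (b' - b))) / (#B:ℂ)^2 := by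
  unfold gam
  push_cast
  rw [← Complex.mul_conj', mul_comm, map_sum, sum_mul]
  congr 1
  refine sum_congr rfl fun b _ => ?_
  rw [mul_sum]
  refine sum_congr rfl fun b' _ => ?_
  rw [mul_sub, sub_eq_neg_add, ps_add, ps_neg]

lemma gam_nonneg (B : Finset (ZMod p)) (r : ZMod p) : 0 ≤ gam B r := by unfold gam; positivity

lemma gam_le (B : Finset (ZMod p)) (r : ZMod p) : gam B r ≤ 1 := by
  unfold gam
  apply div_le_one_of_le₀ _ (by positivity)
  gcongr
  refine (norm_sum_le _ _).trans ?_
  simp [ps_norm]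

lemma ft_sm (B : Finset (ZMod p)) (F : ZMod p → ℝ) (r : ZMod p) : ft (sm B F) r = gam B r * ft F r := by
  rw [gam_eq, div_mul_eq_mul_div, sum_mul]
  unfold ft sm
  push_cast
  simp only [div_mul_eq_mul_div]
  rw [← sum_div]; congr 1
  simp only [sum_mul]
  rw [sum_comm]
  refine sum_congr rfl fun b _ => ?_
  rw [sum_comm]
  refine sum_congr rfl fun b' _ => ?_
  rw [mul_sum, ← Equiv.sum_comp (Equiv.addRight (b' - b))]
  refine sum_congr rfl fun x _ => ?_
  simp only [Equiv.coe_addRight]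
  rw [show x + (b' - b) + b - b' = x by ring, mul_add, ps_add]; ring

lemma sum_gam (B : Finset (ZMod p)) (hB : B.Nonempty) : ∑ r, gam B r = p / (#B:ℝ) := by
  have hB0 : (#B:ℂ) ≠ 0 := by exact_mod_cast hB.card_pos.ne'
  have : ((∑ r, gam B r : ℝ) : ℂ) = ((p / (#B:ℝ) : ℝ) : ℂ) := by
    push_cast
    simp only [gam_eq]
    rw [← sum_div, sum_comm, div_eq_div_iff (by positivity) hB0]
    have : ∀ b ∈ B, ∑ r : ZMod p, ∑ b' ∈ B, ps (r * (b' - b)) = p := by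
      intro b hb
      rw [sum_comm]
      simp only [ps_sum, sub_eq_zero]
      rw [sum_ite_eq' B b, if_pos hb]
    rw [sum_congr rfl this]; simp; ring
  exact_mod_cast this

lemma inv_bound (G : ZMod p → ℝ) (x : ZMod p) : (p:ℝ) * |G x| ≤ ∑ r, ‖ft G r‖ := by
  have h : (p:ℂ) * (G x : ℂ) = ∑ r, ft G r * ps (-(r * x)) := by
    unfold ft
    simp only [sum_mul]
    rw [sum_comm]
    have : ∀ y : ZMod p, ∑ r : ZMod p, (G y:ℂ) * ps (r * y) * ps (-(r * x)) = if y = x then (G y:ℂ) * p else 0 := by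
      intro y
      have : ∀ r : ZMod p, (G y:ℂ) * ps (r * y) * ps (-(r * x)) = G y * ps (r * (y - x)) := by
        intro r; rw [mul_assoc, ← ps_add]; congr 2; ring
      simp only [this, ← mul_sum, ps_sum, sub_eq_zero, mul_ite, mul_zero]
    simp only [this]; rw [sum_ite_eq' univ x]; simp [mul_comm]
  have h2 := congrArg norm h
  rw [norm_mul, Complex.norm_natCast, Complex.norm_real, Real.norm_eq_abs] at h2
  rw [h2]
  refine (norm_sum_le _ _).trans (le_of_eq ?_)
  simp [ps_norm]

lemma box (Γ : Finset (ZMod p)) (N : ℕ) (hN : 0 < N) : ∃ B : Finset (ZMod p), B.Nonempty ∧ (p:ℝ) ≤ (N:ℝ)^(#Γ) * #B ∧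
    ∀ r ∈ Γ, 1 - gam B r ≤ 2 * Real.pi / N := by
  have hp0 : 0 < p := hp.out.pos
  let f : ZMod p → (Γ → Fin N) := fun b r => ⟨N * (r.1 * b).val / p, by
    rw [Nat.div_lt_iff_lt_mul hp0]; exact Nat.mul_lt_mul_of_pos_left (ZMod.val_lt _) hN⟩
  have hcard : Fintype.card (Γ → Fin N) = N^(#Γ) := by simp
  have : Nonempty (Fin N) := ⟨⟨0, hN⟩⟩
  obtain ⟨y, -, hy⟩ := exists_le_card_fiber_of_nsmul_le_card_of_maps_to (s := (univ : Finset (ZMod p))) (t := (univ : Finset (Γ → Fin N))) (f := f)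
    (b := (p:ℝ) / (N:ℝ)^(#Γ)) (fun _ _ => mem_univ _) univ_nonempty (by
      rw [card_univ, card_univ, hcard, ZMod.card, nsmul_eq_mul]; push_cast
      rw [mul_div_cancel₀]; positivity)
  set B := univ.filter (fun x => f x = y) with hB
  have hB0 : (0:ℝ) < #B := lt_of_lt_of_le (by positivity) hy
  refine ⟨B, card_pos.1 (by exact_mod_cast hB0), ?_, ?_⟩
  · rw [div_le_iff₀ (by positivity)] at hy; linarith
  intro r hr
  have key : ∀ b ∈ B, ∀ b' ∈ B, ‖1 - ps (r * (b' - b))‖ ≤ 2 * Real.pi / N := by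
    intro b hb b' hb'
    have h1 : (f b) ⟨r, hr⟩ = (f b') ⟨r, hr⟩ := by rw [(mem_filter.1 hb).2, (mem_filter.1 hb').2]
    simp only [f, Fin.mk.injEq] at h1
    have h2 : ‖ps (r * b) - ps (r * b')‖ ≤ 2 * Real.pi / N := by
      rw [ps_val, ps_val]
      refine (ee_sub_ee_le _ _).trans ?_
      rw [← sub_div, abs_div, Nat.abs_cast, ← mul_div_assoc]
      rw [div_le_div_iff₀ (by positivity) (by positivity)]
      have h3 := Nat.div_add_mod (N * (r * b).val) p
      have h4 := Nat.div_add_mod (N * (r * b').val) p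
      have h5 := Nat.mod_lt (N * (r * b).val) hp0
      have h6 := Nat.mod_lt (N * (r * b').val) hp0
      rw [h1] at h3
      have h7 : N * (r*b).val ≤ N * (r*b').val + p := by omega
      have h8 : N * (r*b').val ≤ N * (r*b).val + p := by omega
      have h7' : (N:ℝ) * (r*b).val ≤ N * (r*b').val + p := by exact_mod_cast h7
      have h8' : (N:ℝ) * (r*b').val ≤ N * (r*b).val + p := by exact_mod_cast h8
      have h9 : |((r*b).val:ℝ) - (r*b').val| * N = |(N:ℝ) * (r*b).val - N * (r*b').val| := by
        rw [← mul_sub, abs_mul, Nat.abs_cast, mul_comm]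
      have h10 : |((r*b).val:ℝ) - (r*b').val| * N ≤ p := by
        rw [h9, abs_le]; constructor <;> linarith
      have := mul_le_mul_of_nonneg_left h10 (show 0 ≤ 2 * Real.pi by positivity)
      linarith
    have h3 : 1 - ps (r * (b' - b)) = (ps (r * b) - ps (r * b')) * ps (-(r * b)) := by
      rw [sub_mul, ← ps_add, ← ps_add, add_neg_cancel, ps_zero]; congr 2; ring
    rw [h3, norm_mul, ps_norm, mul_one]; exact h2
  have h1 : ((1 - gam B r : ℝ) : ℂ) = (∑ b ∈ B, ∑ b' ∈ B, (1 - ps (r * (b' - b)))) / (#B:ℂ)^2 := by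
    push_cast
    rw [gam_eq]
    simp only [sum_sub_distrib]
    have : (#B:ℂ) ≠ 0 := by exact_mod_cast hB0.ne'
    field_simp
    simp; ring
  have h2 : ‖((1 - gam B r : ℝ) : ℂ)‖ ≤ 2 * Real.pi / N := by
    rw [h1, norm_div, norm_pow, Complex.norm_natCast, div_le_iff₀ (by positivity)]
    refine (norm_sum_le _ _).trans ?_
    refine (sum_le_sum fun b hb => (norm_sum_le _ _).trans (sum_le_sum fun b' hb' => key b hb b' hb')).trans (le_of_eq ?_)
    simp; ring
  rw [Complex.norm_real, Real.norm_eq_abs] at h2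
  exact (le_abs_self _).trans h2

end transfer

lemma one_sub_prod_le {ι : Type*} (S : Finset ι) (g : ι → ℝ) (h0 : ∀ i, 0 ≤ g i) (h1 : ∀ i, g i ≤ 1) :
    1 - ∏ i ∈ S, g i ≤ ∑ i ∈ S, (1 - g i) := by
  classical
  induction S using Finset.induction_on with
  | empty => simp
  | insert i S hi ih =>
    rw [prod_insert hi, sum_insert hi]
    have h3 : ∏ i ∈ S, g i ≤ 1 := Finset.prod_le_one (fun i _ => h0 i) (fun i _ => h1 i)
    nlinarith [h0 i, h1 i]

lemma prod_le_sum_pow {s : ℕ} (y : Fin s → ℝ) (hy : ∀ i, 0 ≤ y i) (hs : 0 < s) : ∏ i, y i ≤ ∑ i, (y i)^s := by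
  have : Nonempty (Fin s) := ⟨⟨0, hs⟩⟩
  obtain ⟨j, -, hj⟩ := exists_max_image (univ : Finset (Fin s)) y univ_nonempty
  calc ∏ i, y i ≤ ∏ i : Fin s, y j := Finset.prod_le_prod (fun i _ => hy i) (fun i _ => hj i (mem_univ _))
    _ = (y j)^s := by simp
    _ ≤ _ := single_le_sum (f := fun i => (y i)^s) (fun i _ => pow_nonneg (hy i) s) (mem_univ j)

lemma prod_le_lam {s : ℕ} (y : Fin s → ℝ) (hy : ∀ i, 0 ≤ y i) (i : Fin s) (t : ℝ) (ht : 0 < t) :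
    ∏ j, y j ≤ (y i)^s / t^(s*(s-1)) + t^s * ∑ j, (y j)^s := by
  have hs : 0 < s := i.pos
  have h := prod_le_sum_pow (fun j => if j = i then y j / t^(s-1) else t * y j) (by
    intro j; have := hy j; split_ifs <;> positivity) hs
  have h1 : ∏ j, (if j = i then y j / t^(s-1) else t * y j) = ∏ j, y j := by
    rw [← mul_prod_erase univ _ (mem_univ i), ← mul_prod_erase univ y (mem_univ i), if_pos rfl]
    have : ∀ j ∈ univ.erase i, (if j = i then y j / t^(s-1) else t * y j) = t * y j := by
      intro j hj; rw [if_neg (ne_of_mem_erase hj)]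
    rw [prod_congr rfl this, prod_mul_distrib, prod_const, card_erase_of_mem (mem_univ _), card_univ, Fintype.card_fin]
    field_simp
  rw [h1] at h
  refine h.trans ?_
  rw [← add_sum_erase univ _ (mem_univ i), if_pos rfl, div_pow, ← pow_mul, mul_comm (s-1) s, mul_sum]
  refine add_le_add le_rfl ?_
  refine (sum_le_sum fun j hj => ?_).trans (sum_le_sum_of_subset_of_nonneg (erase_subset i univ) fun j _ _ => by have := hy j; positivity)
  rw [if_neg (ne_of_mem_erase hj), mul_pow]

set_option maxHeartbeats 1000000 in
theorem transfer (s : ℕ) (hs : 3 ≤ s) (δ C : ℝ) (hδ : 0 < δ) (hC : 0 < C) : ∃ c η : ℝ, 0 < c ∧ 0 < η ∧ ∀ (ε : ℝ) (k : ℕ), ∃ κ : ℝ, 0 < κ ∧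
    ∀ (p : ℕ) [Fact p.Prime] (a : Fin s → ZMod p) (F ν : ZMod p → ℝ) (J : ZMod p → ℝ), 2 < p → (∀ i, a i ≠ 0) → ∑ i, a i = 0 →
      (∀ x, 0 ≤ F x) → (∀ x, F x ≤ ν x) → (∀ x, J x ≤ 1) → (∀ r, ‖ft ν r - ft J r‖ ≤ κ * p) →
      (∑ r, ‖ft F r‖^s ≤ C * (p:ℝ)^s) → (∑ r ∈ univ.filter (fun r => ‖ft F r‖ < ε * p), ‖ft F r‖^s ≤ η * (p:ℝ)^s) →
      (#(univ.filter (fun r => ¬ ‖ft F r‖ < ε * p)) ≤ k) → δ * p ≤ ∑ x, F x → c * (p:ℝ)^(s-1) ≤ wc F a := by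
  obtain ⟨c0, hc0, hden⟩ := dense (s - 3) (δ/4) (by positivity)
  set c1 : ℝ := (δ/2)^s * c0 with hc1
  have hc10 : 0 < c1 := by positivity
  have hs0 : (0:ℝ) < s := by exact_mod_cast (by omega : 0 < s)
  -- choose t, rho, eta
  obtain ⟨t, ht0, ht1, ht⟩ : ∃ t : ℝ, 0 < t ∧ t ≤ 1 ∧ s * (t * (s * C)) ≤ c1 / 8 := by
    refine ⟨min 1 (c1 / (8 * (s * (s * C)))), by positivity, min_le_left _ _, ?_⟩
    have := min_le_right 1 (c1 / (8 * (s * (s * C))))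
    rw [le_div_iff₀ (by positivity)] at this
    linarith
  obtain ⟨N, hN⟩ := exists_nat_gt (8 * (s * (s * C)) * (2 * Real.pi) / c1)
  have hN0 : 0 < (N:ℝ) := lt_of_le_of_lt (by positivity) hN
  refine ⟨c1/2, c1 / 8 * t^(s*(s-1)) / s, by positivity, by positivity, ?_⟩
  intro ε k
  refine ⟨1 / (N:ℝ)^k, by positivity, ?_⟩
  intro p hp a F ν J hp2 ha hsum hF0 hFν hJ hνJ hL hsmall hk hmass
  have hp0 : (0:ℝ) < p := by exact_mod_cast hp.out.pos
  set Γ := univ.filter (fun r => ¬ ‖ft F r‖ < ε * p) with hΓ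
  obtain ⟨B, hBn, hBc, hBg⟩ := box Γ N (by exact_mod_cast hN0)
  have hB0 : (0:ℝ) < #B := by exact_mod_cast hBn.card_pos
  have hN1 : (1:ℝ) ≤ N := by exact_mod_cast (show 0 < N by exact_mod_cast hN0)
  have hBc' : (p:ℝ) ≤ (N:ℝ)^k * #B := hBc.trans (by gcongr)
  set g := sm B F with hg
  have hg0 : ∀ x, 0 ≤ g x := fun x => div_nonneg (sum_nonneg fun _ _ => sum_nonneg fun _ _ => hF0 _) (by positivity)
  have hBsq : (∑ b ∈ B, ∑ b' ∈ B, (1:ℝ)) = (#B:ℝ)^2 := by simp; ring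
  have hg2 : ∀ x, g x ≤ 2 := by
    intro x
    have h1 : g x ≤ 1 + sm B (fun y => ν y - J y) x := by
      rw [hg]; unfold sm
      rw [← sub_le_iff_le_add, ← sub_div, div_le_one (by positivity), ← hBsq, ← sum_sub_distrib]
      refine sum_le_sum fun b _ => ?_
      rw [← sum_sub_distrib]
      refine sum_le_sum fun b' _ => ?_
      have := hFν (x + b - b'); have := hJ (x + b - b')
      linarith
    have h2 := inv_bound (sm B (fun y => ν y - J y)) x
    have h3 : ∑ r, ‖ft (sm B (fun y => ν y - J y)) r‖ ≤ ∑ r, 1 / (N:ℝ)^k * p * gam B r := by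
      refine sum_le_sum fun r _ => ?_
      rw [ft_sm, norm_mul, Complex.norm_real, Real.norm_of_nonneg (gam_nonneg _ _), mul_comm]
      refine mul_le_mul_of_nonneg_right ?_ (gam_nonneg _ _)
      refine le_trans (le_of_eq ?_) (hνJ r)
      congr 1
      unfold ft; rw [← sum_sub_distrib]
      refine sum_congr rfl fun y _ => ?_
      push_cast; ring
    rw [← mul_sum, sum_gam B hBn] at h3
    have h4 : 1 / (N:ℝ)^k * p * (p / #B) ≤ p := by
      rw [one_div, inv_mul_eq_div, div_mul_div_comm, div_le_iff₀ (by positivity)]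
      gcongr
    have h5 : (p:ℝ) * |sm B (fun y => ν y - J y) x| ≤ p * 1 := by linarith
    have h6 := le_of_mul_le_mul_left h5 hp0
    have := le_abs_self (sm B (fun y => ν y - J y) x)
    linarith
  have hgsum : ∑ x, g x = ∑ x, F x := by
    rw [hg]; unfold sm
    rw [← sum_div, div_eq_iff (by positivity), sum_comm, ← hBsq, mul_sum]
    refine sum_congr rfl fun b _ => ?_
    rw [sum_comm, mul_sum]
    refine sum_congr rfl fun b' _ => ?_
    rw [mul_one, ← Equiv.sum_comp (Equiv.addRight (b - b')) F]
    refine sum_congr rfl fun x _ => ?_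
    simp [add_sub_assoc]
  -- dense set
  set A := univ.filter (fun x => δ / 2 ≤ g x) with hA
  have hAc : δ / 4 * Fintype.card (ZMod p) ≤ #A := by
    rw [ZMod.card]
    have h1 : ∑ x, g x ≤ ∑ x : ZMod p, (δ / 2 + if x ∈ A then 2 else 0) := by
      refine sum_le_sum fun x _ => ?_
      split_ifs with h
      · have := hg2 x; linarith
      · have : ¬ δ / 2 ≤ g x := fun h' => h (by simp [hA, h'])
        linarith
    rw [sum_add_distrib, sum_ite_mem, univ_inter] at h1
    simp at h1
    rw [hgsum] at h1; linarith
  have h20 : (2:ZMod p) ≠ 0 := by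
    intro h
    have : ((2:ℕ) : ZMod p) = 0 := by exact_mod_cast h
    rw [ZMod.natCast_eq_zero_iff] at this
    exact absurd (Nat.le_of_dvd (by norm_num) this) (by omega)
  have hd := hden (ZMod p) h20 (List.ofFn a) A (by simp; omega) (by
    intro x hx; rw [List.mem_ofFn] at hx; obtain ⟨i, rfl⟩ := hx; exact ha i) (by rw [List.sum_ofFn]; exact hsum) hAc
  rw [cnt_ofFn, ZMod.card, show s - 3 + 2 = s - 1 by omega] at hd
  have hwg : c1 * (p:ℝ)^(s-1) ≤ wc g a := by
    rw [hc1, mul_assoc]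
    refine (mul_le_mul_of_nonneg_left hd (by positivity)).trans ?_
    unfold wc; push_cast
    rw [mul_sum]
    refine sum_le_sum fun x _ => ?_
    by_cases h1 : ∑ i, a i * x i = 0
    · rw [if_pos h1]
      split_ifs with h2
      · rw [mul_one]
        calc (δ/2)^s = ∏ i : Fin s, (δ/2) := by rw [prod_const, card_univ, Fintype.card_fin]
          _ ≤ _ := Finset.prod_le_prod (fun i _ => by positivity) (fun i _ => (mem_filter.1 (h2.1 i)).2)
      · rw [mul_zero]; exact prod_nonneg fun i _ => hg0 _
    · rw [if_neg h1, if_neg (fun h => h1 h.2)]; simp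
  -- difference
  have hdiff : (p:ℝ) * (wc g a - wc F a) ≤ ∑ i : Fin s, ∑ r : ZMod p, (1 - gam B (a i * r)) * ∏ j, ‖ft F (a j * r)‖ := by
    have h1 : (p:ℂ) * ((wc g a - wc F a : ℝ) : ℂ) = ∑ r : ZMod p, ((∏ i, gam B (a i * r) - 1 : ℝ) : ℂ) * ∏ j, ft F (a j * r) := by
      push_cast
      rw [mul_sub, wc_fourier, wc_fourier, ← sum_sub_distrib]
      refine sum_congr rfl fun r _ => ?_
      simp only [hg, ft_sm, prod_mul_distrib]; ring
    have h2 := congrArg norm h1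
    rw [norm_mul, Complex.norm_natCast, Complex.norm_real, Real.norm_eq_abs] at h2
    calc (p:ℝ) * (wc g a - wc F a) ≤ p * |wc g a - wc F a| := by gcongr; exact le_abs_self _
      _ ≤ ∑ r : ZMod p, ∑ i : Fin s, (1 - gam B (a i * r)) * ∏ j, ‖ft F (a j * r)‖ := by
          rw [h2]
          refine (norm_sum_le _ _).trans (sum_le_sum fun r _ => ?_)
          rw [norm_mul, norm_prod, Complex.norm_real, Real.norm_eq_abs, ← sum_mul]
          refine mul_le_mul_of_nonneg_right ?_ (by positivity)
          have h3 : ∏ i, gam B (a i * r) ≤ 1 := Finset.prod_le_one (fun i _ => gam_nonneg _ _) (fun i _ => gam_le _ _)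
          rw [abs_of_nonpos (by linarith)]
          have := one_sub_prod_le univ (fun i => gam B (a i * r)) (fun i => gam_nonneg _ _) (fun i => gam_le _ _)
          linarith
      _ = _ := sum_comm
  have hmulsum : ∀ (i : Fin s) (f : ZMod p → ℝ), ∑ r, f (a i * r) = ∑ r, f r := fun i f =>
    Equiv.sum_comp (Equiv.mulLeft₀ (a i) (ha i)) f
  have hallsum : ∑ r : ZMod p, ∑ j, ‖ft F (a j * r)‖^s ≤ s * C * (p:ℝ)^s := by
    rw [sum_comm]
    calc ∑ j : Fin s, ∑ r : ZMod p, ‖ft F (a j * r)‖^s ≤ ∑ j : Fin s, C * (p:ℝ)^s := by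
          refine sum_le_sum fun j _ => ?_
          rw [hmulsum j (fun r => ‖ft F r‖^s)]; exact hL
      _ = _ := by simp; ring
  have hi : ∀ i : Fin s, ∑ r : ZMod p, (1 - gam B (a i * r)) * ∏ j, ‖ft F (a j * r)‖ ≤ (c1 / (2 * s)) * (p:ℝ)^s := by
    intro i
    set θ := 2 * Real.pi / N with hθ
    have h1 : ∀ r : ZMod p, (1 - gam B (a i * r)) * ∏ j, ‖ft F (a j * r)‖ ≤ (θ + t) * ∑ j, ‖ft F (a j * r)‖^s +
        (if ‖ft F (a i * r)‖ < ε * p then ‖ft F (a i * r)‖^s else 0) / t^(s*(s-1)) := by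
      intro r
      have hS : 0 ≤ ∑ j, ‖ft F (a j * r)‖^s := by positivity
      have hpr : 0 ≤ ∏ j, ‖ft F (a j * r)‖ := by positivity
      have hθ0 : 0 ≤ θ := by positivity
      split_ifs with h
      · have h3 := prod_le_lam (fun j => ‖ft F (a j * r)‖) (fun j => norm_nonneg _) i t ht0
        have h4 : t^s ≤ t := pow_le_of_le_one ht0.le ht1 (by omega)
        have h5 : t^s * ∑ j, ‖ft F (a j * r)‖^s ≤ t * ∑ j, ‖ft F (a j * r)‖^s := by gcongr
        have h6 : (1 - gam B (a i * r)) * ∏ j, ‖ft F (a j * r)‖ ≤ 1 * ∏ j, ‖ft F (a j * r)‖ := by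
          gcongr; have := gam_nonneg B (a i * r); linarith
        have : 0 ≤ θ * ∑ j, ‖ft F (a j * r)‖^s := by positivity
        linarith
      · have h3 := hBg (a i * r) (by simp only [hΓ, mem_filter, mem_univ, true_and]; exact h)
        have h4 := prod_le_sum_pow (fun j => ‖ft F (a j * r)‖) (fun j => norm_nonneg _) (by omega : 0 < s)
        have h5 : (1 - gam B (a i * r)) * ∏ j, ‖ft F (a j * r)‖ ≤ θ * ∑ j, ‖ft F (a j * r)‖^s :=
          mul_le_mul h3 h4 hpr hθ0
        have : 0 ≤ t * ∑ j, ‖ft F (a j * r)‖^s := by positivity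
        rw [zero_div]; linarith
    refine (sum_le_sum fun r _ => h1 r).trans ?_
    rw [sum_add_distrib, ← mul_sum, ← sum_div, hmulsum i (fun r => if ‖ft F r‖ < ε * p then ‖ft F r‖^s else 0), ← sum_filter]
    have h2 : (∑ r ∈ univ.filter (fun r => ‖ft F r‖ < ε * p), ‖ft F r‖^s) / t^(s*(s-1)) ≤ c1 / (8 * s) * (p:ℝ)^s := by
      rw [div_le_iff₀ (by positivity)]
      refine hsmall.trans (le_of_eq ?_)
      field_simp
    have h3 : (θ + t) * ∑ r : ZMod p, ∑ j, ‖ft F (a j * r)‖^s ≤ (θ + t) * (s * C * (p:ℝ)^s) := by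
      gcongr
    have h4 : t * (s * C) ≤ c1 / (8 * s) := by
      rw [le_div_iff₀ (by positivity)]; linarith
    have h5 : θ * (s * C) ≤ c1 / (8 * s) := by
      rw [le_div_iff₀ (by positivity), hθ]
      rw [div_lt_iff₀ hc10] at hN
      rw [div_mul_eq_mul_div, div_mul_eq_mul_div, div_le_iff₀ hN0]
      linarith
    have hps : 0 < (p:ℝ)^s := by positivity
    have h6 : c1 / (2 * s) = 4 * (c1 / (8 * s)) := by field_simp; norm_num
    have h7 : 0 < c1 / (8 * s) := by positivity
    rw [h6]
    nlinarith
  have hfin : (p:ℝ) * (wc g a - wc F a) ≤ p * (c1 / 2 * (p:ℝ)^(s-1)) := by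
    refine (hdiff.trans (sum_le_sum fun i _ => hi i)).trans (le_of_eq ?_)
    rw [sum_const, card_univ, Fintype.card_fin, nsmul_eq_mul]
    obtain ⟨m, rfl⟩ : ∃ m, s = m + 1 := ⟨s - 1, by omega⟩
    rw [Nat.add_sub_cancel, pow_succ]; field_simp
  have := le_of_mul_le_mul_left hfin hp0
  linarith


lemma sum_zmod {p : ℕ} [hp : Fact p.Prime] (φ : ℕ → ℝ) : ∑ r : ZMod p, φ r.val = ∑ r ∈ range p, φ r := by
  refine sum_bij (fun r _ => r.val) (fun r _ => mem_range.2 (ZMod.val_lt r)) (fun r _ r' _ h => ZMod.val_injective p h) ?_ (fun _ _ => rfl)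
  intro b hb; exact ⟨(b : ZMod p), mem_univ _, ZMod.val_natCast_of_lt (mem_range.1 hb)⟩

def pushf (p X : ℕ) (m : ℕ → ℕ) (f : ℕ → ℝ) (x : ZMod p) : ℝ := ∑ n ∈ range X, if (m n : ZMod p) = x then f n else 0

lemma sum_pushf (p X : ℕ) [hp : Fact p.Prime] (m : ℕ → ℕ) (f : ℕ → ℝ) : ∑ x, pushf p X m f x = ∑ n ∈ range X, f n := by
  unfold pushf; rw [sum_comm]; simp

lemma ft_pushf (p X : ℕ) [hp : Fact p.Prime] (m : ℕ → ℕ) (f : ℕ → ℝ) (r : ZMod p) :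
    ft (pushf p X m f) r = ∑ n ∈ range X, (f n : ℂ) * ee ((r.val : ℝ) / p * m n) := by
  unfold ft pushf
  simp only [Complex.ofReal_sum, sum_mul]
  rw [sum_comm]
  refine sum_congr rfl fun n _ => ?_
  have : ∀ x : ZMod p, (((if (m n : ZMod p) = x then f n else 0 : ℝ)) : ℂ) * ps (r * x) = if (m n : ZMod p) = x then (f n : ℂ) * ps (r * x) else 0 := by
    intro x; split_ifs <;> simp
  simp only [this]
  rw [sum_ite_eq univ, if_pos (mem_univ _)]
  congr 1
  have h := ps_int (p := p) ((r.val * m n : ℕ) : ℤ)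
  push_cast at h
  rw [ZMod.natCast_zmod_val] at h
  rw [h]; congr 1; ring

lemma pushf_le {p X : ℕ} {m : ℕ → ℕ} {f : ℕ → ℝ} {c : ℝ} (hc : 0 ≤ c) (hm : ∀ n < X, m n < p) (hinj : ∀ n < X, ∀ n' < X, m n = m n' → n = n')
    (hf : ∀ n < X, f n ≤ c) (x : ZMod p) : pushf p X m f x ≤ c := by
  unfold pushf
  by_cases h : ∃ n < X, (m n : ZMod p) = x
  · obtain ⟨n, hn, rfl⟩ := h
    rw [sum_eq_single_of_mem n (mem_range.2 hn)]
    · simpa using hf n hn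
    · intro n' hn' hne
      rw [if_neg]
      intro h
      rw [ZMod.natCast_eq_natCast_iff, Nat.ModEq, Nat.mod_eq_of_lt (hm n hn), Nat.mod_eq_of_lt (hm n' (mem_range.1 hn'))] at h
      exact hne (hinj _ (mem_range.1 hn') _ hn h)
  · rw [sum_eq_zero]
    · exact hc
    · intro n hn; rw [if_neg]; intro h'; exact h ⟨n, mem_range.1 hn, h'⟩

lemma pow_sum_small {ι : Type*} (S : Finset ι) (y : ι → ℝ) (hy : ∀ i, 0 ≤ y i) (m s : ℕ) (hms : m ≤ s) (B K : ℝ) (hB : 0 ≤ B) (hb : ∀ i ∈ S, y i ≤ B)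
    (h : ∑ i ∈ S, (y i)^m ≤ K * B^m) : ∑ i ∈ S, (y i)^s ≤ K * B^s := by
  calc ∑ i ∈ S, (y i)^s ≤ ∑ i ∈ S, (y i)^m * B^(s-m) := by
        refine sum_le_sum fun i hi => ?_
        have := hy i
        calc (y i)^s = (y i)^m * (y i)^(s-m) := by rw [← pow_add]; congr 1; omega
          _ ≤ _ := by gcongr; exact hb i hi
    _ = (∑ i ∈ S, (y i)^m) * B^(s-m) := by rw [sum_mul]
    _ ≤ K * B^m * B^(s-m) := by gcongr
    _ = K * B^s := by rw [mul_assoc, ← pow_add]; congr 2; omega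

set_option maxHeartbeats 1000000 in
theorem main_count (d T : ℕ) (hd : 2 ≤ d) (hT : 0 < T) (hm : DMP d T) (s : ℕ) (hs : 2 * T + 1 ≤ s)
    (a : Fin s → ℤ) (ha : ∀ i, a i ≠ 0) (hsum : ∑ i, a i = 0) : ∃ A : ℕ, 4 ≤ A ∧ ∀ δ : ℝ, 0 < δ →
    ∃ w0 : ℕ, ∀ (P : ℤ[X]) (W w b : ℕ), Hyp d P W w → w0 ≤ w → ∃ X0 : ℕ, ∀ X, X0 ≤ X → ∀ f : ℕ → ℝ, (∀ n, 0 ≤ f n) →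
      (∀ n < X, f n ≤ uu P (Rf A X) W b n) → (∀ n < X, f n ≤ dl P n * Rf A X) → δ * pn P X ≤ ∑ n ∈ range X, f n →
      ∃ n : Fin s → ℕ, (∀ i, n i < X ∧ 0 < f (n i)) ∧ (∃ i j, n i ≠ n j) ∧ ∑ i, a i * (pn P (n i) : ℤ) = 0 := by
  set S : ℕ := ∑ i, (a i).natAbs with hS
  set C1 : ℝ := 2 * (S + T + 1 : ℕ) with hC1
  have hC11 : 1 ≤ C1 := by rw [hC1]; push_cast; nlinarith [Nat.cast_nonneg (α := ℝ) S, Nat.cast_nonneg (α := ℝ) T]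
  obtain ⟨A, C, hA, hC, hres⟩ := restriction d T hd hT hm C1 hC11
  have hTd := T_ge d T hT (by omega) hm
  refine ⟨A, hA, ?_⟩
  intro δ hδ
  obtain ⟨c, η, hc, hη, htr⟩ := transfer s (by omega) (δ / C1) (C + C * 2^s) (by positivity) (by positivity)
  set ε : ℝ := min 1 ((η / C)^2) with hε
  have hε0 : 0 < ε := by positivity
  have hε1 : ε ≤ 1 := min_le_left _ _
  have hεη : C * ε ^ ((1:ℝ)/2) ≤ η := by
    have : ε ^ ((1:ℝ)/2) ≤ η / C := by
      rw [← Real.sqrt_eq_rpow, Real.sqrt_le_left (by positivity)]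
      exact min_le_right _ _
    rw [le_div_iff₀ hC] at this; linarith
  set εt := ε / C1 with hεt
  have hεt0 : 0 < εt := by positivity
  have hεt1 : εt ≤ 1 := div_le_one_of_le₀ (by linarith) (by positivity)
  set k : ℕ := ⌈C * εt ^ (-(2 * (T:ℝ) + 1/2))⌉₊ with hk
  obtain ⟨κ, hκ, htr⟩ := htr εt k
  set ε4 := min 1 (κ / 2) with hε4
  have hε40 : 0 < ε4 := by positivity
  have hlim : Tendsto (fun w : ℕ => (w:ℝ) ^ (-((8:ℝ) / (8 * d + 1)))) atTop (nhds 0) :=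
    (tendsto_rpow_neg_atTop (by positivity)).comp tendsto_natCast_atTop_atTop
  obtain ⟨w0, hw0⟩ := eventually_atTop.1 (hlim.eventually (gt_mem_nhds (show 0 < κ / 2 by positivity)))
  refine ⟨w0, ?_⟩
  intro P W w b H hw
  obtain ⟨X1, h1⟩ := hres P W w H 1 one_pos le_rfl
  obtain ⟨X2, h2⟩ := hres P W w H ε hε0 hε1
  obtain ⟨X3, h3⟩ := hres P W w H εt hεt0 hεt1
  obtain ⟨X4, h4⟩ := hres P W w H ε4 hε40 (min_le_left _ _)
  have hnn := H.nonneg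
  have hpv1 : 0 ≤ pv P 1 := pv_nonneg hnn 1
  obtain ⟨N, hN⟩ := exists_nat_gt (2 * (2^d)^(s-1) * pv P 1 / c + 1)
  have hN1 : (1:ℝ) < N := lt_of_le_of_lt (by have : 0 ≤ 2 * (2^d)^(s-1) * pv P 1 / c := by positivity
                                             linarith) hN
  refine ⟨X1 + X2 + X3 + X4 + N^A + 3, ?_⟩
  intro X hX f hf0 hfu hfd hmass
  have hX1 : 1 ≤ X := by omega
  set M := pn P X with hM
  have hMpv : (M:ℝ) = pv P X := pn_cast hnn X
  have hMX : (X:ℝ)^d ≤ M := by rw [hMpv]; exact pv_ge hnn H.deg (by omega) X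
  have hX3 : (3:ℝ) ≤ X := by exact_mod_cast (by omega : 3 ≤ X)
  have hM3 : (3:ℝ) ≤ M := by
    refine le_trans ?_ hMX
    calc (3:ℝ) ≤ X := hX3
      _ = (X:ℝ)^1 := by ring
      _ ≤ (X:ℝ)^d := pow_le_pow_right₀ (by linarith) (by omega)
  have hM0 : 0 < M := by
    have : (0:ℝ) < M := by linarith
    exact_mod_cast this
  obtain ⟨p, hp, hpl, hpu⟩ := Nat.exists_prime_lt_and_le_two_mul ((S + T + 1) * M) (by positivity)
  have hpf : Fact p.Prime := ⟨hp⟩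
  have hpu' : (p:ℝ) ≤ C1 * M := by rw [hC1, mul_assoc]; exact_mod_cast hpu
  have hTp : T * M < p := lt_of_le_of_lt (Nat.mul_le_mul_right _ (by omega)) hpl
  have hSp : S * M < p := lt_of_le_of_lt (Nat.mul_le_mul_right _ (by omega)) hpl
  have hMp : M < p := lt_of_le_of_lt (by nlinarith) hpl
  have hMp' : (M:ℝ) ≤ p := by exact_mod_cast hMp.le
  have hp0 : (0:ℝ) < p := by exact_mod_cast hp.pos
  have h1 := h1 X (by omega) b p f hTp hpu' hf0 hfu hfd
  have h2 := h2 X (by omega) b p f hTp hpu' hf0 hfu hfd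
  have h3 := h3 X (by omega) b p f hTp hpu' hf0 hfu hfd
  have h4 := h4 X (by omega) b p f hTp hpu' hf0 hfu hfd
  -- strict monotonicity
  have hmono : StrictMono (pn P) := by
    apply strictMono_nat_of_lt_succ
    intro n
    have e1 : dl P 0 ≤ dl P n := dl_mono hnn (Nat.zero_le n)
    have e2 : 1 ≤ dl P 0 := by
      unfold dl
      rw [pv_zero H.c0, sub_zero, zero_add]
      have := pv_ge hnn H.deg (by omega) 1; simpa using this
    unfold dl at e1 e2
    have : (pn P n : ℝ) < pn P (n+1) := by rw [pn_cast hnn, pn_cast hnn]; unfold dl at *; linarith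
    exact_mod_cast this
  set F := pushf p X (pn P) f with hF
  set ν := pushf p X (pn P) (uu P (Rf A X) W b) with hν
  set J := pushf p M id (fun _ => 1) with hJ
  have hftF : ∀ r : ZMod p, ft F r = Fh P X f ((r.val:ℝ) / p) := fun r => ft_pushf p X (pn P) f r
  have hftν : ∀ r : ZMod p, ft ν r = Fh P X (uu P (Rf A X) W b) ((r.val:ℝ) / p) := fun r => ft_pushf p X (pn P) _ r
  have hftJ : ∀ r : ZMod p, ft J r = DM M ((r.val:ℝ) / p) := by
    intro r; rw [hJ, ft_pushf]; simp [DM]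
  have hF0 : ∀ x, 0 ≤ F x := fun x => sum_nonneg fun n _ => by split_ifs <;> simp [hf0 n]
  set Z : ℕ → ℝ := fun r => ‖Fh P X f ((r:ℝ) / p)‖ with hZ
  have hZ0 : ∀ r, 0 ≤ Z r := fun r => norm_nonneg _
  have hFsum : ∑ n ∈ range X, f n ≤ 2 * M := (sum_le_sum fun n hn => hfu n (mem_range.1 hn)).trans h1.2.2.1
  have hZ2 : ∀ r, Z r ≤ 2 * M := by
    intro r
    refine le_trans ?_ hFsum
    refine (norm_sum_le _ _).trans (sum_le_sum fun n _ => ?_)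
    rw [norm_mul, ee_norm, mul_one, Complex.norm_real, Real.norm_of_nonneg (hf0 n)]
  have hL : ∑ r, ‖ft F r‖^s ≤ (C + C * 2^s) * (p:ℝ)^s := by
    simp only [hftF]
    rw [sum_zmod (fun r : ℕ => ‖Fh P X f ((r:ℝ) / p)‖^s), ← sum_filter_add_sum_filter_not (range p) (fun r : ℕ => ‖Fh P X f ((r:ℝ) / p)‖ < 1 * M), add_mul]
    have e1 := pow_sum_small _ Z hZ0 (2*T+1) s hs M (C * 1 ^ ((1:ℝ)/2)) (by positivity) (fun r hr => by
      have := (mem_filter.1 hr).2; rw [one_mul] at this; exact this.le) h1.1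
    rw [Real.one_rpow, mul_one] at e1
    refine add_le_add (e1.trans (by gcongr)) ?_
    have e2 := h1.2.1
    rw [Real.one_rpow, mul_one] at e2
    calc ∑ r ∈ (range p).filter (fun r : ℕ => ¬ ‖Fh P X f ((r:ℝ) / p)‖ < 1 * M), ‖Fh P X f ((r:ℝ) / p)‖^s
        ≤ ∑ r ∈ (range p).filter (fun r : ℕ => ¬ ‖Fh P X f ((r:ℝ) / p)‖ < 1 * M), (2 * (p:ℝ))^s := by
          refine sum_le_sum fun r _ => ?_
          have := hZ2 r
          gcongr
          exact this.trans (by gcongr)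
      _ = #((range p).filter (fun r : ℕ => 1 * M ≤ ‖Fh P X f ((r:ℝ) / p)‖)) * (2 * (p:ℝ))^s := by
          simp only [not_lt, sum_const, nsmul_eq_mul]
      _ ≤ C * (2 * (p:ℝ))^s := by gcongr
      _ = _ := by rw [mul_pow]; ring
  have hsmall : ∑ r ∈ univ.filter (fun r => ‖ft F r‖ < εt * p), ‖ft F r‖^s ≤ η * (p:ℝ)^s := by
    have e1 := pow_sum_small _ Z hZ0 (2*T+1) s hs M (C * ε ^ ((1:ℝ)/2)) (by positivity) (fun r hr => by
      have := (mem_filter.1 hr).2; refine this.le.trans ?_; exact mul_le_of_le_one_left (by positivity) hε1) h2.1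
    calc _ = ∑ r ∈ range p, (if ‖Fh P X f ((r:ℝ) / p)‖ < εt * p then ‖Fh P X f ((r:ℝ) / p)‖^s else 0) := by
          rw [sum_filter]; simp only [hftF]
          rw [sum_zmod (fun r : ℕ => if ‖Fh P X f ((r:ℝ) / p)‖ < εt * p then ‖Fh P X f ((r:ℝ) / p)‖^s else 0)]
      _ ≤ ∑ r ∈ (range p).filter (fun r : ℕ => ‖Fh P X f ((r:ℝ) / p)‖ < ε * M), Z r ^ s := by
          rw [sum_filter]
          refine sum_le_sum fun r _ => ?_
          have e3 : εt * p ≤ ε * M := by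
            rw [hεt, div_mul_eq_mul_div, div_le_iff₀ (by positivity)]
            calc ε * p ≤ ε * (C1 * M) := by gcongr
              _ = _ := by ring
          split_ifs with e4 e5 e5
          · exact le_rfl
          · exact absurd (lt_of_lt_of_le e4 e3) e5
          · exact pow_nonneg (hZ0 r) s
          · exact le_rfl
      _ ≤ C * ε ^ ((1:ℝ)/2) * (M:ℝ)^s := e1
      _ ≤ _ := by gcongr
  have hkc : #(univ.filter (fun r => ¬ ‖ft F r‖ < εt * p)) ≤ k := by
    have e1 : (#(univ.filter (fun r => ¬ ‖ft F r‖ < εt * p)) : ℝ) ≤ C * εt ^ (-(2 * (T:ℝ) + 1/2)) := by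
      refine le_trans ?_ h3.2.1
      rw [card_filter, card_filter]; push_cast
      simp only [hftF]
      rw [sum_zmod (fun r : ℕ => if ¬ ‖Fh P X f ((r:ℝ) / p)‖ < εt * p then (1:ℝ) else 0)]
      refine sum_le_sum fun r _ => ?_
      split_ifs with e4 e5 e5
      · norm_num
      · norm_num
      · norm_num
      · exact absurd (le_trans (mul_le_mul_of_nonneg_left hMp' hεt0.le) (not_lt.1 e4)) e5
    rw [hk, ← Nat.cast_le (α := ℝ)]
    exact e1.trans (Nat.le_ceil _)
  have hwc := htr p (fun i => (a i : ZMod p)) F ν J (by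
      have : (3:ℝ) ≤ p := hM3.trans hMp'
      have : 3 ≤ p := by exact_mod_cast this
      omega) (by
      intro i h
      rw [ZMod.intCast_zmod_eq_zero_iff_dvd] at h
      have e1 := Int.le_of_dvd (by simpa using ha i) ((dvd_abs _ _).2 h)
      have e2 : (a i).natAbs ≤ S := single_le_sum (f := fun i => (a i).natAbs) (fun _ _ => Nat.zero_le _) (mem_univ i)
      have e3 : S ≤ S * M := Nat.le_mul_of_pos_right _ hM0
      rw [Int.abs_eq_natAbs] at e1
      have : p ≤ (a i).natAbs := by exact_mod_cast e1
      omega) (by exact_mod_cast congrArg (Int.cast : ℤ → ZMod p) hsum) hF0 (by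
      intro x
      refine sum_le_sum fun n hn => ?_
      split_ifs
      · exact hfu n (mem_range.1 hn)
      · exact le_rfl) (fun x => pushf_le zero_le_one (fun n hn => lt_trans hn hMp) (fun n _ n' _ h => h) (fun _ _ => le_rfl) x) (by
      intro r
      rw [hftν, hftJ]
      refine (h4.2.2.2 _).trans ?_
      have e1 := hw0 w hw
      have e2 : ε4 ≤ κ / 2 := min_le_right _ _
      exact mul_le_mul (by linarith) hMp' (by positivity) hκ.le) hL hsmall hkc (by
      rw [hF, sum_pushf]
      refine le_trans ?_ hmass
      rw [div_mul_eq_mul_div, div_le_iff₀ (by positivity)]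
      calc δ * p ≤ δ * (C1 * M) := by gcongr
        _ = _ := by ring)
  -- contradiction if no nontrivial solution
  by_contra hcon
  have hconst : ∀ n : Fin s → ℕ, (∀ i, n i < X ∧ 0 < f (n i)) → ∑ i, a i * (pn P (n i) : ℤ) = 0 → ∀ i j, n i = n j := by
    intro n hn h0 i j
    by_contra hij
    exact hcon ⟨n, hn, ⟨i, j, hij⟩, h0⟩
  have hi0 : Fin s := ⟨0, by omega⟩
  set R := Rf A X with hR
  have hRA : R^A ≤ X := Rf_pow_le (by omega) X
  have hRN : N ≤ R := Rf_ge (by omega) (by omega)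
  have hRr : (1:ℝ) ≤ R := hN1.le.trans (by exact_mod_cast hRN)
  have hR4 : (R:ℝ)^4 ≤ X := by
    have : R^4 ≤ X := (Nat.pow_le_pow_right (by exact_mod_cast hRr) hA).trans hRA
    exact_mod_cast this
  have hFmax : ∀ x, F x ≤ 2^d * M / X * R := by
    intro x
    refine pushf_le (by positivity) (fun n hn => lt_of_lt_of_le (hmono hn) hMp.le) (fun n _ n' _ h => hmono.injective h) (fun n hn => ?_) x
    refine (hfd n hn).trans ?_
    refine mul_le_mul_of_nonneg_right ?_ (by positivity)
    rw [le_div_iff₀ (by positivity)]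
    calc dl P n * X ≤ dl P X * X := by gcongr; exact dl_mono hnn hn.le
      _ = X * dl P X := mul_comm _ _
      _ ≤ _ := by rw [hMpv]; exact dl_le hnn H.deg.le hX1
  have hwc2 : wc F (fun i => (a i : ZMod p)) ≤ ∑ x, (F x)^s := by
    unfold wc
    calc _ ≤ ∑ x : Fin s → ZMod p, ∑ y : ZMod p, if x = (fun _ => y) then (F y)^s else 0 := by
          refine sum_le_sum fun x _ => ?_
          have hnn0 : 0 ≤ ∑ y : ZMod p, if x = (fun _ => y) then (F y)^s else 0 :=
            sum_nonneg fun y _ => by split_ifs; exacts [pow_nonneg (hF0 y) s, le_rfl]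
          split_ifs with e0
          swap; · exact hnn0
          by_cases e1 : ∃ i, F (x i) = 0
          · obtain ⟨i, hi⟩ := e1
            rw [prod_eq_zero (mem_univ i) hi]; exact hnn0
          push Not at e1
          have e2 : ∀ i, ∃ n, n < X ∧ 0 < f n ∧ (pn P n : ZMod p) = x i := by
            intro i
            obtain ⟨n, hn, hne⟩ := exists_ne_zero_of_sum_ne_zero (e1 i)
            have : (pn P n : ZMod p) = x i := by by_contra h; exact hne (if_neg h)
            rw [if_pos this] at hne
            exact ⟨n, mem_range.1 hn, lt_of_le_of_ne (hf0 n) hne.symm, this⟩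
          choose n hn1 hn2 hn3 using e2
          have e3 : ∑ i, a i * (pn P (n i) : ℤ) = 0 := by
            have e4 : ((∑ i, a i * (pn P (n i) : ℤ) : ℤ) : ZMod p) = 0 := by
              push_cast; simp only [hn3]; exact e0
            rw [ZMod.intCast_zmod_eq_zero_iff_dvd] at e4
            refine Int.eq_zero_of_abs_lt_dvd e4 ?_
            calc |∑ i, a i * (pn P (n i) : ℤ)| ≤ ∑ i, |a i * (pn P (n i) : ℤ)| := abs_sum_le_sum_abs _ _
              _ ≤ ∑ i, ((a i).natAbs : ℤ) * M := by
                  refine sum_le_sum fun i _ => ?_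
                  rw [abs_mul, Int.abs_eq_natAbs, Nat.abs_cast]
                  gcongr
                  exact (hmono (hn1 i)).le
              _ = ((S * M : ℕ) : ℤ) := by rw [← sum_mul, hS]; push_cast; rfl
              _ < p := by exact_mod_cast hSp
          have e5 := hconst n (fun i => ⟨hn1 i, hn2 i⟩) e3
          have e6 : x = fun _ => x hi0 := by
            funext i; rw [← hn3 i, e5 i hi0, hn3 hi0]
          refine le_trans (le_of_eq ?_) (single_le_sum (f := fun y => if x = (fun _ => y) then (F y)^s else 0) (fun y _ => by
            split_ifs; exacts [pow_nonneg (hF0 y) s, le_rfl]) (mem_univ (x hi0)))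
          rw [if_pos e6]
          have : ∀ i, x i = x hi0 := fun i => congrFun e6 i
          simp only [this]; simp
      _ = _ := by
          rw [sum_comm]
          refine sum_congr rfl fun y _ => ?_
          rw [sum_ite_eq' univ, if_pos (mem_univ _)]
  have hpow : ∑ x, (F x)^s ≤ (2^d * M / X * R)^(s-1) * (2 * M) := by
    calc ∑ x, (F x)^s ≤ ∑ x, (2^d * M / X * R)^(s-1) * F x := by
          refine sum_le_sum fun x _ => ?_
          have := hF0 x
          calc (F x)^s = (F x)^(s-1) * F x := by rw [← pow_succ]; congr 1; omega
            _ ≤ _ := by gcongr; exact hFmax x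
      _ = (2^d * M / X * R)^(s-1) * ∑ x, F x := by rw [mul_sum]
      _ ≤ _ := by rw [hF, sum_pushf]; gcongr
  have hX0 : (0:ℝ) < X := by linarith
  have hRX : (R:ℝ) / X ≤ 1 := div_le_one_of_le₀ (by nlinarith [pow_le_pow_right₀ hRr (by norm_num : 1 ≤ 4)]) hX0.le
  have hkey : (M:ℝ) * ((R:ℝ)/X)^(s-1) ≤ pv P 1 / N := by
    have e1 : (M:ℝ) ≤ pv P 1 * (X:ℝ)^d := by rw [hMpv]; exact pv_le hnn H.deg.le hX1
    have e2 : ((R:ℝ)/X)^(s-1) ≤ ((R:ℝ)/X)^(2*d) := pow_le_pow_of_le_one (by positivity) hRX (by omega)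
    have e3 : (X:ℝ)^d * ((R:ℝ)/X)^(2*d) = ((R:ℝ)^2/X)^d := by
      rw [pow_mul, ← mul_pow]; congr 1; field_simp
    have e4 : (R:ℝ)^2/X ≤ 1 / R := by
      rw [div_le_div_iff₀ hX0 (by linarith)]
      calc (R:ℝ)^2 * R = (R:ℝ)^3 := by ring
        _ ≤ (R:ℝ)^4 := pow_le_pow_right₀ hRr (by norm_num)
        _ ≤ _ := by linarith
    have e5 : (1:ℝ) / R ≤ 1 / N := by
      have : (N:ℝ) ≤ R := by exact_mod_cast hRN
      gcongr
    have e6 : (1:ℝ) / N ≤ 1 := by rw [div_le_one (by linarith)]; exact hN1.le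
    calc (M:ℝ) * ((R:ℝ)/X)^(s-1) ≤ pv P 1 * (X:ℝ)^d * ((R:ℝ)/X)^(2*d) := by gcongr
      _ = pv P 1 * ((R:ℝ)^2/X)^d := by rw [mul_assoc, e3]
      _ ≤ pv P 1 * (1 / N)^d := by exact mul_le_mul_of_nonneg_left (pow_le_pow_left₀ (by positivity) (e4.trans e5) d) hpv1
      _ ≤ pv P 1 * (1 / N) := by
          gcongr
          exact pow_le_of_le_one (by positivity) e6 (by omega)
      _ = _ := by ring
  have hfinal : c * (M:ℝ)^(s-1) ≤ 2 * (2^d)^(s-1) * (pv P 1 / N) * (M:ℝ)^(s-1) := by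
    calc c * (M:ℝ)^(s-1) ≤ c * (p:ℝ)^(s-1) := by gcongr
      _ ≤ (2^d * M / X * R)^(s-1) * (2 * M) := hwc.trans (hwc2.trans hpow)
      _ = 2 * (2^d)^(s-1) * (M * ((R:ℝ)/X)^(s-1)) * (M:ℝ)^(s-1) := by
          rw [show (2^d * M / X * R : ℝ) = 2^d * M * (R / X) by ring, mul_pow, mul_pow]; ring
      _ ≤ _ := by gcongr
  have h5 := le_of_mul_le_mul_right hfinal (by positivity)
  have h6 : 2 * (2^d)^(s-1) * pv P 1 / c < N := by linarith
  rw [div_lt_iff₀ hc] at h6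
  rw [← mul_div_assoc, le_div_iff₀ (by linarith)] at h5
  linarith


lemma inv_sum_le {W0 : ℕ} (hW0 : 0 < W0) (S : Finset ℕ) (hS : ∀ m ∈ S, m ≠ 0 ∧ m.primeFactors ⊆ W0.primeFactors) :
    ∑ m ∈ S, (1:ℝ) / m ≤ W0 / W0.totient := by
  let f : ℕ →* ℝ := { toFun := fun n => (n:ℝ)⁻¹, map_one' := by simp, map_mul' := fun a b => by push_cast; rw [mul_inv] }
  have h1 := (EulerProduct.summable_and_hasSum_factoredNumbers_prod_filter_prime_geometric (f := f) (fun {p} hp => by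
    show ‖((p:ℝ))⁻¹‖ < 1
    rw [norm_inv, Real.norm_natCast]
    exact inv_lt_one_of_one_lt₀ (by exact_mod_cast hp.one_lt)) W0.primeFactors).2
  have h2 : ∏ p ∈ W0.primeFactors with p.Prime, (1 - f p)⁻¹ = W0 / W0.totient := by
    rw [filter_true_of_mem (fun p hp => Nat.prime_of_mem_primeFactors hp), prod_inv_distrib]
    have e : (W0.totient : ℝ) = W0 * ∏ p ∈ W0.primeFactors, (1 - f p) := by
      have := Nat.totient_eq_mul_prod_factors W0
      have := congrArg (Rat.cast : ℚ → ℝ) this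
      push_cast at this; exact this
    have h0 : (W0.totient : ℝ) ≠ 0 := by have := Nat.totient_pos.2 hW0; positivity
    have h3 : (W0 : ℝ) ≠ 0 := by positivity
    rw [e] at h0 ⊢
    have := right_ne_zero_of_mul h0
    field_simp
  rw [h2] at h1
  have hmem : ∀ m ∈ S, m ∈ Nat.factoredNumbers W0.primeFactors := fun m hm =>
    Nat.mem_factoredNumbers_of_primeFactors_subset (hS m hm).1 (hS m hm).2
  classical
  have h3 := sum_le_hasSum (S.subtype (· ∈ Nat.factoredNumbers W0.primeFactors)) (fun i _ => by
    show (0:ℝ) ≤ ((i:ℕ):ℝ)⁻¹; positivity) h1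
  refine le_trans (le_of_eq ?_) h3
  rw [sum_subtype_of_mem (fun n => f n) hmem]
  exact sum_congr rfl fun m _ => one_div _

lemma VV_log (R : ℕ) {W : ℕ} (hW : 0 < W) : Real.log R ≤ W / W.totient * VV R W := by
  have hlog : Real.log R ≤ ∑ n ∈ Icc 1 R, (1:ℝ) / n := by
    have h1 := log_add_one_le_harmonic R
    rw [harmonic_eq_sum_Icc] at h1
    push_cast at h1
    simp only [one_div]
    refine le_trans ?_ h1
    rcases Nat.eq_zero_or_pos R with rfl | h
    · simp
    · exact Real.log_le_log (by exact_mod_cast h) (by linarith)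
  refine hlog.trans ?_
  have hmaps : ∀ n ∈ Icc 1 R, j2 W n ∈ Js R W := by
    intro n hn
    rw [mem_Icc] at hn
    have h1 : j2 W n ∣ ∏ p ∈ n.primeFactors, p := prod_dvd_prod_of_subset _ _ _ sdiff_subset
    have h2 : Squarefree (∏ p ∈ n.primeFactors, p) := by
      have := UniqueFactorizationMonoid.squarefree_radical (a := n)
      rwa [Nat.radical_eq_prod_primeFactors] at this
    have h3 := h2.squarefree_of_dvd h1
    have h4 := j2_dvd W n
    rw [mem_Js]
    refine ⟨⟨Nat.pos_of_ne_zero h3.ne_zero, (Nat.le_of_dvd (by omega) h4).trans hn.2⟩, h3, ?_⟩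
    rw [← Nat.disjoint_primeFactors h3.ne_zero hW.ne', j2_pf]
    exact sdiff_disjoint
  rw [← sum_fiberwise_of_maps_to hmaps, VV, mul_sum]
  refine sum_le_sum fun j hj => ?_
  rw [mem_Js] at hj
  have hj0 : 0 < j := hj.1.1
  have hcop : Nat.Coprime j W := hj.2.2
  have hdv : ∀ n ∈ (Icc 1 R).filter (fun n => j2 W n = j), j ∣ n := by
    intro n hn; rw [mem_filter] at hn; rw [← hn.2]; exact j2_dvd W n
  have e1 : ∑ n ∈ (Icc 1 R).filter (fun n => j2 W n = j), (1:ℝ) / n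
      = 1 / j * ∑ m ∈ ((Icc 1 R).filter (fun n => j2 W n = j)).image (fun n => n / j), (1:ℝ) / m := by
    rw [sum_image, mul_sum]
    · refine sum_congr rfl fun n hn => ?_
      obtain ⟨m, rfl⟩ := hdv n hn
      rw [Nat.mul_div_cancel_left _ hj0]; push_cast; field_simp
    · intro x hx y hy hxy
      obtain ⟨m, rfl⟩ := hdv x hx
      obtain ⟨k, rfl⟩ := hdv y hy
      simp only [Nat.mul_div_cancel_left _ hj0] at hxy
      rw [hxy]
  rw [e1]
  have h2 := inv_sum_le (W0 := j * W) (by positivity) (((Icc 1 R).filter (fun n => j2 W n = j)).image (fun n => n / j)) (by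
    intro m hm
    obtain ⟨n, hn, rfl⟩ := mem_image.1 hm
    obtain ⟨m, rfl⟩ := hdv n hn
    rw [mem_filter, mem_Icc] at hn
    rw [Nat.mul_div_cancel_left _ hj0]
    have hm0 : m ≠ 0 := by rintro rfl; simp at hn
    refine ⟨hm0, fun p hp => ?_⟩
    have hp' : p ∈ (j * m).primeFactors := by rw [Nat.primeFactors_mul hj0.ne' hm0]; exact mem_union_right _ hp
    rw [Nat.primeFactors_mul hj0.ne' hW.ne', mem_union]
    by_cases hpW : p ∈ W.primeFactors
    · exact Or.inr hpW
    · left; rw [← hn.2, j2_pf]; exact Finset.mem_sdiff.2 ⟨hp', hpW⟩)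
  rw [Nat.totient_mul hcop] at h2
  have a1 : (0:ℝ) < j.totient := by exact_mod_cast Nat.totient_pos.2 hj0
  have a2 : (0:ℝ) < W.totient := by exact_mod_cast Nat.totient_pos.2 hW
  have a3 : (0:ℝ) < j := by exact_mod_cast hj0
  calc _ ≤ 1 / (j:ℝ) * ((j * W : ℕ) / ((j.totient * W.totient : ℕ):ℝ)) := by gcongr
    _ = _ := by push_cast; field_simp

lemma lam_prime {R W x : ℕ} (hx : x.Prime) (hR : R < x) : lam R W x = VV R W := by
  unfold lam VV
  refine sum_congr rfl fun j hj => ?_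
  rw [mem_Js] at hj
  have h1 : cc j x = ArithmeticFunction.moebius j := by
    rw [ArithmeticFunction.moebius_apply_of_squarefree hj.2.1, cc]
    rw [prod_congr rfl (g := fun _ => (-1:ℝ)), prod_const]
    · rw [← (ArithmeticFunction.cardDistinctFactors_eq_cardFactors_iff_squarefree hj.2.1.ne_zero).2 hj.2.1]
      push_cast; rfl
    · intro p hp
      have hp' := Nat.mem_primeFactors.1 hp
      unfold xi
      rw [if_neg]
      intro h
      have e := (Nat.prime_dvd_prime_iff_eq hp'.1 hx).1 h
      have := Nat.le_of_dvd hj.1.1 hp'.2.1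
      omega
  rw [h1, div_mul_eq_mul_div, moeb_sq hj.2.1]

lemma lam_sum (R W b Y : ℕ) : ∑ n ∈ range Y, (lam R W (W * n + b))^2 ≤ Y * VV R W + 2 * (R:ℝ)^4 := by
  have e0 : ((∑ n ∈ range Y, (lam R W (W * n + b))^2 : ℝ) : ℂ) = ∑ j ∈ Js R W, ∑ k ∈ Js R W, (cjk j k : ℂ) *
      ∑ n ∈ range Y, (cc j (W * n + b) : ℂ) * (cc k (W * n + b) : ℂ) := by
    simp_rw [mul_sum]
    rw [sum_congr rfl (fun j _ => sum_comm), sum_comm]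
    push_cast
    refine sum_congr rfl fun n _ => ?_
    unfold lam
    rw [pow_two]; push_cast
    rw [sum_mul_sum]
    refine sum_congr rfl fun j _ => sum_congr rfl fun k _ => ?_
    unfold cjk; push_cast; ring
  have hmean : ∑ j ∈ Js R W, ∑ k ∈ Js R W, (cjk j k : ℂ) * mjk 0 W b 1 0 j k = VV R W := by
    unfold VV
    rw [Complex.ofReal_sum]
    refine sum_congr rfl fun j hj => ?_
    rw [sum_eq_single j]
    · rw [mjk_one 0 b 0 hj hj, if_pos rfl]
      have hpos : 0 < j.totient := Nat.totient_pos.2 (mem_Js.1 hj).1.1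
      have h0 : (j.totient : ℝ) ≠ 0 := by positivity
      have h1 := moeb_sq (mem_Js.1 hj).2.1
      rw [show (j.totient : ℂ) = ((j.totient : ℝ) : ℂ) by simp, ← Complex.ofReal_mul]
      congr 1
      unfold cjk
      field_simp
      rw [sq, h1]
    · intro k hk hne
      rw [mjk_one 0 b 0 hj hk, if_neg hne.symm, mul_zero]
    · intro h; exact absurd hj h
  have hper : ∀ j ∈ Js R W, ∀ k ∈ Js R W, ‖∑ n ∈ range Y, ((cc j (W * n + b) : ℂ) * (cc k (W * n + b) : ℂ) - mjk 0 W b 1 0 j k)‖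
      ≤ 2 * (R:ℝ)^2 * ((j.totient : ℝ) * k.totient) := by
    intro j hj k hk
    have hj' := mem_Js.1 hj
    have hk' := mem_Js.1 hk
    have h1 := periodic_partial (L := 1 * j * k) (by have := hj'.1.1; have := hk'.1.1; positivity)
      (mjk_periodic 0 W b 1 one_pos 0 j k) (B := (j.totient : ℝ) * k.totient) (fun n => by
        rw [norm_mul, norm_mul, ee_norm, mul_one, Complex.norm_real, Complex.norm_real]
        exact mul_le_mul (cc_abs hj'.2.1 _) (cc_abs hk'.2.1 _) (norm_nonneg _) (by positivity)) Y
    have e : ∀ n : ℕ, ee (((0 * (0:ℤ[X]).eval (n:ℤ) : ℤ) : ℝ) / (1:ℕ)) = 1 := fun n => by simp [ee_zero]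
    simp only [e, mul_one] at h1
    have e2 : mjk 0 W b 1 0 j k = avg (1 * j * k) (fun n => (cc j (W * n + b) : ℂ) * (cc k (W * n + b) : ℂ)) := by
      unfold mjk; simp only [e, mul_one]
    rw [e2]
    refine h1.trans ?_
    have : ((1 * j * k : ℕ) : ℝ) ≤ (R:ℝ)^2 := by
      have : 1 * j * k ≤ R^2 := by rw [one_mul, sq]; exact Nat.mul_le_mul hj'.1.2 hk'.1.2
      exact_mod_cast this
    gcongr
  have hdiff : ‖((∑ n ∈ range Y, (lam R W (W * n + b))^2 : ℝ) : ℂ) - ((Y * VV R W : ℝ) : ℂ)‖ ≤ 2 * (R:ℝ)^4 := by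
    rw [e0]; push_cast
    rw [← hmean, mul_sum, ← sum_sub_distrib]
    have hcard : ((Js R W).card : ℝ) ≤ R := by
      have : (Js R W).card ≤ R := by
        unfold Js; refine (card_filter_le _ _).trans ?_; simp
      exact_mod_cast this
    calc _ ≤ ∑ j ∈ Js R W, ∑ k ∈ Js R W, 2 * (R:ℝ)^2 := by
          refine (norm_sum_le _ _).trans (sum_le_sum fun j hj => ?_)
          rw [mul_sum, ← sum_sub_distrib]
          refine (norm_sum_le _ _).trans (sum_le_sum fun k hk => ?_)
          have h1 := hper j hj k hk
          rw [sum_sub_distrib, sum_const, card_range, nsmul_eq_mul] at h1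
          rw [show ∀ u v : ℂ, (cjk j k : ℂ) * u - Y * ((cjk j k : ℂ) * v) = (cjk j k : ℂ) * (u - Y * v) by intros; ring,
            norm_mul, Complex.norm_real, Real.norm_eq_abs]
          have a1 : (0:ℝ) < j.totient := by exact_mod_cast Nat.totient_pos.2 (mem_Js.1 hj).1.1
          have a2 : (0:ℝ) < k.totient := by exact_mod_cast Nat.totient_pos.2 (mem_Js.1 hk).1.1
          calc _ ≤ 1 / ((j.totient : ℝ) * k.totient) * (2 * (R:ℝ)^2 * ((j.totient : ℝ) * k.totient)) := by
                gcongr; exact cjk_abs j k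
            _ = _ := by field_simp
      _ = #(Js R W) * (#(Js R W) * (2 * (R:ℝ)^2)) := by simp only [sum_const, nsmul_eq_mul]
      _ ≤ R * (R * (2 * (R:ℝ)^2)) := by gcongr
      _ = _ := by ring
  rw [← Complex.ofReal_sub, Complex.norm_real, Real.norm_eq_abs] at hdiff
  have := (abs_le.1 hdiff).2
  linarith


lemma bt_raw {R W : ℕ} (hR : 1 ≤ R) (hW : 0 < W) (b Y : ℕ) :
    (#((range Y).filter (fun n => (W * n + b).Prime)) : ℝ) ≤ R + 1 + Y / VV R W + 2 * (R:ℝ)^4 := by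
  have hV := VV_ge_one (W := W) hR
  set S := (range Y).filter (fun n => (W * n + b).Prime)
  have h1 : #(S.filter (fun n => W * n + b ≤ R)) ≤ R + 1 := by
    rw [← card_range (R+1)]
    refine card_le_card_of_injOn (fun n => W * n + b) (fun n hn => ?_) (fun x _ y _ hxy => ?_)
    · have := (mem_filter.1 (mem_coe.1 hn)).2
      exact mem_coe.2 (mem_range.2 (Nat.lt_succ_of_le this))
    · exact Nat.eq_of_mul_eq_mul_left hW (by simpa using hxy)
  have h2 : (VV R W)^2 * #(S.filter (fun n => ¬ W * n + b ≤ R)) ≤ Y * VV R W + 2 * (R:ℝ)^4 := by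
    refine le_trans ?_ (lam_sum R W b Y)
    rw [mul_comm, ← nsmul_eq_mul, ← sum_const]
    calc _ = ∑ n ∈ S.filter (fun n => ¬ W * n + b ≤ R), (lam R W (W * n + b))^2 := by
          refine sum_congr rfl fun n hn => ?_
          rw [mem_filter, mem_filter] at hn
          rw [lam_prime hn.1.2 (by omega)]
      _ ≤ _ := sum_le_sum_of_subset_of_nonneg ((filter_subset _ _).trans (filter_subset _ _)) (fun _ _ _ => sq_nonneg _)
  have h3 : (#(S.filter (fun n => ¬ W * n + b ≤ R)) : ℝ) ≤ Y / VV R W + 2 * (R:ℝ)^4 := by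
    have h0 : (0:ℝ) < VV R W := by linarith
    have hR4 : (0:ℝ) ≤ 2 * (R:ℝ)^4 := by positivity
    have : (VV R W)^2 * #(S.filter (fun n => ¬ W * n + b ≤ R)) ≤ (VV R W)^2 * (Y / VV R W + 2 * (R:ℝ)^4) := by
      refine h2.trans ?_
      have : (VV R W)^2 * (Y / VV R W + 2 * (R:ℝ)^4) = Y * VV R W + (VV R W)^2 * (2 * (R:ℝ)^4) := by field_simp
      rw [this]
      nlinarith [mul_nonneg (show (0:ℝ) ≤ (VV R W)^2 - 1 by nlinarith) hR4]
    exact le_of_mul_le_mul_left this (by positivity)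
  have h4 : #S = #(S.filter (fun n => W * n + b ≤ R)) + #(S.filter (fun n => ¬ W * n + b ≤ R)) :=
    (card_filter_add_card_filter_not _).symm
  have h1' : (#(S.filter (fun n => W * n + b ≤ R)) : ℝ) ≤ R + 1 := by exact_mod_cast h1
  rw [h4]; push_cast; linarith

lemma bt {W : ℕ} (hW : 0 < W) (r : ℕ) {N : ℕ} (hN : (64 * W + 2)^8 ≤ N) :
    (#((Icc 1 N).filter (fun x => x.Prime ∧ x % W = r)) : ℝ) ≤ 33 / W.totient * (N / Real.log N) := by
  set R := Rf 8 N with hR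
  have hRW : 64 * W + 2 ≤ R := Rf_ge (by norm_num) hN
  have hR8 : R^8 ≤ N := Rf_pow_le (by norm_num) N
  have hN16 : (N:ℝ) ≤ (R:ℝ)^16 := by
    have h1 := Rf_lt 8 N
    have h2 : (N:ℝ) = ((N:ℝ) ^ ((1:ℝ) / (8:ℕ)))^8 := by
      rw [← Real.rpow_natCast, ← Real.rpow_mul (by positivity)]; norm_num
    have h3 : ((R:ℝ) + 1) ≤ (R:ℝ)^2 := by
      have : (2:ℝ) ≤ R := by exact_mod_cast (by omega : 2 ≤ R)
      nlinarith
    rw [h2]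
    calc _ ≤ ((R:ℝ)^2)^8 := pow_le_pow_left₀ (by positivity) (h1.le.trans h3) 8
      _ = _ := by ring
  have hRr : (64 * W + 2 : ℝ) ≤ R := by exact_mod_cast hRW
  have hWr : (1:ℝ) ≤ W := by exact_mod_cast hW
  have hR0 : (0:ℝ) < R := by linarith
  have hlR : 0 < Real.log R := Real.log_pos (by linarith)
  have hR8r : (R:ℝ)^8 ≤ N := by exact_mod_cast hR8
  have hNR : (R:ℝ) ≤ N := le_trans (by nlinarith [one_le_pow₀ (n := 7) (show (1:ℝ) ≤ R by linarith)]) hR8r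
  have hN1 : (1:ℝ) < N := by linarith
  have hlN : 0 < Real.log N := Real.log_pos hN1
  have hlog : Real.log N ≤ 16 * Real.log R := by
    have := Real.log_le_log (by linarith) hN16
    rw [Real.log_pow] at this; exact_mod_cast this
  have hφ : (0:ℝ) < W.totient := by exact_mod_cast Nat.totient_pos.2 hW
  have hφW : (W.totient : ℝ) ≤ W := by exact_mod_cast Nat.totient_le W
  have hV := VV_ge_one (W := W) (show 1 ≤ R by omega)
  have hVl := VV_log R hW
  have hcard : #((Icc 1 N).filter (fun x => x.Prime ∧ x % W = r)) ≤ #((range (N / W + 1)).filter (fun n => (W * n + r).Prime)) := by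
    refine card_le_card_of_injOn (fun x => x / W) (fun x hx => ?_) (fun x hx y hy hxy => ?_)
    · rw [mem_coe, mem_filter, mem_Icc] at hx
      have := Nat.div_add_mod x W
      rw [hx.2.2] at this
      rw [mem_coe, mem_filter, mem_range, this]
      exact ⟨Nat.lt_succ_of_le (Nat.div_le_div_right hx.1.2), hx.2.1⟩
    · have h1 := Nat.div_add_mod x W
      have h2 := Nat.div_add_mod y W
      rw [(mem_filter.1 (mem_coe.1 hx)).2.2] at h1
      rw [(mem_filter.1 (mem_coe.1 hy)).2.2] at h2
      simp only at hxy
      rw [← h1, ← h2, hxy]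
  have h1 := bt_raw (show 1 ≤ R by omega) hW r (N / W + 1)
  have h2 : ((N / W + 1 : ℕ) : ℝ) ≤ 2 * N / W := by
    push_cast
    have := Nat.cast_div_le (α := ℝ) (m := N) (n := W)
    have : (1:ℝ) ≤ N / W := by rw [le_div_iff₀ (by linarith)]; linarith
    calc _ ≤ (N:ℝ) / W + N / W := by linarith
      _ = _ := by ring
  have h3 : ((N / W + 1 : ℕ) : ℝ) / VV R W ≤ 32 / W.totient * (N / Real.log N) := by
    have e1 : Real.log N * W.totient / (16 * W) ≤ VV R W := by
      rw [div_le_iff₀ (by positivity)]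
      rw [div_mul_eq_mul_div, le_div_iff₀ hφ] at hVl
      nlinarith
    calc _ ≤ (2 * N / W) / (Real.log N * W.totient / (16 * W)) := by gcongr
      _ = _ := by field_simp; norm_num
  have h4 : (R:ℝ) + 1 + 2 * (R:ℝ)^4 ≤ 1 / W.totient * (N / Real.log N) := by
    have e1 : (R:ℝ) ≤ (R:ℝ)^4 := by
      have : (1:ℝ) ≤ R^3 := one_le_pow₀ (by linarith)
      nlinarith
    have e2 : Real.log N ≤ 16 * R := by have := Real.log_le_sub_one_of_pos hR0; linarith
    have e3 : (64 * W : ℝ) ≤ R^3 := by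
      have : (1:ℝ) ≤ R^2 := one_le_pow₀ (by linarith)
      nlinarith
    calc (R:ℝ) + 1 + 2 * (R:ℝ)^4 ≤ 4 * (R:ℝ)^4 := by linarith
      _ ≤ 1 / (W:ℝ) * ((R:ℝ)^8 / (16 * R)) := by
          rw [div_mul_div_comm, le_div_iff₀ (by positivity)]
          have : 0 ≤ (R:ℝ)^5 * (R^3 - 64 * W) := mul_nonneg (by positivity) (by linarith)
          nlinarith
      _ ≤ _ := by gcongr
  have h5 : (#((Icc 1 N).filter (fun x => x.Prime ∧ x % W = r)) : ℝ) ≤ #((range (N / W + 1)).filter (fun n => (W * n + r).Prime)) := by exact_mod_cast hcard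
  have : 33 / (W.totient : ℝ) * (N / Real.log N) = 32 / W.totient * (N / Real.log N) + 1 / W.totient * (N / Real.log N) := by ring
  linarith

noncomputable def PI (N : ℕ) : ℝ := #((Icc 1 N).filter Nat.Prime)

lemma PI_lower {N : ℕ} (hN : 4 ≤ N) : 1 / 4 * (N / Real.log N) ≤ PI N := by
  have h1 := Chebyshev.pi_ge N
  have e : (Nat.primeCounting N : ℝ) = PI N := by
    unfold PI
    rw [Nat.primeCounting, Nat.primeCounting', Nat.count_eq_card_filter_range]
    congr 2
    ext x
    simp only [mem_filter, mem_range, mem_Icc]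
    constructor
    · intro h; exact ⟨⟨h.2.one_le, by omega⟩, h.2⟩
    · intro h; exact ⟨by omega, h.2⟩
  rw [← e]
  refine le_trans ?_ h1
  have hNr : (4:ℝ) ≤ N := by exact_mod_cast hN
  have hl : 0 < Real.log N := Real.log_pos (by linarith)
  rw [mul_div, div_le_div_iff_of_pos_right hl]
  have h2 : Real.log (N + 1) ≤ (N + 1) / 4 - 1 + 2 * Real.log 2 := by
    have e1 := Real.log_le_sub_one_of_pos (show (0:ℝ) < (N + 1) / 4 by linarith)
    rw [Real.log_div (by linarith) (by norm_num), show (4:ℝ) = 2^2 by norm_num, Real.log_pow] at e1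
    push_cast at e1; linarith
  have := Real.log_two_gt_d9
  have := Real.log_two_lt_d9
  nlinarith

lemma bt_PI {W : ℕ} (hW : 0 < W) (r : ℕ) {κ : ℝ} (hκ : 0 < κ) (hκ1 : κ ≤ 1) : ∃ N0 : ℕ, ∀ N, N0 ≤ N →
    (#((Icc 1 N).filter (fun x => x.Prime ∧ x % W = r ∧ (x:ℝ) ≤ κ * N)) : ℝ) ≤ 264 * κ / W.totient * PI N := by
  obtain ⟨n1, hn1⟩ := exists_nat_gt ((2 / κ)^2)
  obtain ⟨n2, hn2⟩ := exists_nat_gt ((((64 * W + 2)^8 + 1 : ℕ) : ℝ) / κ)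
  refine ⟨n1 + n2 + 4, fun N hN => ?_⟩
  have hN1 : (2 / κ)^2 ≤ N := hn1.le.trans (by exact_mod_cast (by omega : n1 ≤ N))
  have hN2 : (((64 * W + 2)^8 + 1 : ℕ) : ℝ) ≤ κ * N := by
    rw [div_lt_iff₀ hκ] at hn2
    have : (n2:ℝ) ≤ N := by exact_mod_cast (by omega : n2 ≤ N)
    nlinarith
  have hN4 : (4:ℝ) ≤ N := by exact_mod_cast (by omega : 4 ≤ N)
  set N' := ⌊κ * N⌋₊ with hN'
  have a1 : (N':ℝ) ≤ κ * N := Nat.floor_le (by positivity)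
  have a2 : κ * N < N' + 1 := Nat.lt_floor_add_one _
  have hb := bt hW r (N := N') (by
    have : (((64 * W + 2)^8 : ℕ) : ℝ) < N' + 1 := by push_cast at hN2 ⊢; linarith
    have : (64 * W + 2)^8 < N' + 1 := by exact_mod_cast this
    omega)
  have hs : Real.sqrt N ≤ N' := by
    have e1 : 2 / κ ≤ Real.sqrt N := Real.le_sqrt_of_sq_le hN1
    rw [div_le_iff₀ hκ] at e1
    have e2 := Real.sq_sqrt (show (0:ℝ) ≤ N by linarith)
    have e3 : 1 ≤ Real.sqrt N := by rw [Real.one_le_sqrt]; linarith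
    nlinarith
  have hsq : (0:ℝ) < Real.sqrt N := Real.sqrt_pos.2 (by linarith)
  have hl : 0 < Real.log N := Real.log_pos (by linarith)
  have hll : Real.log N / 2 ≤ Real.log N' := by
    rw [← Real.log_sqrt (by linarith)]
    exact Real.log_le_log hsq hs
  have hc : (#((Icc 1 N).filter (fun x => x.Prime ∧ x % W = r ∧ (x:ℝ) ≤ κ * N)) : ℝ) ≤ #((Icc 1 N').filter (fun x => x.Prime ∧ x % W = r)) := by
    have : #((Icc 1 N).filter (fun x => x.Prime ∧ x % W = r ∧ (x:ℝ) ≤ κ * N)) ≤ #((Icc 1 N').filter (fun x => x.Prime ∧ x % W = r)) := by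
      refine card_le_card fun x hx => ?_
      rw [mem_filter, mem_Icc] at hx ⊢
      exact ⟨⟨hx.1.1, Nat.le_floor hx.2.2.2⟩, hx.2.1, hx.2.2.1⟩
    exact_mod_cast this
  have hφ : (0:ℝ) < W.totient := by exact_mod_cast Nat.totient_pos.2 hW
  have hP := PI_lower (show 4 ≤ N by omega)
  calc _ ≤ _ := hc
    _ ≤ 33 / W.totient * (N' / Real.log N') := hb
    _ ≤ 33 / W.totient * ((κ * N) / (Real.log N / 2)) := by gcongr
    _ = 264 * κ / W.totient * (1 / 4 * (N / Real.log N)) := by field_simp; norm_num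
    _ ≤ _ := by gcongr

/-! M9: bad residue classes, densities, necessity -/

lemma pow_dvd_helper {p : ℤ} (hp : Prime p) (a b : ℕ) : ∀ u v : ℤ, p^(a+b) ∣ u * v → ¬ p^b ∣ u → p^a ∣ v := by
  induction b with
  | zero => intro u v _ h; simp at h
  | succ b ih =>
    intro u v h1 h2
    by_cases h : p ∣ u
    · obtain ⟨u', rfl⟩ := h
      refine ih u' v ?_ (fun h3 => h2 (by rw [pow_succ']; exact mul_dvd_mul_left p h3))
      rw [← add_assoc, pow_succ', mul_assoc] at h1
      exact (mul_dvd_mul_iff_left hp.ne_zero).1 h1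
    · exact (pow_dvd_pow p (by omega)).trans (hp.pow_dvd_of_dvd_mul_left _ h h1)

lemma bad_classes {p : ℤ} (hp : Prime p) (J m : ℕ) : ∀ g : ℤ[X], g.natDegree ≤ m → ¬ p^J ∣ g.coeff m →
    ∃ S : Finset ℤ, #S ≤ m ∧ ∀ x : ℤ, p^((m+1)*J) ∣ g.eval x → ∃ r ∈ S, p^J ∣ x - r := by
  induction m with
  | zero =>
    intro g hg h
    refine ⟨∅, by simp, fun x hx => ?_⟩
    rw [eq_C_of_natDegree_eq_zero (Nat.le_zero.1 hg), eval_C] at hx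
    simp only [zero_add, one_mul] at hx
    exact absurd hx h
  | succ m ih =>
    intro g hg h
    by_cases hx0 : ∃ x0 : ℤ, p^((m+1+1)*J) ∣ g.eval x0
    · obtain ⟨x0, hx0⟩ := hx0
      obtain ⟨g1, hg1⟩ := dvd_iff_isRoot.2 (show IsRoot (g - C (g.eval x0)) x0 by simp [IsRoot])
      have hd1 : g1.natDegree ≤ m := by
        rcases eq_or_ne g1 0 with h0 | h0
        · simp [h0]
        have h3 := congrArg natDegree hg1
        rw [natDegree_sub_C, (monic_X_sub_C x0).natDegree_mul' h0, natDegree_X_sub_C] at h3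
        omega
      have hc1 : g1.coeff m = g.coeff (m+1) := by
        have h3 := congrArg (fun q => coeff q (m+1)) hg1
        simp only [coeff_sub, coeff_C_succ, sub_zero, coeff_X_sub_C_mul] at h3
        rw [coeff_eq_zero_of_natDegree_lt (p := g1) (n := m+1) (by omega)] at h3
        linarith
      obtain ⟨S, hS, hS2⟩ := ih g1 hd1 (by rw [hc1]; exact h)
      refine ⟨insert x0 S, (card_insert_le _ _).trans (by omega), fun x hx => ?_⟩
      by_cases hxx : p^J ∣ x - x0
      · exact ⟨x0, mem_insert_self _ _, hxx⟩
      · have h3 : (x - x0) * g1.eval x = g.eval x - g.eval x0 := by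
          have := congrArg (eval x) hg1
          simpa using this.symm
        obtain ⟨r, hr, hr2⟩ := hS2 x (pow_dvd_helper hp _ J (x - x0) _ (by
          rw [h3, show (m+1)*J + J = (m+1+1)*J by ring]; exact dvd_sub hx hx0) hxx)
        exact ⟨r, mem_insert_of_mem hr, hr2⟩
    · exact ⟨∅, by simp, fun x hx => absurd ⟨x, hx⟩ hx0⟩

lemma bad_primes (g : ℤ[X]) (hg : g ≠ 0) {η : ℝ} (hη : 0 < η) : ∃ K : ℕ, ∀ p : ℕ, p.Prime → ∃ N0 : ℕ, ∀ N, N0 ≤ N →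
    (#((Icc 1 N).filter (fun x : ℕ => x.Prime ∧ (p:ℤ)^K ∣ g.eval (x:ℤ))) : ℝ) ≤ η * PI N := by
  set m := g.natDegree with hm
  obtain ⟨J0, hJ0⟩ := pow_unbounded_of_one_lt (m * 264 / η) (show (1:ℝ) < 2 by norm_num)
  set J := J0 + g.leadingCoeff.natAbs + 1 with hJ
  refine ⟨(m+1)*J, fun p hp => ?_⟩
  have hp2 := hp.two_le
  have hlead : ¬ (p:ℤ)^J ∣ g.coeff m := by
    intro h
    have h1 := Int.natAbs_dvd_natAbs.2 h
    rw [Int.natAbs_pow, Int.natAbs_natCast] at h1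
    have h2 := Nat.le_of_dvd (Int.natAbs_pos.2 (leadingCoeff_ne_zero.2 hg)) h1
    have h3 : J < 2^J := Nat.lt_two_pow_self
    have h4 : 2^J ≤ p^J := Nat.pow_le_pow_left hp2 J
    omega
  obtain ⟨S, hS, hS2⟩ := bad_classes (Nat.prime_iff_prime_int.1 hp) J m g le_rfl hlead
  have hpJ : 0 < p^J := pow_pos hp.pos J
  choose f hf using fun r : ℕ => bt_PI hpJ r (κ := 1) one_pos le_rfl
  refine ⟨∑ r ∈ S, f ((r % (p^J:ℕ)).toNat), fun N hN => ?_⟩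
  have hsub : (Icc 1 N).filter (fun x : ℕ => x.Prime ∧ (p:ℤ)^((m+1)*J) ∣ g.eval (x:ℤ)) ⊆
      S.biUnion (fun r => (Icc 1 N).filter (fun x : ℕ => x.Prime ∧ x % p^J = (r % (p^J:ℕ)).toNat ∧ (x:ℝ) ≤ 1 * N)) := by
    intro x hx
    rw [mem_filter, mem_Icc] at hx
    obtain ⟨r, hr, hr2⟩ := hS2 x hx.2.2
    rw [mem_biUnion]
    refine ⟨r, hr, mem_filter.2 ⟨mem_Icc.2 hx.1, hx.2.1, ?_, by rw [one_mul]; exact_mod_cast hx.1.2⟩⟩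
    have h1 : (x:ℤ) % (p^J:ℕ) = r % (p^J:ℕ) := Int.emod_eq_emod_iff_emod_sub_eq_zero.2 (Int.emod_eq_zero_of_dvd (by push_cast; exact hr2))
    rw [← h1, ← Int.natCast_mod, Int.toNat_natCast]
  have hPI : 0 ≤ PI N := by unfold PI; exact Nat.cast_nonneg _
  have hφ : (2:ℝ)^J0 ≤ ((p^J).totient : ℝ) := by
    have : 2^J0 ≤ (p^J).totient := by
      rw [Nat.totient_prime_pow hp (by omega)]
      calc 2^J0 ≤ p^J0 := Nat.pow_le_pow_left hp2 _
        _ ≤ p^(J-1) := Nat.pow_le_pow_right hp.pos (by omega)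
        _ ≤ _ := Nat.le_mul_of_pos_right _ (by omega)
    exact_mod_cast this
  have hSm : (#S:ℝ) ≤ m := by exact_mod_cast hS
  rw [div_lt_iff₀ hη] at hJ0
  calc (#((Icc 1 N).filter (fun x : ℕ => x.Prime ∧ (p:ℤ)^((m+1)*J) ∣ g.eval (x:ℤ))) : ℝ)
      ≤ ∑ r ∈ S, (#((Icc 1 N).filter (fun x : ℕ => x.Prime ∧ x % p^J = (r % (p^J:ℕ)).toNat ∧ (x:ℝ) ≤ 1 * N)) : ℝ) := by
        exact_mod_cast (card_le_card hsub).trans card_biUnion_le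
    _ ≤ ∑ r ∈ S, 264 * 1 / ((p^J).totient : ℝ) * PI N := sum_le_sum fun r hr =>
        hf _ N ((single_le_sum (f := fun r : ℤ => f ((r % (p^J:ℕ)).toNat)) (fun _ _ => Nat.zero_le _) hr).trans hN)
    _ = #S * (264 * 1 / ((p^J).totient : ℝ)) * PI N := by rw [sum_const, nsmul_eq_mul, mul_assoc]
    _ ≤ m * (264 * 1 / (2:ℝ)^J0) * PI N := by gcongr
    _ ≤ η * PI N := by
        gcongr
        rw [mul_one, mul_div, div_le_iff₀ (by positivity)]
        linarith

open Classical in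
noncomputable def cA (A : Set ℕ) (N : ℕ) : ℝ := #((Icc 1 N).filter (· ∈ A))

lemma ratio_eq (A : Set ℕ) : (fun N : ℕ => (Nat.card (A ∩ Set.Icc 1 N : Set ℕ) : ℝ) / (Nat.card {p : ℕ | p.Prime ∧ p ≤ N} : ℝ))
    = fun N => cA A N / PI N := by
  classical
  funext N
  have h1 : (A ∩ Set.Icc 1 N : Set ℕ) = ((Icc 1 N).filter (· ∈ A) : Finset ℕ) := by
    ext x; simp only [Set.mem_inter_iff, Set.mem_Icc, coe_filter, mem_Icc, Set.mem_ofPred_eq]; tauto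
  have h2 : {p : ℕ | p.Prime ∧ p ≤ N} = ((Icc 1 N).filter Nat.Prime : Finset ℕ) := by
    ext x; simp only [Set.mem_ofPred_eq, coe_filter, mem_Icc]
    exact ⟨fun h => ⟨⟨h.1.one_le, h.2⟩, h.1⟩, fun h => ⟨h.2, h.1.2⟩⟩
  rw [h1, h2, Nat.card_coe_set_eq, Set.ncard_coe_finset, Nat.card_coe_set_eq, Set.ncard_coe_finset]
  unfold cA PI
  congr 3

lemma PI_pos {N : ℕ} (hN : 2 ≤ N) : 0 < PI N := by
  unfold PI
  exact_mod_cast card_pos.2 ⟨2, mem_filter.2 ⟨mem_Icc.2 ⟨by norm_num, hN⟩, Nat.prime_two⟩⟩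

lemma cA_le {A : Set ℕ} (hA : ∀ n ∈ A, n.Prime) (N : ℕ) : cA A N ≤ PI N := by
  classical
  unfold cA PI
  have : #((Icc 1 N).filter (· ∈ A)) ≤ #((Icc 1 N).filter Nat.Prime) :=
    card_le_card (monotone_filter_right _ (fun x _ hx => hA x hx))
  exact_mod_cast this

lemma freq_of_limsup {A : Set ℕ} (h : 0 < limsup (fun N => cA A N / PI N) atTop) :
    ∃ α : ℝ, 0 < α ∧ ∃ᶠ N in atTop, α * PI N ≤ cA A N := by
  obtain ⟨α, h1, h2⟩ := exists_between h
  refine ⟨α, h1, ?_⟩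
  have h3 := frequently_lt_of_lt_limsup (isCoboundedUnder_le_of_le atTop (x := 0) (fun N => by unfold cA PI; positivity)) h2
  refine (h3.and_eventually (eventually_ge_atTop 2)).mono fun N hN => ?_
  have := (lt_div_iff₀ (PI_pos hN.2)).1 hN.1
  exact this.le

lemma limsup_of_freq {A : Set ℕ} (hA : ∀ n ∈ A, n.Prime) {α : ℝ} (hα : 0 < α) (h : ∃ᶠ N in atTop, α * PI N ≤ cA A N) :
    0 < limsup (fun N => cA A N / PI N) atTop := by
  refine lt_of_lt_of_le hα (le_limsup_of_frequently_le ((h.and_eventually (eventually_ge_atTop 2)).mono fun N hN => ?_) ?_)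
  · rw [le_div_iff₀ (PI_pos hN.2)]; exact hN.1
  · refine isBoundedUnder_of ⟨1, fun N => ?_⟩
    exact div_le_one_of_le₀ (cA_le hA N) (by unfold PI; positivity)

/-- if a set of primes contains at least half the primes then some residue class in it is dense -/
lemma necessity (s : ℕ) (a : Fin s → ℤ) (b : ℤ) (h : ℤ[X]) (hs : 0 < s) (hg : C (∑ i, a i) * h - C b ≠ 0)
    (H : ∀ A : Set ℕ, (∀ n ∈ A, n.Prime) → 0 < limsup (fun N => cA A N / PI N) atTop →
      ∃ x : Fin s → ℕ, (∀ i, x i ∈ A) ∧ (∃ i j, x i ≠ x j) ∧ ∑ i, a i * h.eval (x i : ℤ) = b) : False := by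
  classical
  set g := C (∑ i, a i) * h - C b with hgd
  obtain ⟨K, hK⟩ := bad_primes g hg (η := 1/2) (by norm_num)
  obtain ⟨N0, hN0⟩ := hK 2 Nat.prime_two
  set m := 2^K with hm
  have hm0 : 0 < m := by positivity
  let A : ℕ → Set ℕ := fun r => {x | x.Prime ∧ ¬ (2:ℤ)^K ∣ g.eval (x:ℤ) ∧ x % m = r}
  have hfr : ∃ r, ∃ᶠ N in atTop, (1 / (4 * m : ℝ)) * PI N ≤ cA (A r) N := by
    by_contra hcon
    push Not at hcon
    have h1 : ∀ᶠ N in atTop, ∀ r ∈ range m, cA (A r) N < (1 / (4 * m : ℝ)) * PI N := by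
      rw [eventually_all_finset]
      intro r _
      exact hcon r
    obtain ⟨N, h2, h3, h4⟩ := (h1.and ((eventually_ge_atTop N0).and (eventually_ge_atTop 2))).exists
    have h5 := hN0 N h3
    have h6 : PI N = #((Icc 1 N).filter (fun x : ℕ => x.Prime ∧ (2:ℤ)^K ∣ g.eval (x:ℤ))) + ∑ r ∈ range m, cA (A r) N := by
      unfold PI cA
      rw [← Nat.cast_sum, ← Nat.cast_add]
      congr 1
      rw [← card_filter_add_card_filter_not (s := (Icc 1 N).filter Nat.Prime) (fun x : ℕ => (2:ℤ)^K ∣ g.eval (x:ℤ)), filter_filter]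
      congr 1
      rw [card_eq_sum_card_fiberwise (f := fun x => x % m) (t := range m) (fun x _ => mem_coe.2 (mem_range.2 (Nat.mod_lt _ hm0)))]
      refine sum_congr rfl fun r _ => ?_
      rw [filter_filter, filter_filter]
      congr 1; ext x; simp only [mem_filter, A, Set.mem_ofPred_eq, and_assoc]
    have h7 : ∑ r ∈ range m, cA (A r) N ≤ ∑ r ∈ range m, (1 / (4 * m : ℝ)) * PI N := sum_le_sum fun r hr => (h2 r hr).le
    rw [sum_const, card_range, nsmul_eq_mul] at h7
    have h8 : (m:ℝ) * (1 / (4 * m : ℝ) * PI N) = PI N / 4 := by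
      have : (m:ℝ) ≠ 0 := by positivity
      field_simp
    have := PI_pos h4
    push_cast at h5
    linarith
  obtain ⟨r, hr⟩ := hfr
  obtain ⟨x, hx, _, hsum⟩ := H (A r) (fun n hn => hn.1) (limsup_of_freq (fun n hn => hn.1) (by positivity) hr)
  refine (hx ⟨0, hs⟩).2.1 ?_
  set x0 := x ⟨0, hs⟩ with hx0
  have h1 : g.eval (x0:ℤ) = ∑ i, a i * (h.eval (x0:ℤ) - h.eval (x i : ℤ)) := by
    rw [hgd]
    simp only [mul_sub, sum_sub_distrib, hsum, eval_sub, eval_mul, eval_C, ← sum_mul]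
  rw [h1]
  refine dvd_sum fun i _ => Dvd.dvd.mul_left (dvd_trans ?_ (sub_dvd_eval_sub _ _ h)) _
  have h2 : x0 ≡ x i [MOD m] := by
    show x0 % m = x i % m
    rw [(hx _).2.2, (hx i).2.2]
  have h3 := (Nat.modEq_iff_dvd.1 h2.symm)
  rw [hm] at h3; push_cast at h3; exact h3

/-! M10: construction of the normalised polynomial -/

lemma ev_nonneg (q : ℤ[X]) (hq : 0 ≤ q.leadingCoeff) : ∀ᶠ b : ℕ in atTop, 0 ≤ q.eval (b:ℤ) := by
  rcases Nat.eq_zero_or_pos q.natDegree with h0 | h0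
  · rw [eq_C_of_natDegree_eq_zero h0] at hq ⊢
    rw [leadingCoeff_C] at hq
    exact Eventually.of_forall fun _ => by rw [eval_C]; exact hq
  · have hinj : Function.Injective (Int.castRingHom ℝ) := Int.cast_injective
    have h1 := tendsto_atTop_of_leadingCoeff_nonneg (q.map (Int.castRingHom ℝ))
      (by rw [degree_map_eq_of_injective hinj]; exact natDegree_pos_iff_degree_pos.1 h0)
      (by rw [leadingCoeff_map_of_injective hinj]; simpa using hq)
    filter_upwards [(h1.comp tendsto_natCast_atTop_atTop).eventually_ge_atTop 0] with b hb
    have h2 : eval (b:ℝ) (q.map (Int.castRingHom ℝ)) = ((q.eval (b:ℤ) : ℤ) : ℝ) := by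
      have := eval_map_apply (f := Int.castRingHom ℝ) (p := q) (b:ℤ)
      simpa using this
    rw [Function.comp_apply, h2] at hb
    exact_mod_cast hb

lemma ev_taylor (h : ℤ[X]) (hl : 0 < h.leadingCoeff) : ∃ B : ℕ, ∀ b : ℕ, B ≤ b → ∀ i, 0 ≤ (taylor (b:ℤ) h).coeff i := by
  have h1 : ∀ᶠ b : ℕ in atTop, ∀ i ∈ range (h.natDegree + 1), 0 ≤ (hasseDeriv i h).eval (b:ℤ) := by
    rw [eventually_all_finset]
    intro i hi
    refine ev_nonneg _ ?_
    rw [leadingCoeff, natDegree_hasseDeriv, hasseDeriv_coeff, Nat.sub_add_cancel (by rw [mem_range] at hi; omega)]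
    exact mul_nonneg (Int.natCast_nonneg _) hl.le
  obtain ⟨B, hB⟩ := eventually_atTop.1 h1
  refine ⟨B, fun b hb i => ?_⟩
  rw [taylor_coeff]
  by_cases hi : i < h.natDegree + 1
  · exact hB b hb i (mem_range.2 hi)
  · rw [hasseDeriv_eq_zero_of_lt_natDegree _ _ (by omega), eval_zero]

lemma mkP {d : ℕ} (hd : 2 ≤ d) (h : ℤ[X]) (hdeg : h.natDegree = d) (hl : 0 < h.leadingCoeff) {w K W : ℕ} (hW : 0 < W)
    (hWp : ∀ p : ℕ, p.Prime → p ∣ W → p^K ∣ W) (hWw : ∀ p : ℕ, p.Prime → ¬ p ∣ W → w < p) (b : ℕ)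
    (hb : ∀ i, 0 ≤ (taylor (b:ℤ) h).coeff i)
    (hbad : ∀ p : ℕ, p.Prime → p ∣ W → ¬ (p:ℤ)^K ∣ (derivative h).eval (b:ℤ)) (hlw : h.leadingCoeff.natAbs ≤ w) (hdw : d ≤ w)
    (hw : ∀ p : ℕ, w < p → 24 * (d:ℝ)^(d+1) * (p:ℝ) ^ ((8:ℝ) / (8 * d + 1)) ≤ (p:ℝ) ^ ((1:ℝ) / d)) :
    ∃ P : ℤ[X], ∃ g : ℤ, 0 < g ∧ Hyp d P W w ∧ ∀ n : ℤ, g * P.eval n = h.eval (W * n + b) - h.eval (b:ℤ) := by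
  set t := taylor (b:ℤ) h with ht
  have ht1 : t.coeff 1 = (derivative h).eval (b:ℤ) := taylor_coeff_one _ _
  have htd : t.natDegree = d := by rw [ht, natDegree_taylor, hdeg]
  have htl : t.coeff d = h.leadingCoeff := by rw [← htd, ← leadingCoeff_taylor (b:ℤ) h]; rfl
  set g : ℕ := Int.gcd (t.coeff 1) W with hg
  have hW' : (0:ℤ) < W := by exact_mod_cast hW
  have hg0 : 0 < g := Int.gcd_pos_of_ne_zero_right _ hW'.ne'
  obtain ⟨u, hu⟩ : (g:ℤ) ∣ t.coeff 1 := Int.gcd_dvd_left _ _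
  obtain ⟨v, hv⟩ : (g:ℤ) ∣ W := Int.gcd_dvd_right _ _
  have hg0' : (0:ℤ) < g := by exact_mod_cast hg0
  have hu0 : 0 ≤ u := by
    have := hb 1; rw [hu] at this; exact nonneg_of_mul_nonneg_right this hg0'
  have hv0 : 0 < v := by rw [hv] at hW'; exact pos_of_mul_pos_right hW' hg0'.le
  have huv : Int.gcd u v = 1 := by
    have h1 := Int.gcd_div_gcd_div_gcd hg0
    rwa [← hg, hu, hv, Int.mul_ediv_cancel_left _ hg0'.ne', Int.mul_ediv_cancel_left _ hg0'.ne'] at h1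
  have hpv : ∀ p : ℕ, p.Prime → p ∣ W → (p:ℤ) ∣ v := by
    intro p hp hpW
    by_contra hcon
    have h1 : (p:ℤ)^K ∣ g * v := by rw [← hv]; exact_mod_cast hWp p hp hpW
    have h2 := (Nat.prime_iff_prime_int.1 hp).pow_dvd_of_dvd_mul_right _ hcon h1
    exact hbad p hp hpW (by rw [← ht1, hu]; exact h2.mul_right _)
  set P : ℤ[X] := X * (C u + X * (C v * t.divX.divX.comp (C (W:ℤ) * X))) with hP
  have c0 : P.coeff 0 = 0 := by rw [hP]; simp
  have c1 : P.coeff 1 = u := by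
    rw [hP, coeff_X_mul, coeff_add]; simp
  have c2 : ∀ i, P.coeff (i+2) = v * (t.coeff (i+2) * W^i) := by
    intro i
    rw [hP, show i+2 = i+1+1 from rfl, coeff_X_mul, coeff_add, coeff_X_mul, coeff_C_mul, comp_C_mul_X_coeff, coeff_divX, coeff_divX,
      coeff_C_succ, zero_add]
  have cd : P.coeff d = v * (h.leadingCoeff * W^(d-2)) := by
    have := c2 (d-2); rwa [Nat.sub_add_cancel hd, htl] at this
  refine ⟨P, g * W, mul_pos hg0' hW', ⟨hd, hW, ?_, ?_, c0, ?_, ?_, hdw, hw⟩, ?_⟩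
  · refine natDegree_eq_of_le_of_coeff_ne_zero (natDegree_le_iff_coeff_eq_zero.2 fun i hi => ?_) ?_
    · obtain ⟨j, rfl⟩ : ∃ j, i = j+2 := ⟨i-2, by omega⟩
      rw [c2, coeff_eq_zero_of_natDegree_lt (p := t) (by omega)]; ring
    · rw [cd]; positivity
  · rintro (_ | _ | i)
    · exact c0.ge
    · rw [zero_add, c1]; exact hu0
    · rw [c2]; have := hb (i+2); positivity
  · intro p hp hpW
    refine ⟨fun h1 => ?_, fun i hi => ?_⟩
    · rw [c1] at h1
      have h2 := Int.dvd_gcd h1 (hpv p hp hpW)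
      rw [huv] at h2
      exact hp.one_lt.ne' (Nat.dvd_one.1 (by exact_mod_cast h2))
    · obtain ⟨j, rfl⟩ : ∃ j, i = j+2 := ⟨i-2, by omega⟩
      rw [c2]; exact (hpv p hp hpW).mul_right _
  · intro p hp hpW
    refine ⟨hWw p hp hpW, fun h1 => ?_⟩
    have hpp := Nat.prime_iff_prime_int.1 hp
    have hpW' : ¬ (p:ℤ) ∣ W := by exact_mod_cast hpW
    rw [cd] at h1
    rcases hpp.dvd_or_dvd h1 with h2 | h2
    · exact hpW' (by rw [hv]; exact h2.mul_left _)
    · rcases hpp.dvd_or_dvd h2 with h3 | h3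
      · have h4 := Nat.le_of_dvd (Int.natAbs_pos.2 hl.ne') (by simpa using Int.natAbs_dvd_natAbs.2 h3)
        have := hWw p hp hpW
        omega
      · exact hpW' (hpp.dvd_of_dvd_pow h3)
  · intro n
    have e1 : h.eval (W * n + b) = t.eval (W * n) := (taylor_eval _ _ _).symm
    have e0 : h.eval (b:ℤ) = t.coeff 0 := by rw [ht, taylor_coeff_zero]
    have e2 : t.eval (W*n) = (t.divX.divX.eval (W*n) * (W*n) + t.coeff 1) * (W*n) + t.coeff 0 := by
      conv_lhs => rw [← divX_mul_X_add t, ← divX_mul_X_add t.divX]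
      simp [coeff_divX]
    rw [e1, e0, e2, hu, hP]
    simp only [eval_mul, eval_add, eval_X, eval_C, eval_comp]
    rw [hv]; ring

/-! M11: choice of w, the dense class and the lower bound for the weighted sum -/

lemma choose_w {d : ℕ} (hd : 2 ≤ d) : ∃ w1 : ℕ, ∀ p : ℕ, w1 ≤ p →
    24 * (d:ℝ)^(d+1) * (p:ℝ) ^ ((8:ℝ) / (8 * d + 1)) ≤ (p:ℝ) ^ ((1:ℝ) / d) := by
  have hd0 : (0:ℝ) < d := by exact_mod_cast (by omega : 0 < d)
  have he : (1:ℝ)/d = 1/(d*(8*d+1)) + 8/(8*d+1) := by field_simp; ring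
  have h1 := ((tendsto_rpow_atTop (y := (1:ℝ)/(d*(8*d+1))) (by positivity)).comp tendsto_natCast_atTop_atTop).eventually_ge_atTop
    (24 * (d:ℝ)^(d+1))
  obtain ⟨w1, hw1⟩ := eventually_atTop.1 (h1.and (eventually_ge_atTop 1))
  refine ⟨w1, fun p hp => ?_⟩
  obtain ⟨h2, h3⟩ := hw1 p hp
  rw [he, Real.rpow_add (by exact_mod_cast h3)]
  exact mul_le_mul_of_nonneg_right h2 (by positivity)

lemma dense_class {A : Set ℕ} (hA : ∀ n ∈ A, n.Prime) {α κ : ℝ} (hα : 0 < α) (hκ : 0 < κ) (hκ1 : κ ≤ 1) (hκα : 264 * κ ≤ α / 8)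
    (g : ℤ[X]) (w K W : ℕ) (hW : 0 < W) (hWw : ∀ p : ℕ, p.Prime → p ∣ W → p ≤ w)
    (hK : ∀ p : ℕ, p.Prime → ∃ N0 : ℕ, ∀ N, N0 ≤ N →
      (#((Icc 1 N).filter (fun x : ℕ => x.Prime ∧ (p:ℤ)^K ∣ g.eval (x:ℤ))) : ℝ) ≤ α / (4 * (w+1)) * PI N) :
    ∃ N0 : ℕ, ∀ N, N0 ≤ N → α * PI N ≤ cA A N → ∃ r < W, ∃ S : Finset ℕ,
      (∀ x ∈ S, x ∈ A ∧ x ≤ N ∧ κ * N < x ∧ x % W = r ∧ ∀ p : ℕ, p.Prime → p ∣ W → ¬ (p:ℤ)^K ∣ g.eval (x:ℤ)) ∧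
      α / 4 * PI N / W.totient ≤ #S := by
  classical
  have hK' : ∀ p : ℕ, ∃ N0 : ℕ, p.Prime → ∀ N, N0 ≤ N →
      (#((Icc 1 N).filter (fun x : ℕ => x.Prime ∧ (p:ℤ)^K ∣ g.eval (x:ℤ))) : ℝ) ≤ α / (4 * (w+1)) * PI N := fun p => by
    by_cases hp : p.Prime
    · obtain ⟨N0, h⟩ := hK p hp; exact ⟨N0, fun _ => h⟩
    · exact ⟨0, fun h => absurd h hp⟩
  choose F hF using hK'
  obtain ⟨N1, hN1⟩ := bt_PI one_pos 0 hκ hκ1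
  obtain ⟨N2, hN2⟩ := exists_nat_ge (W / κ)
  refine ⟨N1 + N2 + ∑ p ∈ range (w+1), F p, fun N hN hd => ?_⟩
  have hPI : 0 ≤ PI N := by unfold PI; positivity
  have hWN : (W:ℝ) ≤ κ * N := by
    rw [div_le_iff₀ hκ] at hN2
    have : (N2:ℝ) ≤ N := by exact_mod_cast (by omega : N2 ≤ N)
    nlinarith
  let B : ℕ → Finset ℕ := fun p => (Icc 1 N).filter (fun x : ℕ => x.Prime ∧ (p:ℤ)^K ∣ g.eval (x:ℤ))
  let D : Finset ℕ := (Icc 1 N).filter (fun x : ℕ => x.Prime ∧ x % 1 = 0 ∧ (x:ℝ) ≤ κ * N)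
  let G : Finset ℕ := (Icc 1 N).filter (fun x : ℕ => x ∈ A ∧ κ * N < x ∧ ∀ p : ℕ, p.Prime → p ∣ W → ¬ (p:ℤ)^K ∣ g.eval (x:ℤ))
  have hsub : (Icc 1 N).filter (· ∈ A) ⊆ (G ∪ D) ∪ ((range (w+1)).filter Nat.Prime).biUnion B := by
    intro x hx
    rw [mem_filter] at hx
    rw [mem_union, mem_union]
    by_cases h1 : (x:ℝ) ≤ κ * N
    · exact Or.inl (Or.inr (mem_filter.2 ⟨hx.1, hA x hx.2, Nat.mod_one x, h1⟩))
    by_cases h2 : ∀ p : ℕ, p.Prime → p ∣ W → ¬ (p:ℤ)^K ∣ g.eval (x:ℤ)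
    · exact Or.inl (Or.inl (mem_filter.2 ⟨hx.1, hx.2, not_le.1 h1, h2⟩))
    · push Not at h2
      obtain ⟨p, hp, hpW, h3⟩ := h2
      exact Or.inr (mem_biUnion.2 ⟨p, mem_filter.2 ⟨mem_range.2 (Nat.lt_succ_of_le (hWw p hp hpW)), hp⟩,
        mem_filter.2 ⟨hx.1, hA x hx.2, h3⟩⟩)
  have hc : cA A N ≤ (#G + #D : ℝ) + ∑ p ∈ (range (w+1)).filter Nat.Prime, (#(B p) : ℝ) := by
    unfold cA
    exact_mod_cast (card_le_card hsub).trans ((card_union_le _ _).trans (add_le_add (card_union_le _ _) card_biUnion_le))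
  have hD : (#D:ℝ) ≤ α / 8 * PI N := by
    have h1 := hN1 N (by omega)
    rw [Nat.totient_one, Nat.cast_one, div_one] at h1
    exact h1.trans (mul_le_mul_of_nonneg_right hκα hPI)
  have hB : ∑ p ∈ (range (w+1)).filter Nat.Prime, (#(B p) : ℝ) ≤ α / 4 * PI N := by
    calc ∑ p ∈ (range (w+1)).filter Nat.Prime, (#(B p) : ℝ)
        ≤ ∑ p ∈ (range (w+1)).filter Nat.Prime, α / (4 * (w+1)) * PI N := sum_le_sum fun p hp => by
          rw [mem_filter] at hp
          have := single_le_sum (f := F) (fun _ _ => Nat.zero_le _) hp.1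
          exact hF p hp.2 N (by omega)
      _ ≤ ∑ p ∈ range (w+1), α / (4 * (w+1)) * PI N :=
          sum_le_sum_of_subset_of_nonneg (filter_subset _ _) fun _ _ _ => by positivity
      _ = α / 4 * PI N := by
          rw [sum_const, card_range, nsmul_eq_mul]; push_cast
          field_simp
  have hG : α / 4 * PI N ≤ #G := by nlinarith
  have hφ : (0:ℝ) < W.totient := by exact_mod_cast Nat.totient_pos.2 hW
  obtain ⟨r, hr, hr2⟩ := exists_le_card_fiber_of_nsmul_le_card_of_maps_to (s := G) (t := (range W).filter W.Coprime)
    (f := fun x => x % W) (b := α / 4 * PI N / W.totient) (fun x hx => by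
      obtain ⟨_, h2, h3, _⟩ := mem_filter.1 hx
      refine mem_filter.2 ⟨mem_range.2 (Nat.mod_lt _ hW), ?_⟩
      have h4 : W < x := by exact_mod_cast hWN.trans_lt h3
      have h5 : Nat.Coprime x W := ((hA x h2).coprime_iff_not_dvd).2 fun h => absurd (Nat.le_of_dvd hW h) (not_le.2 h4)
      rw [Nat.coprime_comm, Nat.Coprime, ← Nat.gcd_rec]; exact h5.symm)
    (card_pos.1 (Nat.totient_pos.2 hW)) (by
      have : #((range W).filter W.Coprime) = W.totient := rfl
      rw [this, nsmul_eq_mul, mul_div_cancel₀ _ hφ.ne']; exact hG)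
  refine ⟨r, mem_range.1 (mem_filter.1 hr).1, _, fun x hx => ?_, hr2⟩
  obtain ⟨h1, h2⟩ := mem_filter.1 hx
  obtain ⟨h3, h4, h5, h6⟩ := mem_filter.1 h1
  exact ⟨h4, (mem_Icc.1 h3).2, h5, h2, h6⟩

lemma dl_lower {d : ℕ} {P : ℤ[X]} {W w : ℕ} (H : Hyp d P W w) {n X : ℕ} {κ : ℝ} (hκ : 0 < κ) (hκ1 : κ ≤ 1) (hn : 0 < n)
    (hnX : n < X) (h : κ * X ≤ n) : κ^d * pv P X / X ≤ dl P n := by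
  have hn' : (0:ℝ) < n := by exact_mod_cast hn
  have hnX' : (n:ℝ) ≤ X := by exact_mod_cast hnX.le
  have h1 : pv P n ≤ n * dl P n := by
    rw [← sum_dl P H.c0]
    calc ∑ k ∈ range n, dl P k ≤ ∑ k ∈ range n, dl P n := sum_le_sum fun k hk => dl_mono H.nonneg (mem_range.1 hk).le
      _ = n * dl P n := by rw [sum_const, card_range, nsmul_eq_mul]
  have h2 : κ^d * pv P X ≤ pv P n := by
    rw [pv_eq_le P n H.deg.le, pv_eq_le P X H.deg.le, mul_sum]
    refine sum_le_sum fun i hi => ?_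
    have h3 : (0:ℝ) ≤ P.coeff i := by exact_mod_cast H.nonneg i
    have hi' : i ≤ d := by rw [mem_range] at hi; omega
    calc κ^d * (P.coeff i * (X:ℝ)^i) = P.coeff i * (κ^d * (X:ℝ)^i) := by ring
      _ ≤ P.coeff i * (κ^i * (X:ℝ)^i) := by gcongr ?_ * (?_ * ?_); exact pow_le_pow_of_le_one hκ.le hκ1 hi'
      _ = P.coeff i * (κ * X)^i := by rw [mul_pow]
      _ ≤ P.coeff i * (n:ℝ)^i := by gcongr
  have h4 := dl_nonneg H.nonneg n
  rw [div_le_iff₀ (by linarith)]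
  nlinarith

lemma logR_lower {A0 N X W : ℕ} (hA0 : 4 ≤ A0) (hW : 0 < W) (hN : W^2 ≤ N) (hN2 : 16^A0 ≤ N) (hX : N ≤ W * X) :
    1 ≤ Rf A0 X ∧ Real.log N / (4 * A0) ≤ Real.log (Rf A0 X) := by
  have hN0 : 0 < N := lt_of_lt_of_le (by positivity) hN
  have hX0 : 0 < X := Nat.pos_of_ne_zero (by rintro rfl; omega)
  have hR : 1 ≤ Rf A0 X := Rf_ge (by omega) (by rw [one_pow]; exact hX0)
  refine ⟨hR, ?_⟩
  have hR' : (1:ℝ) ≤ Rf A0 X := by exact_mod_cast hR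
  have hA : (0:ℝ) < A0 := by exact_mod_cast (by omega : 0 < A0)
  have hX1 : (0:ℝ) < X := by exact_mod_cast hX0
  have hN1 : (0:ℝ) < N := by exact_mod_cast hN0
  have hNX : N ≤ X^2 := by
    have h1 : N * N ≤ (W*X)*(W*X) := Nat.mul_le_mul hX hX
    have h2 : N * N ≤ N * X^2 := h1.trans (by rw [show W*X*(W*X) = W^2*X^2 by ring]; exact Nat.mul_le_mul_right _ hN)
    exact Nat.le_of_mul_le_mul_left h2 hN0
  have h1 : Real.log N ≤ 2 * Real.log X := by
    have := Real.log_le_log hN1 (show (N:ℝ) ≤ (X:ℝ)^2 by exact_mod_cast hNX)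
    rwa [Real.log_pow] at this
  have h2 : (1:ℝ)/A0 * Real.log X ≤ Real.log 2 + Real.log (Rf A0 X) := by
    rw [← Real.log_mul (by norm_num) (by linarith), ← Real.log_rpow hX1]
    exact Real.log_le_log (by positivity) ((Rf_lt A0 X).le.trans (by linarith))
  have h3 : 4 * A0 * Real.log 2 ≤ Real.log N := by
    have := Real.log_le_log (by positivity) (show ((2:ℝ)^4)^A0 ≤ N by norm_num; exact_mod_cast hN2)
    rw [Real.log_pow, Real.log_pow] at this; push_cast at this; linarith
  rw [div_mul_eq_mul_div, one_mul, div_le_iff₀ hA] at h2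
  rw [div_le_iff₀ (by positivity)]
  nlinarith

lemma weight_sum {d : ℕ} {P : ℤ[X]} {W w : ℕ} (H : Hyp d P W w) {A0 : ℕ} (hA0 : 4 ≤ A0) {κ c : ℝ} (hκ : 0 < κ) (hκ1 : κ ≤ 1)
    (hc : 0 < c) (b : ℕ) : ∃ N1 : ℕ, ∀ N, N1 ≤ N → ∀ X, X = N / W + 1 → ∀ M : Finset ℕ,
      (∀ n ∈ M, n < X ∧ (W*n+b).Prime ∧ κ * N < ((W*n+b : ℕ) : ℝ)) → c / W.totient * (N / Real.log N) ≤ #M →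
      ∃ f : ℕ → ℝ, (∀ n, 0 ≤ f n) ∧ (∀ n, f n ≤ uu P (Rf A0 X) W b n) ∧ (∀ n, f n ≤ dl P n * Rf A0 X) ∧ (∀ n, 0 < f n → n ∈ M) ∧
        c * (κ/4)^d / (8 * A0) * pn P X ≤ ∑ n ∈ range X, f n := by
  classical
  obtain ⟨N2, hN2⟩ := exists_nat_ge (2 * b / κ)
  obtain ⟨N3, hN3⟩ := exists_nat_gt (4 / κ^2)
  obtain ⟨Q, hQ⟩ : ∃ Q, Q = 16^A0 := ⟨_, rfl⟩
  refine ⟨W^2 + Q + N2 + N3 + 2, fun N hN X hX M hM hcard => ?_⟩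
  have hW := H.hW
  have hW2 : W ≤ W^2 := Nat.le_self_pow (by norm_num) W
  have hNX : N < W * X := by rw [hX]; exact Nat.lt_mul_div_succ N hW
  have hXN : W * X ≤ 2 * N := by
    rw [hX, mul_add, mul_one]; have := Nat.mul_div_le N W; omega
  obtain ⟨hR, hlog⟩ := logR_lower (X := X) hA0 hW (by omega : W^2 ≤ N) (by rw [← hQ]; omega) hNX.le
  set R := Rf A0 X with hRd
  have hN0 : (2:ℝ) ≤ N := by exact_mod_cast (by omega : 2 ≤ N)
  have hW' : (0:ℝ) < W := by exact_mod_cast hW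
  have hXN' : (W:ℝ) * X ≤ 2 * N := by exact_mod_cast hXN
  have hb : 2 * b ≤ κ * N := by
    rw [div_le_iff₀ hκ] at hN2
    have : (N2:ℝ) ≤ N := by exact_mod_cast (by omega : N2 ≤ N)
    nlinarith
  have hRN : (R:ℝ) < κ * N := by
    have h1 : R^2 ≤ X := (Nat.pow_le_pow_right hR (by omega)).trans (Rf_pow_le (by omega) X)
    have h2 : R^2 ≤ 2 * N := h1.trans ((Nat.le_mul_of_pos_left X hW).trans hXN)
    have h3 : (R:ℝ)^2 ≤ 2 * N := by exact_mod_cast h2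
    have h4 : (N3:ℝ) ≤ N := by exact_mod_cast (by omega : N3 ≤ N)
    have h5 : 4 / κ^2 < N := hN3.trans_le h4
    rw [div_lt_iff₀ (by positivity)] at h5
    refine lt_of_pow_lt_pow_left₀ 2 (by positivity) ?_
    calc (R:ℝ)^2 ≤ 2 * N := h3
      _ < 4 * N := by linarith
      _ < (N * κ^2) * N := by gcongr
      _ = (κ * N)^2 := by ring
  have hV := VV_ge_one (R := R) (W := W) hR
  have hdl := dl_nonneg H.nonneg
  refine ⟨fun n => if n ∈ M then dl P n * VV R W else 0, fun n => ?_, fun n => ?_, fun n => ?_, fun n hn => ?_, ?_⟩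
  · show 0 ≤ if n ∈ M then dl P n * VV R W else 0
    split_ifs
    · exact mul_nonneg (hdl n) (by linarith)
    · exact le_rfl
  · show (if n ∈ M then dl P n * VV R W else 0) ≤ _
    unfold uu
    split_ifs with h
    · obtain ⟨_, h2, h3⟩ := hM n h
      rw [lam_prime h2 (by exact_mod_cast hRN.trans h3)]
      refine le_of_eq ?_
      field_simp
    · have := hdl n; positivity
  · show (if n ∈ M then dl P n * VV R W else 0) ≤ _
    split_ifs with h
    · exact mul_le_mul_of_nonneg_left (VV_le R W) (hdl n)
    · exact mul_nonneg (hdl n) (Nat.cast_nonneg _)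
  · by_contra h
    simp only [h, if_false, lt_irrefl] at hn
  · have hMX : M ⊆ range X := fun n hn => mem_range.2 (hM n hn).1
    rw [sum_ite_mem, inter_eq_right.2 hMX]
    have hpv : 0 ≤ pv P X := pv_nonneg H.nonneg X
    have hX1 : (0:ℝ) < X := by
      rw [hX]; positivity
    have hφ : (0:ℝ) < W.totient := by exact_mod_cast Nat.totient_pos.2 hW
    have hlN : 0 < Real.log N := Real.log_pos (by linarith)
    have hA : (0:ℝ) < A0 := by exact_mod_cast (by omega : 0 < A0)
    have hVl : W.totient / W * (Real.log N / (4 * A0)) ≤ VV R W := by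
      have := hlog.trans (VV_log R hW)
      rw [div_mul_eq_mul_div, le_div_iff₀ hφ] at this
      rw [div_mul_eq_mul_div, div_le_iff₀ hW']
      linarith
    have hn : ∀ n ∈ M, (κ/4)^d * pv P X / X * (W.totient / W * (Real.log N / (4 * A0))) ≤ dl P n * VV R W := by
      intro n hn
      obtain ⟨h1, _, h3⟩ := hM n hn
      push_cast at h3
      have h4 : κ / 4 * X ≤ n := by
        have : W * (κ / 4 * X) ≤ W * n := by nlinarith
        exact le_of_mul_le_mul_left this hW'
      have h5 : 0 < n := by
        have : (0:ℝ) < n := lt_of_lt_of_le (by positivity) h4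
        exact_mod_cast this
      exact mul_le_mul (dl_lower H (by positivity) (by linarith) h5 h1 h4) hVl (by positivity) (hdl n)
    rw [pn_cast H.nonneg]
    calc c * (κ/4)^d / (8 * A0) * pv P X
        = (c * (κ/4)^d / (8 * A0) * pv P X / (W * X)) * (W * X) := by field_simp
      _ ≤ (c * (κ/4)^d / (8 * A0) * pv P X / (W * X)) * (2 * N) := by gcongr
      _ = c / W.totient * (N / Real.log N) * ((κ/4)^d * pv P X / X * (W.totient / W * (Real.log N / (4 * A0)))) := by
          field_simp; ring
      _ ≤ #M * ((κ/4)^d * pv P X / X * (W.totient / W * (Real.log N / (4 * A0)))) := by gcongr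
      _ = ∑ n ∈ M, ((κ/4)^d * pv P X / X * (W.totient / W * (Real.log N / (4 * A0)))) := by rw [sum_const, nsmul_eq_mul]
      _ ≤ ∑ n ∈ M, dl P n * VV R W := sum_le_sum hn

/-! M12: sufficiency -/

lemma sufficiency {d T : ℕ} (hd : 2 ≤ d) (hT : 0 < T) (hm : DMP d T) {s : ℕ} (hs : 2*T+1 ≤ s) (a : Fin s → ℤ) (ha : ∀ i, a i ≠ 0)
    (hsum : ∑ i, a i = 0) (h : ℤ[X]) (hdeg : h.natDegree = d) (hl : 0 < h.leadingCoeff) {A : Set ℕ} (hA : ∀ n ∈ A, n.Prime)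
    {α : ℝ} (hα : 0 < α) (hfreq : ∃ᶠ N in atTop, α * PI N ≤ cA A N) :
    ∃ x : Fin s → ℕ, (∀ i, x i ∈ A) ∧ (∃ i j, x i ≠ x j) ∧ ∑ i, a i * h.eval (x i : ℤ) = 0 := by
  classical
  obtain ⟨A0, hA0, hmain⟩ := main_count d T hd hT hm s hs a ha hsum
  obtain ⟨κ, hκ, hκ1, hκα⟩ : ∃ κ : ℝ, 0 < κ ∧ κ ≤ 1 ∧ 264 * κ ≤ α / 8 :=
    ⟨min 1 (α/2112), lt_min one_pos (by positivity), min_le_left _ _, by have := min_le_right 1 (α/2112); linarith⟩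
  have hA0' : (0:ℝ) < A0 := by exact_mod_cast (by omega : 0 < A0)
  obtain ⟨w0, hw0⟩ := hmain ((α/16) * (κ/4)^d / (8 * A0)) (by positivity)
  obtain ⟨w1, hw1⟩ := choose_w hd
  obtain ⟨w, hww⟩ : ∃ w : ℕ, w = w0 + w1 + d + h.leadingCoeff.natAbs := ⟨_, rfl⟩
  have hder : derivative h ≠ 0 := fun h0 => by
    have := natDegree_eq_zero_of_derivative_eq_zero h0; omega
  obtain ⟨K, hK⟩ := bad_primes (derivative h) hder (η := α / (4 * (w+1))) (by positivity)
  obtain ⟨W, hWd⟩ : ∃ W : ℕ, W = w.factorial^(K+1) := ⟨_, rfl⟩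
  have hW : 0 < W := by rw [hWd]; exact pow_pos (Nat.factorial_pos w) _
  have hWw : ∀ p : ℕ, p.Prime → (p ∣ W ↔ p ≤ w) := fun p hp => by
    rw [hWd, Prime.dvd_pow_iff_dvd hp.prime (by omega), hp.dvd_factorial]
  have hWp : ∀ p : ℕ, p.Prime → p ∣ W → p^K ∣ W := fun p hp hpW => by
    rw [hWw p hp, ← hp.dvd_factorial] at hpW
    rw [hWd]; exact (pow_dvd_pow p (by omega)).trans (pow_dvd_pow_of_dvd hpW (K+1))
  obtain ⟨B, hB⟩ := ev_taylor h hl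
  obtain ⟨N0, hN0⟩ := dense_class hA hα hκ hκ1 hκα (derivative h) w K W hW (fun p hp h1 => (hWw p hp).1 h1) hK
  have key : ∀ r : ℕ, ∃ N1 : ℕ, ∀ N, N1 ≤ N → ∀ S : Finset ℕ,
      (∀ x ∈ S, x ∈ A ∧ x ≤ N ∧ κ * N < x ∧ x % W = r ∧ ∀ p : ℕ, p.Prime → p ∣ W → ¬ (p:ℤ)^K ∣ (derivative h).eval (x:ℤ)) →
      α / 4 * PI N / W.totient ≤ #S →
      ∃ x : Fin s → ℕ, (∀ i, x i ∈ A) ∧ (∃ i j, x i ≠ x j) ∧ ∑ i, a i * h.eval (x i : ℤ) = 0 := by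
    intro r
    obtain ⟨b, hbd⟩ : ∃ b, b = r + W * B := ⟨_, rfl⟩
    have hφ : (0:ℝ) < W.totient := by exact_mod_cast Nat.totient_pos.2 hW
    by_cases hbad : ∀ p : ℕ, p.Prime → p ∣ W → ¬ (p:ℤ)^K ∣ (derivative h).eval (b:ℤ)
    · have hBb : B ≤ b := by rw [hbd]; have := Nat.le_mul_of_pos_left B hW; omega
      obtain ⟨P, g, hg, H, hPg⟩ := mkP hd h hdeg hl (w := w) hW hWp (fun p hp h1 => by rw [hWw p hp] at h1; omega) b (hB b hBb) hbad
        (by omega) (by omega) (fun p hp => hw1 p (by omega))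
      obtain ⟨X0, hX0⟩ := hw0 P W w b H (by omega)
      obtain ⟨N1, hN1⟩ := weight_sum H hA0 hκ hκ1 (show 0 < α/16 by positivity) b
      obtain ⟨N2, hN2⟩ := exists_nat_ge (b / κ)
      refine ⟨N1 + N2 + W * X0 + 4, fun N hN S hS hcard => ?_⟩
      have hNb : (b:ℝ) ≤ κ * N := by
        rw [div_le_iff₀ hκ] at hN2
        have : (N2:ℝ) ≤ N := by exact_mod_cast (by omega : N2 ≤ N)
        nlinarith
      obtain ⟨X, hX⟩ : ∃ X, X = N / W + 1 := ⟨_, rfl⟩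
      have hXX : X0 ≤ X := by
        have : X0 ≤ N / W := (Nat.le_div_iff_mul_le hW).2 (by rw [mul_comm]; omega)
        omega
      let M : Finset ℕ := (range X).filter (fun n => W * n + b ∈ S)
      have hM : S ⊆ M.image (fun n => W * n + b) := by
        intro x hx
        obtain ⟨_, h2, h3, h4, _⟩ := hS x hx
        have hbx : b < x := by exact_mod_cast hNb.trans_lt h3
        have h5 : b ≡ x [MOD W] := by
          show b % W = x % W
          rw [h4, hbd, Nat.add_mul_mod_self_left, ← h4, Nat.mod_mod]
        obtain ⟨n, hn⟩ := (Nat.modEq_iff_dvd' hbx.le).1 h5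
        have h6 : W * n + b = x := by omega
        refine mem_image.2 ⟨n, mem_filter.2 ⟨mem_range.2 ?_, by rw [h6]; exact hx⟩, h6⟩
        have : n ≤ N / W := (Nat.le_div_iff_mul_le hW).2 (by rw [mul_comm]; omega)
        omega
      have hMS : (#S:ℝ) ≤ #M := by exact_mod_cast (card_le_card hM).trans card_image_le
      obtain ⟨f, hf0, hf1, hf2, hf3, hf4⟩ := hN1 N (by omega) X hX M (fun n hn => by
        obtain ⟨h1, h2⟩ := mem_filter.1 hn
        obtain ⟨h3, _, h5, _⟩ := hS _ h2
        exact ⟨mem_range.1 h1, hA _ h3, h5⟩) (by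
          refine le_trans ?_ (hcard.trans hMS)
          rw [div_mul_eq_mul_div]
          refine div_le_div_of_nonneg_right ?_ hφ.le
          have := PI_lower (N := N) (by omega)
          nlinarith)
      obtain ⟨n, hn1, ⟨i, j, hij⟩, hn2⟩ := hX0 X hXX f hf0 (fun n _ => hf1 n) (fun n _ => hf2 n) hf4
      refine ⟨fun i => W * n i + b, fun i => (hS _ (mem_filter.1 (hf3 _ (hn1 i).2)).2).1, ⟨i, j, fun h1 => hij ?_⟩, ?_⟩
      · have h1 : W * n i + b = W * n j + b := h1
        exact Nat.eq_of_mul_eq_mul_left hW (by omega)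
      · have e1 : ∀ m : ℕ, h.eval (((W * m + b : ℕ) : ℤ)) = g * (pn P m : ℤ) + h.eval (b:ℤ) := by
          intro m
          have e2 : (pn P m : ℤ) = P.eval (m:ℤ) := by
            have := pn_cast H.nonneg m
            unfold pv at this; exact_mod_cast this
          rw [e2, hPg]; push_cast; ring
        calc ∑ i, a i * h.eval (((W * n i + b : ℕ) : ℤ)) = ∑ i, (g * (a i * (pn P (n i) : ℤ)) + a i * h.eval (b:ℤ)) :=
              sum_congr rfl fun i _ => by rw [e1]; ring
          _ = 0 := by rw [sum_add_distrib, ← mul_sum, hn2, ← sum_mul, hsum]; ring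
    · push Not at hbad
      obtain ⟨p, hp, hpW, hpb⟩ := hbad
      refine ⟨2, fun N hN S hS hcard => ?_⟩
      have h1 : (0:ℝ) < #S := lt_of_lt_of_le (by have := PI_pos hN; positivity) hcard
      obtain ⟨x, hx⟩ := card_pos.1 (by exact_mod_cast h1 : 0 < #S)
      obtain ⟨_, _, _, h4, h5⟩ := hS x hx
      refine absurd ?_ (h5 p hp hpW)
      have h6 : (p:ℤ)^K ∣ (x:ℤ) - b := by
        refine dvd_trans (by exact_mod_cast hWp p hp hpW : (p:ℤ)^K ∣ (W:ℤ)) (Nat.modEq_iff_dvd.1 ?_)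
        show b % W = x % W
        rw [h4, hbd, Nat.add_mul_mod_self_left, ← h4, Nat.mod_mod]
      have h7 := dvd_add (h6.trans (sub_dvd_eval_sub (x:ℤ) b (derivative h))) hpb
      rwa [sub_add_cancel] at h7
  choose N1 hN1 using key
  obtain ⟨N, hN2, hN3⟩ := (hfreq.and_eventually (eventually_ge_atTop (N0 + ∑ r ∈ range W, N1 r))).exists
  obtain ⟨r, hr, S, hS, hcard⟩ := hN0 N (by omega) hN2
  have := single_le_sum (f := N1) (fun _ _ => Nat.zero_le _) (mem_range.2 hr)
  exact hN1 r N (by omega) S hS hcard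


end Body

theorem density_regularity_over_primes_criterion
    (d T : ℕ) (hd : 2 ≤ d) (hT : 0 < T) (hmoment : DiagonalMomentProperty d T)
    (s : ℕ) (hs : 2 * T + 1 ≤ s)
    (a : Fin s → ℤ) (ha : ∀ i, a i ≠ 0) (b : ℤ)
    (h : Polynomial ℤ) (hdeg : h.natDegree = d) :
    DensityRegularPrimes s a b h ↔ (b = 0 ∧ ∑ i, a i = 0) := by
  have hd0 : h ≠ 0 := fun h0 => by rw [h0, Polynomial.natDegree_zero] at hdeg; omega
  have hl0 : h.leadingCoeff ≠ 0 := Polynomial.leadingCoeff_ne_zero.2 hd0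
  constructor
  · intro H
    by_contra hcon
    refine necessity s a b h (by omega) (fun h0 => hcon ?_) fun A hA hlim => H A hA (by rw [ratio_eq]; exact hlim)
    have hc : ∀ k, (∑ i, a i) * h.coeff k - (Polynomial.C b).coeff k = 0 := fun k => by
      have := congrArg (fun q => Polynomial.coeff q k) h0
      simpa only [Polynomial.coeff_sub, Polynomial.coeff_C_mul, Polynomial.coeff_zero] using this
    have h1 : ∑ i, a i = 0 := by
      have := hc d
      rw [Polynomial.coeff_C_ne_zero (by omega), sub_zero] at this
      rcases mul_eq_zero.1 this with h2 | h2
      · exact h2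
      · rw [← hdeg] at h2; exact absurd h2 hl0
    have h2 := hc 0
    rw [h1, zero_mul, Polynomial.coeff_C_zero] at h2
    exact ⟨by omega, h1⟩
  · rintro ⟨rfl, hsum⟩ A hA hlim
    rw [ratio_eq] at hlim
    obtain ⟨α, hα, hfreq⟩ := freq_of_limsup hlim
    rcases lt_or_gt_of_ne hl0 with h1 | h1
    · obtain ⟨x, hx, hne, h2⟩ := sufficiency hd hT hmoment hs a ha hsum (-h) (by rw [Polynomial.natDegree_neg, hdeg])
        (by rw [Polynomial.leadingCoeff_neg]; omega) hA hα hfreq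
      refine ⟨x, hx, hne, ?_⟩
      simpa only [Polynomial.eval_neg, mul_neg, sum_neg_distrib, neg_eq_zero] using h2
    · exact sufficiency hd hT hmoment hs a ha hsum h hdeg h1 hA hα hfreq
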